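/- (Theorem 4.1, Green's function is comparable to the inverse capacity.) Assume the Monge-Ampère measure μ of u is doubling with respect to the center of mass on the sections of u with constants α, β. Then there is a constant C ≥ 1 depending only on n, α, β such that: for every open set V ⊂⊂ Ω, every x₀ ∈ V, every t > 0 with S_u(x₀, 2t) ⊂⊂ V, and every Green's function g_V(·, x₀) of L_u in V with pole x₀, one has C^{-1} · [cap_{L_u}(cl(S_u(x₀, t)), V)]^{-1} ≤ g_V(x, x₀) ≤ C · [cap_{L_u}(cl(S_u(x₀, t)), V)]^{-1} for all x ∈ ∂S_u(x₀, t). -/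

import Mathlib

open MeasureTheory

noncomputable section

/-- Euclidean space `ℝⁿ`. -/
abbrev E (n : ℕ) := EuclideanSpace ℝ (Fin n)

/-- First partial derivative `∂_i f (x)`. -/
noncomputable def pd {n : ℕ} (f : E n → ℝ) (x : E n) (i : Fin n) : ℝ :=
  fderiv ℝ f x (EuclideanSpace.single i 1)

/-- Second partial derivative `∂_{ij} f (x)`. -/
noncomputable def pd2 {n : ℕ} (f : E n → ℝ) (x : E n) (i j : Fin n) : ℝ :=
  fderiv ℝ (fun y => fderiv ℝ f y (EuclideanSpace.single j 1)) x (EuclideanSpace.single i 1)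

/-- Hessian matrix `D²f(x)`. -/
noncomputable def Hess {n : ℕ} (f : E n → ℝ) (x : E n) : Matrix (Fin n) (Fin n) ℝ :=
  Matrix.of fun i j => pd2 f x i j

/-- The cofactor matrix `U = (det D²u)(D²u)⁻¹` of the Hessian of `u`,
realized as the adjugate. -/
noncomputable def cofU {n : ℕ} (u : E n → ℝ) (x : E n) : Matrix (Fin n) (Fin n) ℝ :=
  (Hess u x).adjugate

/-- Section of the convex function `u`:
`S_u(x₀,t) = {x ∈ cl Ω : u x < u x₀ + ∇u(x₀)·(x - x₀) + t}`. -/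
def MASection {n : ℕ} (Ω : Set (E n)) (u : E n → ℝ) (x₀ : E n) (t : ℝ) : Set (E n) :=
  {x ∈ closure Ω | u x < u x₀ + fderiv ℝ u x₀ (x - x₀) + t}

/-- `A ⊂⊂ B`: the closure of `A` is a compact subset of `B`. -/
def CptIn {n : ℕ} (A B : Set (E n)) : Prop :=
  IsCompact (closure A) ∧ closure A ⊆ B

/-- Uniform convexity of a domain: balls of radius proportional to `‖x - y‖²`
centered at midpoints of points of the closure stay in the closure. -/
def UnifConvex {n : ℕ} (Ω : Set (E n)) : Prop :=
  ∃ δ > 0, ∀ x ∈ closure Ω, ∀ y ∈ closure Ω,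
    Metric.closedBall (midpoint ℝ x y) (δ * ‖x - y‖ ^ 2) ⊆ closure Ω

/-- Standing assumptions: `Ω` is a bounded, open, nonempty, uniformly convex domain and
`u` is a smooth convex function on `cl Ω` vanishing on `∂Ω`. -/
def MASetup {n : ℕ} (Ω : Set (E n)) (u : E n → ℝ) : Prop :=
  IsOpen Ω ∧ Bornology.IsBounded Ω ∧ Ω.Nonempty ∧ UnifConvex Ω ∧
  ContDiffOn ℝ (⊤ : ℕ∞) u (closure Ω) ∧ ConvexOn ℝ (closure Ω) u ∧
  ∀ x ∈ frontier Ω, u x = 0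

/-- `λ ≤ det D²u ≤ Λ` in `Ω`. -/
def DetBounds {n : ℕ} (Ω : Set (E n)) (u : E n → ℝ) (lam Lam : ℝ) : Prop :=
  ∀ x ∈ Ω, lam ≤ (Hess u x).det ∧ (Hess u x).det ≤ Lam

/-- The Monge-Ampère measure of `u`: `μ(A) = ∫_A det D²u`. -/
noncomputable def maMeasure {n : ℕ} (u : E n → ℝ) (A : Set (E n)) : ℝ :=
  ∫ x in A, (Hess u x).det

/-- Center of mass of a set. -/
noncomputable def centerOfMass {n : ℕ} (S : Set (E n)) : E n :=
  (volume S).toReal⁻¹ • ∫ x in S, x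

/-- The `α`-dilation of `S` with respect to its center of mass. -/
def dilateCM {n : ℕ} (α : ℝ) (S : Set (E n)) : Set (E n) :=
  (fun x => centerOfMass S + α • (x - centerOfMass S)) '' S

/-- The Monge-Ampère measure of `u` is doubling with respect to the center of mass
on the sections of `u`, with constants `0 < α < 1 < β`. -/
def DoublingCM {n : ℕ} (Ω : Set (E n)) (u : E n → ℝ) (α β : ℝ) : Prop :=
  0 < α ∧ α < 1 ∧ 1 < β ∧
  ∀ x₀ ∈ Ω, ∀ t : ℝ, 0 < t → CptIn (MASection Ω u x₀ t) Ω →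
    maMeasure u (MASection Ω u x₀ t) ≤ β * maMeasure u (dilateCM α (MASection Ω u x₀ (t / 2)))

/-- `g` is a Green's function of the linearized Monge-Ampère operator `L_u` in `V`
with pole `y`: positive and smooth on `V \ {y}`, `L_u`-harmonic there, vanishing
continuously on `∂V`, and `∫_V g · (L_u φ) = φ(y)` (i.e. `∫_V g · U^{ij}∂_{ij}φ = -φ(y)`)
for all test functions `φ`. -/
def IsGreen {n : ℕ} (u : E n → ℝ) (V : Set (E n)) (y : E n) (g : E n → ℝ) : Prop :=
  (∀ x ∈ V \ {y}, 0 < g x) ∧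
  ContDiffOn ℝ (⊤ : ℕ∞) g (V \ {y}) ∧
  (∀ x ∈ V \ {y}, ∑ i, ∑ j, cofU u x i j * pd2 g x i j = 0) ∧
  ContinuousOn g (closure V \ {y}) ∧
  (∀ x ∈ frontier V, g x = 0) ∧
  ∀ φ : E n → ℝ, ContDiff ℝ (⊤ : ℕ∞) φ → HasCompactSupport φ → tsupport φ ⊆ V →
    (∫ x in V, g x * ∑ i, ∑ j, cofU u x i j * pd2 φ x i j) = -φ y

/-- Capacity of a compact set `K` relative to `V` for the operator `L_u`:
the infimum of `∫_V U^{ij} ∂_iΦ ∂_jΦ` over Lipschitz `Φ` compactly supported in `V`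
with `Φ ≥ 1` on `K`. -/
noncomputable def capacity {n : ℕ} (u : E n → ℝ) (K V : Set (E n)) : ℝ :=
  sInf { e : ℝ | ∃ Φ : E n → ℝ, (∃ L : NNReal, LipschitzWith L Φ) ∧
    HasCompactSupport Φ ∧ tsupport Φ ⊆ V ∧ (∀ x ∈ K, 1 ≤ Φ x) ∧
    e = ∫ x in V, ∑ i, ∑ j, cofU u x i j * pd Φ x i * pd Φ x j }

namespace LinMA

open scoped ContDiff

variable {n : ℕ}

/-- The `i`-th coordinate vector. -/
abbrev ev (i : Fin n) : E n := EuclideanSpace.single i (1 : ℝ)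

/-- The quadratic form of the cofactor matrix. -/
def UB (u : E n → ℝ) (x : E n) (a b : Fin n → ℝ) : ℝ :=
  ∑ i, ∑ j, cofU u x i j * a i * b j

/-- The nondivergence form operator `U^{ij} ∂_{ij}`. -/
def Lu (u v : E n → ℝ) (x : E n) : ℝ := ∑ i, ∑ j, cofU u x i j * pd2 v x i j

lemma pd2_eq (f : E n → ℝ) (x : E n) (i j : Fin n) :
    pd2 f x i j = pd (fun y => pd f y j) x i := rfl

lemma contDiffAt_pd {f : E n → ℝ} {x : E n} (hf : ContDiffAt ℝ ∞ f x) (i : Fin n) :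
    ContDiffAt ℝ ∞ (fun y => pd f y i) x := by
  have h : ContDiffAt ℝ ∞ (fderiv ℝ f) x := hf.fderiv_right (m := ∞) (by simp)
  exact h.clm_apply contDiffAt_const

lemma contDiffAt_pd2 {f : E n → ℝ} {x : E n} (hf : ContDiffAt ℝ ∞ f x) (i j : Fin n) :
    ContDiffAt ℝ ∞ (fun y => pd2 f y i j) x :=
  contDiffAt_pd (contDiffAt_pd hf j) i

lemma fderiv_pd_apply {f : E n → ℝ} {x : E n} (hf : ContDiffAt ℝ ∞ f x) (j : Fin n) (v : E n) :
    fderiv ℝ (fun y => pd f y j) x v = fderiv ℝ (fderiv ℝ f) x v (ev j) := by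
  have h : ContDiffAt ℝ ∞ (fderiv ℝ f) x := hf.fderiv_right (m := ∞) (by simp)
  have h2 : DifferentiableAt ℝ (fderiv ℝ f) x := h.differentiableAt (by simp)
  have := (h2.hasFDerivAt.clm_apply (hasFDerivAt_const (ev j) x)).fderiv
  change fderiv ℝ (fun y => fderiv ℝ f y (ev j)) x v = _
  rw [this]; simp

lemma pd2_eq_snd {f : E n → ℝ} {x : E n} (hf : ContDiffAt ℝ ∞ f x) (i j : Fin n) :
    pd2 f x i j = fderiv ℝ (fderiv ℝ f) x (ev i) (ev j) :=
  fderiv_pd_apply hf j _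

lemma pd2_symm {f : E n → ℝ} {x : E n} (hf : ContDiffAt ℝ ∞ f x) (i j : Fin n) :
    pd2 f x i j = pd2 f x j i := by
  rw [pd2_eq_snd hf, pd2_eq_snd hf]
  have : IsSymmSndFDerivAt ℝ f x := hf.isSymmSndFDerivAt (by
    simp only [minSmoothness_of_isRCLikeNormedField]
    exact WithTop.coe_le_coe.2 (le_top : (2 : ℕ∞) ≤ ⊤))
  exact this _ _

lemma ev_sum (v : E n) : v = ∑ i, v i • ev i := by
  ext j
  simp [ev, Pi.single_apply]

lemma clm_apply_eq_sum (L : E n →L[ℝ] ℝ) (v : E n) : L v = ∑ i, v i * L (ev i) := by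
  conv_lhs => rw [ev_sum v]
  simp [map_sum, -PiLp.smul_apply]

lemma fderiv_eq_sum (f : E n → ℝ) (x v : E n) : fderiv ℝ f x v = ∑ i, v i * pd f x i :=
  clm_apply_eq_sum _ v

lemma snd_eq_sum {f : E n → ℝ} {x : E n} (hf : ContDiffAt ℝ ∞ f x) (v w : E n) :
    fderiv ℝ (fderiv ℝ f) x v w = ∑ i, ∑ j, v i * w j * pd2 f x i j := by
  rw [clm_apply_eq_sum _ w]
  have : ∀ j, fderiv ℝ (fderiv ℝ f) x v (ev j) = ∑ i, v i * pd2 f x i j := by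
    intro j
    rw [← fderiv_pd_apply hf j, fderiv_eq_sum]
    rfl
  simp_rw [this, Finset.mul_sum]
  rw [Finset.sum_comm]
  refine Finset.sum_congr rfl fun i _ => Finset.sum_congr rfl fun j _ => by ring

lemma contDiffAt_matrix_det {m : ℕ} {A : E n → Matrix (Fin m) (Fin m) ℝ} {x : E n}
    (hA : ∀ i j, ContDiffAt ℝ ∞ (fun y => A y i j) x) :
    ContDiffAt ℝ ∞ (fun y => (A y).det) x := by
  simp_rw [Matrix.det_apply]
  refine ContDiffAt.sum fun σ _ => ?_
  have : ContDiffAt ℝ ∞ (fun y => ∏ i, A y (σ i) i) x :=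
    contDiffAt_prod fun i _ => hA _ _
  exact this.const_smul _

lemma contDiffAt_det {f : E n → ℝ} {x : E n} (hf : ContDiffAt ℝ ∞ f x) :
    ContDiffAt ℝ ∞ (fun y => (Hess f y).det) x :=
  contDiffAt_matrix_det fun i j => contDiffAt_pd2 hf i j

lemma contDiffAt_cofU {f : E n → ℝ} {x : E n} (hf : ContDiffAt ℝ ∞ f x) (i j : Fin n) :
    ContDiffAt ℝ ∞ (fun y => cofU f y i j) x := by
  simp only [cofU, Matrix.adjugate_apply]
  refine contDiffAt_matrix_det fun k l => ?_
  by_cases hk : k = j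
  · subst hk
    simp only [Matrix.updateRow_self]
    exact contDiffAt_const
  · simp only [Matrix.updateRow_ne hk]
    exact contDiffAt_pd2 hf k l

lemma hess_symm {f : E n → ℝ} {x : E n} (hf : ContDiffAt ℝ ∞ f x) :
    (Hess f x).transpose = Hess f x := by
  ext i j; exact pd2_symm hf j i

lemma cofU_symm {f : E n → ℝ} {x : E n} (hf : ContDiffAt ℝ ∞ f x) (i j : Fin n) :
    cofU f x i j = cofU f x j i := by
  have : (cofU f x).transpose = cofU f x := by
    rw [cofU, Matrix.adjugate_transpose, hess_symm hf]
  conv_lhs => rw [← this]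
  rfl

/-- Jacobi's formula for the derivative of a determinant in a direction. -/
lemma pd_det {A : E n → Matrix (Fin n) (Fin n) ℝ} {x : E n}
    (hA : ∀ i j, DifferentiableAt ℝ (fun y => A y i j) x) (k : Fin n) :
    pd (fun y => (A y).det) x k
      = ∑ i, ∑ j, (A x).adjugate i j * pd (fun y => A y j i) x k := by
  have h1 : HasFDerivAt (fun y => (A y).det) (∑ σ : Equiv.Perm (Fin n),
      (Equiv.Perm.sign σ : ℤ) • ∑ i, (∏ j ∈ Finset.univ.erase i, A x (σ j) j) •
        fderiv ℝ (fun y => A y (σ i) i) x) x := by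
    simp_rw [Matrix.det_apply]
    refine HasFDerivAt.fun_sum fun σ _ => ?_
    have := HasFDerivAt.finsetProd (u := Finset.univ) (g := fun i y => A y (σ i) i)
      (g' := fun i => fderiv ℝ (fun y => A y (σ i) i) x) (x := x)
      (fun i _ => (hA _ _).hasFDerivAt)
    exact this.const_smul _
  rw [pd, h1.fderiv]
  have h2 : ∀ i j, (A x).adjugate i j = ∑ σ : Equiv.Perm (Fin n),
      (Equiv.Perm.sign σ : ℤ) • ∏ l, (A x).updateRow j (Pi.single i 1) (σ l) l := by
    intro i j
    rw [Matrix.adjugate_apply, Matrix.det_apply]; rfl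
  have h3 : ∀ i j, (A x).adjugate i j = ∑ σ : Equiv.Perm (Fin n),
      (Equiv.Perm.sign σ : ℤ) • (if σ i = j then ∏ l ∈ Finset.univ.erase i, A x (σ l) l else 0) := by
    intro i j
    rw [h2]
    refine Finset.sum_congr rfl fun σ _ => ?_
    congr 1
    split_ifs with h
    · rw [← Finset.mul_prod_erase _ _ (Finset.mem_univ i), h, Matrix.updateRow_self]
      simp only [Pi.single_eq_same, one_mul]
      refine Finset.prod_congr rfl fun l hl => ?_
      rw [Matrix.updateRow_ne]
      intro hc
      exact (Finset.ne_of_mem_erase hl) (σ.injective (hc.trans h.symm))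
    · refine Finset.prod_eq_zero (Finset.mem_univ (σ.symm j)) ?_
      rw [Equiv.apply_symm_apply, Matrix.updateRow_self, Pi.single_eq_of_ne]
      intro hc; apply h; rw [← hc]; simp
  simp_rw [h3, Finset.sum_mul]
  simp only [sum_apply, smul_apply]
  rw [Finset.sum_congr rfl (fun i _ => Finset.sum_comm), Finset.sum_comm]
  refine Finset.sum_congr rfl fun σ _ => ?_
  rw [Finset.smul_sum]
  refine Finset.sum_congr rfl fun i _ => ?_
  rw [Finset.sum_eq_single (σ i)]
  · simp [pd, mul_assoc]
  · intro b _ hb; simp [Ne.symm hb]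
  · simp

lemma exists_cutoff {K W : Set (E n)} (hK : IsCompact K) (hW : IsOpen W) (hKW : K ⊆ W) :
    ∃ χ : E n → ℝ, ContDiff ℝ ∞ χ ∧ HasCompactSupport χ ∧ tsupport χ ⊆ W ∧
      (∀ x, 0 ≤ χ x ∧ χ x ≤ 1) ∧ ∃ N, IsOpen N ∧ K ⊆ N ∧ ∀ x ∈ N, χ x = 1 := by
  obtain ⟨L, hL, hKL, hLW⟩ := exists_compact_between hK hW hKW
  obtain ⟨L', hL', hLL', hLW'⟩ := exists_compact_between hL hW hLW
  obtain ⟨f, hf, hr, hs, h1⟩ := exists_contMDiff_support_eq_eq_one_iff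
    (modelWithCornersSelf ℝ (E n)) (n := ⊤) isOpen_interior hL.isClosed hLL'
  have hts : tsupport f ⊆ L' := by
    rw [tsupport, hs]
    exact closure_minimal interior_subset hL'.isClosed
  refine ⟨f, contMDiff_iff_contDiff.1 hf, hL'.of_isClosed_subset (isClosed_tsupport f) hts,
    hts.trans hLW', fun x => ?_, interior L, isOpen_interior, hKL,
    fun x hx => (h1 x).1 (interior_subset hx)⟩
  have := hr ⟨x, rfl⟩
  exact ⟨this.1, this.2⟩

lemma contDiff_mul_of_tsupport {a f : E n → ℝ} {W : Set (E n)} (ha : ContDiff ℝ ∞ a)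
    (haW : tsupport a ⊆ W) (hf : ∀ x ∈ W, ContDiffAt ℝ ∞ f x) :
    ContDiff ℝ ∞ (fun x => a x * f x) := by
  rw [contDiff_iff_contDiffAt]
  intro x
  by_cases hx : x ∈ tsupport a
  · exact ha.contDiffAt.mul (hf x (haW hx))
  · have h0 : (fun y => a y * f y) =ᶠ[nhds x] fun _ => 0 := by
      filter_upwards [notMem_tsupport_iff_eventuallyEq.1 hx] with y hy
      simp [hy]
    exact contDiffAt_const.congr_of_eventuallyEq h0

lemma continuous_of_zero_outside {h : E n → ℝ} {K W : Set (E n)} (hK : IsCompact K)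
    (hW : IsOpen W) (hKW : K ⊆ W) (hc : ContinuousOn h W) (h0 : ∀ x ∉ K, h x = 0) :
    Continuous h ∧ HasCompactSupport h := by
  constructor
  · rw [continuous_iff_continuousAt]
    intro x
    by_cases hx : x ∈ W
    · exact hc.continuousAt (hW.mem_nhds hx)
    · have : h =ᶠ[nhds x] fun _ => 0 := by
        filter_upwards [hK.isClosed.isOpen_compl.mem_nhds (fun hk => hx (hKW hk))] with y hy
        exact h0 y hy
      exact continuousAt_const.congr this.symm
  · exact HasCompactSupport.intro hK h0

lemma integrable_of_zero_outside {h : E n → ℝ} {K W : Set (E n)} (hK : IsCompact K)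
    (hW : IsOpen W) (hKW : K ⊆ W) (hc : ContinuousOn h W) (h0 : ∀ x ∉ K, h x = 0) :
    Integrable h := by
  obtain ⟨h1, h2⟩ := continuous_of_zero_outside hK hW hKW hc h0
  exact h1.integrable_of_hasCompactSupport h2

lemma pd_eq_zero_of_notMem_tsupport {f : E n → ℝ} {x : E n} (hx : x ∉ tsupport f) (i : Fin n) :
    pd f x i = 0 := by
  have h : f =ᶠ[nhds x] fun _ => (0 : ℝ) := notMem_tsupport_iff_eventuallyEq.1 hx
  rw [pd, h.fderiv_eq]; simp

lemma abs_pd_le {f : E n → ℝ} {L : NNReal} (hf : LipschitzWith L f) (x : E n) (i : Fin n) :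
    |pd f x i| ≤ L := by
  have h := norm_fderiv_le_of_lipschitz ℝ hf (x₀ := x)
  have := (fderiv ℝ f x).le_opNorm (ev i)
  have h1 : ‖ev i‖ = 1 := by simp [ev]
  rw [h1, mul_one] at this
  exact this.trans h

lemma measurable_pd (f : E n → ℝ) (i : Fin n) : Measurable fun x => pd f x i :=
  measurable_fderiv_apply_const ℝ f (ev i)

/-- The product of a continuous compactly supported function and a partial derivative of a
Lipschitz function is integrable. -/
lemma integrable_pd_mul {f h : E n → ℝ} {L : NNReal} (hf : LipschitzWith L f)
    (hh : Integrable h) (i : Fin n) : Integrable fun x => pd f x i * h x :=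
  hh.bdd_mul (measurable_pd f i).aestronglyMeasurable (c := L)
    (Filter.Eventually.of_forall fun x => abs_pd_le hf x i)

lemma pd_mul {f g : E n → ℝ} {x : E n} (hf : DifferentiableAt ℝ f x)
    (hg : DifferentiableAt ℝ g x) (i : Fin n) :
    pd (fun y => f y * g y) x i = f x * pd g x i + pd f x i * g x := by
  have := fderiv_fun_mul hf hg
  rw [pd, this]; simp [pd, mul_comm]

lemma pd_sum {ι : Type*} {s : Finset ι} {f : ι → E n → ℝ} {x : E n}
    (hf : ∀ k ∈ s, DifferentiableAt ℝ (f k) x) (i : Fin n) :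
    pd (fun y => ∑ k ∈ s, f k y) x i = ∑ k ∈ s, pd (f k) x i := by
  rw [pd, fderiv_fun_sum hf]; simp [pd]

lemma pd_congr {f g : E n → ℝ} {x : E n} (h : f =ᶠ[nhds x] g) (i : Fin n) :
    pd f x i = pd g x i := by
  rw [pd, h.fderiv_eq, pd]

/-- Integration by parts against a Lipschitz function with compact support. -/
lemma integral_pd_mul {a F : E n → ℝ} {W : Set (E n)} {L : NNReal} (hW : IsOpen W)
    (ha : LipschitzWith L a) (hac : HasCompactSupport a) (haW : tsupport a ⊆ W)
    (hF : ∀ x ∈ W, ContDiffAt ℝ ∞ F x) (i : Fin n) :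
    ∫ x, a x * pd F x i = -∫ x, pd a x i * F x := by
  obtain ⟨χ, hχ, hχc, hχW, -, N, hN, hKN, hχ1⟩ := exists_cutoff hac hW haW
  have hG : ContDiff ℝ ∞ (fun x => χ x * F x) := contDiff_mul_of_tsupport hχ hχW hF
  have hGc : HasCompactSupport (fun x => χ x * F x) := hχc.mul_right
  obtain ⟨D, hD⟩ := hG.lipschitzWith_of_hasCompactSupport hGc (by simp)
  have key := hD.integral_lineDeriv_mul_eq (μ := volume) ha hac (ev i)
  have e1 : ∀ x, lineDeriv ℝ (fun x => χ x * F x) x (ev i) * a x = a x * pd F x i := by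
    intro x
    by_cases hx : x ∈ tsupport a
    · have hev : (fun x => χ x * F x) =ᶠ[nhds x] F := by
        filter_upwards [hN.mem_nhds (hKN hx)] with y hy
        simp [hχ1 y hy]
      rw [(hG.contDiffAt.differentiableAt (by simp)).lineDeriv_eq_fderiv, hev.fderiv_eq, mul_comm]
      rfl
    · simp [image_eq_zero_of_notMem_tsupport hx]
  have e2 : ∀ᵐ x, lineDeriv ℝ a x (-ev i) * (χ x * F x) = -(pd a x i * F x) := by
    filter_upwards [ha.ae_differentiableAt] with x hx
    rw [hx.lineDeriv_eq_fderiv, map_neg]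
    by_cases hxs : x ∈ tsupport a
    · rw [hχ1 x (hKN hxs)]; simp [pd]
    · have := pd_eq_zero_of_notMem_tsupport hxs i
      simp only [pd] at this
      simp [ev, this, pd]
  rw [integral_congr_ae e2, integral_congr_ae (Filter.Eventually.of_forall e1), integral_neg] at key
  exact key

/-- The rows of the cofactor matrix of a Hessian are divergence free (Piola identity),
at a point where the Hessian is invertible. -/
lemma piola_of_det_ne_zero {u : E n → ℝ} {x : E n}
    (hev : ∀ᶠ y in nhds x, ContDiffAt ℝ ∞ u y) (hd : (Hess u x).det ≠ 0) (j : Fin n) : ∑ i, pd (fun y => cofU u y i j) x i = 0 := by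
  have hu := hev.self_of_nhds
  have hne : (∞ : WithTop ℕ∞) ≠ 0 := by simp
  have hdH : ∀ i j, DifferentiableAt ℝ (fun y => pd2 u y i j) x := fun i j =>
    (contDiffAt_pd2 hu i j).differentiableAt hne
  have hdC : ∀ i j, DifferentiableAt ℝ (fun y => cofU u y i j) x := fun i j =>
    (contDiffAt_cofU hu i j).differentiableAt hne
  have hsymm3 : ∀ i j k, pd (fun y => pd2 u y j k) x i = pd (fun y => pd2 u y j i) x k := by
    intro i j k
    have h1 : ∀ i j k, pd (fun y => pd2 u y j k) x i = pd (fun y => pd2 u y i k) x j :=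
      fun i j k => pd2_symm (contDiffAt_pd hu k) i j
    have h2 : ∀ i j k, pd (fun y => pd2 u y j k) x i = pd (fun y => pd2 u y k j) x i := by
      intro i j k
      refine pd_congr ?_ _
      filter_upwards [hev] with y hy using pd2_symm hy j k
    rw [h2, h1, h2]
  have key : ∀ k, ∑ j, (∑ i, pd (fun y => cofU u y i j) x i) * Hess u x j k = 0 := by
    intro k
    have hid : ∀ i, pd (fun y => ∑ j, cofU u y i j * pd2 u y j k) x i
        = if i = k then pd (fun y => (Hess u y).det) x k else 0 := by
      intro i
      have : ∀ y, ∑ j, cofU u y i j * pd2 u y j k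
          = ((Hess u y).det • (1 : Matrix (Fin n) (Fin n) ℝ)) i k := by
        intro y
        rw [← Matrix.adjugate_mul, Matrix.mul_apply]; rfl
      simp_rw [this]
      split_ifs with h
      · subst h; simp
      · simp [h, pd]
    have hs : ∑ i, pd (fun y => ∑ j, cofU u y i j * pd2 u y j k) x i
        = pd (fun y => (Hess u y).det) x k := by
      simp_rw [hid]; simp
    have hl : ∀ i, pd (fun y => ∑ j, cofU u y i j * pd2 u y j k) x i
        = ∑ j, (cofU u x i j * pd (fun y => pd2 u y j k) x i
            + pd (fun y => cofU u y i j) x i * pd2 u x j k) := by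
      intro i
      rw [pd_sum (fun j _ => (hdC i j).fun_mul (hdH j k))]
      exact Finset.sum_congr rfl fun j _ => pd_mul (hdC i j) (hdH j k) i
    have hr : pd (fun y => (Hess u y).det) x k
        = ∑ i, ∑ j, cofU u x i j * pd (fun y => pd2 u y j k) x i := by
      rw [pd_det (A := fun y => Hess u y) (fun i j => hdH i j) k]
      exact Finset.sum_congr rfl fun i _ => Finset.sum_congr rfl fun j _ => by
        rw [hsymm3 i j k]; rfl
    rw [Finset.sum_congr rfl fun i _ => hl i, hr] at hs
    simp_rw [Finset.sum_add_distrib] at hs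
    have h0 : ∑ i, ∑ j, pd (fun y => cofU u y i j) x i * pd2 u x j k = 0 := by linarith
    rw [Finset.sum_comm] at h0
    simp_rw [Finset.sum_mul]
    exact h0
  have hv : Matrix.vecMul (fun j => ∑ i, pd (fun y => cofU u y i j) x i) (Hess u x) = 0 := by
    ext k
    simpa [Matrix.vecMul, dotProduct] using key k
  exact congrFun (Matrix.eq_zero_of_vecMul_eq_zero hd hv) j

/-- Integration by parts for the linearized Monge-Ampère operator. -/
lemma integral_mul_Lu {u a b : E n → ℝ} {W : Set (E n)} {L : NNReal} (hW : IsOpen W)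
    (hu : ∀ x ∈ W, ContDiffAt ℝ ∞ u x)
    (hp : ∀ x ∈ W, ∀ j, ∑ i, pd (fun y => cofU u y i j) x i = 0)
    (ha : LipschitzWith L a) (hac : HasCompactSupport a) (haW : tsupport a ⊆ W)
    (hb : ∀ x ∈ W, ContDiffAt ℝ ∞ b x) :
    ∫ x, a x * Lu u b x = -∫ x, UB u x (pd a x) (pd b x) := by
  have hne : (∞ : WithTop ℕ∞) ≠ 0 := by simp
  have hF : ∀ i, ∀ x ∈ W, ContDiffAt ℝ ∞ (fun y => ∑ j, cofU u y i j * pd b y j) x := by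
    intro i x hx
    exact ContDiffAt.sum fun j _ => (contDiffAt_cofU (hu x hx) i j).mul (contDiffAt_pd (hb x hx) j)
  have hzero : ∀ x ∉ tsupport a, a x = 0 := fun x hx => image_eq_zero_of_notMem_tsupport hx
  have hdiv : ∀ x, a x * Lu u b x
      = ∑ i, a x * pd (fun y => ∑ j, cofU u y i j * pd b y j) x i := by
    intro x
    by_cases hx : x ∈ tsupport a
    · have hxW := haW hx
      have h1 : ∀ i, pd (fun y => ∑ j, cofU u y i j * pd b y j) x i
          = ∑ j, (cofU u x i j * pd2 b x i j + pd (fun y => cofU u y i j) x i * pd b x j) := by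
        intro i
        have d1 := fun j => (contDiffAt_cofU (hu x hxW) i j).differentiableAt hne
        have d2 := fun j => (contDiffAt_pd (hb x hxW) j).differentiableAt hne
        rw [pd_sum (fun j _ => (d1 j).fun_mul (d2 j))]
        exact Finset.sum_congr rfl fun j _ => pd_mul (d1 j) (d2 j) i
      rw [← Finset.mul_sum]
      congr 1
      simp_rw [h1, Finset.sum_add_distrib]
      have h2 : ∑ i, ∑ j, pd (fun y => cofU u y i j) x i * pd b x j = 0 := by
        rw [Finset.sum_comm]
        refine Finset.sum_eq_zero fun j _ => ?_
        rw [← Finset.sum_mul, hp x hxW j, zero_mul]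
      rw [h2, add_zero]; rfl
    · simp [hzero x hx]
  have hi1 : ∀ i ∈ Finset.univ, Integrable
      (fun x => a x * pd (fun y => ∑ j, cofU u y i j * pd b y j) x i) := by
    intro i _
    refine integrable_of_zero_outside hac hW haW ?_ (fun x hx => by simp [hzero x hx])
    intro x hx
    exact (ha.continuous.continuousAt.mul
      (contDiffAt_pd (hF i x hx) i).continuousAt).continuousWithinAt
  obtain ⟨χ, hχ, hχc, hχW, -, N, hN, hKN, hχ1⟩ := exists_cutoff hac hW haW
  have hi2 : ∀ i ∈ Finset.univ, Integrable
      (fun x => pd a x i * ∑ j, cofU u x i j * pd b x j) := by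
    intro i _
    have hG : ContDiff ℝ ∞ (fun x => χ x * ∑ j, cofU u x i j * pd b x j) :=
      contDiff_mul_of_tsupport hχ hχW (hF i)
    have := integrable_pd_mul ha
      (hG.continuous.integrable_of_hasCompactSupport (μ := volume) hχc.mul_right) i
    refine this.congr (Filter.Eventually.of_forall fun x => ?_)
    by_cases hx : x ∈ tsupport a
    · simp [hχ1 x (hKN hx)]
    · simp [pd_eq_zero_of_notMem_tsupport hx]
  simp_rw [hdiv]
  rw [integral_finsetSum _ hi1]
  simp_rw [integral_pd_mul hW ha hac haW (hF _)]
  rw [Finset.sum_neg_distrib, ← integral_finsetSum _ hi2]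
  congr 1
  refine integral_congr_ae (Filter.Eventually.of_forall fun x => ?_)
  refine Finset.sum_congr rfl fun i _ => ?_
  rw [Finset.mul_sum]
  exact Finset.sum_congr rfl fun j _ => by ring

/-- The quadratic form integrand of a compactly supported Lipschitz function paired with a smooth
function is integrable. -/
lemma integrable_UB {u a b : E n → ℝ} {W : Set (E n)} {L : NNReal} (hW : IsOpen W)
    (hu : ∀ x ∈ W, ContDiffAt ℝ ∞ u x)
    (ha : LipschitzWith L a) (hac : HasCompactSupport a) (haW : tsupport a ⊆ W)
    (hb : ∀ x ∈ W, ContDiffAt ℝ ∞ b x) :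
    Integrable fun x => UB u x (pd a x) (pd b x) := by
  obtain ⟨χ, hχ, hχc, hχW, -, N, hN, hKN, hχ1⟩ := exists_cutoff hac hW haW
  refine integrable_finsetSum _ fun i _ => integrable_finsetSum _ fun j _ => ?_
  have hG : ContDiff ℝ ∞ (fun x => χ x * (cofU u x i j * pd b x j)) :=
    contDiff_mul_of_tsupport hχ hχW
      fun x hx => (contDiffAt_cofU (hu x hx) i j).mul (contDiffAt_pd (hb x hx) j)
  have := integrable_pd_mul ha
    (hG.continuous.integrable_of_hasCompactSupport (μ := volume) hχc.mul_right) i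
  refine this.congr (Filter.Eventually.of_forall fun x => ?_)
  by_cases hx : x ∈ tsupport a
  · simp [hχ1 x (hKN hx)]; ring
  · simp [pd_eq_zero_of_notMem_tsupport hx]

/-- The standing assumptions on the domain and the convex function, in usable form. -/
structure Setup (n : ℕ) (α β : ℝ) (Ω : Set (E n)) (u : E n → ℝ) : Prop where
  hn : 2 ≤ n
  op : IsOpen Ω
  bdd : Bornology.IsBounded Ω
  cvx : Convex ℝ Ω
  smooth : ∀ x ∈ Ω, ContDiffAt ℝ ∞ u x
  cont : ContinuousOn u (closure Ω)
  conv : ConvexOn ℝ (closure Ω) u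
  bdry : ∀ x ∈ frontier Ω, u x = 0
  neg : ∃ x ∈ Ω, u x < 0
  doub : DoublingCM Ω u α β

/-- The gap between `u` and its tangent plane at `z`, evaluated at `x`. -/
def dd (u : E n → ℝ) (z x : E n) : ℝ := u x - u z - fderiv ℝ u z (x - z)

lemma mem_section {Ω : Set (E n)} {u : E n → ℝ} {y x : E n} {s : ℝ} :
    x ∈ MASection Ω u y s ↔ x ∈ closure Ω ∧ dd u y x < s := by
  simp only [MASection, Set.mem_ofPred_eq, dd]
  constructor <;> rintro ⟨h1, h2⟩ <;> exact ⟨h1, by linarith⟩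

@[simp] lemma dd_self (u : E n → ℝ) (z : E n) : dd u z z = 0 := by simp [dd]

/-- Exact relation between gaps with different base points. -/
lemma dd_three (u : E n → ℝ) (y z x : E n) :
    dd u z x = dd u y x - dd u y z - (fderiv ℝ u z - fderiv ℝ u y) (x - z) := by
  simp only [dd, sub_apply]
  have : fderiv ℝ u y (x - y) = fderiv ℝ u y (x - z) + fderiv ℝ u y (z - y) := by
    rw [← map_add]; congr 1; abel
  rw [this]; ring

lemma adjugate_posSemidef {A : Matrix (Fin n) (Fin n) ℝ} (hA : A.PosSemidef) :
    A.adjugate.PosSemidef := by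
  have hp : ∀ ε : ℝ, 0 < ε → (A + ε • (1 : Matrix (Fin n) (Fin n) ℝ)).adjugate.PosSemidef := by
    intro ε hε
    have h1 : (A + ε • (1 : Matrix (Fin n) (Fin n) ℝ)).PosDef :=
      Matrix.PosDef.posSemidef_add hA (Matrix.PosDef.one.smul hε)
    have h2 := (h1.inv.posSemidef).smul h1.det_pos.le
    rwa [Matrix.inv_def, smul_smul, Ring.mul_inverse_cancel _ (by simpa using h1.det_pos.ne'),
      one_smul] at h2
  refine Matrix.PosSemidef.of_dotProduct_mulVec_nonneg ?_ fun x => ?_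
  · rw [Matrix.IsHermitian, Matrix.adjugate_conjTranspose, hA.isHermitian]
  · have hc : Continuous fun ε : ℝ => star x ⬝ᵥ
        ((A + ε • (1 : Matrix (Fin n) (Fin n) ℝ)).adjugate.mulVec x) := by
      have : Continuous fun ε : ℝ => (A + ε • (1 : Matrix (Fin n) (Fin n) ℝ)) := by fun_prop
      exact Continuous.dotProduct continuous_const
        (Continuous.matrix_mulVec this.matrix_adjugate continuous_const)
    have ht := (hc.tendsto 0).mono_left (nhdsWithin_le_nhds (s := Set.Ioi 0))
    simp only [zero_smul, add_zero] at ht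
    refine ge_of_tendsto ht ?_
    filter_upwards [self_mem_nhdsWithin] with ε hε
    exact (hp ε hε).dotProduct_mulVec_nonneg x

lemma UB_eq (u : E n → ℝ) (x : E n) (a b : Fin n → ℝ) :
    UB u x a b = a ⬝ᵥ (cofU u x).mulVec b := by
  simp only [UB, dotProduct, Matrix.mulVec, Finset.mul_sum]
  exact Finset.sum_congr rfl fun i _ => Finset.sum_congr rfl fun j _ => by ring

lemma UB_add_left (u : E n → ℝ) (x : E n) (a b c : Fin n → ℝ) :
    UB u x (a + b) c = UB u x a c + UB u x b c := by simp [UB_eq, add_dotProduct]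

lemma UB_add_right (u : E n → ℝ) (x : E n) (a b c : Fin n → ℝ) :
    UB u x a (b + c) = UB u x a b + UB u x a c := by
  simp [UB_eq, Matrix.mulVec_add, dotProduct_add]

lemma UB_smul_left (u : E n → ℝ) (x : E n) (r : ℝ) (a b : Fin n → ℝ) :
    UB u x (r • a) b = r * UB u x a b := by simp [UB_eq, smul_dotProduct]

lemma UB_smul_right (u : E n → ℝ) (x : E n) (r : ℝ) (a b : Fin n → ℝ) :
    UB u x a (r • b) = r * UB u x a b := by
  simp [UB_eq, Matrix.mulVec_smul, dotProduct_smul]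

variable {α β : ℝ} {Ω : Set (E n)} {u : E n → ℝ}

namespace Setup

lemma dd_nonneg (h : Setup n α β Ω u) {z x : E n} (hz : z ∈ Ω) (hx : x ∈ closure Ω) :
    0 ≤ dd u z x := by
  have hd : HasFDerivAt u (fderiv ℝ u z) z :=
    ((h.smooth z hz).differentiableAt (by simp)).hasFDerivAt
  have hl := hd.hasLineDerivAt (x - z)
  have ht := hl.tendsto_slope_zero_right
  refine sub_nonneg.2 (le_of_tendsto ht ?_)
  filter_upwards [Ioc_mem_nhdsGT (show (0 : ℝ) < 1 by norm_num)] with t ht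
  have hc := h.conv.2 (subset_closure hz) hx (sub_nonneg.2 ht.2) ht.1.le (by ring)
  have e : z + t • (x - z) = (1 - t) • z + t • x := by module
  simp only [smul_eq_mul] at hc ⊢
  simp only [e]
  rw [inv_mul_le_iff₀ ht.1]
  linarith

lemma grad_mono (h : Setup n α β Ω u) {z x : E n} (hz : z ∈ Ω) (hx : x ∈ Ω) :
    0 ≤ (fderiv ℝ u x - fderiv ℝ u z) (x - z) := by
  have h1 := h.dd_nonneg hz (subset_closure hx)
  have h2 := h.dd_nonneg hx (subset_closure hz)
  have h3 := dd_three u z x z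
  have : (fderiv ℝ u x - fderiv ℝ u z) (z - x) = -(fderiv ℝ u x - fderiv ℝ u z) (x - z) := by
    rw [← map_neg]; simp
  rw [this, dd_self] at h3
  linarith

lemma eventually_smooth (h : Setup n α β Ω u) {x : E n} (hx : x ∈ Ω) :
    ∀ᶠ y in nhds x, ContDiffAt ℝ ∞ u y := by
  filter_upwards [h.op.mem_nhds hx] with y hy using h.smooth y hy

lemma snd_nonneg (h : Setup n α β Ω u) {x : E n} (hx : x ∈ Ω) (v : E n) :
    0 ≤ fderiv ℝ (fderiv ℝ u) x v v := by
  have hsm : ContDiffAt ℝ ∞ (fderiv ℝ u) x := (h.smooth x hx).fderiv_right (m := ∞) (by simp)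
  have hl := (hsm.differentiableAt (by simp)).hasFDerivAt.hasLineDerivAt v
  have ht := hl.tendsto_slope_zero_right
  have ht2 := ((ContinuousLinearMap.apply ℝ ℝ v).continuous.tendsto _).comp ht
  refine ge_of_tendsto ht2 ?_
  have hin : ∀ᶠ t : ℝ in nhdsWithin 0 (Set.Ioi 0), x + t • v ∈ Ω := by
    have : Filter.Tendsto (fun t : ℝ => x + t • v) (nhds 0) (nhds x) := by
      have : Continuous fun t : ℝ => x + t • v := by fun_prop
      simpa using this.tendsto 0
    exact (this.mono_left nhdsWithin_le_nhds).eventually (h.op.mem_nhds hx)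
  filter_upwards [hin, self_mem_nhdsWithin] with t ht htp
  have htp' : (0 : ℝ) < t := htp
  have := h.grad_mono hx ht
  simp only [add_sub_cancel_left, map_smul, smul_eq_mul] at this
  simp only [Function.comp, ContinuousLinearMap.apply_apply, smul_apply, smul_eq_mul]
  exact mul_nonneg (by positivity) (nonneg_of_mul_nonneg_right this htp')

lemma hess_posSemidef (h : Setup n α β Ω u) {x : E n} (hx : x ∈ Ω) : (Hess u x).PosSemidef := by
  refine Matrix.PosSemidef.of_dotProduct_mulVec_nonneg ?_ fun v => ?_
  · rw [Matrix.IsHermitian, Matrix.conjTranspose_eq_transpose_of_trivial, hess_symm (h.smooth x hx)]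
  · have := h.snd_nonneg hx (WithLp.toLp 2 v)
    rw [snd_eq_sum (h.smooth x hx)] at this
    refine this.trans_eq ?_
    simp only [dotProduct, Matrix.mulVec, Finset.mul_sum]
    exact Finset.sum_congr rfl fun i _ => Finset.sum_congr rfl fun j _ => by simp [Hess]; ring

lemma det_nonneg (h : Setup n α β Ω u) {x : E n} (hx : x ∈ Ω) : 0 ≤ (Hess u x).det :=
  (h.hess_posSemidef hx).det_nonneg

lemma cof_posSemidef (h : Setup n α β Ω u) {x : E n} (hx : x ∈ Ω) : (cofU u x).PosSemidef :=
  adjugate_posSemidef (h.hess_posSemidef hx)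

lemma UB_symm (h : Setup n α β Ω u) {x : E n} (hx : x ∈ Ω) (a b : Fin n → ℝ) :
    UB u x a b = UB u x b a := by
  rw [UB, UB, Finset.sum_comm]
  refine Finset.sum_congr rfl fun i _ => Finset.sum_congr rfl fun j _ => ?_
  rw [cofU_symm (h.smooth x hx)]; ring

lemma UB_nonneg (h : Setup n α β Ω u) {x : E n} (hx : x ∈ Ω) (a : Fin n → ℝ) :
    0 ≤ UB u x a a := by
  rw [UB_eq]; simpa using (h.cof_posSemidef hx).dotProduct_mulVec_nonneg a

lemma UB_sq_le (h : Setup n α β Ω u) {x : E n} (hx : x ∈ Ω) (a b : Fin n → ℝ) :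
    UB u x a b ^ 2 ≤ UB u x a a * UB u x b b := by
  have key : ∀ t : ℝ, 0 ≤ UB u x b b * (t * t) + (2 * UB u x a b) * t + UB u x a a := by
    intro t
    have := h.UB_nonneg hx (a + t • b)
    simp only [UB_add_left, UB_add_right, UB_smul_left, UB_smul_right] at this
    rw [h.UB_symm hx b a] at this
    linarith
  have := discrim_le_zero key
  rw [discrim] at this
  nlinarith

lemma hess_posDef (h : Setup n α β Ω u) {x : E n} (hx : x ∈ Ω) (hd : (Hess u x).det ≠ 0) :
    (Hess u x).PosDef :=
  (Matrix.PosSemidef.posDef_iff_det_ne_zero (h.hess_posSemidef hx)).2 hd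

lemma UB_pos (h : Setup n α β Ω u) {x : E n} (hx : x ∈ Ω) (hd : (Hess u x).det ≠ 0)
    {a : Fin n → ℝ} (ha : a ≠ 0) : 0 < UB u x a a := by
  have h1 := h.hess_posDef hx hd
  have h2 := h1.inv.dotProduct_mulVec_pos ha
  have h3 : cofU u x = (Hess u x).det • (Hess u x)⁻¹ := by
    rw [Matrix.inv_def, smul_smul, Ring.mul_inverse_cancel _ (by simpa using hd), one_smul, cofU]
  rw [UB_eq, h3, Matrix.smul_mulVec, dotProduct_smul]
  exact mul_pos h1.det_pos (by simpa using h2)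

end Setup

lemma CptIn.mono {A A' B : Set (E n)} (h : CptIn A B) (hA : A' ⊆ A) : CptIn A' B :=
  ⟨h.1.of_isClosed_subset isClosed_closure (closure_mono hA), (closure_mono hA).trans h.2⟩

lemma sec_mono {y : E n} {s s' : ℝ} (h : s' ≤ s) : MASection Ω u y s' ⊆ MASection Ω u y s :=
  fun _ hx => mem_section.2 ⟨(mem_section.1 hx).1, (mem_section.1 hx).2.trans_le h⟩

namespace Setup

lemma dd_cont (h : Setup n α β Ω u) (y : E n) : ContinuousOn (dd u y) (closure Ω) := by
  unfold dd
  exact (h.cont.sub continuousOn_const).sub (by fun_prop)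

lemma dd_convexOn (h : Setup n α β Ω u) (y : E n) : ConvexOn ℝ (closure Ω) (dd u y) := by
  refine ⟨h.conv.1, fun a ha b hb s t hs ht hst => ?_⟩
  have := h.conv.2 ha hb hs ht hst
  simp only [dd, smul_eq_mul] at *
  have e : fderiv ℝ u y (s • a + t • b - y)
      = s * fderiv ℝ u y (a - y) + t * fderiv ℝ u y (b - y) := by
    have : s • a + t • b - y = s • (a - y) + t • (b - y) := by
      have : y = (s + t) • y := by rw [hst, one_smul]
      nth_rw 1 [this]; module
    rw [this, map_add, map_smul, map_smul]; rfl
  rw [e]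
  have : u y = (s + t) * u y := by rw [hst, one_mul]
  linarith

lemma cl_convex (h : Setup n α β Ω u) : Convex ℝ (closure Ω) := h.conv.1

lemma dd_segment (h : Setup n α β Ω u) {y x : E n} (hy : y ∈ Ω) (hx : x ∈ closure Ω) {t : ℝ}
    (ht0 : 0 ≤ t) (ht1 : t ≤ 1) :
    y + t • (x - y) ∈ closure Ω ∧ dd u y (y + t • (x - y)) ≤ t * dd u y x := by
  have e : y + t • (x - y) = (1 - t) • y + t • x := by module
  have h1 := (h.dd_convexOn y).2 (subset_closure hy) hx (sub_nonneg.2 ht1) ht0 (by ring)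
  rw [e]
  refine ⟨h.cl_convex (subset_closure hy) hx (sub_nonneg.2 ht1) ht0 (by ring), ?_⟩
  simpa using h1

lemma sec_convex (h : Setup n α β Ω u) (y : E n) (s : ℝ) : Convex ℝ (MASection Ω u y s) := by
  have := (h.dd_convexOn y).convex_lt s
  have e : MASection Ω u y s = {x ∈ closure Ω | dd u y x < s} := Set.ext fun x => mem_section
  rwa [e]

lemma sec_bdd (h : Setup n α β Ω u) (y : E n) (s : ℝ) :
    Bornology.IsBounded (MASection Ω u y s) :=
  h.bdd.closure.subset fun _ hx => hx.1

lemma sec_closure_compact (h : Setup n α β Ω u) (y : E n) (s : ℝ) :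
    IsCompact (closure (MASection Ω u y s)) := (h.sec_bdd y s).isCompact_closure

lemma self_mem_sec {y : E n} (hy : y ∈ Ω) {s : ℝ} (hs : 0 < s) : y ∈ MASection Ω u y s :=
  mem_section.2 ⟨subset_closure hy, by simpa using hs⟩

lemma sec_open (h : Setup n α β Ω u) {y : E n} {s : ℝ} (hc : CptIn (MASection Ω u y s) Ω) :
    IsOpen (MASection Ω u y s) := by
  have h1 : MASection Ω u y s = Ω ∩ dd u y ⁻¹' Set.Iio s := by
    ext x
    constructor
    · intro hx; exact ⟨hc.2 (subset_closure hx), (mem_section.1 hx).2⟩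
    · intro hx; exact mem_section.2 ⟨subset_closure hx.1, hx.2⟩
  rw [h1]
  exact ((h.dd_cont y).mono subset_closure).isOpen_inter_preimage h.op isOpen_Iio

lemma mem_closure_sec_of_le (h : Setup n α β Ω u) {y x : E n} {s : ℝ} (hy : y ∈ Ω) (hs : 0 < s)
    (hx : x ∈ closure Ω) (hd : dd u y x ≤ s) : x ∈ closure (MASection Ω u y s) := by
  have ht : Filter.Tendsto (fun t : ℝ => y + t • (x - y)) (nhdsWithin 1 (Set.Iio 1)) (nhds x) := by
    have : Continuous fun t : ℝ => y + t • (x - y) := by fun_prop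
    have := this.tendsto 1
    simp only [one_smul, add_sub_cancel] at this
    exact this.mono_left nhdsWithin_le_nhds
  refine mem_closure_of_tendsto ht ?_
  filter_upwards [Ioo_mem_nhdsLT (show (0 : ℝ) < 1 by norm_num)] with t ht
  obtain ⟨h1, h2⟩ := h.dd_segment hy hx ht.1.le ht.2.le
  refine mem_section.2 ⟨h1, h2.trans_lt ?_⟩
  calc t * dd u y x ≤ t * s := by gcongr; exact ht.1.le
    _ < s := by nlinarith [ht.2]

lemma dd_le_of_mem_closure (h : Setup n α β Ω u) {y x : E n} {s : ℝ}
    (hx : x ∈ closure (MASection Ω u y s)) : x ∈ closure Ω ∧ dd u y x ≤ s := by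
  have hsub : MASection Ω u y s ⊆ closure Ω := fun _ hx => hx.1
  have hx' : x ∈ closure Ω := closure_minimal hsub isClosed_closure hx
  refine ⟨hx', ?_⟩
  have : IsClosed (closure Ω ∩ dd u y ⁻¹' Set.Iic s) :=
    (h.dd_cont y).preimage_isClosed_of_isClosed isClosed_closure isClosed_Iic
  have hss : MASection Ω u y s ⊆ closure Ω ∩ dd u y ⁻¹' Set.Iic s :=
    fun z hz => ⟨hz.1, (mem_section.1 hz).2.le⟩
  exact (closure_minimal hss this hx).2

lemma dd_eq_of_mem_frontier (h : Setup n α β Ω u) {y x : E n} {s : ℝ}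
    (hc : CptIn (MASection Ω u y s) Ω) (hx : x ∈ frontier (MASection Ω u y s)) :
    x ∈ Ω ∧ dd u y x = s := by
  have h1 := h.dd_le_of_mem_closure (frontier_subset_closure hx)
  refine ⟨hc.2 (frontier_subset_closure hx), le_antisymm h1.2 ?_⟩
  by_contra hlt
  push Not at hlt
  have : x ∈ MASection Ω u y s := mem_section.2 ⟨h1.1, hlt⟩
  rw [(h.sec_open hc).frontier_eq] at hx
  exact hx.2 this

lemma cptIn_of_le (h : Setup n α β Ω u) {y : E n} {s : ℝ}
    (hs : ∀ x ∈ closure Ω, dd u y x ≤ s → x ∈ Ω) : CptIn (MASection Ω u y s) Ω :=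
  ⟨h.sec_closure_compact y s, fun x hx => hs x (h.dd_le_of_mem_closure hx).1
    (h.dd_le_of_mem_closure hx).2⟩

lemma contDiffAt_dd (h : Setup n α β Ω u) (y : E n) {x : E n} (hx : x ∈ Ω) :
    ContDiffAt ℝ ∞ (dd u y) x := by
  unfold dd
  have := h.smooth x hx
  fun_prop

lemma hasFDerivAt_dd (h : Setup n α β Ω u) (y : E n) {x : E n} (hx : x ∈ Ω) :
    HasFDerivAt (dd u y) (fderiv ℝ u x - fderiv ℝ u y) x := by
  have h1 : HasFDerivAt u (fderiv ℝ u x) x :=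
    ((h.smooth x hx).differentiableAt (by simp)).hasFDerivAt
  have h2 : HasFDerivAt (fun x => fderiv ℝ u y (x - y)) (fderiv ℝ u y) x := by
    have := (fderiv ℝ u y).hasFDerivAt.comp x ((hasFDerivAt_id x).sub_const y)
    rwa [ContinuousLinearMap.comp_id] at this
  exact (h1.sub_const (u y)).sub h2

lemma contDiffAt_fderiv (h : Setup n α β Ω u) {x : E n} (hx : x ∈ Ω) :
    ContDiffAt ℝ ∞ (fderiv ℝ u) x := (h.smooth x hx).fderiv_right (m := ∞) (by simp)

end Setup

/-- The gradient as a vector field. -/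
def gr (f : E n → ℝ) (x : E n) : E n := WithLp.toLp 2 (pd f x)

@[simp] lemma gr_apply (f : E n → ℝ) (x : E n) (i : Fin n) : gr f x i = pd f x i := rfl

lemma inner_gr (f : E n → ℝ) (x v : E n) : inner ℝ (gr f x) v = fderiv ℝ f x v := by
  rw [fderiv_eq_sum]
  simp [PiLp.inner_apply, gr]

lemma contDiffAt_gr {f : E n → ℝ} {x : E n} (hf : ContDiffAt ℝ ∞ f x) :
    ContDiffAt ℝ ∞ (gr f) x := by
  rw [contDiffAt_euclidean]
  intro i; exact contDiffAt_pd hf i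

lemma det_fderiv_gr {f : E n → ℝ} {x : E n} (hf : ContDiffAt ℝ ∞ f x) :
    (fderiv ℝ (gr f) x).det = (Hess f x).det := by
  have hd : DifferentiableAt ℝ (gr f) x := (contDiffAt_gr hf).differentiableAt (by simp)
  rw [ContinuousLinearMap.det,
    ← LinearMap.det_toMatrix (EuclideanSpace.basisFun (Fin n) ℝ).toBasis, ← Matrix.det_transpose]
  congr 1
  ext i j
  rw [Matrix.transpose_apply, LinearMap.toMatrix_apply]
  simp only [OrthonormalBasis.coe_toBasis, EuclideanSpace.basisFun_apply,
    ContinuousLinearMap.coe_coe, OrthonormalBasis.coe_toBasis_repr_apply,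
    EuclideanSpace.basisFun_repr, Hess, Matrix.of_apply]
  have h1 : HasFDerivAt (fun y => gr f y j) ((EuclideanSpace.proj j : E n →L[ℝ] ℝ).comp
      (fderiv ℝ (gr f) x)) x := (EuclideanSpace.proj j : E n →L[ℝ] ℝ).hasFDerivAt.comp x hd.hasFDerivAt
  have h2 := h1.fderiv
  change _ = fderiv ℝ (fun y => gr f y j) x (ev i)
  rw [h2]; rfl

/-- The image of a set under a gradient map has volume at most the integral of the Hessian
determinant. -/
lemma volume_gr_image_le {f : E n → ℝ} {B : Set (E n)} (hB : MeasurableSet B)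
    (hf : ∀ x ∈ B, ContDiffAt ℝ ∞ f x) :
    volume (gr f '' B) ≤ ∫⁻ x in B, ENNReal.ofReal |(Hess f x).det| := by
  refine (addHaar_image_le_lintegral_abs_det_fderiv volume hB
    (fun x hx => ((contDiffAt_gr (hf x hx)).differentiableAt (by simp)).hasFDerivAt.hasFDerivWithinAt)).trans
    (le_of_eq ?_)
  refine setLIntegral_congr_fun hB fun x hx => ?_
  simp only [det_fderiv_gr (hf x hx)]

namespace Setup

/-- The gradient of a convex function is injective where the Hessian is invertible. -/
lemma gr_injOn (h : Setup n α β Ω u) : Set.InjOn (gr u) {x ∈ Ω | (Hess u x).det ≠ 0} := by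
  intro a ha b hb hab
  by_contra hne
  set v := b - a with hv
  have hv0 : v ≠ 0 := sub_ne_zero.2 (Ne.symm hne)
  have hfd : fderiv ℝ u a = fderiv ℝ u b := by
    ext w; rw [← inner_gr, ← inner_gr, hab]
  -- the gradient is constant in direction `v` along the segment
  have hseg : ∀ t ∈ Set.Icc (0 : ℝ) 1, fderiv ℝ u (a + t • v) v = fderiv ℝ u a v := by
    intro t ht
    have hx : a + t • v ∈ Ω := by
      have := h.cvx ha.1 hb.1 (sub_nonneg.2 ht.2) ht.1 (by ring)
      convert this using 1; rw [hv]; module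
    rcases eq_or_lt_of_le ht.1 with h0 | h0
    · rw [← h0]; simp
    rcases eq_or_lt_of_le ht.2 with h1 | h1
    · rw [h1]; simp [hv, hfd]
    have m1 := h.grad_mono ha.1 hx
    have m2 := h.grad_mono hx hb.1
    have e1 : a + t • v - a = t • v := by abel
    have e2 : b - (a + t • v) = (1 - t) • v := by rw [hv]; module
    rw [e1, map_smul, smul_eq_mul] at m1
    rw [e2, map_smul, smul_eq_mul] at m2
    have m1' := nonneg_of_mul_nonneg_right m1 h0
    have m2' := nonneg_of_mul_nonneg_right m2 (by linarith)
    simp only [sub_apply, ← hfd] at m1' m2'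
    linarith
  have hpd := h.hess_posDef ha.1 ha.2
  have hsnd : fderiv ℝ (fderiv ℝ u) a v v = 0 := by
    have hd := ((h.contDiffAt_fderiv ha.1).differentiableAt (by simp)).hasFDerivAt.hasLineDerivAt v
    have ht := hd.tendsto_slope_zero_right
    have ht2 := ((ContinuousLinearMap.apply ℝ ℝ v).continuous.tendsto _).comp ht
    refine tendsto_nhds_unique ht2 (tendsto_const_nhds.congr' ?_)
    filter_upwards [Ioc_mem_nhdsGT (show (0 : ℝ) < 1 by norm_num)] with t ht
    simp [hseg t ⟨ht.1.le, ht.2⟩]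
  have hpos := hpd.dotProduct_mulVec_pos (x := v.ofLp) (by
    intro h0; apply hv0; ext i; exact congrFun h0 i)
  rw [snd_eq_sum (h.smooth a ha.1)] at hsnd
  have : star v.ofLp ⬝ᵥ (Hess u a).mulVec v.ofLp = ∑ i, ∑ j, v i * v j * pd2 u a i j := by
    simp only [dotProduct, Matrix.mulVec, Finset.mul_sum]
    exact Finset.sum_congr rfl fun i _ => Finset.sum_congr rfl fun j _ => by simp [Hess]; ring
  rw [this, hsnd] at hpos
  exact lt_irrefl _ hpos

lemma contOn_det (h : Setup n α β Ω u) : ContinuousOn (fun x => (Hess u x).det) Ω :=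
  fun x hx => (contDiffAt_det (h.smooth x hx)).continuousAt.continuousWithinAt

lemma integrableOn_det (h : Setup n α β Ω u) {B : Set (E n)} (hB : CptIn B Ω) :
    IntegrableOn (fun x => (Hess u x).det) B :=
  ((h.contOn_det.mono hB.2).integrableOn_compact hB.1).mono_set subset_closure

lemma ma_nonneg (h : Setup n α β Ω u) {B : Set (E n)} (hm : MeasurableSet B) (hB : B ⊆ Ω) :
    0 ≤ maMeasure u B := setIntegral_nonneg hm fun _ hx => h.det_nonneg (hB hx)

lemma ma_mono (h : Setup n α β Ω u) {A B : Set (E n)} (hm : MeasurableSet B) (hB : CptIn B Ω)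
    (hAB : A ⊆ B) : maMeasure u A ≤ maMeasure u B := by
  refine setIntegral_mono_set (h.integrableOn_det hB) ?_ (Filter.Eventually.of_forall hAB)
  filter_upwards [ae_restrict_mem hm] with x hx using h.det_nonneg (hB.2 (subset_closure hx))

lemma ofReal_ma (h : Setup n α β Ω u) {B : Set (E n)} (hm : MeasurableSet B) (hB : CptIn B Ω) :
    ENNReal.ofReal (maMeasure u B) = ∫⁻ x in B, ENNReal.ofReal (Hess u x).det := by
  refine ofReal_integral_eq_lintegral_ofReal (h.integrableOn_det hB) ?_
  filter_upwards [ae_restrict_mem hm] with x hx using h.det_nonneg (hB.2 (subset_closure hx))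

/-- The Monge-Ampère measure is the volume of the gradient image. -/
lemma volume_gr_image (h : Setup n α β Ω u) {B : Set (E n)} (hm : MeasurableSet B)
    (hB : CptIn B Ω) : volume (gr u '' B) = ENNReal.ofReal (maMeasure u B) := by
  have hBΩ : B ⊆ Ω := fun x hx => hB.2 (subset_closure hx)
  rw [h.ofReal_ma hm hB]
  apply le_antisymm
  · refine (volume_gr_image_le hm fun x hx => h.smooth x (hBΩ hx)).trans (le_of_eq ?_)
    refine setLIntegral_congr_fun hm fun x hx => ?_
    simp only [abs_of_nonneg (h.det_nonneg (hBΩ hx))]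
  · set B' := B ∩ {x ∈ Ω | (Hess u x).det ≠ 0} with hB'
    have hopen : IsOpen {x ∈ Ω | (Hess u x).det ≠ 0} :=
      h.contOn_det.isOpen_inter_preimage h.op isOpen_ne
    have hm' : MeasurableSet B' := hm.inter hopen.measurableSet
    have e1 := lintegral_abs_det_fderiv_eq_addHaar_image volume hm'
      (fun x hx => ((contDiffAt_gr (h.smooth x (hBΩ hx.1))).differentiableAt
        (by simp)).hasFDerivAt.hasFDerivWithinAt) (h.gr_injOn.mono Set.inter_subset_right)
    calc ∫⁻ x in B, ENNReal.ofReal (Hess u x).det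
        = ∫⁻ x in B', ENNReal.ofReal |(fderiv ℝ (gr u) x).det| := by
          rw [← lintegral_indicator hm, ← lintegral_indicator hm']
          refine lintegral_congr fun x => ?_
          by_cases hx : x ∈ B
          · rw [Set.indicator_of_mem hx]
            by_cases hd : (Hess u x).det = 0
            · rw [Set.indicator_of_notMem (fun hx' => hx'.2.2 hd), hd]; simp
            · rw [Set.indicator_of_mem (show x ∈ B' from ⟨hx, hBΩ hx, hd⟩),
                det_fderiv_gr (h.smooth x (hBΩ hx)), abs_of_nonneg (h.det_nonneg (hBΩ hx))]
          · rw [Set.indicator_of_notMem hx, Set.indicator_of_notMem (fun hx' => hx hx'.1)]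
      _ = volume (gr u '' B') := e1
      _ ≤ volume (gr u '' B) := measure_mono (Set.image_mono Set.inter_subset_left)

end Setup

/-- Linear combination of the vectors `a i`. -/
def lin (a : Fin n → E n) : (Fin n → ℝ) →ₗ[ℝ] E n :=
  Fintype.linearCombination ℝ a

lemma lin_apply (a : Fin n → E n) (c : Fin n → ℝ) : lin a c = ∑ i, c i • a i := by
  simp [lin, Fintype.linearCombination_apply]

/-- The matrix with columns `a i`. -/
def colMat (a : Fin n → E n) : Matrix (Fin n) (Fin n) ℝ := Matrix.of fun i j => a j i

lemma lin_eq_mulVec (a : Fin n → E n) (c : Fin n → ℝ) :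
    lin a c = WithLp.toLp 2 ((colMat a).mulVec c) := by
  ext i
  rw [lin_apply]
  simp [colMat, Matrix.mulVec, dotProduct, mul_comm]

lemma continuous_lin (a : Fin n → E n) : Continuous (lin a) :=
  LinearMap.continuous_of_finiteDimensional _

lemma inner_lin_right (a : Fin n → E n) (c : Fin n → ℝ) (q : E n) :
    inner ℝ q (lin a c) = ∑ i, c i * inner ℝ q (a i) := by
  rw [lin_apply, inner_sum]
  simp [real_inner_smul_right]

/-- Absolute determinant of a family of vectors. -/
def da (a : Fin n → E n) : ℝ := |(colMat a).det|

lemma da_nonneg (a : Fin n → E n) : 0 ≤ da a := abs_nonneg _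

lemma volume_lin_image (a : Fin n → E n) (B : Set (Fin n → ℝ)) :
    volume (lin a '' B) = ENNReal.ofReal (da a) * volume B := by
  have e : lin a '' B = (MeasurableEquiv.toLp 2 (Fin n → ℝ)) '' (Matrix.toLin' (colMat a) '' B) := by
    rw [Set.image_image]
    refine Set.image_congr fun c _ => ?_
    rw [lin_eq_mulVec]; simp
  rw [e, ← MeasurableEquiv.preimage_symm,
    (EuclideanSpace.volume_preserving_symm_measurableEquiv_toLp (Fin n)).measure_preimage_equiv,
    Measure.addHaar_image_linearMap]
  simp [da]

/-- The cube `[-r, r]^n` in coordinates. -/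
def cube (n : ℕ) (r : ℝ) : Set (Fin n → ℝ) := {c | ∀ i, |c i| ≤ r}

lemma volume_cube {r : ℝ} : volume (cube n r) = ENNReal.ofReal (2 * r) ^ n := by
  have : cube n r = Set.Icc (fun _ => -r) (fun _ => r) := by
    ext c
    simp only [cube, Set.mem_ofPred_eq, Set.mem_Icc, Pi.le_def, abs_le, forall_and]
  rw [this, Real.volume_Icc_pi]
  simp [two_mul]

lemma lin_surjective {a : Fin n → E n} (ha : da a ≠ 0) (x : E n) : ∃ c, lin a c = x := by
  have hd : (colMat a).det ≠ 0 := by simpa [da] using ha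
  refine ⟨(colMat a)⁻¹.mulVec x.ofLp, ?_⟩
  rw [lin_eq_mulVec, Matrix.mulVec_mulVec, Matrix.mul_nonsing_inv _ (by simpa using hd)]
  simp

/-- Every basis of `ℝⁿ` has a dual basis. -/
lemma exists_dual {a : Fin n → E n} (ha : da a ≠ 0) : ∃ b : Fin n → E n,
    (∀ i j, inner ℝ (b i) (a j) = if i = j then (1 : ℝ) else 0) ∧ da b = (da a)⁻¹ := by
  have hd : (colMat a).det ≠ 0 := by simpa [da] using ha
  refine ⟨fun i => WithLp.toLp 2 fun k => (colMat a)⁻¹ i k, fun i j => ?_, ?_⟩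
  · have h1 := Matrix.nonsing_inv_mul (colMat a) (by simpa using hd)
    have h2 := congrFun (congrFun h1 i) j
    rw [Matrix.mul_apply, Matrix.one_apply] at h2
    rw [← h2, PiLp.inner_apply]
    refine Finset.sum_congr rfl fun k _ => ?_
    simp [colMat, mul_comm]
  · have : colMat (fun i => (WithLp.toLp 2 fun k => (colMat a)⁻¹ i k : E n))
        = ((colMat a)⁻¹).transpose := by
      ext i j; simp [colMat]
    rw [da, this, Matrix.det_transpose, Matrix.det_nonsing_inv, Ring.inverse_eq_inv', abs_inv, da]

/-- Expansion of a vector in the dual basis. -/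
lemma dual_expansion {a b : Fin n → E n} (ha : da a ≠ 0)
    (hb : ∀ i j, inner ℝ (b i) (a j) = if i = j then (1 : ℝ) else 0) (q : E n) :
    q = lin b fun i => inner ℝ q (a i) := by
  refine ext_inner_right ℝ fun x => ?_
  obtain ⟨c, rfl⟩ := lin_surjective ha x
  rw [inner_lin_right, inner_lin_right]
  refine Finset.sum_congr rfl fun i _ => ?_
  rw [lin_apply, sum_inner]
  simp [real_inner_smul_left, hb]

/-- The polar cube: vectors whose pairings with all `a i` are at most `κ`. -/
lemma volume_polar_cube {a : Fin n → E n} (ha : da a ≠ 0) {κ : ℝ} (w : E n) :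
    volume {q : E n | ∀ i, |inner ℝ (q - w) (a i)| ≤ κ}
      = ENNReal.ofReal (da a)⁻¹ * ENNReal.ofReal (2 * κ) ^ n := by
  obtain ⟨b, hb, hdb⟩ := exists_dual ha
  have e : {q : E n | ∀ i, |inner ℝ (q - w) (a i)| ≤ κ} = (fun x => w + x) '' (lin b '' cube n κ) := by
    ext q
    simp only [Set.mem_ofPred_eq, Set.mem_image]
    constructor
    · intro hq
      exact ⟨q - w, ⟨_, hq, (dual_expansion ha hb (q - w)).symm⟩, by abel⟩
    · rintro ⟨_, ⟨c, hc, rfl⟩, rfl⟩ i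
      have : inner ℝ (lin b c) (a i) = c i := by
        rw [lin_apply, sum_inner]; simp [real_inner_smul_left, hb]
      rw [add_sub_cancel_left, this]; exact hc i
  rw [e, Set.image_add_left, measure_preimage_add, volume_lin_image, volume_cube, hdb]

/-- A bounded open convex set is squeezed between two comparable parallelepipeds centered at a
given interior point. -/
lemma exists_box {S : Set (E n)} (hb : Bornology.IsBounded S) {y : E n}
    (hy : S ∈ nhds y) : ∃ a : Fin n → E n, 0 < da a ∧ (∀ i, y + a i ∈ closure S) ∧
      ∀ x ∈ closure S, ∃ c ∈ cube n 1, x = y + lin a c := by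
  have hK : IsCompact (closure S) := hb.isCompact_closure
  have hKpi : IsCompact (Set.univ.pi fun _ : Fin n => closure S) := isCompact_univ_pi fun _ => hK
  have hne : (Set.univ.pi fun _ : Fin n => closure S).Nonempty :=
    ⟨fun _ => y, fun i _ => subset_closure (mem_of_mem_nhds hy)⟩
  have hcont : Continuous fun v : Fin n → E n => da fun i => v i - y := by
    unfold da colMat
    refine continuous_abs.comp (Continuous.matrix_det ?_)
    refine continuous_matrix fun i j => ?_
    simp only [Matrix.of_apply, PiLp.sub_apply]
    fun_prop
  obtain ⟨v, hv, hmax⟩ := hKpi.exists_isMaxOn hne hcont.continuousOn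
  set a : Fin n → E n := fun i => v i - y with ha
  have hpos : 0 < da a := by
    obtain ⟨ρ, hρ, hball⟩ := Metric.mem_nhds_iff.1 hy
    have hw : (fun i => y + (ρ / 2) • ev i) ∈ Set.univ.pi fun _ : Fin n => closure S := by
      intro i _
      refine subset_closure (hball ?_)
      simp [Metric.mem_ball, dist_eq_norm, norm_smul, abs_of_pos hρ]
      linarith
    refine lt_of_lt_of_le ?_ (hmax hw)
    have : colMat (fun i => y + (ρ / 2) • ev i - y) = (ρ / 2) • (1 : Matrix (Fin n) (Fin n) ℝ) := by
      ext i j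
      simp [colMat, Matrix.one_apply]
    simp only [da]
    rw [this, Matrix.det_smul, Matrix.det_one]
    have : 0 < (ρ / 2) ^ n := by positivity
    simp only [Fintype.card_fin, mul_one]; positivity
  refine ⟨a, hpos, fun i => by simpa [ha] using hv i trivial, fun x hx => ?_⟩
  have hd : (colMat a).det ≠ 0 := by have := hpos.ne'; simpa [da] using this
  have hcr := Matrix.mulVec_cramer (colMat a) (x - y).ofLp
  refine ⟨(colMat a).det⁻¹ • (colMat a).cramer (x - y).ofLp, fun i => ?_, ?_⟩
  · have hw : Function.update v i x ∈ Set.univ.pi fun _ : Fin n => closure S := by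
      intro j _
      by_cases hji : j = i
      · subst hji; simpa using hx
      · simpa [hji] using hv j trivial
    have h1 := hmax hw
    have h2 : colMat (fun j => Function.update v i x j - y)
        = (colMat a).updateCol i (x - y).ofLp := by
      ext k j
      by_cases hji : j = i
      · subst hji; simp [colMat]
      · simp [colMat, hji, ha]
    simp only [Set.mem_ofPred_eq, da] at h1
    rw [h2, ← Matrix.cramer_apply] at h1
    rw [Pi.smul_apply, smul_eq_mul, abs_mul, abs_inv, inv_mul_le_iff₀ (by simpa using hd), mul_one]
    exact h1
  · rw [lin_eq_mulVec, Matrix.mulVec_smul, hcr, smul_smul, inv_mul_cancel₀ hd, one_smul]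
    simp

/-- Positive combinations with total weight less than one stay in an open convex set. -/
lemma add_lin_mem {S : Set (E n)} (ho : IsOpen S) (hcv : Convex ℝ S) {y : E n} (hy : y ∈ S)
    {a : Fin n → E n} (ha : ∀ i, y + a i ∈ closure S) {c : Fin n → ℝ} (hc : ∀ i, 0 ≤ c i)
    (hs : ∑ i, c i < 1) : y + lin a c ∈ S := by
  rcases eq_or_lt_of_le (Finset.sum_nonneg fun i (_ : i ∈ Finset.univ) => hc i) with h0 | h0
  · have : c = 0 := by
      ext i
      exact (Finset.sum_eq_zero_iff_of_nonneg fun i _ => hc i).1 h0.symm i (Finset.mem_univ i)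
    simpa [this] using hy
  set σ := ∑ i, c i with hσ
  have hp : ∑ i, (c i / σ) • (y + a i) ∈ closure S := by
    refine hcv.closure.sum_mem (fun i _ => div_nonneg (hc i) h0.le) ?_ fun i _ => ha i
    rw [← Finset.sum_div, ← hσ, div_self h0.ne']
  have e : y + lin a c = (1 - σ) • y + σ • ∑ i, (c i / σ) • (y + a i) := by
    rw [Finset.smul_sum, lin_apply]
    have : ∀ i, σ • (c i / σ) • (y + a i) = c i • y + c i • a i := by
      intro i
      rw [smul_smul, mul_div_cancel₀ _ h0.ne', smul_add]
    simp_rw [this, Finset.sum_add_distrib, ← Finset.sum_smul, ← hσ]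
    module
  rw [e]
  have := hcv.combo_interior_closure_mem_interior (by rwa [ho.interior_eq]) hp
    (sub_pos.2 hs) h0.le (by ring : 1 - σ + σ = 1)
  rwa [ho.interior_eq] at this

lemma lin_image_add_volume (a : Fin n → E n) (y : E n) (B : Set (Fin n → ℝ)) :
    volume ((fun c => y + lin a c) '' B) = ENNReal.ofReal (da a) * volume B := by
  rw [← volume_lin_image, ← Set.image_image (fun x => y + x) (lin a), Set.image_add_left,
    measure_preimage_add]

lemma volume_le_of_box {S : Set (E n)} {y : E n} {a : Fin n → E n}
    (h : ∀ x ∈ S, ∃ c ∈ cube n 1, x = y + lin a c) :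
    volume S ≤ ENNReal.ofReal (2 ^ n * da a) := by
  have hsub : S ⊆ (fun c => y + lin a c) '' cube n 1 := by
    intro x hx
    obtain ⟨c, hc, rfl⟩ := h x hx
    exact ⟨c, hc, rfl⟩
  refine (measure_mono hsub).trans ?_
  rw [lin_image_add_volume, volume_cube, mul_one, mul_comm, ENNReal.ofReal_mul (by positivity),
    ENNReal.ofReal_pow (by norm_num)]

lemma volume_Icc_const (l r : ℝ) : volume (Set.Icc (fun _ : Fin n => l) (fun _ => r))
    = ENNReal.ofReal (r - l) ^ n := by
  rw [Real.volume_Icc_pi]; simp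

lemma le_volume_of_box {S : Set (E n)} (ho : IsOpen S) (hcv : Convex ℝ S) {y : E n} (hy : y ∈ S)
    {a : Fin n → E n} (ha : ∀ i, y + a i ∈ closure S) (hn : 0 < n) :
    ENNReal.ofReal (da a * (2 * n : ℝ)⁻¹ ^ n) ≤ volume S := by
  have hsub : (fun c => y + lin a c) '' Set.Icc (fun _ => 0) (fun _ => (2 * n : ℝ)⁻¹) ⊆ S := by
    rintro _ ⟨c, hc, rfl⟩
    refine add_lin_mem ho hcv hy ha hc.1 ?_
    calc ∑ i, c i ≤ ∑ _i : Fin n, (2 * n : ℝ)⁻¹ := Finset.sum_le_sum fun i _ => hc.2 i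
      _ < 1 := by
        have : (0 : ℝ) < n := by exact_mod_cast hn
        simp; field_simp; norm_num
  refine le_trans (le_of_eq ?_) (measure_mono hsub)
  rw [lin_image_add_volume, volume_Icc_const, ENNReal.ofReal_mul (da_nonneg a), sub_zero,
    ENNReal.ofReal_pow (by positivity)]

/-- The family `a` spans a parallelepiped comparable to `S` around `y`. -/
structure IsBox (S : Set (E n)) (y : E n) (a : Fin n → E n) : Prop where
  pos : 0 < da a
  vert : ∀ i, y + a i ∈ closure S
  cover : ∀ x ∈ closure S, ∃ c ∈ cube n 1, x = y + lin a c

lemma Setup.npos (h : Setup n α β Ω u) : 0 < n := by have := h.hn; omega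

lemma Setup.exists_isBox (h : Setup n α β Ω u) {y : E n} {s : ℝ} (hy : y ∈ Ω) (hs : 0 < s)
    (hc : CptIn (MASection Ω u y s) Ω) : ∃ a, IsBox (MASection Ω u y s) y a := by
  obtain ⟨a, h1, h2, h3⟩ := exists_box (h.sec_bdd y s)
    ((h.sec_open hc).mem_nhds (Setup.self_mem_sec hy hs))
  exact ⟨a, h1, h2, h3⟩

/-- Affine functions below the section height are realized as slopes (Alexandrov). -/
lemma Setup.slope_mem (h : Setup n α β Ω u) {y z : E n} {s : ℝ} (_hy : y ∈ Ω)
    (hc : CptIn (MASection Ω u y s) Ω) (hz : z ∈ MASection Ω u y s) {q : E n}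
    (hq : ∀ x ∈ MASection Ω u y s, inner ℝ q (x - z) ≤ 1) {t : ℝ} (ht : 0 ≤ t)
    (hts : t < s - dd u y z) : gr u y + t • q ∈ gr u '' MASection Ω u y s := by
  set S := MASection Ω u y s with hS
  have hKΩ : closure S ⊆ Ω := hc.2
  set F : E n → ℝ := fun x => dd u y x - t * inner ℝ q (x - z) with hF
  have hFc : ContinuousOn F (closure S) :=
    ((h.dd_cont y).mono (hKΩ.trans subset_closure)).sub (by fun_prop)
  obtain ⟨x, hx, hmin⟩ := hc.1.exists_isMinOn ⟨z, subset_closure hz⟩ hFc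
  have hq' : ∀ x ∈ closure S, inner ℝ q (x - z) ≤ 1 := by
    intro x hx
    have : IsClosed {x : E n | inner ℝ q (x - z) ≤ 1} :=
      isClosed_le (by fun_prop) continuous_const
    exact closure_minimal hq this hx
  have hxS : x ∈ S := by
    refine mem_section.2 ⟨subset_closure (hKΩ hx), ?_⟩
    have h1 : F x ≤ F z := hmin (subset_closure hz)
    simp only [hF, sub_self, inner_zero_right, mul_zero, sub_zero] at h1
    have := mul_le_mul_of_nonneg_left (hq' x hx) ht
    linarith
  refine ⟨x, hxS, ?_⟩
  have hloc : IsLocalMin F x := by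
    filter_upwards [(h.sec_open hc).mem_nhds hxS] with w hw using hmin (subset_closure hw)
  have hxΩ := hKΩ hx
  have hd : HasFDerivAt F ((fderiv ℝ u x - fderiv ℝ u y) - t • innerSL ℝ q) x := by
    refine (h.hasFDerivAt_dd y hxΩ).sub ?_
    have h2 := ((innerSL ℝ q).hasFDerivAt (x := x - z)).comp x ((hasFDerivAt_id x).sub_const z)
    rw [ContinuousLinearMap.comp_id] at h2
    exact h2.const_mul t
  have h0 := hloc.hasFDerivAt_eq_zero hd
  refine ext_inner_right ℝ fun v => ?_
  have h1 := DFunLike.congr_fun h0 v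
  simp only [sub_apply, smul_apply, innerSL_apply_apply, smul_eq_mul, zero_apply] at h1
  rw [inner_add_left, real_inner_smul_left, inner_gr, inner_gr]
  linarith

lemma Setup.alek (h : Setup n α β Ω u) {y z : E n} {s : ℝ} (hy : y ∈ Ω)
    (hc : CptIn (MASection Ω u y s) Ω) (hz : z ∈ MASection Ω u y s) {Q : Set (E n)}
    (hQ : ∀ q ∈ Q, ∀ x ∈ MASection Ω u y s, inner ℝ q (x - z) ≤ 1) :
    ENNReal.ofReal (((s - dd u y z) / 2) ^ n) * volume Q
      ≤ ENNReal.ofReal (maMeasure u (MASection Ω u y s)) := by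
  have hpos : 0 < s - dd u y z := sub_pos.2 (mem_section.1 hz).2
  rw [← h.volume_gr_image (h.sec_open hc).measurableSet hc]
  set t := (s - dd u y z) / 2 with ht
  have htp : 0 < t := by positivity
  have hsub : (fun x => gr u y + x) '' ((fun q => t • q) '' Q) ⊆ gr u '' MASection Ω u y s := by
    rintro _ ⟨_, ⟨q, hq, rfl⟩, rfl⟩
    exact h.slope_mem hy hc hz (hQ q hq) htp.le (by rw [ht]; linarith)
  refine le_trans (le_of_eq ?_) (measure_mono hsub)
  rw [Set.image_add_left, measure_preimage_add, Set.image_smul, Measure.addHaar_smul]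
  simp [abs_of_pos htp]

/-- Lower bound for the Monge-Ampère measure of a section. -/
lemma exists_ma_lower (n : ℕ) (α β : ℝ) : ∃ C > 0, ∀ (Ω : Set (E n)) (u : E n → ℝ),
    Setup n α β Ω u → ∀ y ∈ Ω, ∀ s > 0, CptIn (MASection Ω u y s) Ω →
    ∀ a, IsBox (MASection Ω u y s) y a →
      s ^ n ≤ C * (maMeasure u (MASection Ω u y s) * da a) := by
  refine ⟨max 1 (n : ℝ) ^ n, by positivity, fun Ω u h y hy s hs hc a ha => ?_⟩
  have hn : (0 : ℝ) < n := by exact_mod_cast h.npos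
  have h1n : (1 : ℝ) ≤ n := by exact_mod_cast h.npos
  rw [max_eq_right h1n]
  have hma := h.ma_nonneg (h.sec_open hc).measurableSet
    (fun x hx => hc.2 (subset_closure hx))
  have key := h.alek hy hc (Setup.self_mem_sec hy hs) (Q := {q | ∀ i, |inner ℝ (q - 0) (a i)| ≤ (n : ℝ)⁻¹})
    (by
      intro q hq x hx
      obtain ⟨c, hcc, rfl⟩ := ha.cover x (subset_closure hx)
      rw [add_sub_cancel_left, inner_lin_right]
      calc ∑ i, c i * inner ℝ q (a i) ≤ ∑ _i : Fin n, (n : ℝ)⁻¹ := by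
            refine Finset.sum_le_sum fun i _ => (le_abs_self _).trans ?_
            rw [abs_mul]
            have := hq i
            rw [sub_zero] at this
            calc |c i| * |inner ℝ q (a i)| ≤ 1 * (n : ℝ)⁻¹ := by
                  gcongr; exact hcc i
              _ = _ := one_mul _
        _ = 1 := by simp [hn.ne'])
  rw [volume_polar_cube ha.pos.ne', dd_self, sub_zero, ← ENNReal.ofReal_pow (by positivity),
    ← ENNReal.ofReal_mul (by have := ha.pos; positivity), ← ENNReal.ofReal_mul (by positivity),
    ENNReal.ofReal_le_ofReal_iff hma] at key
  have hda := ha.pos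
  have e : s ^ n = (n : ℝ) ^ n * (((s / 2) ^ n * ((da a)⁻¹ * (2 * (n : ℝ)⁻¹) ^ n)) * da a) := by
    rw [div_pow, mul_pow, inv_pow]; field_simp
  rw [e]
  gcongr

/-- A cube of definite size around the center of mass stays in the set. -/
lemma centerOfMass_add_lin_mem {S : Set (E n)} (ho : IsOpen S) (hcv : Convex ℝ S)
    (hb : Bornology.IsBounded S) {y : E n} (hy : y ∈ S) {a : Fin n → E n} (hapos : 0 < da a)
    (ha : ∀ i, y + a i ∈ closure S) (hn : 0 < n) {Λ : ℝ} (hΛ : 0 < Λ)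
    (hvol : volume S ≤ ENNReal.ofReal (Λ * da a)) {w : Fin n → ℝ}
    (hw : w ∈ cube n ((4 * n : ℝ)⁻¹ * ((4 * n : ℝ)⁻¹ ^ n / Λ))) :
    centerOfMass S + lin a w ∈ closure S := by
  have hnR : (0 : ℝ) < n := by exact_mod_cast hn
  set Q : Set (E n) := (fun c => y + lin a c) ''
    Set.Icc (fun _ => (4 * n : ℝ)⁻¹) (fun _ => (2 * n : ℝ)⁻¹) with hQ
  have hQm : MeasurableSet Q := by
    have : IsCompact Q := isCompact_Icc.image (continuous_const.add (continuous_lin a))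
    exact this.measurableSet
  have hin : ∀ c : Fin n → ℝ, (∀ i, 0 ≤ c i ∧ c i ≤ 3 / (4 * n)) → y + lin a c ∈ S := by
    intro c hc
    refine add_lin_mem ho hcv hy ha (fun i => (hc i).1) ?_
    calc ∑ i, c i ≤ ∑ _i : Fin n, (3 / (4 * n) : ℝ) := Finset.sum_le_sum fun i _ => (hc i).2
      _ < 1 := by simp; field_simp; norm_num
  have hQS : Q ⊆ S := by
    rintro _ ⟨c, hc, rfl⟩
    refine hin c fun i => ⟨le_trans (by positivity) (hc.1 i), (hc.2 i).trans ?_⟩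
    field_simp; norm_num
  have hSfin : volume S ≠ ⊤ := hb.measure_lt_top.ne
  have hSpos : 0 < volume S := ho.measure_pos volume ⟨y, hy⟩
  have hvQ : volume.real Q = da a * ((4 * n : ℝ)⁻¹) ^ n := by
    have : (2 * n : ℝ)⁻¹ - (4 * n : ℝ)⁻¹ = (4 * n : ℝ)⁻¹ := by field_simp; norm_num
    rw [Measure.real, hQ, lin_image_add_volume, volume_Icc_const, this,
      ← ENNReal.ofReal_pow (by positivity), ← ENNReal.ofReal_mul (da_nonneg a),
      ENNReal.toReal_ofReal (by positivity)]
  have hvS : 0 < volume.real S := ENNReal.toReal_pos hSpos.ne' hSfin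
  have hvS' : volume.real S ≤ Λ * da a := ENNReal.toReal_le_of_le_ofReal (by positivity) hvol
  set lam := volume.real Q / volume.real S with hlam
  have hlampos : 0 < lam := by rw [hlam, hvQ]; positivity
  have hlamlow : (4 * n : ℝ)⁻¹ ^ n / Λ ≤ lam := by
    rw [hlam, hvQ, div_le_div_iff₀ hΛ hvS]
    calc (4 * n : ℝ)⁻¹ ^ n * volume.real S ≤ (4 * n : ℝ)⁻¹ ^ n * (Λ * da a) := by gcongr
      _ = _ := by ring
  set w' := lin a (lam⁻¹ • w) with hw'
  have hfi : IntegrableOn (fun x : E n => x) S := by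
    obtain ⟨R, hR⟩ := hb.exists_norm_le
    exact Measure.integrableOn_of_bounded hSfin (aestronglyMeasurable_id)
      (M := R) (by filter_upwards [ae_restrict_mem ho.measurableSet] with x hx using hR x hx)
  have hgi : IntegrableOn (Q.indicator fun _ => w') S := by
    refine Integrable.indicator ?_ hQm
    exact integrableOn_const hSfin
  have havg : ⨍ x in S, (x + Q.indicator (fun _ => w') x) ∈ closure S := by
    refine Convex.set_average_mem hcv.closure isClosed_closure hSpos.ne' hSfin ?_ (hfi.add hgi)
    filter_upwards [ae_restrict_mem ho.measurableSet] with x hx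
    by_cases hxQ : x ∈ Q
    · rw [Set.indicator_of_mem hxQ]
      obtain ⟨c, hc, rfl⟩ := hxQ
      rw [hw', add_assoc, ← map_add]
      refine subset_closure (hin _ fun i => ?_)
      have h1 : |lam⁻¹ * w i| ≤ (4 * n : ℝ)⁻¹ := by
        rw [abs_mul, abs_inv, abs_of_pos hlampos, inv_mul_le_iff₀ hlampos, mul_comm]
        exact (hw i).trans (by gcongr)
      have h2 := abs_le.1 h1
      have h3 := hc.1 i
      have h4 := hc.2 i
      have e1 : (3 / (4 * n) : ℝ) = (2 * n : ℝ)⁻¹ + (4 * n : ℝ)⁻¹ := by field_simp; norm_num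
      simp only [Pi.add_apply, Pi.smul_apply, smul_eq_mul]
      rw [e1]
      constructor <;> linarith [h2.1, h2.2]
    · rw [Set.indicator_of_notMem hxQ, add_zero]
      exact subset_closure hx
  have e : ⨍ x in S, (x + Q.indicator (fun _ => w') x) = centerOfMass S + lin a w := by
    rw [setAverage_eq, integral_add hfi hgi, smul_add, setIntegral_indicator hQm,
      Set.inter_eq_right.2 hQS, setIntegral_const, smul_smul]
    congr 1
    rw [hw', map_smul, smul_smul]
    have : (volume.real S)⁻¹ * volume.real Q * lam⁻¹ = 1 := by
      rw [hlam]
      have : volume.real Q ≠ 0 := by rw [hvQ]; positivity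
      field_simp
    rw [this, one_smul]
  rwa [e] at havg

/-- Upper bound for the Monge-Ampère measure of a section, from the doubling property. -/
lemma exists_ma_upper (n : ℕ) (α β : ℝ) : ∃ C > 0, ∀ (Ω : Set (E n)) (u : E n → ℝ),
    Setup n α β Ω u → ∀ y ∈ Ω, ∀ s > 0, CptIn (MASection Ω u y s) Ω →
    ∀ a, IsBox (MASection Ω u y s) y a →
      maMeasure u (MASection Ω u y s) * da a ≤ C * s ^ n := by
  set κ : ℝ := (4 * n : ℝ)⁻¹ * ((4 * n : ℝ)⁻¹ ^ n / (4 ^ n)) with hκ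
  set η : ℝ := (1 - α) * κ with hη
  refine ⟨max 1 (β * (2 * η⁻¹) ^ n), by positivity, fun Ω u h y hy s hs hc a ha => ?_⟩
  obtain ⟨hα0, hα1, hβ, hdoub⟩ := h.doub
  have hnR : (0 : ℝ) < n := by exact_mod_cast h.npos
  have hκp : 0 < κ := by positivity
  have hηp : 0 < η := mul_pos (by linarith) hκp
  set S' := MASection Ω u y (s / 2) with hS'
  have hsub : S' ⊆ MASection Ω u y s := sec_mono (by linarith)
  have hc' : CptIn S' Ω := CptIn.mono hc hsub
  have ho' := h.sec_open hc'
  have hS'Ω : closure S' ⊆ Ω := hc'.2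
  set a' : Fin n → E n := fun i => (1 / 2 : ℝ) • a i with ha'
  have hlin : ∀ c, lin a' c = (1 / 2 : ℝ) • lin a c := by
    intro c
    simp only [lin_apply, ha', Finset.smul_sum]
    exact Finset.sum_congr rfl fun i _ => smul_comm _ _ _
  have hda' : da a' = (1 / 2) ^ n * da a := by
    have : colMat a' = (1 / 2 : ℝ) • colMat a := by ext i j; simp [colMat, ha']
    rw [da, this, Matrix.det_smul, abs_mul, da, Fintype.card_fin, abs_of_pos (by positivity)]
  have hda'p : 0 < da a' := by rw [hda']; have := ha.pos; positivity
  have hvert : ∀ i, y + a' i ∈ closure S' := by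
    intro i
    have h1 := h.dd_le_of_mem_closure (ha.vert i)
    have h2 := h.dd_segment hy h1.1 (t := 1 / 2) (by norm_num) (by norm_num)
    rw [add_sub_cancel_left] at h2
    exact h.mem_closure_sec_of_le hy (by positivity) h2.1 (by linarith [h2.2, h1.2])
  have hvol : volume S' ≤ ENNReal.ofReal (4 ^ n * da a') := by
    refine (volume_le_of_box (fun x hx => ha.cover x (subset_closure (hsub hx)))).trans
      (le_of_eq ?_)
    rw [hda', ← mul_assoc, ← mul_pow]; norm_num
  have hcm : ∀ w ∈ cube n κ, centerOfMass S' + lin a' w ∈ closure S' := fun w hw =>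
    centerOfMass_add_lin_mem ho' (h.sec_convex y _) (h.sec_bdd y _) (Setup.self_mem_sec hy (by positivity))
      hda'p hvert h.npos (by positivity) hvol hw
  have hdil : ∀ z ∈ dilateCM α S', ∀ w ∈ cube n η, z + lin a' w ∈ closure S' := by
    rintro _ ⟨p, hp, rfl⟩ w hw
    have h1 := hcm ((1 - α)⁻¹ • w) (fun i => by
      rw [Pi.smul_apply, smul_eq_mul, abs_mul, abs_inv, abs_of_pos (by linarith : 0 < 1 - α),
        inv_mul_le_iff₀ (by linarith)]
      exact hw i)
    have h2 := (h.sec_convex y (s / 2)).closure (subset_closure hp) h1 hα0.le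
      (by linarith : 0 ≤ 1 - α) (by ring)
    convert h2 using 1
    rw [map_smul, smul_add, smul_smul, mul_inv_cancel₀ (by linarith), one_smul]
    module
  have hdilS : dilateCM α S' ⊆ closure S' := fun z hz => by
    simpa using hdil z hz 0 (fun i => by simpa using hηp.le)
  have hdilc : CptIn (dilateCM α S') Ω :=
    ⟨hc'.1.of_isClosed_subset isClosed_closure (closure_minimal hdilS isClosed_closure),
      (closure_minimal hdilS isClosed_closure).trans hS'Ω⟩
  have hdilm : MeasurableSet (dilateCM α S') := by
    have e : dilateCM α S' = AffineMap.homothety (centerOfMass S') α '' S' := by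
      refine Set.image_congr fun x _ => ?_
      simp [AffineMap.homothety_apply, add_comm]
    rw [e]
    exact (AffineMap.homothety_isOpenMap _ _ hα0.ne' _ ho').measurableSet
  have hgrad : gr u '' dilateCM α S'
      ⊆ {q | ∀ i, |inner ℝ (q - gr u y) (a' i)| ≤ η⁻¹ * (s / 2)} := by
    rintro _ ⟨z, hz, rfl⟩
    have hzΩ := hS'Ω (hdilS hz)
    have hz0 := h.dd_nonneg hy (subset_closure hzΩ)
    have hone : ∀ w ∈ cube n η, inner ℝ (gr u z - gr u y) (lin a' w) ≤ s / 2 := by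
      intro w hw
      have h1 := h.dd_le_of_mem_closure (hdil z hz w hw)
      have h2 := h.dd_nonneg hzΩ h1.1
      rw [dd_three u y z, add_sub_cancel_left] at h2
      rw [inner_sub_left, inner_gr, inner_gr]
      simp only [sub_apply] at h2
      linarith [h1.2]
    intro i
    have hbd : ∀ σ : ℝ, |σ| = 1 → σ * inner ℝ (gr u z - gr u y) (a' i) ≤ η⁻¹ * (s / 2) := by
      intro σ hσ
      have := hone (Pi.single i (η * σ)) (fun j => by
        by_cases hj : j = i
        · subst hj; simp [abs_mul, hσ, abs_of_pos hηp]
        · simp [hj, hηp.le])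
      rw [inner_lin_right, Finset.sum_eq_single i (fun j _ hj => by simp [hj])
        (fun hi => absurd (Finset.mem_univ i) hi), Pi.single_eq_same] at this
      rw [le_inv_mul_iff₀ hηp]; linarith
    rw [abs_le]
    have h1 := hbd 1 (by simp)
    have h2 := hbd (-1) (by simp)
    constructor <;> linarith
  have hvolgr := measure_mono (μ := volume) hgrad
  rw [h.volume_gr_image hdilm hdilc, volume_polar_cube hda'p.ne', ← ENNReal.ofReal_pow (by positivity),
    ← ENNReal.ofReal_mul (by positivity), ENNReal.ofReal_le_ofReal_iff (by positivity)] at hvolgr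
  have hd := hdoub y hy s hs hc
  have hda := ha.pos
  calc maMeasure u (MASection Ω u y s) * da a
      ≤ (β * ((da a')⁻¹ * (2 * (η⁻¹ * (s / 2))) ^ n)) * da a := by
        gcongr
        exact hd.trans (by gcongr)
    _ = (β * (2 * η⁻¹) ^ n) * s ^ n := by
        rw [hda']
        have : 2 * (η⁻¹ * (s / 2)) = η⁻¹ * s := by ring
        rw [this, mul_pow, mul_pow, one_div, inv_pow]
        field_simp
    _ ≤ _ := by gcongr; exact le_max_right _ _

/-- Points of definite depth in a section are surrounded by a definite fraction of its box. -/
lemma exists_depth_box (n : ℕ) (α β : ℝ) {lam : ℝ} (hlam : 0 < lam) :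
    ∃ η > 0, ∀ (Ω : Set (E n)) (u : E n → ℝ),
    Setup n α β Ω u → ∀ y ∈ Ω, ∀ s > 0, CptIn (MASection Ω u y s) Ω →
    ∀ a, IsBox (MASection Ω u y s) y a → ∀ z ∈ closure Ω, dd u y z ≤ s - lam * s →
      ∀ w ∈ cube n η, z + lin a w ∈ MASection Ω u y s := by
  obtain ⟨C, hC, hupper⟩ := exists_ma_upper n α β
  obtain ⟨N, hN⟩ := exists_nat_gt (max 1 (C * (2 / lam * (2 * n)) ^ n))
  have hN1 : (1 : ℝ) < N := (le_max_left _ _).trans_lt hN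
  have hN0 : (0 : ℝ) < N := by linarith
  refine ⟨(2 * N : ℝ)⁻¹, by positivity, fun Ω u h y hy s hs hc a ha z hz hdz w hw => ?_⟩
  have hnR : (0 : ℝ) < n := by exact_mod_cast h.npos
  by_contra hnot
  set S := MASection Ω u y s with hS
  have hzS : z ∈ S := mem_section.2 ⟨hz, by nlinarith⟩
  obtain ⟨f, hf⟩ := geometric_hahn_banach_open_point (h.sec_convex y s) (h.sec_open hc) hnot
  set ρ := f (lin a w) with hρ
  have hρpos : 0 < ρ := by have := hf z hzS; rw [map_add] at this; linarith
  set F : E n := ρ⁻¹ • (InnerProductSpace.toDual ℝ (E n)).symm f with hF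
  have hFin : ∀ v, inner ℝ F v = ρ⁻¹ * f v := by
    intro v; rw [hF, real_inner_smul_left, InnerProductSpace.toDual_symm_apply]
  have hFS : ∀ x ∈ S, inner ℝ F (x - z) ≤ 1 := by
    intro x hx
    rw [hFin, inv_mul_le_iff₀ hρpos, map_sub]
    have := hf x hx; rw [map_add] at this; linarith
  have hFw : ∑ i, w i * inner ℝ F (a i) = 1 := by
    rw [← inner_lin_right, hFin, ← hρ, inv_mul_cancel₀ hρpos.ne']
  obtain ⟨i, hi⟩ : ∃ i, 2 * N / n ≤ |inner ℝ F (a i)| := by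
    by_contra! hcon
    have : ∑ i, w i * inner ℝ F (a i) < 1 := by
      calc ∑ i, w i * inner ℝ F (a i) ≤ ∑ i, (2 * N : ℝ)⁻¹ * |inner ℝ F (a i)| := by
            refine Finset.sum_le_sum fun i _ => (le_abs_self _).trans ?_
            rw [abs_mul]; gcongr; exact hw i
        _ < ∑ _i : Fin n, (2 * N : ℝ)⁻¹ * (2 * N / n) := by
            refine Finset.sum_lt_sum_of_nonempty ⟨⟨0, h.npos⟩, Finset.mem_univ _⟩ fun i _ => ?_
            have := hcon i; gcongr
        _ = 1 := by simp; field_simp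
    linarith
  set κ : ℝ := (4 * n : ℝ)⁻¹ with hκ
  set P : ℕ → Set (E n) := fun k =>
    {q | ∀ j, |inner ℝ (q - (k / (2 * N) : ℝ) • F) (a j)| ≤ κ} with hP
  have hPc : ∀ k, IsClosed (P k) := fun k => by
    simp only [hP, Set.ofPred_forall]
    exact isClosed_iInter fun j => isClosed_le (by fun_prop) continuous_const
  have hPv : ∀ k, volume (P k) = ENNReal.ofReal (da a)⁻¹ * ENNReal.ofReal (2 * κ) ^ n :=
    fun k => volume_polar_cube ha.pos.ne' _
  have hdisj : Pairwise (Function.onFun Disjoint P) := by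
    intro k l hkl
    rw [Function.onFun, Set.disjoint_left]
    intro q hq1 hq2
    have h1 := hq1 i
    have h2 := hq2 i
    rw [inner_sub_left, real_inner_smul_left] at h1 h2
    have h3 : |((k : ℝ) - l) / (2 * N) * inner ℝ F (a i)| ≤ 2 * κ := by
      have : ((k : ℝ) - l) / (2 * N) * inner ℝ F (a i)
          = (inner ℝ q (a i) - l / (2 * N) * inner ℝ F (a i))
            - (inner ℝ q (a i) - k / (2 * N) * inner ℝ F (a i)) := by ring
      rw [this]
      exact (abs_sub _ _).trans (by linarith)
    have h4 : (1 : ℝ) ≤ |(k : ℝ) - l| := by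
      have : (1 : ℤ) ≤ |(k : ℤ) - l| := Int.one_le_abs (by omega)
      exact_mod_cast this
    rw [abs_mul, abs_div, abs_of_pos (by positivity : (0 : ℝ) < 2 * N)] at h3
    have h5 : 1 / (2 * N) * (2 * N / n) ≤ |(k : ℝ) - l| / (2 * N) * |inner ℝ F (a i)| := by
      gcongr
    have h6 : 1 / (2 * N : ℝ) * (2 * N / n) = 4 * κ := by rw [hκ]; field_simp
    have : 0 < κ := by positivity
    linarith
  set Q := ⋃ k ∈ Finset.range N, P k with hQ
  have hQv : volume Q = N * (ENNReal.ofReal (da a)⁻¹ * ENNReal.ofReal (2 * κ) ^ n) := by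
    rw [hQ, measure_biUnion_finset (fun k _ l _ hkl => hdisj hkl)
      (fun k _ => (hPc k).measurableSet)]
    simp [hPv]
  have hQ1 : ∀ q ∈ Q, ∀ x ∈ S, inner ℝ q (x - z) ≤ 1 := by
    intro q hq x hx
    simp only [hQ, Set.mem_iUnion, Finset.mem_range] at hq
    obtain ⟨k, hk, hq⟩ := hq
    have hkN : (k : ℝ) / (2 * N) ≤ 1 / 2 := by
      have : (k : ℝ) ≤ N := by exact_mod_cast hk.le
      rw [div_le_iff₀ (by positivity)]; linarith
    obtain ⟨c, hcc, hxc⟩ := ha.cover x (subset_closure hx)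
    obtain ⟨c', hcc', hzc⟩ := ha.cover z (subset_closure hzS)
    have e1 : x - z = lin a (c - c') := by rw [hxc, hzc, map_sub]; abel
    have h1 : inner ℝ (q - (k / (2 * N) : ℝ) • F) (x - z) ≤ 1 / 2 := by
      rw [e1, inner_lin_right]
      calc ∑ j, (c - c') j * inner ℝ (q - (k / (2 * N) : ℝ) • F) (a j)
          ≤ ∑ _j : Fin n, 2 * κ := by
            refine Finset.sum_le_sum fun j _ => (le_abs_self _).trans ?_
            rw [abs_mul]
            gcongr
            · have := abs_sub (c j) (c' j)
              have h1 := hcc j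
              have h2 := hcc' j
              simp only [Pi.sub_apply]; linarith
            · exact hq j
        _ = 1 / 2 := by simp [hκ]; field_simp; norm_num
    rw [inner_sub_left, real_inner_smul_left] at h1
    have h2 : (k : ℝ) / (2 * N) * inner ℝ F (x - z) ≤ 1 / 2 * 1 :=
      (mul_le_mul_of_nonneg_left (hFS x hx) (by positivity)).trans (by gcongr)
    linarith
  have key := h.alek hy hc hzS hQ1
  have hup := hupper Ω u h y hy s hs hc a ha
  have hd := ha.pos
  have hma := h.ma_nonneg (h.sec_open hc).measurableSet
    (fun x hx => hc.2 (subset_closure hx))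
  have hdep : 0 < s - dd u y z := by nlinarith
  rw [hQv, ← ENNReal.ofReal_pow (by positivity), ← ENNReal.ofReal_mul (by positivity),
    ← ENNReal.ofReal_natCast, ← ENNReal.ofReal_mul (by positivity),
    ← ENNReal.ofReal_mul (by positivity), ENNReal.ofReal_le_ofReal_iff hma] at key
  have h7 : (lam * s / 2) ^ n * (N * ((da a)⁻¹ * (2 * κ) ^ n)) * da a ≤ C * s ^ n := by
    refine le_trans ?_ hup
    gcongr
    refine le_trans ?_ key
    gcongr; linarith
  have h8 : (lam * s / 2) ^ n * (N * ((da a)⁻¹ * (2 * κ) ^ n)) * da a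
      = N * s ^ n / (2 / lam * (2 * n)) ^ n := by
    have : (2 / lam * (2 * n) : ℝ) = (lam / 2 * (2 * κ))⁻¹ := by
      rw [hκ]; field_simp; norm_num
    have e : (lam * s / 2) ^ n * (2 * κ) ^ n = s ^ n * (lam / 2 * (2 * κ)) ^ n := by
      rw [← mul_pow, ← mul_pow]; ring
    rw [this, inv_pow, div_inv_eq_mul]
    calc _ = N * ((lam * s / 2) ^ n * (2 * κ) ^ n) * ((da a)⁻¹ * da a) := by ring
      _ = _ := by rw [inv_mul_cancel₀ hd.ne', e]; ring
  rw [h8, div_le_iff₀ (by positivity)] at h7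
  have h9 : C * (2 / lam * (2 * n)) ^ n < N := (le_max_right _ _).trans_lt hN
  have : C * s ^ n * (2 / lam * (2 * n)) ^ n = (C * (2 / lam * (2 * n)) ^ n) * s ^ n := by ring
  rw [this] at h7
  have := mul_lt_mul_of_pos_right h9 (by positivity : 0 < s ^ n)
  linarith

/-- Sublevel sets of `u` minus a linear function are sections. -/
lemma Setup.exists_touch (h : Setup n α β Ω u) (f : E n →L[ℝ] ℝ) {c : ℝ} {x₁ : E n}
    (hx₁ : x₁ ∈ closure Ω) (h₁ : u x₁ - f x₁ < c)
    (hc : {x ∈ closure Ω | u x - f x < c} ⊆ Ω) :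
    ∃ v ∈ Ω, (∀ x, dd u v x = (u x - f x) - (u v - f v)) ∧ u v - f v ≤ u x₁ - f x₁ := by
  obtain ⟨v, hv, hmin⟩ := h.bdd.isCompact_closure.exists_isMinOn ⟨x₁, hx₁⟩
    (h.cont.sub f.continuous.continuousOn)
  have h1 : u v - f v ≤ u x₁ - f x₁ := hmin hx₁
  have hvΩ : v ∈ Ω := hc ⟨hv, h1.trans_lt h₁⟩
  refine ⟨v, hvΩ, fun x => ?_, h1⟩
  have hloc : IsLocalMin (fun x => u x - f x) v := by
    filter_upwards [h.op.mem_nhds hvΩ] with w hw using hmin (subset_closure hw)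
  have hd : HasFDerivAt (fun x => u x - f x) (fderiv ℝ u v - f) v :=
    (((h.smooth v hvΩ).differentiableAt (by simp)).hasFDerivAt).sub f.hasFDerivAt
  have h0 := sub_eq_zero.1 (hloc.hasFDerivAt_eq_zero hd)
  rw [dd, h0, map_sub]; ring

/-- Rays from the center to points of half height can be prolonged inside a section. -/
lemma exists_prolong (n : ℕ) (α β : ℝ) : ∃ η > (0 : ℝ), ∀ (Ω : Set (E n)) (u : E n → ℝ),
    Setup n α β Ω u → ∀ y ∈ Ω, ∀ s > 0, CptIn (MASection Ω u y s) Ω →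
    ∀ z ∈ closure Ω, dd u y z ≤ s / 2 → y + (1 + η) • (z - y) ∈ MASection Ω u y s := by
  obtain ⟨η, hη, hbox⟩ := exists_depth_box n α β (lam := 1 / 2) (by norm_num)
  refine ⟨η, hη, fun Ω u h y hy s hs hc z hz hzs => ?_⟩
  obtain ⟨a, ha⟩ := h.exists_isBox hy hs hc
  have hzS : z ∈ MASection Ω u y s := mem_section.2 ⟨hz, by linarith⟩
  obtain ⟨c, hcc, hzc⟩ := ha.cover z (subset_closure hzS)
  have := hbox Ω u h y hy s hs hc a ha z hz (by linarith) (η • c) (fun i => by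
    rw [Pi.smul_apply, smul_eq_mul, abs_mul, abs_of_pos hη]
    have := hcc i; nlinarith)
  convert this using 1
  have e : z - y = lin a c := by rw [hzc]; abel
  rw [map_smul, ← e]; module

/-- Engulfing: slopes at points of half height are controlled in the box of the section. -/
lemma exists_slope_bound (n : ℕ) (α β : ℝ) : ∃ C > (0 : ℝ), ∀ (Ω : Set (E n)) (u : E n → ℝ),
    Setup n α β Ω u → ∀ y ∈ Ω, ∀ r > 0, CptIn (MASection Ω u y (2 * r)) Ω →
    ∀ a, IsBox (MASection Ω u y (2 * r)) y a → ∀ z ∈ closure Ω, dd u y z ≤ r →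
      ∀ c ∈ cube n 1, |(fderiv ℝ u z - fderiv ℝ u y) (lin a c)| ≤ C * r := by
  obtain ⟨η, hη, hbox⟩ := exists_depth_box n α β (lam := 1 / 2) (by norm_num)
  refine ⟨2 / η, by positivity, fun Ω u h y hy r hr hc a ha z hz hzr => ?_⟩
  have hzS : z ∈ MASection Ω u y (2 * r) := mem_section.2 ⟨hz, by linarith⟩
  have hzΩ : z ∈ Ω := hc.2 (subset_closure hzS)
  have key : ∀ c ∈ cube n 1, (fderiv ℝ u z - fderiv ℝ u y) (lin a c) ≤ 2 / η * r := by
    intro c hcc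
    have h1 := hbox Ω u h y hy (2 * r) (by positivity) hc a ha z hz (by linarith) (η • c) (fun i => by
      rw [Pi.smul_apply, smul_eq_mul, abs_mul, abs_of_pos hη]
      have := hcc i; nlinarith)
    have h2 := mem_section.1 h1
    have h3 := h.dd_nonneg hzΩ h2.1
    have h4 := h.dd_nonneg hy hz
    rw [dd_three u y z, add_sub_cancel_left] at h3
    have e : (fderiv ℝ u z - fderiv ℝ u y) (lin a (η • c))
        = (fderiv ℝ u z - fderiv ℝ u y) (lin a c) * η := by
      rw [map_smul, map_smul, smul_eq_mul, mul_comm]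
    rw [div_mul_eq_mul_div, le_div_iff₀ hη]
    linarith [h2.2]
  intro c hcc
  rw [abs_le]
  have h1 := key c hcc
  have h2 := key (-c) (fun i => by rw [Pi.neg_apply, abs_neg]; exact hcc i)
  rw [map_neg, map_neg] at h2
  constructor <;> linarith

lemma exists_engulf (n : ℕ) (α β : ℝ) : ∃ C ≥ (1 : ℝ), ∀ (Ω : Set (E n)) (u : E n → ℝ),
    Setup n α β Ω u → ∀ y ∈ Ω, ∀ r > 0, CptIn (MASection Ω u y (2 * r)) Ω →
    ∀ z ∈ closure Ω, dd u y z ≤ r → ∀ x ∈ closure Ω, dd u y x ≤ 2 * r → dd u z x ≤ C * r := by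
  obtain ⟨C, hC, hsl⟩ := exists_slope_bound n α β
  refine ⟨2 + 2 * C, by linarith, fun Ω u h y hy r hr hc z hz hzr x hx hxr => ?_⟩
  obtain ⟨a, ha⟩ := h.exists_isBox hy (by positivity) hc
  obtain ⟨c, hcc, hxc⟩ := ha.cover x (h.mem_closure_sec_of_le hy (by positivity) hx hxr)
  obtain ⟨c', hcc', hzc⟩ := ha.cover z (h.mem_closure_sec_of_le hy (by positivity) hz (by linarith))
  have e : x - z = lin a c - lin a c' := by rw [hxc, hzc]; abel
  have h1 := abs_le.1 (hsl Ω u h y hy r hr hc a ha z hz hzr c hcc)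
  have h2 := abs_le.1 (hsl Ω u h y hy r hr hc a ha z hz hzr c' hcc')
  have h4 := h.dd_nonneg hy hz
  rw [dd_three u y z, e, map_sub]
  linarith [h1.1, h2.2]

set_option maxHeartbeats 1000000 in
/-- Separation: points of different heights in a section are at a definite gap. -/
lemma exists_separation (n : ℕ) (α β : ℝ) {γ : ℝ} (hγ0 : 0 < γ) (hγ1 : γ ≤ 1) :
    ∃ c > (0 : ℝ), ∀ (Ω : Set (E n)) (u : E n → ℝ),
    Setup n α β Ω u → ∀ y ∈ Ω, ∀ R > 0, CptIn (MASection Ω u y ((1 - γ / 2) * R)) Ω →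
    ∀ z ∈ closure Ω, dd u y z ≤ (1 - γ) * R → ∀ x ∈ closure Ω, R ≤ dd u y x →
      c * R ≤ dd u z x := by
  obtain ⟨η, hη, hbox⟩ := exists_depth_box n α β (lam := γ / 4) (by positivity)
  obtain ⟨N, hN⟩ := exists_nat_gt (16 / (η * γ))
  have hN' : 16 < N * (η * γ) := by rwa [div_lt_iff₀ (by positivity)] at hN
  set M : ℝ := 8 / γ with hM
  have hM1 : 1 ≤ M := by rw [hM, le_div_iff₀ hγ0]; linarith
  have hMpos : 0 < M := by linarith
  refine ⟨γ / 8 * (M ^ N)⁻¹, by positivity, fun Ω u h y hy R hR hc z hz hzR x hx hxR => ?_⟩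
  by_contra! hlt
  set ρ₀ : ℝ := γ / 8 * (M ^ N)⁻¹ * R with hρ₀
  have hρ₀pos : 0 < ρ₀ := by positivity
  set κ : ℝ := (1 - γ / 2) * R with hκ
  have hγR : 0 < γ * R := by positivity
  have hκR : κ ≤ R := by rw [hκ]; linarith
  have hzS : z ∈ MASection Ω u y κ := mem_section.2 ⟨hz, by rw [hκ]; linarith⟩
  have hzΩ : z ∈ Ω := hc.2 (subset_closure hzS)
  -- the point on the segment where the height is exactly `R`
  obtain ⟨x', hx', hx'R, hx'ρ⟩ : ∃ x' ∈ closure Ω, dd u y x' = R ∧ dd u z x' ≤ ρ₀ := by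
    have hmaps : Set.MapsTo (fun t : ℝ => z + t • (x - z)) (Set.Icc 0 1) (closure Ω) :=
      fun t ht => (h.dd_segment hzΩ hx ht.1 ht.2).1
    have hcont : ContinuousOn (fun t : ℝ => dd u y (z + t • (x - z))) (Set.Icc 0 1) :=
      (h.dd_cont y).comp (by fun_prop) hmaps
    have hm : R ∈ Set.Icc (dd u y (z + (0 : ℝ) • (x - z))) (dd u y (z + (1 : ℝ) • (x - z))) := by
      simp only [zero_smul, add_zero, one_smul, add_sub_cancel]
      exact ⟨by linarith, hxR⟩
    obtain ⟨t, ht, hts⟩ := intermediate_value_Icc zero_le_one hcont hm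
    refine ⟨_, hmaps ht, hts, ?_⟩
    have h1 := (h.dd_segment hzΩ hx ht.1 ht.2).2
    have h2 := h.dd_nonneg hzΩ hx
    nlinarith [ht.1, ht.2]
  set e : E n := x' - z with he
  set D := fderiv ℝ u z - fderiv ℝ u y with hD
  have hq : ∀ w, dd u y w = dd u y z + D (w - z) + dd u z w := by
    intro w; rw [dd_three u y z w]; ring
  have hM1N : 1 ≤ M ^ N := one_le_pow₀ hM1
  have hρ₀R : ρ₀ ≤ γ * R / 8 := by
    have : (M ^ N)⁻¹ ≤ 1 := inv_le_one_of_one_le₀ hM1N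
    rw [hρ₀]; nlinarith
  have hDe : γ * R / 2 ≤ D e := by
    have := hq x'
    rw [hx'R] at this
    linarith
  have hMk : ∀ k ≤ N, M ^ k * ρ₀ ≤ γ * R / 8 := by
    intro k hk
    have h1 : M ^ k ≤ M ^ N := pow_le_pow_right₀ hM1 hk
    calc M ^ k * ρ₀ ≤ M ^ N * ρ₀ := by gcongr
      _ = γ * R / 8 := by rw [hρ₀]; field_simp
  have hind : ∀ k ≤ N, z - (k * (η / 8) : ℝ) • e ∈ closure Ω ∧
      dd u z (z - (k * (η / 8) : ℝ) • e) ≤ M ^ k * ρ₀ := by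
    intro k
    induction k with
    | zero => intro _; simp [hz, hρ₀pos.le]
    | succ k ih =>
      intro hk
      obtain ⟨hw1, hw2⟩ := ih (by omega)
      set w := z - (k * (η / 8) : ℝ) • e with hw
      set ρ := M ^ k * ρ₀ with hρ
      have hρpos : 0 < ρ := by positivity
      have hρR : ρ ≤ γ * R / 8 := hMk k (by omega)
      set δ := 4 * ρ / (γ * R) with hδ
      have hδpos : 0 < δ := by positivity
      have hδ2 : δ ≤ 1 / 2 := by rw [hδ, div_le_iff₀ hγR]; linarith
      have hδR : δ * (γ * R) = 4 * ρ := by rw [hδ]; field_simp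
      set f : E n →L[ℝ] ℝ := (1 - δ) • fderiv ℝ u z + δ • fderiv ℝ u y with hf
      set cst : ℝ := (1 - δ) * (u z - fderiv ℝ u z z) + δ * (u y - fderiv ℝ u y y + κ) with hcst
      have hval : ∀ p, u p - f p - cst = (1 - δ) * dd u z p + δ * (dd u y p - κ) := by
        intro p
        simp only [hf, hcst, dd, add_apply, smul_apply, smul_eq_mul, map_sub]
        ring
      have hcsub : {p ∈ closure Ω | u p - f p < cst} ⊆ MASection Ω u y κ := by
        rintro p ⟨hp, hp'⟩
        refine mem_section.2 ⟨hp, ?_⟩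
        have h1 := hval p
        have h2 := h.dd_nonneg hzΩ hp
        have h3 : 0 ≤ (1 - δ) * dd u z p := mul_nonneg (by linarith) h2
        by_contra! hcon
        have h4 := mul_nonneg hδpos.le (sub_nonneg.2 hcon)
        linarith
      have hwval : u w - f w - cst ≤ -(δ * (γ * R) / 4) := by
        rw [hval]
        have h1 := hq w
        have h2 : D (w - z) ≤ 0 := by
          have : w - z = -((k * (η / 8) : ℝ) • e) := by rw [hw]; abel
          rw [this, map_neg, map_smul, smul_eq_mul]
          have : 0 ≤ (k * (η / 8) : ℝ) * D e := by
            have : 0 ≤ D e := by linarith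
            positivity
          linarith
        have h3 : dd u y w - κ ≤ ρ - γ * R / 2 := by rw [hκ]; linarith
        have h4 := mul_le_mul_of_nonneg_left h3 hδpos.le
        have h5 : (1 - δ) * dd u z w ≤ (1 - δ) * ρ :=
          mul_le_mul_of_nonneg_left hw2 (by linarith)
        linarith
      have hwc : u w - f w < cst := by
        have : 0 < δ * (γ * R) := by positivity
        linarith
      obtain ⟨v, hv, hvd, hvw⟩ := h.exists_touch f hw1 hwc
        (hcsub.trans (subset_closure.trans hc.2))
      set ht := cst - (u v - f v) with hht
      have hsec : ∀ p, p ∈ MASection Ω u v ht ↔ p ∈ closure Ω ∧ u p - f p < cst := by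
        intro p
        rw [mem_section, hvd, hht]
        constructor <;> rintro ⟨h1, h2⟩ <;> exact ⟨h1, by linarith⟩
      have htpos : 0 < ht := by linarith
      have hvcl := subset_closure hv
      have htR : ht ≤ δ * R := by
        have h1 := hval v
        have h2 := h.dd_nonneg hzΩ hvcl
        have h3 := h.dd_nonneg hy hvcl
        have h4 : 0 ≤ (1 - δ) * dd u z v := mul_nonneg (by linarith) h2
        have h5 : 0 ≤ δ * dd u y v := by positivity
        have h6 : δ * κ ≤ δ * R := by gcongr
        rw [hht]; linarith
      have hsc : CptIn (MASection Ω u v ht) Ω :=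
        CptIn.mono hc fun p hp => hcsub ((hsec p).1 hp)
      obtain ⟨a, ha⟩ := h.exists_isBox hv htpos hsc
      have hpt : z + (1 / 4 : ℝ) • e ∈ MASection Ω u v ht := by
        have h1 := h.dd_segment hzΩ hx' (t := 1 / 4) (by norm_num) (by norm_num)
        have h2 : dd u y (z + (1 / 4 : ℝ) • e) ≤ 3 / 4 * dd u y z + 1 / 4 * R := by
          have := (h.dd_convexOn y).2 hz hx' (by norm_num : (0 : ℝ) ≤ 3 / 4)
            (by norm_num : (0 : ℝ) ≤ 1 / 4) (by norm_num)
          rw [hx'R, smul_eq_mul, smul_eq_mul] at this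
          have e1 : z + (1 / 4 : ℝ) • e = (3 / 4 : ℝ) • z + (1 / 4 : ℝ) • x' := by rw [he]; module
          rwa [e1]
        refine (hsec _).2 ⟨h1.1, ?_⟩
        rw [← sub_neg, hval]
        have h0 := h.dd_nonneg hzΩ hx'
        have h3 : dd u z (z + (1 / 4 : ℝ) • e) ≤ 1 / 4 * ρ := by
          have hρ1 : ρ₀ ≤ ρ := by
            rw [hρ]; have := one_le_pow₀ hM1 (n := k); nlinarith
          refine h1.2.trans ?_
          linarith
        have h4 : dd u y (z + (1 / 4 : ℝ) • e) - κ ≤ -(γ * R) / 4 := by rw [hκ]; linarith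
        have h5 := mul_le_mul_of_nonneg_left h4 hδpos.le
        have h6 : (1 - δ) * dd u z (z + (1 / 4 : ℝ) • e) ≤ (1 - δ) * (1 / 4 * ρ) :=
          mul_le_mul_of_nonneg_left h3 (by linarith)
        have h7 : 0 < δ * ρ := by positivity
        linarith
      have hwsec : w ∈ MASection Ω u v ht := (hsec w).2 ⟨hw1, hwc⟩
      obtain ⟨c₁, hc₁, hp₁⟩ := ha.cover _ (subset_closure hpt)
      obtain ⟨c₂, hc₂, hp₂⟩ := ha.cover _ (subset_closure hwsec)
      set τ : ℝ := 1 / 4 + k * (η / 8) with hτ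
      have hτ4 : 1 / 4 ≤ τ := by rw [hτ]; have : 0 ≤ k * (η / 8) := by positivity
                                 linarith
      have hτe : τ • e = lin a (c₁ - c₂) := by
        have : τ • e = (z + (1 / 4 : ℝ) • e) - w := by rw [hτ, hw]; module
        rw [this, hp₁, hp₂, map_sub]; abel
      have hnext := hbox Ω u h v hv ht htpos hsc a ha w hw1 (by
          rw [hvd]
          have : γ / 4 * ht ≤ γ / 4 * (δ * R) := by gcongr
          linarith) ((-(η / 8) * τ⁻¹) • (c₁ - c₂)) (fun i => by
          rw [Pi.smul_apply, smul_eq_mul, abs_mul, abs_mul, abs_neg, abs_inv,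
            abs_of_pos (by positivity : 0 < η / 8), abs_of_pos (by linarith : 0 < τ)]
          have h1 : |(c₁ - c₂) i| ≤ 2 := by
            have := abs_sub (c₁ i) (c₂ i)
            have h1 := hc₁ i
            have h2 := hc₂ i
            simp only [Pi.sub_apply]; linarith
          have h2 : τ⁻¹ ≤ 4 := by rw [inv_le_comm₀ (by linarith) (by norm_num)]; linarith
          calc η / 8 * τ⁻¹ * |(c₁ - c₂) i| ≤ η / 8 * 4 * 2 := by gcongr
            _ = η := by ring)
      have hew : w + lin a ((-(η / 8) * τ⁻¹) • (c₁ - c₂))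
          = z - (((k + 1 : ℕ) : ℝ) * (η / 8)) • e := by
        rw [map_smul, ← hτe, smul_smul, mul_assoc, inv_mul_cancel₀ (by linarith), hw]
        push_cast
        module
      rw [hew] at hnext
      set w' := z - (((k + 1 : ℕ) : ℝ) * (η / 8)) • e with hw'
      obtain ⟨hn1, hn2⟩ := (hsec w').1 hnext
      refine ⟨hn1, ?_⟩
      rw [← sub_neg, hval] at hn2
      have h1 := h.dd_nonneg hy hn1
      have h2 := h.dd_nonneg hzΩ hn1
      have h5 : 0 ≤ δ * dd u y w' := by positivity
      have h6 : δ * κ ≤ δ * R := by gcongr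
      have h7 : 1 / 2 * dd u z w' ≤ (1 - δ) * dd u z w' := by gcongr; linarith
      have h8 : dd u z w' ≤ 2 * (δ * R) := by linarith
      have h9 : M ^ (k + 1) * ρ₀ = 2 * (δ * R) := by
        rw [pow_succ, mul_assoc, mul_comm M, ← mul_assoc, ← hρ, hM, hδ]; field_simp; norm_num
      rw [h9]; exact h8
  obtain ⟨h1, h2⟩ := hind N le_rfl
  have h3 := hq (z - (N * (η / 8) : ℝ) • e)
  have h4 := h.dd_nonneg hy h1
  have h5 := hMk N le_rfl
  have h6 : D (z - (N * (η / 8) : ℝ) • e - z) = -(N * (η / 8) * D e) := by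
    rw [sub_sub_cancel_left, map_neg, map_smul, smul_eq_mul]
  rw [h6] at h3
  have h7 : N * (η / 8) * (γ * R / 2) ≤ N * (η / 8) * D e := by gcongr
  have h8 : R < N * (η / 8) * (γ * R / 2) := by
    calc R = 16 * R / 16 := by ring
      _ < N * (η * γ) * R / 16 := by gcongr
      _ = _ := by ring
  linarith

lemma da_le_of_subset {S S' : Set (E n)} (ho : IsOpen S) (hcv : Convex ℝ S) {y z : E n}
    (hy : y ∈ S) {a a' : Fin n → E n} (ha : IsBox S y a) (ha' : IsBox S' z a') (hn : 0 < n)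
    (hSS : S ⊆ S') : da a ≤ (4 * n : ℝ) ^ n * da a' := by
  have hnR : (0 : ℝ) < n := by exact_mod_cast hn
  have h1 := le_volume_of_box ho hcv hy ha.vert hn
  have h2 := volume_le_of_box (S := S') (y := z) (a := a')
    fun x hx => ha'.cover x (subset_closure hx)
  have h3 := h1.trans ((measure_mono hSS).trans h2)
  rw [ENNReal.ofReal_le_ofReal_iff (by have := ha'.pos; positivity), inv_pow, ← div_eq_mul_inv,
    div_le_iff₀ (by positivity)] at h3
  refine h3.trans (le_of_eq ?_)
  have : (4 * n : ℝ) = 2 * (2 * n) := by ring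
  rw [this, mul_pow 2 (2 * n : ℝ)]; ring

/-- Sections of comparable height contained in one another have comparable measure. -/
lemma exists_ma_compare (n : ℕ) (α β Λ : ℝ) : ∃ C ≥ (1 : ℝ), ∀ (Ω : Set (E n)) (u : E n → ℝ),
    Setup n α β Ω u → ∀ y ∈ Ω, ∀ z ∈ Ω, ∀ s > 0, ∀ s' > 0, s' ≤ Λ * s →
    CptIn (MASection Ω u y s') Ω → MASection Ω u z s ⊆ MASection Ω u y s' →
      maMeasure u (MASection Ω u y s') ≤ C * maMeasure u (MASection Ω u z s) := by
  obtain ⟨C₁, hC₁, hup⟩ := exists_ma_upper n α β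
  obtain ⟨C₂, hC₂, hlo⟩ := exists_ma_lower n α β
  refine ⟨max 1 (C₁ * |Λ| ^ n * C₂ * (4 * n) ^ n), le_max_left _ _,
    fun Ω u h y hy z hz s hs s' hs' hss hc hsub => ?_⟩
  have hc' : CptIn (MASection Ω u z s) Ω := CptIn.mono hc hsub
  obtain ⟨a, ha⟩ := h.exists_isBox hy hs' hc
  obtain ⟨a', ha'⟩ := h.exists_isBox hz hs hc'
  have h1 := hup Ω u h y hy s' hs' hc a ha
  have h2 := hlo Ω u h z hz s hs hc' a' ha'
  have h3 := da_le_of_subset (h.sec_open hc') (h.sec_convex z s) (Setup.self_mem_sec hz hs) ha' ha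
    h.npos hsub
  have hm := h.ma_nonneg (h.sec_open hc').measurableSet fun x hx => hc'.2 (subset_closure hx)
  have hΛ : s' ≤ |Λ| * s := hss.trans (by gcongr; exact le_abs_self _)
  have hapos := ha.pos
  refine le_of_mul_le_mul_right (h1.trans ?_) hapos
  calc C₁ * s' ^ n ≤ C₁ * (|Λ| * s) ^ n := by gcongr
    _ = C₁ * |Λ| ^ n * s ^ n := by rw [mul_pow]; ring
    _ ≤ C₁ * |Λ| ^ n * (C₂ * (maMeasure u (MASection Ω u z s) * da a')) := by gcongr
    _ ≤ C₁ * |Λ| ^ n * (C₂ * (maMeasure u (MASection Ω u z s) * ((4 * n) ^ n * da a))) := by gcongr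
    _ = C₁ * |Λ| ^ n * C₂ * (4 * n) ^ n * maMeasure u (MASection Ω u z s) * da a := by ring
    _ ≤ _ := by gcongr; exact le_max_right _ _

lemma Setup.ma_pos (h : Setup n α β Ω u) {y : E n} (hy : y ∈ Ω) {s : ℝ} (hs : 0 < s)
    (hc : CptIn (MASection Ω u y s) Ω) : 0 < maMeasure u (MASection Ω u y s) := by
  obtain ⟨C₂, hC₂, hlo⟩ := exists_ma_lower n α β
  obtain ⟨a, ha⟩ := h.exists_isBox hy hs hc
  have h2 := hlo Ω u h y hy s hs hc a ha
  have : 0 < C₂ * (maMeasure u (MASection Ω u y s) * da a) := lt_of_lt_of_le (by positivity) h2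
  exact pos_of_mul_pos_left (pos_of_mul_pos_right this hC₂.le) ha.pos.le

/-- The minimum point of `u`. -/
lemma Setup.exists_min (h : Setup n α β Ω u) : ∃ y ∈ Ω, fderiv ℝ u y = 0 ∧ u y < 0 ∧
    (∀ x ∈ closure Ω, u y ≤ u x) := by
  obtain ⟨x₁, hx₁, hneg⟩ := h.neg
  obtain ⟨y, hy, hmin⟩ := h.bdd.isCompact_closure.exists_isMinOn ⟨x₁, subset_closure hx₁⟩ h.cont
  have hy0 : u y < 0 := (hmin (subset_closure hx₁)).trans_lt hneg
  have hyΩ : y ∈ Ω := by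
    by_contra hn
    have := h.bdry y ⟨hy, by rwa [h.op.interior_eq]⟩
    linarith
  refine ⟨y, hyΩ, ?_, hy0, fun x hx => hmin hx⟩
  refine IsLocalMin.fderiv_eq_zero ?_
  filter_upwards [h.op.mem_nhds hyΩ] with w hw using hmin (subset_closure hw)

lemma Setup.exists_prolong_mem (h : Setup n α β Ω u) {x y : E n} (hx : x ∈ Ω) :
    ∃ ε > (0 : ℝ), x + ε • (x - y) ∈ Ω := by
  have hc : Continuous fun ε : ℝ => x + ε • (x - y) := by fun_prop
  have h1 : ∀ᶠ ε : ℝ in nhds 0, x + ε • (x - y) ∈ Ω :=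
    hc.continuousAt.eventually_mem (by simpa using h.op.mem_nhds hx)
  obtain ⟨ε, hε, hε0⟩ := ((h1.filter_mono nhdsWithin_le_nhds).and
    (self_mem_nhdsWithin : Set.Ioi (0 : ℝ) ∈ nhdsWithin 0 (Set.Ioi 0))).exists
  exact ⟨ε, hε0, hε⟩

lemma Setup.u_neg (h : Setup n α β Ω u) {x : E n} (hx : x ∈ Ω) : u x < 0 := by
  obtain ⟨y, hy, -, hy0, hmin⟩ := h.exists_min
  have key : ∀ M, (∀ w ∈ closure Ω, u w ≤ M) → u y < M → ∀ w ∈ Ω, u w < M := by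
    intro M hM hyM w hw
    obtain ⟨ε, hε, hm⟩ := h.exists_prolong_mem (y := y) hw
    have h1 := h.conv.2 (subset_closure hm) (subset_closure hy)
      (by positivity : 0 ≤ 1 / (1 + ε)) (by positivity : 0 ≤ ε / (1 + ε)) (by field_simp)
    have e : (1 / (1 + ε)) • (w + ε • (w - y)) + (ε / (1 + ε)) • y = w := by
      have : w + ε • (w - y) = (1 + ε) • w - ε • y := by module
      rw [this, smul_sub, smul_smul, smul_smul, one_div_mul_cancel (by positivity), one_smul,
        div_mul_eq_mul_div, one_mul, sub_add_cancel]
    rw [e, smul_eq_mul, smul_eq_mul] at h1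
    have h2 := hM _ (subset_closure hm)
    calc u w ≤ _ := h1
      _ < 1 / (1 + ε) * M + ε / (1 + ε) * M :=
        add_lt_add_of_le_of_lt (mul_le_mul_of_nonneg_left h2 (by positivity))
          (mul_lt_mul_of_pos_left hyM (by positivity))
      _ = M := by field_simp
  obtain ⟨p, hp, hmax⟩ := h.bdd.isCompact_closure.exists_isMaxOn ⟨y, subset_closure hy⟩ h.cont
  by_cases hpΩ : p ∈ Ω
  · rcases (hmin p hp).lt_or_eq with hlt | heq
    · exact absurd (key (u p) (fun w hw => hmax hw) hlt p hpΩ) (lt_irrefl _)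
    · have : u x ≤ u p := hmax (subset_closure hx)
      linarith
  · have hp0 := h.bdry p ⟨hp, by rwa [h.op.interior_eq]⟩
    exact key 0 (fun w hw => hp0 ▸ hmax hw) hy0 x hx

lemma Setup.mem_of_neg (h : Setup n α β Ω u) {x : E n} (hx : x ∈ closure Ω) (hneg : u x < 0) :
    x ∈ Ω := by
  by_contra hn
  have := h.bdry x ⟨hx, by rwa [h.op.interior_eq]⟩
  linarith

/-- Small sections are compactly contained in the domain. -/
lemma Setup.exists_small_section (h : Setup n α β Ω u) {x : E n} (hx : x ∈ Ω) :
    ∃ s > 0, CptIn (MASection Ω u x s) Ω := by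
  obtain ⟨y, hy, hdy, hy0, hmin⟩ := h.exists_min
  have hdd : ∀ w, dd u y w = u w - u y := fun w => by simp [dd, hdy]
  have hx0 := h.u_neg hx
  obtain ⟨c, hc, hsep⟩ := exists_separation n α β (γ := u x / u y) (div_pos_of_neg_of_neg hx0 hy0)
    ((div_le_one_of_neg hy0).2 (hmin x (subset_closure hx)))
  have hγ : u x / u y * -u y = - u x := by
    rw [mul_neg, div_mul_cancel₀ _ hy0.ne]
  have hcpt : CptIn (MASection Ω u y ((1 - u x / u y / 2) * -u y)) Ω := by
    refine h.cptIn_of_le fun w hw hwd => h.mem_of_neg hw ?_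
    rw [hdd] at hwd
    nlinarith
  have hpos : 0 < -u y := by linarith
  refine ⟨c * -u y / 2, by positivity, h.cptIn_of_le fun w hw hwd => ?_⟩
  by_contra hn
  have h1 := hsep Ω u h y hy (-u y) hpos hcpt x (subset_closure hx)
    (by rw [hdd]; linarith) w hw (by rw [hdd, h.bdry w ⟨hw, by rwa [h.op.interior_eq]⟩]; linarith)
  have : 0 < c * -u y := by positivity
  linarith

/-- All iterated partial derivatives of order at most `k` vanish. -/
def Flat : ℕ → (E n → ℝ) → E n → Prop
  | 0, f, x => f x = 0
  | k + 1, f, x => f x = 0 ∧ ∀ i, Flat k (fun y => pd f y i) x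

lemma ae_pd_eq_zero {W : Set (E n)} (hW : IsOpen W) {f : E n → ℝ}
    (hf : ∀ x ∈ W, ContDiffAt ℝ ∞ f x) (hn : 0 < n) :
    ∀ᵐ x, x ∈ W → f x = 0 → ∀ i, pd f x i = 0 := by
  set Z := W ∩ f ⁻¹' {0} with hZ
  have hZm : MeasurableSet Z := by
    have hc : ContinuousOn f W := fun x hx => (hf x hx).continuousAt.continuousWithinAt
    have : IsOpen (W ∩ f ⁻¹' {0}ᶜ) := hc.isOpen_inter_preimage hW isOpen_compl_singleton
    have e : Z = W \ (W ∩ f ⁻¹' {0}ᶜ) := by ext x; simp [hZ]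
    rw [e]; exact hW.measurableSet.diff this.measurableSet
  set v : E n := ev ⟨0, hn⟩ with hv
  have hv0 : ‖v‖ = 1 := by simp [hv, ev]
  have hA : ApproximatesLinearOn (fun x => f x • v) (0 : E n →L[ℝ] E n) Z 0 := by
    intro x hx y hy
    have h1 : f x = 0 := hx.2
    have h2 : f y = 0 := hy.2
    simp [h1, h2]
  have key := hA.norm_fderiv_sub_le volume hZm (fun x => (fderiv ℝ f x).smulRight v)
    (fun x hx => ((((hf x hx.1).differentiableAt (by simp)).hasFDerivAt).smul_const v).hasFDerivWithinAt)
  rw [ae_restrict_iff' hZm] at key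
  filter_upwards [key] with x hx hxW hfx i
  have h1 := hx ⟨hxW, hfx⟩
  have h2 : (fderiv ℝ f x).smulRight v = 0 := by
    rw [nonpos_iff_eq_zero, nnnorm_eq_zero, sub_zero] at h1; exact h1
  have h3 := DFunLike.congr_fun h2 (ev i)
  have h4 : pd f x i • v = 0 := h3
  rcases smul_eq_zero.1 h4 with h5 | h5
  · exact h5
  · rw [h5, norm_zero] at hv0; norm_num at hv0

lemma ae_flat {W : Set (E n)} (hW : IsOpen W) (hn : 0 < n) (k : ℕ) : ∀ {f : E n → ℝ},
    (∀ x ∈ W, ContDiffAt ℝ ∞ f x) → ∀ᵐ x, x ∈ W → f x = 0 → Flat k f x := by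
  induction k with
  | zero => intro f _; exact Filter.Eventually.of_forall fun x _ hx => hx
  | succ k ih =>
    intro f hf
    have h1 : ∀ᵐ x, ∀ i, x ∈ W → pd f x i = 0 → Flat k (fun y => pd f y i) x :=
      ae_all_iff.2 fun i => ih fun x hx => contDiffAt_pd (hf x hx) i
    filter_upwards [ae_pd_eq_zero hW hf hn, h1] with x hx1 hx2 hxW hfx
    exact ⟨hfx, fun i => hx2 i hxW (hx1 hxW hfx i)⟩

lemma Flat.bound {W : Set (E n)} (hW : IsOpen W) {x : E n} (hx : x ∈ W) (k : ℕ) : ∀ {f : E n → ℝ},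
    (∀ x ∈ W, ContDiffAt ℝ ∞ f x) → Flat k f x →
      ∃ C > 0, ∃ r > 0, ∀ y ∈ Metric.ball x r, |f y| ≤ C * ‖y - x‖ ^ k := by
  induction k with
  | zero =>
    intro f hf h0
    have hc : ContinuousAt f x := (hf x hx).continuousAt
    have : ∀ᶠ y in nhds x, |f y| < 1 := by
      refine hc.abs.eventually_lt continuousAt_const ?_
      have : f x = 0 := h0
      simp [this]
    obtain ⟨r, hr, hb⟩ := Metric.eventually_nhds_iff_ball.1 this
    exact ⟨1, one_pos, r, hr, fun y hy => by simpa using (hb y hy).le⟩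
  | succ k ih =>
    intro f hf h0
    have h1 : ∀ i, ∃ C > 0, ∃ r > 0, ∀ y ∈ Metric.ball x r, |pd f y i| ≤ C * ‖y - x‖ ^ k :=
      fun i => ih (fun y hy => contDiffAt_pd (hf y hy) i) (h0.2 i)
    choose C hC r hr hb using h1
    obtain ⟨r₀, hr₀, hrW⟩ := Metric.isOpen_iff.1 hW x hx
    obtain ⟨r₁, hr₁, hr₁i⟩ : ∃ r₁ > 0, ∀ i, r₁ ≤ r i := by
      by_cases hne : Nonempty (Fin n)
      · obtain ⟨i₀, hi₀⟩ := Finite.exists_min r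
        exact ⟨r i₀, hr i₀, hi₀⟩
      · exact ⟨1, one_pos, fun i => absurd ⟨i⟩ hne⟩
    refine ⟨1 + ∑ i, C i, by have := Finset.sum_nonneg fun i (_ : i ∈ Finset.univ) => (hC i).le; linarith,
      min r₀ r₁, lt_min hr₀ hr₁, fun y hy => ?_⟩
    have hsum : 0 ≤ ∑ i, C i := Finset.sum_nonneg fun i _ => (hC i).le
    rw [Metric.mem_ball] at hy
    have hfd : ∀ w ∈ Metric.closedBall x ‖y - x‖, ‖fderiv ℝ f w‖ ≤ (∑ i, C i) * ‖y - x‖ ^ k := by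
      intro w hw
      rw [mem_closedBall_iff_norm] at hw
      refine ContinuousLinearMap.opNorm_le_bound _ (by positivity) fun v => ?_
      rw [fderiv_eq_sum, Finset.sum_mul, Finset.sum_mul]
      refine (norm_sum_le _ _).trans (Finset.sum_le_sum fun i _ => ?_)
      rw [norm_mul, Real.norm_eq_abs, Real.norm_eq_abs, mul_comm]
      have h2 : |v i| ≤ ‖v‖ := by simpa using PiLp.norm_apply_le v i
      have h3 : |pd f w i| ≤ C i * ‖y - x‖ ^ k := by
        refine (hb i w ?_).trans (by have := (hC i).le; gcongr)
        rw [Metric.mem_ball, dist_eq_norm]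
        rw [dist_eq_norm] at hy
        exact hw.trans_lt (hy.trans_le ((min_le_right _ _).trans (hr₁i i)))
      have := (hC i).le
      gcongr
    have hmv := (convex_closedBall x ‖y - x‖).norm_image_sub_le_of_norm_fderiv_le (𝕜 := ℝ)
      (f := f) (C := (∑ i, C i) * ‖y - x‖ ^ k) (x := x) (y := y)
      (fun w hw => by
        refine (hf w (hrW ?_)).differentiableAt (by simp)
        rw [Metric.mem_closedBall] at hw
        rw [Metric.mem_ball]
        rw [← dist_eq_norm] at hw
        exact hw.trans_lt (hy.trans_le (min_le_left _ _)))
      hfd (Metric.mem_closedBall_self (norm_nonneg _))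
      (by rw [mem_closedBall_iff_norm])
    have hfx : f x = 0 := h0.1
    rw [hfx, sub_zero, Real.norm_eq_abs] at hmv
    refine hmv.trans ?_
    rw [mul_assoc, ← pow_succ]
    gcongr
    linarith

lemma Setup.not_flat (h : Setup n α β Ω u) {x : E n} (hx : x ∈ Ω) :
    ∃ k, ¬ Flat k (fun y => (Hess u y).det) x := by
  obtain ⟨s, hs, hc⟩ := h.exists_small_section hx
  obtain ⟨η, hη, hprol⟩ := exists_prolong n α β
  obtain ⟨C, hC, hlo⟩ := exists_ma_lower n α β
  obtain ⟨k, hk⟩ := pow_unbounded_of_one_lt ((2 : ℝ) ^ n) (by linarith : 1 < 1 + η)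
  refine ⟨k, fun hflat => ?_⟩
  obtain ⟨M, hM, r, hr, hb⟩ := hflat.bound h.op hx k
    (fun y hy => contDiffAt_det (h.smooth y hy))
  set S : ℕ → Set (E n) := fun m => MASection Ω u x (s / 2 ^ m) with hS
  have hsm : ∀ m : ℕ, s / 2 ^ m ≤ s := fun m => div_le_self hs.le (one_le_pow₀ (by norm_num))
  have hSc : ∀ m, CptIn (S m) Ω := fun m => CptIn.mono hc (sec_mono (hsm m))
  obtain ⟨D, hD⟩ := (h.sec_bdd x s).exists_norm_le
  have hdiam : ∀ m, ∀ z ∈ S m, ‖z - x‖ ≤ (D + ‖x‖) / (1 + η) ^ m := by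
    intro m
    induction m with
    | zero =>
      intro z hz
      have : z ∈ MASection Ω u x s := by simpa [hS] using hz
      have := hD z this
      have := norm_sub_le z x
      simp; linarith
    | succ m ih =>
      intro z hz
      have h1 := hprol Ω u h x hx (s / 2 ^ m) (by positivity) (hSc m) z hz.1
        (by
          have := (mem_section.1 hz).2.le
          rwa [pow_succ, ← div_div] at this)
      have h2 := ih _ h1
      rw [add_sub_cancel_left, norm_smul, Real.norm_of_nonneg (by positivity)] at h2
      rw [pow_succ, ← div_div, le_div_iff₀ (by positivity)]
      linarith
  have hDx : 0 ≤ D + ‖x‖ := by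
    have := (norm_nonneg _).trans (hdiam 0 x (Setup.self_mem_sec hx (by positivity)))
    simpa using this
  obtain ⟨a₀, ha₀⟩ := h.exists_isBox hx hs hc
  set V := (4 * n : ℝ) ^ n * da a₀ with hV
  have hVpos : 0 < V := by
    have := ha₀.pos
    have hnR : (0 : ℝ) < n := by exact_mod_cast h.npos
    positivity
  have hvolS : ∀ m, volume.real (S m) ≤ volume.real (S 0) := fun m =>
    measureReal_mono (sec_mono (by simpa using hsm m)) ((h.sec_bdd x _).measure_lt_top.ne)
  set K := C * (M * (D + ‖x‖) ^ k * volume.real (S 0) * V) with hK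
  have hbound : ∀ m : ℕ, (D + ‖x‖) / (1 + η) ^ m < r →
      s ^ n ≤ K * (2 ^ n / (1 + η) ^ k) ^ m := by
    intro m hm
    obtain ⟨a, ha⟩ := h.exists_isBox hx (by positivity) (hSc m)
    have h1 := hlo Ω u h x hx _ (by positivity) (hSc m) a ha
    have h2 : da a ≤ V := da_le_of_subset (h.sec_open (hSc m)) (h.sec_convex _ _)
      (Setup.self_mem_sec hx (by positivity)) ha ha₀ h.npos (sec_mono (hsm m))
    have h3 : maMeasure u (S m) ≤ M * ((D + ‖x‖) / (1 + η) ^ m) ^ k * volume.real (S 0) := by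
      have hle : ‖∫ y in S m, (Hess u y).det‖
          ≤ M * ((D + ‖x‖) / (1 + η) ^ m) ^ k * volume.real (S m) := by
        refine norm_setIntegral_le_of_norm_le_const ((h.sec_bdd x _).measure_lt_top)
          fun y hy => ?_
        have h4 := hdiam m y hy
        refine (hb y ?_).trans (by gcongr)
        rw [Metric.mem_ball, dist_eq_norm]; exact h4.trans_lt hm
      refine (le_abs_self _).trans (hle.trans ?_)
      have := hvolS m
      gcongr
    have h5 : 0 ≤ maMeasure u (S m) := h.ma_nonneg (h.sec_open (hSc m)).measurableSet
      (fun y hy => (hSc m).2 (subset_closure hy))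
    have h6 : (s / 2 ^ m) ^ n ≤ C * (M * ((D + ‖x‖) / (1 + η) ^ m) ^ k * volume.real (S 0) * V) := by
      refine h1.trans ?_
      have := ha.pos.le
      gcongr
    rw [div_pow, div_le_iff₀ (by positivity)] at h6
    refine h6.trans (le_of_eq ?_)
    rw [hK, div_pow, div_pow, ← pow_mul, ← pow_mul, ← pow_mul, ← pow_mul, mul_comm m n, mul_comm m k]
    ring
  have t1 : Filter.Tendsto (fun m : ℕ => (D + ‖x‖) / (1 + η) ^ m) Filter.atTop (nhds 0) :=
    Filter.Tendsto.div_atTop tendsto_const_nhds (tendsto_pow_atTop_atTop_of_one_lt (by linarith))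
  have t2 : Filter.Tendsto (fun m : ℕ => K * (2 ^ n / (1 + η) ^ k : ℝ) ^ m) Filter.atTop
      (nhds 0) := by
    have := (tendsto_pow_atTop_nhds_zero_of_lt_one (r := (2 ^ n / (1 + η) ^ k : ℝ)) (by positivity)
      ((div_lt_one (by positivity)).2 hk)).const_mul K
    simpa using this
  obtain ⟨m, hm1, hm2⟩ := ((t1.eventually_lt_const hr).and
    (t2.eventually_lt_const (by positivity : 0 < s ^ n))).exists
  exact absurd (hbound m hm1) (not_le.2 hm2)

/-- The Monge-Ampère density is positive almost everywhere. -/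
lemma Setup.ae_det_pos (h : Setup n α β Ω u) : ∀ᵐ x, x ∈ Ω → 0 < (Hess u x).det := by
  have h1 : ∀ᵐ x, ∀ k, x ∈ Ω → (Hess u x).det = 0 → Flat k (fun y => (Hess u y).det) x :=
    ae_all_iff.2 fun k => ae_flat h.op h.npos k fun x hx => contDiffAt_det (h.smooth x hx)
  filter_upwards [h1] with x hx hxΩ
  refine lt_of_le_of_ne (h.det_nonneg hxΩ) fun h0 => ?_
  obtain ⟨k, hk⟩ := h.not_flat hxΩ
  exact hk (hx k hxΩ h0.symm)

lemma Setup.mem_closure_det_pos (h : Setup n α β Ω u) {x : E n} (hx : x ∈ Ω) :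
    ∃ᶠ y in nhds x, y ∈ Ω ∧ 0 < (Hess u y).det := by
  intro hcon
  have h1 : ∀ᶠ y in nhds x, y ∈ Ω := h.op.mem_nhds hx
  obtain ⟨r, hr, hb⟩ := Metric.eventually_nhds_iff_ball.1 (hcon.and h1)
  have h2 : volume (Metric.ball x r) = 0 := by
    refine measure_mono_null ?_ (ae_iff.1 h.ae_det_pos)
    intro y hy hn
    exact (hb y hy).1 ⟨(hb y hy).2, hn (hb y hy).2⟩
  exact (Metric.measure_ball_pos volume x hr).ne' h2

lemma Setup.piola (h : Setup n α β Ω u) {x : E n} (hx : x ∈ Ω) (j : Fin n) :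
    ∑ i, pd (fun y => cofU u y i j) x i = 0 := by
  have hcont : ContinuousAt (fun z => ∑ i, pd (fun y => cofU u y i j) z i) x :=
    tendsto_finsetSum _ fun i _ =>
      (contDiffAt_pd (contDiffAt_cofU (h.smooth x hx) i j) i).continuousAt
  by_contra hne
  have h1 := hcont.eventually_ne hne
  obtain ⟨y, ⟨hyΩ, hd⟩, hy⟩ := ((h.mem_closure_det_pos hx).and_eventually h1).exists
  exact hy (piola_of_det_ne_zero (h.eventually_smooth hyΩ) hd.ne' j)

lemma Setup.contOn_cofU (h : Setup n α β Ω u) (i j : Fin n) :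
    ContinuousOn (fun x => cofU u x i j) Ω := fun x hx =>
  (contDiffAt_cofU (h.smooth x hx) i j).continuousAt.continuousWithinAt

lemma Setup.contOn_UB (h : Setup n α β Ω u) {G : Set (E n)} (hG : G ⊆ Ω)
    {a b : E n → Fin n → ℝ} (ha : ∀ i, ContinuousOn (fun x => a x i) G)
    (hb : ∀ i, ContinuousOn (fun x => b x i) G) :
    ContinuousOn (fun x => UB u x (a x) (b x)) G := by
  unfold UB
  exact continuousOn_finsetSum _ fun i _ => continuousOn_finsetSum _ fun j _ =>
    (((h.contOn_cofU i j).mono hG).mul (ha i)).mul (hb j)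

lemma contOn_pd {G : Set (E n)} {f : E n → ℝ} (hf : ∀ x ∈ G, ContDiffAt ℝ ∞ f x) (i : Fin n) :
    ContinuousOn (fun x => pd f x i) G := fun x hx =>
  (contDiffAt_pd (hf x hx) i).continuousAt.continuousWithinAt

lemma Setup.exists_UB_le (h : Setup n α β Ω u) {K : Set (E n)} (hK : IsCompact K) (hKΩ : K ⊆ Ω) :
    ∃ C > (0 : ℝ), ∀ x ∈ K, ∀ a : Fin n → ℝ, UB u x a a ≤ C * ∑ i, a i ^ 2 := by
  have h1 : ∀ i j, ∃ C, ∀ x ∈ K, ‖cofU u x i j‖ ≤ C := fun i j =>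
    hK.exists_bound_of_continuousOn ((h.contOn_cofU i j).mono hKΩ)
  choose B hB using h1
  refine ⟨∑ i, ∑ j, |B i j| + 1, by positivity, fun x hx a => ?_⟩
  have key : ∀ i j, cofU u x i j * a i * a j ≤ |B i j| * ∑ k, a k ^ 2 := by
    intro i j
    have h2 : |cofU u x i j| ≤ |B i j| := (hB i j x hx).trans (le_abs_self _)
    have h3 : |a i * a j| ≤ ∑ k, a k ^ 2 := by
      have hi : a i ^ 2 ≤ ∑ k, a k ^ 2 :=
        Finset.single_le_sum (f := fun k => a k ^ 2) (fun k _ => sq_nonneg _) (Finset.mem_univ i)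
      have hj : a j ^ 2 ≤ ∑ k, a k ^ 2 :=
        Finset.single_le_sum (f := fun k => a k ^ 2) (fun k _ => sq_nonneg _) (Finset.mem_univ j)
      rw [abs_mul]
      have := sq_nonneg (|a i| - |a j|)
      have e1 := sq_abs (a i)
      have e2 := sq_abs (a j)
      nlinarith
    calc cofU u x i j * a i * a j ≤ |cofU u x i j * (a i * a j)| := by
          rw [mul_assoc]; exact le_abs_self _
      _ = |cofU u x i j| * |a i * a j| := abs_mul _ _
      _ ≤ _ := by gcongr
  have h0 : 0 ≤ ∑ k, a k ^ 2 := Finset.sum_nonneg fun k _ => sq_nonneg _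
  calc UB u x a a ≤ ∑ i, ∑ j, |B i j| * ∑ k, a k ^ 2 :=
        Finset.sum_le_sum fun i _ => Finset.sum_le_sum fun j _ => key i j
    _ = (∑ i, ∑ j, |B i j|) * ∑ k, a k ^ 2 := by simp_rw [Finset.sum_mul]
    _ ≤ _ := by gcongr; linarith

lemma UB_zero_left (u : E n → ℝ) (x : E n) (b : Fin n → ℝ) : UB u x 0 b = 0 := by simp [UB]

lemma UB_zero_right (u : E n → ℝ) (x : E n) (a : Fin n → ℝ) : UB u x a 0 = 0 := by simp [UB]

lemma Setup.rigid (h : Setup n α β Ω u) {G : Set (E n)} (hG : IsOpen G) (hGΩ : G ⊆ Ω)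
    {a : E n → Fin n → ℝ} (ha : ∀ i, ContinuousOn (fun x => a x i) G)
    (h0 : ∀ x ∈ G, UB u x (a x) (a x) = 0) : ∀ x ∈ G, a x = 0 := by
  intro x hx
  by_contra hne
  obtain ⟨i, hi⟩ : ∃ i, a x i ≠ 0 := by
    by_contra hcon; push Not at hcon; exact hne (funext hcon)
  have h1 : ∀ᶠ y in nhds x, a y i ≠ 0 :=
    ((ha i).continuousAt (hG.mem_nhds hx)).eventually_ne hi
  obtain ⟨y, ⟨hyΩ, hd⟩, hy, hyG⟩ :=
    ((h.mem_closure_det_pos (hGΩ hx)).and_eventually (h1.and (hG.mem_nhds hx))).exists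
  have := h.UB_pos hyΩ hd.ne' (a := a y) (fun hc => hy (by rw [hc]; rfl))
  rw [h0 y hyG] at this
  exact lt_irrefl _ this

lemma eq_zero_of_setIntegral_le {G : Set (E n)} (hG : IsOpen G) {F : E n → ℝ}
    (hF : ContinuousOn F G) (hF0 : ∀ x ∈ G, 0 ≤ F x) (hFi : IntegrableOn F G)
    (hI : ∫ x in G, F x ≤ 0) : ∀ x ∈ G, F x = 0 := by
  have h0 : 0 ≤ᵐ[volume.restrict G] F :=
    (ae_restrict_iff' hG.measurableSet).2 (Filter.Eventually.of_forall hF0)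
  have h1 : ∫ x in G, F x = 0 := le_antisymm hI (setIntegral_nonneg hG.measurableSet hF0)
  have h2 := (setIntegral_eq_zero_iff_of_nonneg_ae h0 hFi).1 h1
  exact fun x hx => Measure.eqOn_open_of_ae_eq h2 hG hF continuousOn_const hx

lemma Setup.exists_pole_cutoff (h : Setup n α β Ω u) {p : E n} (hp : p ∈ Ω) {ρ : ℝ} (hρ : 0 < ρ)
    {ε : ℝ} (hε : 0 < ε) : ∃ ξ : E n → ℝ, ContDiff ℝ ∞ ξ ∧ tsupport ξ ⊆ Metric.ball p ρ ∧
      tsupport ξ ⊆ Ω ∧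
      (∀ x, 0 ≤ ξ x ∧ ξ x ≤ 1) ∧ (∃ N, IsOpen N ∧ p ∈ N ∧ ∀ x ∈ N, ξ x = 1) ∧
      ∫ x, UB u x (pd ξ x) (pd ξ x) ≤ ε := by
  obtain ⟨r₀, hr₀, hr₀Ω⟩ := Metric.nhds_basis_closedBall.mem_iff.1 (h.op.mem_nhds hp)
  set R := min (min r₀ 1) (ρ / 2) with hR
  have hRpos : 0 < R := by positivity
  have hR1 : R ≤ 1 := (min_le_left _ _).trans (min_le_right _ _)
  have hRρ : R < ρ := (min_le_right _ _).trans_lt (by linarith)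
  have hRΩ : Metric.closedBall p R ⊆ Ω :=
    (Metric.closedBall_subset_closedBall ((min_le_left _ _).trans (min_le_left _ _))).trans hr₀Ω
  obtain ⟨C, hC, hUB⟩ := h.exists_UB_le (isCompact_closedBall p R) hRΩ
  obtain ⟨χ, hχ, hχc, hχs, hχ01, N₀, hN₀, hKN₀, hχ1⟩ :=
    exists_cutoff (isCompact_closedBall (0 : E n) (1 / 2)) Metric.isOpen_ball
      (Metric.closedBall_subset_ball (by norm_num : (1 / 2 : ℝ) < 1))
  obtain ⟨L, hL⟩ := hχ.lipschitzWith_of_hasCompactSupport hχc (by simp)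
  set c : ℕ → ℝ := fun k => 2 ^ k / R with hc
  have hcpos : ∀ k, 0 < c k := fun k => by positivity
  set f : ℕ → E n → ℝ := fun k x => χ (c k • (x - p)) with hf
  have hfd : ∀ k, ContDiff ℝ ∞ (f k) := fun k =>
    hχ.comp (by fun_prop : ContDiff ℝ ∞ fun x : E n => c k • (x - p))
  have hfl : ∀ k, ∀ x i, |pd (f k) x i| ≤ L * c k := by
    intro k x i
    have h1 : LipschitzWith (L * (c k).toNNReal) (f k) := by
      refine hL.comp (LipschitzWith.of_dist_le_mul fun y z => ?_)
      rw [dist_smul₀, Real.norm_of_nonneg (hcpos k).le, dist_sub_right,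
        Real.coe_toNNReal _ (hcpos k).le]
    have := abs_pd_le h1 x i
    rwa [NNReal.coe_mul, Real.coe_toNNReal _ (hcpos k).le] at this
  have hcont : ∀ k, Continuous fun x : E n => c k • (x - p) := fun k => by fun_prop
  have hf0 : ∀ k x, pd (f k) x ≠ 0 → 1 / 2 < c k * ‖x - p‖ ∧ c k * ‖x - p‖ < 1 := by
    intro k x hx
    have hnorm : ‖c k • (x - p)‖ = c k * ‖x - p‖ := by
      rw [norm_smul, Real.norm_of_nonneg (hcpos k).le]
    constructor
    · by_contra hle
      refine hx (funext fun i => ?_)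
      have hm : c k • (x - p) ∈ N₀ := hKN₀ (by
        rw [mem_closedBall_zero_iff, hnorm]; linarith)
      have : f k =ᶠ[nhds x] fun _ => 1 := by
        filter_upwards [(hcont k).continuousAt.preimage_mem_nhds (hN₀.mem_nhds hm)] with y hy
        exact hχ1 _ hy
      rw [pd_congr this]; simp [pd]
    · by_contra hle
      refine hx (funext fun i => ?_)
      have hm : c k • (x - p) ∈ (tsupport χ)ᶜ := fun hm => by
        have := hχs hm
        rw [mem_ball_zero_iff, hnorm] at this; linarith
      have : f k =ᶠ[nhds x] fun _ => 0 := by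
        filter_upwards [(hcont k).continuousAt.preimage_mem_nhds
          ((isClosed_tsupport χ).isOpen_compl.mem_nhds hm)] with y hy
        exact image_eq_zero_of_notMem_tsupport (f := χ) hy
      rw [pd_congr this]; simp [pd]
  have huniq : ∀ x k l, pd (f k) x ≠ 0 → pd (f l) x ≠ 0 → k = l := by
    have key : ∀ x k l, pd (f k) x ≠ 0 → pd (f l) x ≠ 0 → ¬ k < l := by
      intro x k l hk hl hkl
      have h1 := (hf0 k x hk).1
      have h2 := (hf0 l x hl).2
      have h3 : 2 * c k ≤ c l := by
        simp only [hc]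
        rw [← mul_div_assoc, ← pow_succ']
        gcongr
        · norm_num
        · exact hkl
      have h4 := mul_le_mul_of_nonneg_right h3 (norm_nonneg (x - p))
      linarith
    intro x k l hk hl
    exact le_antisymm (not_lt.1 (key x l k hl hk)) (not_lt.1 (key x k l hk hl))
  set v := volume.real (Metric.ball (0 : E n) 1) with hv
  set A := C * (n * L ^ 2 * v) with hA
  obtain ⟨N, hN⟩ := exists_nat_gt (A / ε)
  have hA0 : 0 ≤ A := by positivity
  have hNpos : (0 : ℝ) < N := (div_nonneg hA0 hε.le).trans_lt hN
  set ξ : E n → ℝ := fun x => (1 / N : ℝ) * ∑ k ∈ Finset.range N, f k x with hξ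
  have hpdξ : ∀ x i, pd ξ x i = (1 / N : ℝ) * ∑ k ∈ Finset.range N, pd (f k) x i := by
    intro x i
    have : HasFDerivAt ξ ((1 / N : ℝ) • ∑ k ∈ Finset.range N, fderiv ℝ (f k) x) x := by
      have := (HasFDerivAt.fun_sum (u := Finset.range N) fun k _ =>
        ((hfd k).differentiable (by simp) x).hasFDerivAt).const_mul (1 / N : ℝ)
      exact this
    simp [pd, this.fderiv]
  have hsq : ∀ x, ∑ i, pd ξ x i ^ 2
      = (1 / N : ℝ) ^ 2 * ∑ k ∈ Finset.range N, ∑ i, pd (f k) x i ^ 2 := by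
    intro x
    simp_rw [hpdξ, mul_pow]
    rw [← Finset.mul_sum, Finset.sum_comm]
    congr 1
    refine Finset.sum_congr rfl fun i _ => ?_
    by_cases hex : ∃ k ∈ Finset.range N, pd (f k) x ≠ 0
    · obtain ⟨k, hk, hkx⟩ := hex
      have hz : ∀ l ∈ Finset.range N, l ≠ k → pd (f l) x i = 0 := fun l _ hl => by
        by_contra hcon
        exact hl (huniq x l k (fun hc => hcon (by rw [hc]; rfl)) hkx)
      rw [Finset.sum_eq_single_of_mem k hk hz,
        Finset.sum_eq_single_of_mem k hk fun l hl hlk => by rw [hz l hl hlk]; simp]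
    · push Not at hex
      rw [Finset.sum_eq_zero fun k hk => by rw [hex k hk]; rfl,
        Finset.sum_eq_zero fun k hk => by rw [hex k hk]; simp]
      simp
  have hR' : ∀ k, ∀ x ∉ Metric.ball p (1 / c k), pd (f k) x = 0 := by
    intro k x hx
    by_contra hcon
    have := (hf0 k x hcon).2
    rw [Metric.mem_ball, dist_eq_norm, lt_div_iff₀ (hcpos k), mul_comm] at hx
    exact hx this
  have hck : ∀ k, 1 / R ≤ c k := fun k => by
    simp only [hc]; gcongr; exact one_le_pow₀ (by norm_num)
  have hck' : ∀ k, 1 / c k ≤ R := fun k => by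
    rw [div_le_iff₀ (hcpos k)]
    have := hck k
    rwa [div_le_iff₀ hRpos, mul_comm] at this
  have hts : tsupport ξ ⊆ Metric.closedBall p R := by
    refine closure_minimal (fun x hx => ?_) Metric.isClosed_closedBall
    by_contra hcon
    refine hx ?_
    simp only [hξ]
    rw [Finset.sum_eq_zero, mul_zero]
    intro k _
    refine image_eq_zero_of_notMem_tsupport (f := χ) fun hm => ?_
    have := hχs hm
    rw [mem_ball_zero_iff, norm_smul, Real.norm_of_nonneg (hcpos k).le] at this
    rw [mem_closedBall_iff_norm, not_le] at hcon
    have h1 := mul_le_mul_of_nonneg_right (hck k) (norm_nonneg (x - p))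
    have h2 : 1 < 1 / R * ‖x - p‖ := by
      rw [div_mul_eq_mul_div, one_mul, one_lt_div hRpos]; exact hcon
    linarith
  refine ⟨ξ, contDiff_const.mul (ContDiff.sum fun k _ => hfd k),
    hts.trans (Metric.closedBall_subset_ball hRρ), hts.trans hRΩ, fun x => ⟨?_, ?_⟩, ?_, ?_⟩
  · exact mul_nonneg (by positivity) (Finset.sum_nonneg fun k _ => (hχ01 _).1)
  · have : ∑ k ∈ Finset.range N, f k x ≤ ∑ k ∈ Finset.range N, (1 : ℝ) :=
      Finset.sum_le_sum fun k _ => (hχ01 _).2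
    simp only [Finset.sum_const, Finset.card_range, nsmul_eq_mul, mul_one] at this
    simp only [hξ]
    rw [div_mul_eq_mul_div, one_mul]
    exact (div_le_one hNpos).2 this
  · refine ⟨Metric.ball p (1 / (2 * c N)), Metric.isOpen_ball,
      Metric.mem_ball_self (by have := hcpos N; positivity), fun x hx => ?_⟩
    simp only [hξ]
    rw [Finset.sum_congr rfl fun k hk => ?_, Finset.sum_const, Finset.card_range, nsmul_eq_mul,
      mul_one, one_div_mul_cancel hNpos.ne']
    refine hχ1 _ (hKN₀ ?_)
    rw [mem_closedBall_zero_iff, norm_smul, Real.norm_of_nonneg (hcpos k).le]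
    rw [Metric.mem_ball, dist_eq_norm, lt_div_iff₀ (by have := hcpos N; positivity)] at hx
    have h1 : c k ≤ c N := by
      simp only [hc]; gcongr
      · norm_num
      · exact (Finset.mem_range.1 hk).le
    have h2 := mul_le_mul_of_nonneg_right h1 (norm_nonneg (x - p))
    linarith
  · have hle : ∀ x, UB u x (pd ξ x) (pd ξ x) ≤ C * (1 / N : ℝ) ^ 2 *
        ∑ k ∈ Finset.range N, (Metric.ball p (1 / c k)).indicator (fun _ => n * (L * c k) ^ 2) x := by
      intro x
      have hbig : ∑ k ∈ Finset.range N, ∑ i, pd (f k) x i ^ 2 ≤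
          ∑ k ∈ Finset.range N, (Metric.ball p (1 / c k)).indicator
            (fun _ => (n * (L * c k) ^ 2 : ℝ)) x := by
        refine Finset.sum_le_sum fun k _ => ?_
        by_cases hx : x ∈ Metric.ball p (1 / c k)
        · rw [Set.indicator_of_mem hx]
          calc ∑ i, pd (f k) x i ^ 2 ≤ ∑ _i : Fin n, (L * c k) ^ 2 :=
                Finset.sum_le_sum fun i _ => sq_le_sq' (abs_le.1 (hfl k x i)).1 (abs_le.1 (hfl k x i)).2
            _ = _ := by simp
        · rw [Set.indicator_of_notMem hx, hR' k x hx]; simp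
      by_cases hx : x ∈ Metric.closedBall p R
      · refine (hUB x hx _).trans ?_
        rw [hsq, mul_assoc]
        gcongr
      · have : pd ξ x = 0 := funext fun i =>
          pd_eq_zero_of_notMem_tsupport (fun hm => hx (hts hm)) i
        rw [this, UB_zero_left]
        refine mul_nonneg (by positivity) (Finset.sum_nonneg fun k _ => ?_)
        exact Set.indicator_nonneg (fun _ _ => by positivity) _
    have hintg : ∀ k, Integrable ((Metric.ball p (1 / c k)).indicator
        (fun _ => (n * (L * c k) ^ 2 : ℝ))) := fun k =>
      (integrable_indicator_iff Metric.isOpen_ball.measurableSet).2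
        (integrableOn_const Metric.isBounded_ball.measure_lt_top.ne)
    have hmono := integral_mono_of_nonneg (f := fun x => UB u x (pd ξ x) (pd ξ x))
      (Filter.Eventually.of_forall fun x => by
        by_cases hx : x ∈ Metric.closedBall p R
        · exact h.UB_nonneg (hRΩ hx) _
        · have : pd ξ x = 0 := funext fun i =>
            pd_eq_zero_of_notMem_tsupport (fun hm => hx (hts hm)) i
          simp only [this, UB_zero_left]; exact le_rfl)
      ((integrable_finsetSum (Finset.range N) fun k _ => hintg k).const_mul (C * (1 / N : ℝ) ^ 2))
      (Filter.Eventually.of_forall hle)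
    refine hmono.trans ?_
    rw [integral_const_mul, integral_finsetSum _ fun k _ => hintg k]
    have hone : ∀ k ∈ Finset.range N, ∫ x, (Metric.ball p (1 / c k)).indicator
        (fun _ => (n * (L * c k) ^ 2 : ℝ)) x ≤ n * L ^ 2 * v := by
      intro k _
      have hck := hcpos k
      have h1 : 1 / c k ≤ 1 := (hck' k).trans hR1
      rw [integral_indicator Metric.isOpen_ball.measurableSet, setIntegral_const, smul_eq_mul]
      have hb : volume.real (Metric.ball p (1 / c k)) = (1 / c k) ^ n * v := by
        rw [hv, measureReal_def, Measure.addHaar_ball_of_pos _ _ (by positivity : 0 < 1 / c k),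
          ENNReal.toReal_mul, finrank_euclideanSpace_fin, ENNReal.toReal_ofReal (by positivity),
          measureReal_def]
      rw [hb]
      have h2 : (1 / c k) ^ n ≤ (1 / c k) ^ 2 := pow_le_pow_of_le_one (by positivity) h1 h.hn
      have h3 : (1 / c k) ^ 2 * c k ^ 2 = 1 := by
        rw [← mul_pow, one_div_mul_cancel hck.ne', one_pow]
      have hv0 : 0 ≤ v := measureReal_nonneg
      calc (1 / c k) ^ n * v * (n * (L * c k) ^ 2) ≤ (1 / c k) ^ 2 * v * (n * (L * c k) ^ 2) := by
            gcongr
        _ = n * L ^ 2 * v * ((1 / c k) ^ 2 * c k ^ 2) := by ring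
        _ = _ := by rw [h3, mul_one]
    calc C * (1 / N : ℝ) ^ 2 * (∑ k ∈ Finset.range N,
          ∫ x, (Metric.ball p (1 / c k)).indicator (fun _ => (n * (L * c k) ^ 2 : ℝ)) x)
        ≤ C * (1 / N : ℝ) ^ 2 * ∑ k ∈ Finset.range N, (n * L ^ 2 * v) := by
          gcongr with k hk; exact hone k hk
      _ = A / N := by
          rw [Finset.sum_const, Finset.card_range, nsmul_eq_mul, hA]; field_simp
      _ ≤ ε := by
          rw [div_le_iff₀ hNpos]; rw [div_lt_iff₀ hε] at hN; linarith

/-- The energy density of a function supported in `Ω` is nonnegative everywhere. -/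
lemma Setup.UB_pd_nonneg (h : Setup n α β Ω u) {ξ : E n → ℝ} (hξ : tsupport ξ ⊆ Ω) (x : E n) :
    0 ≤ UB u x (pd ξ x) (pd ξ x) := by
  by_cases hx : x ∈ Ω
  · exact h.UB_nonneg hx _
  · have : pd ξ x = 0 := funext fun i =>
      pd_eq_zero_of_notMem_tsupport (fun hm => hx (hξ hm)) i
    rw [this, UB_zero_left]

lemma Setup.integrable_energy (h : Setup n α β Ω u) {ξ : E n → ℝ} (hξ : ContDiff ℝ ∞ ξ)
    (hc : HasCompactSupport ξ) (hs : tsupport ξ ⊆ Ω) :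
    Integrable fun x => UB u x (pd ξ x) (pd ξ x) := by
  obtain ⟨L, hL⟩ := hξ.lipschitzWith_of_hasCompactSupport hc (by simp)
  exact integrable_UB h.op h.smooth hL hc hs fun x _ => hξ.contDiffAt

/-- `b` is a smooth solution of the linearized equation on the open set `G ⊆ Ω`. -/
structure Sol (Ω : Set (E n)) (u : E n → ℝ) (G : Set (E n)) (b : E n → ℝ) : Prop where
  op : IsOpen G
  sub : G ⊆ Ω
  smooth : ∀ x ∈ G, ContDiffAt ℝ ∞ b x
  eq : ∀ x ∈ G, Lu u b x = 0

lemma Sol.mono {G G' : Set (E n)} {b : E n → ℝ} (hb : Sol Ω u G b) (hG' : IsOpen G') (hs : G' ⊆ G) :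
    Sol Ω u G' b :=
  ⟨hG', hs.trans hb.sub, fun x hx => hb.smooth x (hs hx), fun x hx => hb.eq x (hs hx)⟩

lemma Sol.cont {G : Set (E n)} {b : E n → ℝ} (hb : Sol Ω u G b) : ContinuousOn b G :=
  fun x hx => (hb.smooth x hx).continuousAt.continuousWithinAt

lemma Sol.affine_sub {G : Set (E n)} {b : E n → ℝ} (hb : Sol Ω u G b) (k : ℝ) (L : E n →L[ℝ] ℝ)
    (p : E n) : Sol Ω u G (fun x => k + L (x - p) - b x) := by
  have hsm : ∀ x ∈ G, ContDiffAt ℝ ∞ (fun x => k + L (x - p) - b x) x := fun x hx =>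
    (by fun_prop : ContDiffAt ℝ ∞ (fun x => k + L (x - p)) x).sub (hb.smooth x hx)
  refine ⟨hb.op, hb.sub, hsm, fun x hx => ?_⟩
  have h1 : ∀ j, (fun y => pd (fun x => k + L (x - p) - b x) y j)
      =ᶠ[nhds x] fun y => L (ev j) - pd b y j := by
    intro j
    filter_upwards [hb.op.mem_nhds hx] with y hy
    have hd : HasFDerivAt (fun x => k + L (x - p) - b x) (L - fderiv ℝ b y) y :=
      ((L.hasFDerivAt.comp y ((hasFDerivAt_id y).sub_const p)).const_add k).sub
        ((hb.smooth y hy).differentiableAt (by simp)).hasFDerivAt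
    rw [pd, hd.fderiv]; rfl
  have h2 : ∀ i j, pd2 (fun x => k + L (x - p) - b x) x i j = - pd2 b x i j := by
    intro i j
    have : pd2 (fun x => k + L (x - p) - b x) x i j
        = pd (fun y => L (ev j) - pd b y j) x i := pd_congr (h1 j) i
    rw [this]
    have hd : HasFDerivAt (fun y => L (ev j) - pd b y j) (- fderiv ℝ (fun y => pd b y j) x) x :=
      (((contDiffAt_pd (hb.smooth x hx) j).differentiableAt (by simp)).hasFDerivAt).const_sub _
    have e : pd2 b x i j = pd (fun y => pd b y j) x i := rfl
    rw [e, pd, hd.fderiv]; rfl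
  have := hb.eq x hx
  simp only [Lu] at this ⊢
  simp only [h2, mul_neg, Finset.sum_neg_distrib, this, neg_zero]

lemma Setup.weak (h : Setup n α β Ω u) {G : Set (E n)} {b : E n → ℝ} (hb : Sol Ω u G b)
    {a : E n → ℝ} {L : NNReal} (ha : LipschitzWith L a) (hac : HasCompactSupport a)
    (has : tsupport a ⊆ G) : ∫ x, UB u x (pd a x) (pd b x) = 0 := by
  have h1 := integral_mul_Lu hb.op (fun x hx => h.smooth x (hb.sub hx))
    (fun x hx j => h.piola (hb.sub hx) j) ha hac has hb.smooth
  have h2 : ∀ x, a x * Lu u b x = 0 := by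
    intro x
    by_cases hx : x ∈ G
    · rw [hb.eq x hx, mul_zero]
    · rw [image_eq_zero_of_notMem_tsupport (f := a) fun hm => hx (has hm), zero_mul]
  simp only [h2, integral_zero] at h1
  linarith

lemma pd_comp {H : ℝ → ℝ} {b : E n → ℝ} {x : E n} (hH : DifferentiableAt ℝ H (b x))
    (hb : DifferentiableAt ℝ b x) (i : Fin n) :
    pd (fun y => H (b y)) x i = deriv H (b x) * pd b x i := by
  have : HasFDerivAt (fun y => H (b y)) (deriv H (b x) • fderiv ℝ b x) x :=
    hH.hasDerivAt.comp_hasFDerivAt x hb.hasFDerivAt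
  simp [pd, this.fderiv]

/-- Caccioppoli inequality. -/
lemma Setup.caccioppoli (h : Setup n α β Ω u) {G : Set (E n)} {b : E n → ℝ} (hb : Sol Ω u G b)
    {η : E n → ℝ} (hη : ContDiff ℝ ∞ η) (hηc : HasCompactSupport η) (hηs : tsupport η ⊆ G)
    {H : ℝ → ℝ} (hH : ∀ x ∈ G, ContDiffAt ℝ ∞ H (b x)) (hH' : ∀ x ∈ G, 0 ≤ deriv H (b x))
    {R : E n → ℝ} (hR : Integrable R) (hR0 : ∀ x, 0 ≤ R x)
    (hle : ∀ x ∈ G, H (b x) ^ 2 * UB u x (pd η x) (pd η x) ≤ R x * deriv H (b x)) :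
    Integrable (fun x => η x ^ 2 * deriv H (b x) * UB u x (pd b x) (pd b x)) ∧
    ∫ x, η x ^ 2 * deriv H (b x) * UB u x (pd b x) (pd b x) ≤ 4 * ∫ x, R x := by
  have hf1 : ContDiff ℝ ∞ fun x => η x * H (b x) :=
    contDiff_mul_of_tsupport hη hηs fun x hx => (hH x hx).comp x (hb.smooth x hx)
  have ha : ContDiff ℝ ∞ fun x => η x * (η x * H (b x)) := hη.mul hf1
  have hts : tsupport (fun x => η x * (η x * H (b x))) ⊆ tsupport η :=
    tsupport_mul_subset_left (f := η)
  have hac : HasCompactSupport fun x => η x * (η x * H (b x)) := hηc.mul_right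
  obtain ⟨L, hL⟩ := ha.lipschitzWith_of_hasCompactSupport hac (by simp)
  have hw := h.weak hb hL hac (hts.trans hηs)
  have hpda : ∀ x ∈ G, pd (fun x => η x * (η x * H (b x))) x
      = (η x ^ 2 * deriv H (b x)) • pd b x + (2 * η x * H (b x)) • pd η x := by
    intro x hx
    funext i
    have hd1 : DifferentiableAt ℝ η x := (hη.differentiable (by simp)) x
    have hd2 : DifferentiableAt ℝ (fun x => H (b x)) x :=
      ((hH x hx).comp x (hb.smooth x hx)).differentiableAt (by simp)
    rw [pd_mul hd1 ((hf1.differentiable (by simp)) x), pd_mul hd1 hd2,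
      pd_comp ((hH x hx).differentiableAt (by simp)) ((hb.smooth x hx).differentiableAt (by simp))]
    simp only [Pi.add_apply, Pi.smul_apply, smul_eq_mul]
    ring
  have hcont : ContinuousOn (fun x => η x ^ 2 * deriv H (b x) * UB u x (pd b x) (pd b x)) G := by
    refine ((hη.continuous.continuousOn.pow 2).mul fun x hx => ?_).mul
      (h.contOn_UB hb.sub (contOn_pd hb.smooth) (contOn_pd hb.smooth))
    have : ContinuousAt (deriv H) (b x) :=
      ((hH x hx).continuousAt_fderiv (by simp)).clm_apply continuousAt_const
    exact (this.comp (hb.smooth x hx).continuousAt).continuousWithinAt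
  have hintg : Integrable (fun x => η x ^ 2 * deriv H (b x) * UB u x (pd b x) (pd b x)) :=
    integrable_of_zero_outside hηc hb.op hηs hcont fun x hx => by
      rw [image_eq_zero_of_notMem_tsupport hx]; ring
  refine ⟨hintg, ?_⟩
  have hint2 := integrable_UB hb.op (fun x hx => h.smooth x (hb.sub hx)) hL hac (hts.trans hηs)
    hb.smooth
  have hpt : ∀ x, (1 / 2 : ℝ) * (η x ^ 2 * deriv H (b x) * UB u x (pd b x) (pd b x)) - 2 * R x
      ≤ UB u x (pd (fun x => η x * (η x * H (b x))) x) (pd b x) := by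
    intro x
    by_cases hx : x ∈ G
    · rw [hpda x hx, UB_add_left, UB_smul_left, UB_smul_left]
      set A := UB u x (pd b x) (pd b x)
      set B := UB u x (pd η x) (pd η x)
      set D := UB u x (pd η x) (pd b x)
      have hA : 0 ≤ A := h.UB_nonneg (hb.sub hx) _
      have hB : 0 ≤ B := h.UB_nonneg (hb.sub hx) _
      have hD : D ^ 2 ≤ B * A := h.UB_sq_le (hb.sub hx) _ _
      have hX : 0 ≤ η x ^ 2 * deriv H (b x) * A := mul_nonneg (mul_nonneg (sq_nonneg _) (hH' x hx)) hA
      have hle' := hle x hx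
      have hRx := hR0 x
      have h1 : (2 * η x * H (b x) * D) ^ 2
          ≤ (1 / 2 * (η x ^ 2 * deriv H (b x) * A) + 2 * R x) ^ 2 := by
        calc (2 * η x * H (b x) * D) ^ 2 = 4 * η x ^ 2 * H (b x) ^ 2 * D ^ 2 := by ring
          _ ≤ 4 * η x ^ 2 * H (b x) ^ 2 * (B * A) := by gcongr
          _ = 4 * η x ^ 2 * A * (H (b x) ^ 2 * B) := by ring
          _ ≤ 4 * η x ^ 2 * A * (R x * deriv H (b x)) := by gcongr
          _ = 4 * (η x ^ 2 * deriv H (b x) * A) * R x := by ring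
          _ ≤ _ := by
            have := sq_nonneg (1 / 2 * (η x ^ 2 * deriv H (b x) * A) - 2 * R x)
            linarith
      have h2 := abs_le_of_sq_le_sq' h1 (by positivity)
      have := h2.1
      linarith
    · have hxη : x ∉ tsupport η := fun hm => hx (hηs hm)
      have e : pd (fun x => η x * (η x * H (b x))) x = 0 := funext fun i =>
        pd_eq_zero_of_notMem_tsupport (fun hm => hxη (hts hm)) i
      rw [e, UB_zero_left, image_eq_zero_of_notMem_tsupport hxη]
      have := hR0 x
      linarith
  have h3 := integral_mono ((hintg.const_mul (1 / 2 : ℝ)).sub (hR.const_mul 2)) hint2 hpt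
  simp only [Pi.sub_apply] at h3
  rw [hw, integral_sub (hintg.const_mul _) (hR.const_mul 2), integral_const_mul,
    integral_const_mul] at h3
  linarith

lemma deriv_expNegInvGlue (τ : ℝ) : deriv expNegInvGlue τ = τ⁻¹ ^ 2 * expNegInvGlue τ := by
  have := expNegInvGlue.hasDerivAt_polynomial_eval_inv_mul 1 τ
  simpa using this.deriv

lemma expNegInvGlue_le_one (τ : ℝ) : expNegInvGlue τ ≤ 1 := by
  rcases le_or_gt τ 0 with hτ | hτ
  · rw [expNegInvGlue.zero_of_nonpos hτ]; exact zero_le_one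
  · rw [expNegInvGlue, if_neg (not_le.2 hτ), Real.exp_le_one_iff]
    have := inv_pos.2 hτ
    linarith

lemma sq_expNegInvGlue_le {τ M : ℝ} (hM : τ ≤ M) :
    expNegInvGlue τ ^ 2 ≤ M ^ 2 * deriv expNegInvGlue τ := by
  rw [deriv_expNegInvGlue]
  rcases le_or_gt τ 0 with hτ | hτ
  · rw [expNegInvGlue.zero_of_nonpos hτ]; simp
  · have h0 := expNegInvGlue.nonneg τ
    have h1 : 1 ≤ M ^ 2 * τ⁻¹ ^ 2 := by
      rw [← mul_pow]
      refine one_le_pow₀ ?_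
      rw [← div_eq_mul_inv]
      exact (one_le_div hτ).2 hM
    calc expNegInvGlue τ ^ 2 = expNegInvGlue τ * expNegInvGlue τ := sq _
      _ ≤ 1 * expNegInvGlue τ := by gcongr; exact expNegInvGlue_le_one τ
      _ ≤ (M ^ 2 * τ⁻¹ ^ 2) * expNegInvGlue τ := by gcongr
      _ = _ := by ring

/-- Maximum principle, insensitive to a pole at which the solution is bounded above. -/
lemma Setup.le_zero_of_compact (h : Setup n α β Ω u) {D K : Set (E n)} {p : E n} (hD : IsOpen D)
    (hDΩ : D ⊆ Ω) (hp : p ∈ Ω) {b : E n → ℝ} (hb : Sol Ω u (D \ {p}) b) (hK : IsCompact K)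
    (hKD : K ⊆ D) {M : ℝ} (hM : ∀ x ∈ D \ {p}, b x ≤ M) (hout : ∀ x ∈ D \ {p}, x ∉ K → b x ≤ 0) :
    ∀ x ∈ D \ {p}, b x ≤ 0 := by
  intro x₁ hx₁
  by_contra hpos
  push Not at hpos
  have hne : x₁ ≠ p := hx₁.2
  have hnorm : 0 < ‖x₁ - p‖ := norm_pos_iff.2 (sub_ne_zero.2 hne)
  obtain ⟨χ, hχ, hχc, hχs, hχ01, N, hN, hKN, hχ1⟩ := exists_cutoff hK hD hKD
  have hHs : ContDiff ℝ ∞ expNegInvGlue := expNegInvGlue.contDiff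
  have hzero : ∀ x, x ≠ p → pd (fun y => χ y * expNegInvGlue (b y)) x = 0 := by
    intro x hxp
    by_cases hxD : x ∈ D
    swap
    · funext i
      refine pd_eq_zero_of_notMem_tsupport (fun hm => hxD (hχs ?_)) i
      exact tsupport_mul_subset_left (f := χ) hm
    have hxG : x ∈ D \ {p} := ⟨hxD, hxp⟩
    have hbd : DifferentiableAt ℝ b x := (hb.smooth x hxG).differentiableAt (by simp)
    have hHd : DifferentiableAt ℝ expNegInvGlue (b x) := hHs.differentiable (by simp) _
    have hHbd : DifferentiableAt ℝ (fun y => expNegInvGlue (b y)) x :=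
      DifferentiableAt.comp (g := expNegInvGlue) x hHd hbd
    rcases le_or_gt (b x) 0 with hbx | hbx
    · funext i
      rw [pd_mul (hχ.differentiable (by simp) x) hHbd, pd_comp hHd hbd, deriv_expNegInvGlue,
        expNegInvGlue.zero_of_nonpos hbx]
      simp
    have hδ : 0 < ‖x - p‖ := norm_pos_iff.2 (sub_ne_zero.2 hxp)
    set G1 : Set (E n) := ((D \ {p}) ∩ b ⁻¹' Set.Ioi 0) ∩ (Metric.closedBall p (‖x - p‖ / 2))ᶜ
      with hG1
    have hG1o : IsOpen G1 := (hb.cont.isOpen_inter_preimage hb.op isOpen_Ioi).inter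
      Metric.isClosed_closedBall.isOpen_compl
    have hxG1 : x ∈ G1 := ⟨⟨hxG, hbx⟩, by
      rw [Set.mem_compl_iff, mem_closedBall_iff_norm]; linarith⟩
    have hG1s : G1 ⊆ D \ {p} := fun y hy => hy.1.1
    have hG1K : ∀ y ∈ G1, y ∈ K := fun y hy => by
      by_contra hn; exact absurd (hout y hy.1.1 hn) (not_le.2 hy.1.2)
    set F : E n → ℝ := fun y => deriv expNegInvGlue (b y) * UB u y (pd b y) (pd b y) with hF
    have hFc : ContinuousOn F (D \ {p}) := by
      refine ContinuousOn.mul ?_ (h.contOn_UB hb.sub (contOn_pd hb.smooth) (contOn_pd hb.smooth))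
      exact ((hHs.continuous_deriv (by simp)).comp_continuousOn hb.cont)
    have hH'0 : ∀ τ, 0 ≤ deriv expNegInvGlue τ := fun τ => by
      rw [deriv_expNegInvGlue]; exact mul_nonneg (sq_nonneg _) (expNegInvGlue.nonneg _)
    have hF0 : ∀ y ∈ D \ {p}, 0 ≤ F y := fun y hy =>
      mul_nonneg (hH'0 _) (h.UB_nonneg (hb.sub hy) _)
    have hstep : ∀ ε > (0 : ℝ), IntegrableOn F G1 ∧ ∫ y in G1, F y ≤ 4 * (M ^ 2 * ε) := by
      intro ε hε
      obtain ⟨ξ, hξ, hξs, hξΩ, hξ01, ⟨Nξ, hNξ, hpNξ, hξ1⟩, hξe⟩ :=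
        h.exists_pole_cutoff hp (half_pos hδ) hε
      have hη : ContDiff ℝ ∞ fun y => χ y * (1 - ξ y) := hχ.mul (contDiff_const.sub hξ)
      have hηs : tsupport (fun y => χ y * (1 - ξ y)) ⊆ tsupport χ ∩ Nξᶜ := by
        refine closure_minimal (fun y hy => ⟨subset_closure fun h0 => hy (by simp [h0]),
          fun hyN => hy (by simp [hξ1 y hyN])⟩) ((isClosed_tsupport χ).inter hNξ.isClosed_compl)
      have hηG : tsupport (fun y => χ y * (1 - ξ y)) ⊆ D \ {p} := fun y hy =>
        ⟨hχs (hηs hy).1, fun hc => (hηs hy).2 (by rw [Set.mem_singleton_iff.1 hc]; exact hpNξ)⟩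
      have hηc : HasCompactSupport fun y => χ y * (1 - ξ y) := hχc.mul_right
      have hξc : HasCompactSupport ξ := (isCompact_closedBall p _).of_isClosed_subset
        (isClosed_tsupport ξ) (hξs.trans Metric.ball_subset_closedBall)
      have hξU := h.UB_pd_nonneg hξΩ
      have hRi : Integrable fun y => M ^ 2 * UB u y (pd ξ y) (pd ξ y) :=
        (h.integrable_energy hξ hξc hξΩ).const_mul _
      obtain ⟨hi, hle⟩ := h.caccioppoli hb hη hηc hηG (H := expNegInvGlue)
        (fun y _ => hHs.contDiffAt) (fun y _ => hH'0 _) hRi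
        (fun y => mul_nonneg (sq_nonneg _) (hξU y)) (by
          intro y hy
          rcases le_or_gt (b y) 0 with hby | hby
          · rw [expNegInvGlue.zero_of_nonpos hby]
            have := mul_nonneg (mul_nonneg (sq_nonneg M) (hξU y)) (hH'0 (b y))
            simpa using this
          · have hyK : y ∈ K := by
              by_contra hn; exact absurd (hout y hy hn) (not_le.2 hby)
            have hloc : (fun y => χ y * (1 - ξ y)) =ᶠ[nhds y] fun y => 1 - ξ y := by
              filter_upwards [hN.mem_nhds (hKN hyK)] with z hz
              rw [hχ1 z hz, one_mul]
            have e : pd (fun y => χ y * (1 - ξ y)) y = (-1 : ℝ) • pd ξ y := by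
              funext i
              rw [pd_congr hloc]
              have : HasFDerivAt (fun y => 1 - ξ y) (-fderiv ℝ ξ y) y :=
                (hξ.differentiable (by simp) y).hasFDerivAt.const_sub 1
              rw [pd, this.fderiv]; simp [pd]
            rw [e, UB_smul_left, UB_smul_right]
            have h1 := sq_expNegInvGlue_le (hM y hy)
            have h2 := mul_le_mul_of_nonneg_right h1 (hξU y)
            linarith)
      have hEq : ∀ y ∈ G1, F y = (χ y * (1 - ξ y)) ^ 2 * deriv expNegInvGlue (b y)
          * UB u y (pd b y) (pd b y) := by
        intro y hy
        have hy1 : ξ y = 0 := by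
          refine image_eq_zero_of_notMem_tsupport (f := ξ) fun hm => hy.2 ?_
          exact Metric.ball_subset_closedBall (hξs hm)
        rw [hy1, hχ1 y (hKN (hG1K y hy))]
        simp [hF]
      refine ⟨(hi.integrableOn (s := G1)).congr_fun (fun y hy => (hEq y hy).symm) hG1o.measurableSet,
        ?_⟩
      rw [setIntegral_congr_fun hG1o.measurableSet hEq]
      refine (setIntegral_le_integral hi (Filter.Eventually.of_forall fun y => ?_)).trans
        (hle.trans ?_)
      · by_cases hy : y ∈ Ω
        · exact mul_nonneg (mul_nonneg (sq_nonneg _) (hH'0 _)) (h.UB_nonneg hy _)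
        · have : χ y = 0 := image_eq_zero_of_notMem_tsupport (f := χ) fun hm => hy (hDΩ (hχs hm))
          simp [this]
      · rw [integral_const_mul]
        gcongr
    have hle0 : ∫ y in G1, F y ≤ 0 := by
      refine le_of_forall_pos_le_add fun ε hε => ?_
      have := (hstep (ε / (4 * (M ^ 2 + 1))) (by positivity)).2
      have h1 : 4 * (M ^ 2 * (ε / (4 * (M ^ 2 + 1)))) = ε * (M ^ 2 / (M ^ 2 + 1)) := by
        field_simp
      have h2 : M ^ 2 / (M ^ 2 + 1) ≤ 1 := (div_le_one (by positivity)).2 (by linarith)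
      have h3 := mul_le_mul_of_nonneg_left h2 hε.le
      linarith
    have hF00 := eq_zero_of_setIntegral_le hG1o (hFc.mono hG1s) (fun y hy => hF0 y (hG1s hy))
      (hstep 1 one_pos).1 hle0
    have hpd0 := h.rigid hG1o (hG1s.trans hb.sub) (a := pd b)
      (contOn_pd fun y hy => hb.smooth y (hG1s hy)) (fun y hy => by
        have h1 := hF00 y hy
        rcases mul_eq_zero.1 h1 with h2 | h2
        · rw [deriv_expNegInvGlue] at h2
          have h3 : 0 < b y := hy.1.2
          have := mul_pos (pow_pos (inv_pos.2 h3) 2) (expNegInvGlue.pos_of_pos h3)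
          exact absurd h2 this.ne'
        · exact h2) x hxG1
    have hloc : (fun y => χ y * expNegInvGlue (b y)) =ᶠ[nhds x] fun y => expNegInvGlue (b y) := by
      filter_upwards [hN.mem_nhds (hKN (hG1K x hxG1))] with z hz
      rw [hχ1 z hz, one_mul]
    funext i
    rw [pd_congr hloc, pd_comp hHd hbd, hpd0]
    simp
  have hdiff : ∀ x, x ≠ p → DifferentiableAt ℝ (fun y => χ y * expNegInvGlue (b y)) x := by
    intro x hxp
    by_cases hxD : x ∈ D
    · exact (hχ.differentiable (by simp) x).mul (DifferentiableAt.comp (g := expNegInvGlue) x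
        (hHs.differentiable (by simp) _) ((hb.smooth x ⟨hxD, hxp⟩).differentiableAt (by simp)))
    · have : (fun y => χ y * expNegInvGlue (b y)) =ᶠ[nhds x] fun _ => 0 := by
        filter_upwards [(isClosed_tsupport χ).isOpen_compl.mem_nhds fun hm => hxD (hχs hm)] with y hy
        rw [image_eq_zero_of_notMem_tsupport (f := χ) hy, zero_mul]
      exact (differentiableAt_const _).congr_of_eventuallyEq this
  set γ : ℝ → E n := fun τ => p + τ • (x₁ - p) with hγ
  have hγd : ∀ τ, HasDerivAt γ (x₁ - p) τ := fun τ => by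
    have := ((hasDerivAt_id τ).smul_const (x₁ - p)).const_add p
    rw [one_smul] at this
    exact this
  have hγp : ∀ τ, 1 ≤ τ → γ τ ≠ p := fun τ hτ hc => by
    have : τ • (x₁ - p) = 0 := by simpa [hγ] using hc
    rcases smul_eq_zero.1 this with h1 | h1
    · linarith
    · exact hne (sub_eq_zero.1 h1)
  have hder : ∀ τ, 1 ≤ τ → HasDerivAt (fun τ => χ (γ τ) * expNegInvGlue (b (γ τ))) 0 τ := by
    intro τ hτ
    have h1 := ((hdiff _ (hγp τ hτ)).hasFDerivAt).comp_hasDerivAt τ (hγd τ)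
    rw [fderiv_eq_sum, hzero _ (hγp τ hτ)] at h1
    simp only [Pi.zero_apply, mul_zero, Finset.sum_const_zero] at h1
    exact h1
  obtain ⟨B, hB⟩ := hχc.isBounded.exists_norm_le
  set T := 1 + (|B| + ‖p‖ + 1) / ‖x₁ - p‖ with hT
  have hT1 : 1 ≤ T := by
    have : 0 ≤ (|B| + ‖p‖ + 1) / ‖x₁ - p‖ := by positivity
    linarith
  have hconst := constant_of_has_deriv_right_zero (a := 1) (b := T)
    (fun τ hτ => (hder τ hτ.1).continuousAt.continuousWithinAt)
    (fun τ hτ => (hder τ hτ.1).hasDerivWithinAt) T ⟨hT1, le_rfl⟩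
  have hTout : χ (γ T) = 0 := by
    refine image_eq_zero_of_notMem_tsupport (f := χ) fun hm => ?_
    have h1 := hB _ hm
    have h2 : ‖T • (x₁ - p)‖ ≤ ‖γ T‖ + ‖p‖ := by
      have : T • (x₁ - p) = γ T - p := by simp [hγ]
      rw [this]; exact norm_sub_le _ _
    rw [norm_smul, Real.norm_of_nonneg (by linarith), hT, add_mul, div_mul_cancel₀ _ hnorm.ne'] at h2
    have := le_abs_self B
    linarith
  have hx₁K : x₁ ∈ K := by
    by_contra hn; exact absurd (hout x₁ hx₁ hn) (not_le.2 hpos)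
  have h1 : γ 1 = x₁ := by simp [hγ]
  rw [hTout, zero_mul, h1, hχ1 x₁ (hKN hx₁K), one_mul] at hconst
  exact absurd hconst (expNegInvGlue.pos_of_pos hpos).ne

lemma prod_le_one_of_sum_eq {ι : Type*} [Fintype ι] {f : ι → ℝ} (h0 : ∀ i, 0 ≤ f i)
    (hs : ∑ i, f i = Fintype.card ι) : ∏ i, f i ≤ 1 := by
  have h1 : ∏ i, f i ≤ ∏ i, Real.exp (f i - 1) :=
    Finset.prod_le_prod (fun i _ => h0 i) fun i _ => by
      have := Real.add_one_le_exp (f i - 1); linarith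
  rw [← Real.exp_sum] at h1
  have h2 : ∑ i, (f i - 1) = 0 := by
    rw [Finset.sum_sub_distrib, hs]; simp
  rwa [h2, Real.exp_zero] at h1

open scoped MatrixOrder Matrix.Norms.L2Operator in
lemma exists_eq_conjTranspose_mul_self {A : Matrix (Fin n) (Fin n) ℝ} (hA : A.PosSemidef) :
    ∃ B : Matrix (Fin n) (Fin n) ℝ, A = B.conjTranspose * B := by
  obtain ⟨B, hB⟩ := CStarAlgebra.nonneg_iff_eq_star_mul_self.mp hA.nonneg
  exact ⟨B, hB⟩

/-- Concavity of `det ^ (1 / n)`, in tangent form. -/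
lemma det_le_of_trace {P M : Matrix (Fin n) (Fin n) ℝ} (hP : P.PosDef) (hM : M.PosSemidef)
    (ht : (P.adjugate * M).trace = n * P.det) : M.det ≤ P.det := by
  have hd : 0 < P.det := hP.det_pos
  obtain ⟨B, hB⟩ := exists_eq_conjTranspose_mul_self hP.inv.posSemidef
  have hN : (B * M * B.conjTranspose).PosSemidef := hM.mul_mul_conjTranspose_same B
  have htr : (B * M * B.conjTranspose).trace = n := by
    rw [Matrix.trace_mul_comm, ← Matrix.mul_assoc, ← hB, Matrix.inv_def, Matrix.smul_mul,
      Matrix.trace_smul, ht, Ring.inverse_eq_inv']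
    simp only [smul_eq_mul]
    field_simp
  have hdet : (B * M * B.conjTranspose).det = P.det⁻¹ * M.det := by
    have : P⁻¹.det = P.det⁻¹ := by
      rw [Matrix.det_nonsing_inv, Ring.inverse_eq_inv']
    rw [← this, hB]
    simp only [Matrix.det_mul]; ring
  have h1 : (B * M * B.conjTranspose).det ≤ 1 := by
    rw [hN.1.det_eq_prod_eigenvalues]
    have := hN.1.trace_eq_sum_eigenvalues
    rw [htr] at this
    exact prod_le_one_of_sum_eq (fun i => hN.eigenvalues_nonneg i) (by simpa using this.symm)
  rw [hdet] at h1
  have := mul_le_mul_of_nonneg_left h1 hd.le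
  rwa [← mul_assoc, mul_inv_cancel₀ hd.ne', one_mul, mul_one] at this

lemma snd_nonneg_of_isLocalMin {f : E n → ℝ} {x : E n} (hf : ContDiffAt ℝ ∞ f x)
    (hm : IsLocalMin f x) (v : E n) : 0 ≤ fderiv ℝ (fderiv ℝ f) x v v := by
  by_contra! hneg
  have hev : ∀ᶠ y in nhds x, ContDiffAt ℝ 2 f y :=
    (hf.of_le (by exact WithTop.coe_le_coe.2 le_top)).eventually (by simp)
  have hl : ∀ t : ℝ, HasDerivAt (fun t : ℝ => x + t • v) v t := fun t => by
    simpa using ((hasDerivAt_id t).smul_const v).const_add x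
  have hlc : Filter.Tendsto (fun t : ℝ => x + t • v) (nhds 0) (nhds x) := by
    simpa using (hl 0).continuousAt.tendsto
  have h1 : ∀ᶠ t in nhds (0 : ℝ), deriv (fun t : ℝ => f (x + t • v)) t
      = fderiv ℝ f (x + t • v) v := by
    filter_upwards [hlc.eventually hev] with t ht
    exact ((ht.differentiableAt (by simp)).hasFDerivAt.comp_hasDerivAt t (hl t)).deriv
  have h2 : HasDerivAt (fun t : ℝ => fderiv ℝ f (x + t • v) v)
      (fderiv ℝ (fderiv ℝ f) x v v) 0 := by
    have hd : DifferentiableAt ℝ (fderiv ℝ f) x :=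
      (hf.fderiv_right (m := ∞) (by simp)).differentiableAt (by simp)
    have hd' : HasFDerivAt (fderiv ℝ f) (fderiv ℝ (fderiv ℝ f) x) (x + (0 : ℝ) • v) := by
      simpa using hd.hasFDerivAt
    have h3 : HasDerivAt (fun t : ℝ => fderiv ℝ f (x + t • v)) (fderiv ℝ (fderiv ℝ f) x v) 0 :=
      hd'.comp_hasDerivAt (0 : ℝ) (hl 0)
    have := h3.clm_apply (hasDerivAt_const (0 : ℝ) v)
    simpa only [map_zero, add_zero] using this
  have h3 : deriv (deriv fun t : ℝ => f (x + t • v)) 0 = fderiv ℝ (fderiv ℝ f) x v v := by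
    rw [Filter.EventuallyEq.deriv_eq h1]; exact h2.deriv
  have h4 : deriv (fun t : ℝ => f (x + t • v)) 0 = 0 := by
    rw [h1.self_of_nhds, zero_smul, add_zero, hm.fderiv_eq_zero]; rfl
  have hmax : IsLocalMax (fun t : ℝ => f (x + t • v)) 0 :=
    isLocalMax_of_deriv_deriv_neg (by rw [h3]; exact hneg) h4
      (ContinuousAt.comp (by simpa using hf.continuousAt) (hl 0).continuousAt)
  have hmin : ∀ᶠ t in nhds (0 : ℝ), f x ≤ f (x + t • v) := hlc.eventually hm
  have hc : (fun t : ℝ => f (x + t • v)) =ᶠ[nhds 0] fun _ => f x := by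
    filter_upwards [hmax, hmin] with t h1 h2
    exact le_antisymm (by simpa using h1) h2
  have : deriv (deriv fun t : ℝ => f (x + t • v)) 0 = 0 := by
    rw [hc.deriv.deriv_eq]; simp
  linarith

lemma attain {X : Type*} [TopologicalSpace X] {Q : Set X} {p z : X} {f : X → ℝ} [T2Space X]
    (hQ : IsCompact Q) (hf : ContinuousOn f (Q \ {p})) {B : ℝ} (hB : ∀ x ∈ Q \ {p}, B ≤ f x)
    (hz : z ∈ Q \ {p}) : (∃ x ∈ Q \ {p}, ∀ y ∈ Q \ {p}, f x ≤ f y) ∨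
      (p ∈ Q ∧ ∃ I, (∀ x ∈ Q \ {p}, I ≤ f x) ∧
        ∀ ε > 0, ∃ᶠ x in nhdsWithin p {p}ᶜ, x ∈ Q ∧ f x < I + ε) := by
  by_contra! hcon
  obtain ⟨hno, hno2⟩ := hcon
  have hbd : BddBelow (f '' (Q \ {p})) := ⟨B, by rintro _ ⟨x, hx, rfl⟩; exact hB x hx⟩
  have hne : (f '' (Q \ {p})).Nonempty := ⟨_, z, hz, rfl⟩
  set I := sInf (f '' (Q \ {p})) with hI
  have hIle : ∀ x ∈ Q \ {p}, I ≤ f x := fun x hx => csInf_le hbd ⟨x, hx, rfl⟩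
  have key : ∃ W, IsOpen W ∧ p ∈ W ∧ ∃ ε > 0, ∀ x ∈ Q \ {p}, x ∈ W → I + ε ≤ f x := by
    by_cases hp : p ∈ Q
    · obtain ⟨ε, hε, hfr⟩ := hno2 hp I hIle
      rw [eventually_nhdsWithin_iff] at hfr
      obtain ⟨W, hW, hWo, hpW⟩ := mem_nhds_iff.1 hfr
      exact ⟨W, hWo, hpW, ε, hε, fun x hx hxW => hW hxW hx.2 hx.1⟩
    · refine ⟨Qᶜ, hQ.isClosed.isOpen_compl, hp, 1, one_pos, fun x hx hxW => (hxW hx.1).elim⟩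
  obtain ⟨W, hWo, hpW, ε, hε, hW⟩ := key
  have hc : IsCompact (Q \ W) := hQ.diff hWo
  have hsub : Q \ W ⊆ Q \ {p} := fun x hx => ⟨hx.1, fun h => hx.2 (by rw [h]; exact hpW)⟩
  obtain ⟨_, ⟨x1, hx1, rfl⟩, hx1I⟩ := exists_lt_of_csInf_lt hne (show sInf _ < I + ε by linarith)
  have hx1W : x1 ∉ W := fun hw => by have := hW x1 hx1 hw; linarith
  obtain ⟨x2, hx2, hmin⟩ := hc.exists_isMinOn ⟨x1, hx1.1, hx1W⟩ (hf.mono hsub)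
  obtain ⟨y, hy, hlt⟩ := hno x2 (hsub hx2)
  by_cases hyW : y ∈ W
  · have a1 := hW y hy hyW
    have a2 := hmin (a := x1) ⟨hx1.1, hx1W⟩
    simp only [Set.mem_ofPred_eq] at a2
    linarith
  · have a2 := hmin (a := y) ⟨hy.1, hyW⟩
    simp only [Set.mem_ofPred_eq] at a2
    linarith

lemma hess_posSemidef_of_snd_nonneg {f : E n → ℝ} {x : E n} (hf : ContDiffAt ℝ ∞ f x)
    (h : ∀ v, 0 ≤ fderiv ℝ (fderiv ℝ f) x v v) : (Hess f x).PosSemidef := by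
  refine Matrix.PosSemidef.of_dotProduct_mulVec_nonneg ?_ fun v => ?_
  · rw [Matrix.IsHermitian, Matrix.conjTranspose_eq_transpose_of_trivial, hess_symm hf]
  · have := h (WithLp.toLp 2 v)
    rw [snd_eq_sum hf] at this
    refine this.trans_eq ?_
    simp only [dotProduct, Matrix.mulVec, Finset.mul_sum]
    exact Finset.sum_congr rfl fun i _ => Finset.sum_congr rfl fun j _ => by simp [Hess]; ring

lemma pd2_add_smul {f g : E n → ℝ} {x : E n} (hf : ContDiffAt ℝ ∞ f x) (hg : ContDiffAt ℝ ∞ g x)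
    (c : ℝ) (i j : Fin n) (hfe : ∀ᶠ y in nhds x, ContDiffAt ℝ ∞ f y)
    (hge : ∀ᶠ y in nhds x, ContDiffAt ℝ ∞ g y) :
    pd2 (fun y => f y + c * g y) x i j = pd2 f x i j + c * pd2 g x i j := by
  have h1 : (fun y => pd (fun y => f y + c * g y) y j)
      =ᶠ[nhds x] fun y => pd f y j + c * pd g y j := by
    filter_upwards [hfe, hge] with y h1 h2
    have hd := (h1.differentiableAt (by simp)).hasFDerivAt.add
      ((h2.differentiableAt (by simp)).hasFDerivAt.const_mul c)
    have hd' : HasFDerivAt (fun y => f y + c * g y) (fderiv ℝ f y + c • fderiv ℝ g y) y := hd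
    rw [pd, hd'.fderiv]; rfl
  rw [pd2_eq, pd_congr h1 i]
  have hd : HasFDerivAt (fun y => pd f y j + c * pd g y j)
      (fderiv ℝ (fun y => pd f y j) x + c • fderiv ℝ (fun y => pd g y j) x) x :=
    ((contDiffAt_pd hf j).differentiableAt (by simp)).hasFDerivAt.add
      (((contDiffAt_pd hg j).differentiableAt (by simp)).hasFDerivAt.const_mul c)
  rw [pd, hd.fderiv]; rfl

lemma Lu_eq_trace (u v : E n → ℝ) {x : E n} (hv : ContDiffAt ℝ ∞ v x) :
    Lu u v x = ((Hess u x).adjugate * Hess v x).trace := by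
  simp only [Lu, cofU, Matrix.trace, Matrix.diag, Matrix.mul_apply]
  refine Finset.sum_congr rfl fun i _ => Finset.sum_congr rfl fun j _ => ?_
  rw [pd2_symm hv]; rfl

lemma Setup.contact (h : Setup n α β Ω u) {G : Set (E n)} {w : E n → ℝ} (hw : Sol Ω u G w)
    {x v : E n} (hx : x ∈ G) {a : ℝ} (ha : 0 < a)
    (hm : IsLocalMin (fun y => w y + a * dd u v y) x) :
    gr u v = gr (fun y => u y + a⁻¹ * w y) x ∧ ((Hess u x).det = 0 ∨
      |(Hess (fun y => u y + a⁻¹ * w y) x).det| ≤ (Hess u x).det) := by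
  have hxΩ := hw.sub hx
  have hus := h.smooth x hxΩ
  have hws := hw.smooth x hx
  set ψ : E n → ℝ := fun y => u y + a⁻¹ * w y with hψ
  have hψs : ContDiffAt ℝ ∞ ψ x := hus.add (contDiffAt_const.mul hws)
  set L := fderiv ℝ u v with hL
  have hm2 : IsLocalMin (fun y => ψ y - L y) x := by
    filter_upwards [hm] with y hy
    have e : ∀ y, ψ y - L y = a⁻¹ * (w y + a * dd u v y) + (u v - L v) := by
      intro y; simp only [hψ, dd, map_sub]; field_simp; ring
    rw [e, e]
    have := mul_le_mul_of_nonneg_left hy (inv_pos.2 ha).le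
    linarith
  have hev : ∀ᶠ y in nhds x, ContDiffAt ℝ ∞ ψ y := by
    filter_upwards [hw.op.mem_nhds hx] with y hy
    exact (h.smooth y (hw.sub hy)).add (contDiffAt_const.mul (hw.smooth y hy))
  have hfd : ∀ᶠ y in nhds x, fderiv ℝ (fun y => ψ y - L y) y = fderiv ℝ ψ y - L := by
    filter_upwards [hev] with y hy
    exact ((hy.differentiableAt (by simp)).hasFDerivAt.sub L.hasFDerivAt).fderiv
  have h0 : fderiv ℝ ψ x = L := by
    have := hm2.fderiv_eq_zero
    rw [hfd.self_of_nhds] at this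
    exact sub_eq_zero.1 this
  have h2 : fderiv ℝ (fderiv ℝ (fun y => ψ y - L y)) x = fderiv ℝ (fderiv ℝ ψ) x := by
    rw [Filter.EventuallyEq.fderiv_eq hfd]
    exact fderiv_sub_const _
  have hpsd : (Hess ψ x).PosSemidef := hess_posSemidef_of_snd_nonneg hψs fun e => by
    have := snd_nonneg_of_isLocalMin (hψs.sub L.contDiff.contDiffAt) hm2 e
    rwa [h2] at this
  refine ⟨?_, ?_⟩
  · have : pd u v = pd ψ x := by
      funext i; rw [pd, pd, h0]
    rw [gr, gr, this]
  · by_cases hd : (Hess u x).det = 0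
    · exact Or.inl hd
    refine Or.inr ?_
    rw [abs_of_nonneg hpsd.det_nonneg]
    refine det_le_of_trace (h.hess_posDef hxΩ hd) hpsd ?_
    rw [← Lu_eq_trace u ψ hψs]
    have e1 : Lu u ψ x = Lu u u x + a⁻¹ * Lu u w x := by
      simp only [Lu, Finset.mul_sum, ← Finset.sum_add_distrib]
      refine Finset.sum_congr rfl fun i _ => Finset.sum_congr rfl fun j _ => ?_
      rw [pd2_add_smul hus hws a⁻¹ i j (h.eventually_smooth hxΩ)
        (by filter_upwards [hw.op.mem_nhds hx] with y hy; exact hw.smooth y hy)]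
      ring
    rw [e1, hw.eq x hx, Lu_eq_trace u u hus, Matrix.adjugate_mul]
    simp [Matrix.trace_smul, mul_comm]

/-- The slopes of the paraboloids touching a nonnegative solution at its pole form a null set. -/
lemma Setup.pole_slopes_null (h : Setup n α β Ω u) {D Q : Set (E n)} {w : E n → ℝ} {p : E n}
    (hD : IsOpen D) (hpD : p ∈ D) (hDQ : D ⊆ Q) (hw : Sol Ω u (D \ {p}) w) (hpΩ : D ⊆ Ω)
    (hw0 : ∀ x ∈ D \ {p}, 0 ≤ w x) {a k : ℝ} (ha : 0 < a)
    (hfr : ∀ ε > 0, ∃ᶠ x in nhdsWithin p {p}ᶜ, w x < k + ε) :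
    volume {q : E n | ∀ x ∈ Q \ {p}, k + a * (u p - u x + inner ℝ q (x - p)) ≤ w x} = 0 := by
  set N := {q : E n | ∀ x ∈ Q \ {p}, k + a * (u p - u x + inner ℝ q (x - p)) ≤ w x} with hN
  have hconv : Convex ℝ N := by
    intro q hq q' hq' s t hs ht hst x hx
    have h1 := mul_le_mul_of_nonneg_left (hq x hx) hs
    have h2 := mul_le_mul_of_nonneg_left (hq' x hx) ht
    rw [inner_add_left, real_inner_smul_left, real_inner_smul_left]
    have e : k + a * (u p - u x + (s * inner ℝ q (x - p) + t * inner ℝ q' (x - p)))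
        = s * (k + a * (u p - u x + inner ℝ q (x - p)))
          + t * (k + a * (u p - u x + inner ℝ q' (x - p))) := by
      have ht' : t = 1 - s := by linarith
      subst ht'; ring
    have e2 : w x = s * w x + t * w x := by rw [← add_mul, hst, one_mul]
    rw [e, e2]; exact add_le_add h1 h2
  suffices hintg : interior N = ∅ by
    refine measure_mono_null ?_ (Convex.addHaar_frontier volume hconv)
    rw [frontier, hintg, Set.sdiff_empty]; exact subset_closure
  rw [Set.eq_empty_iff_forall_notMem]
  intro q0 hq0
  obtain ⟨ρ, hρ, hball⟩ := Metric.isOpen_iff.1 isOpen_interior q0 hq0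
  set ℓ : E n →L[ℝ] ℝ := a • (innerSL ℝ q0 - fderiv ℝ u p) with hℓ
  have hd : HasFDerivAt u (fderiv ℝ u p) p :=
    ((h.smooth p (hpΩ hpD)).differentiableAt (by simp)).hasFDerivAt
  have hlo := (hasFDerivAt_iff_isLittleO.1 hd).def (show (0 : ℝ) < ρ / 4 by positivity)
  obtain ⟨s, hs, hsb⟩ := Metric.mem_nhds_iff.1 (Filter.inter_mem hlo (hD.mem_nhds hpD))
  have key : ∀ x ∈ Metric.ball p s \ {p}, k + ℓ (x - p) + a * (ρ / 4) * ‖x - p‖ ≤ w x := by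
    intro x hx
    have hxs := hsb hx.1
    have hxp : x - p ≠ 0 := sub_ne_zero.2 hx.2
    have hnp : 0 < ‖x - p‖ := norm_pos_iff.2 hxp
    have h1 := hxs.1
    simp only [Set.mem_ofPred_eq, Real.norm_eq_abs] at h1
    have h1' := (abs_le.1 h1).2
    have hq : q0 + (ρ / 2 / ‖x - p‖) • (x - p) ∈ N := by
      refine interior_subset (hball ?_)
      rw [Metric.mem_ball, dist_self_add_left, norm_smul, Real.norm_eq_abs,
        abs_of_pos (by positivity), div_mul_cancel₀ _ hnp.ne']
      linarith
    have h2 := hq x ⟨hDQ hxs.2, hx.2⟩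
    rw [inner_add_left, real_inner_smul_left, real_inner_self_eq_norm_sq] at h2
    have e : ρ / 2 / ‖x - p‖ * ‖x - p‖ ^ 2 = ρ / 2 * ‖x - p‖ := by field_simp
    rw [e] at h2
    have e2 : ℓ (x - p) = a * (inner ℝ q0 (x - p) - fderiv ℝ u p (x - p)) := by
      simp [hℓ, innerSL_apply_apply]
    rw [e2]
    refine le_trans ?_ h2
    have h3 := mul_le_mul_of_nonneg_left h1' ha.le
    linarith
  have hsub : Metric.ball p s ⊆ D := fun x hx => (hsb hx).2
  have hop : IsOpen (Metric.ball p s \ {p}) := Metric.isOpen_ball.sdiff isClosed_singleton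
  set δ := a * (ρ / 4) * (s / 2) with hδ
  have hδp : 0 < δ := by positivity
  have hb := (hw.mono hop (Set.sdiff_subset_sdiff_left hsub)).affine_sub (k + δ) ℓ p
  have hle := h.le_zero_of_compact Metric.isOpen_ball (hsub.trans hpΩ) (hpΩ hpD) hb
    (isCompact_closedBall p (s / 2)) (Metric.closedBall_subset_ball (by linarith))
    (M := k + δ + ‖ℓ‖ * s) (fun x hx => by
      have h1 := hw0 x ⟨hsub hx.1, hx.2⟩
      have h2 := (le_abs_self _).trans (ℓ.le_opNorm (x - p))
      have h3 : ‖x - p‖ ≤ s := by rw [← dist_eq_norm]; exact (Metric.mem_ball.1 hx.1).le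
      have h4 := mul_le_mul_of_nonneg_left h3 (norm_nonneg ℓ)
      linarith) (fun x hx hxK => by
      have h1 := key x hx
      have h2 : s / 2 < ‖x - p‖ := by rwa [Metric.mem_closedBall, not_le, dist_eq_norm] at hxK
      have h3 : a * (ρ / 4) * (s / 2) ≤ a * (ρ / 4) * ‖x - p‖ :=
        mul_le_mul_of_nonneg_left h2.le (by positivity)
      linarith)
  have hlc : ∀ᶠ x in nhds p, -(δ / 2) < ℓ (x - p) := by
    have : Filter.Tendsto (fun x => ℓ (x - p)) (nhds p) (nhds 0) := by
      have := (by fun_prop : Continuous fun x => ℓ (x - p)).tendsto p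
      simpa using this
    exact this.eventually (lt_mem_nhds (by linarith))
  obtain ⟨x, ⟨hx1, hx2⟩, hx3, hx4⟩ := ((hfr (δ / 2) (by linarith)).and_eventually
    ((Filter.Eventually.filter_mono nhdsWithin_le_nhds
      (hlc.and (Metric.isOpen_ball.mem_nhds (Metric.mem_ball_self hs)))).and
      self_mem_nhdsWithin)).exists.imp fun x hx => (⟨⟨hx.1, hx.2.1.1⟩, hx.2.1.2, hx.2.2⟩ :
        (w x < k + δ / 2 ∧ -(δ / 2) < ℓ (x - p)) ∧ x ∈ Metric.ball p s ∧ x ∈ ({p}ᶜ : Set (E n)))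
  have := hle x ⟨hx3, hx4⟩
  linarith

lemma measurableSet_inter_le {G : Set (E n)} (hG : IsOpen G) {f g : E n → ℝ}
    (hf : ContinuousOn f G) (hg : ContinuousOn g G) : MeasurableSet {x ∈ G | f x ≤ g x} := by
  have h1 : IsOpen (G ∩ (fun x => f x - g x) ⁻¹' Set.Ioi 0) :=
    (hf.sub hg).isOpen_inter_preimage hG isOpen_Ioi
  have : {x ∈ G | f x ≤ g x} = G \ (G ∩ (fun x => f x - g x) ⁻¹' Set.Ioi 0) := by
    ext x; simp only [Set.mem_ofPred_eq, Set.mem_sdiff, Set.mem_inter_iff, Set.mem_preimage,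
      Set.mem_Ioi, not_and, not_lt, sub_nonpos]
    exact ⟨fun hx => ⟨hx.1, fun _ => hx.2⟩, fun hx => ⟨hx.1, hx.2 hx.1⟩⟩
  rw [this]; exact hG.measurableSet.diff h1.measurableSet

/-- The measure of the contact gradients is controlled by the Monge-Ampère measure of the set where
the solution is small. -/
lemma Setup.contact_measure (h : Setup n α β Ω u) {G : Set (E n)} {w : E n → ℝ}
    (hw : Sol Ω u G w) (hG : CptIn G Ω) {a M : ℝ} :
    volume (gr (fun y => u y + a⁻¹ * w y) '' {x ∈ G | w x ≤ M ∧ ((Hess u x).det = 0 ∨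
      |(Hess (fun y => u y + a⁻¹ * w y) x).det| ≤ (Hess u x).det)}) ≤
      ENNReal.ofReal (maMeasure u {x ∈ G | w x ≤ M}) := by
  set ψ : E n → ℝ := fun y => u y + a⁻¹ * w y with hψ
  have hψs : ∀ x ∈ G, ContDiffAt ℝ ∞ ψ x := fun x hx =>
    (h.smooth x (hw.sub hx)).add (contDiffAt_const.mul (hw.smooth x hx))
  have hdu : ContinuousOn (fun x => (Hess u x).det) G := h.contOn_det.mono hw.sub
  have hdψ : ContinuousOn (fun x => (Hess ψ x).det) G := fun x hx =>
    (contDiffAt_det (hψs x hx)).continuousAt.continuousWithinAt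
  have mA : MeasurableSet {x ∈ G | w x ≤ M} :=
    measurableSet_inter_le hw.op hw.cont continuousOn_const
  have m1 : MeasurableSet {x ∈ G | (Hess u x).det ≤ 0} :=
    measurableSet_inter_le hw.op hdu continuousOn_const
  have m2 : MeasurableSet {x ∈ G | |(Hess ψ x).det| ≤ (Hess u x).det} :=
    measurableSet_inter_le hw.op hdψ.abs hdu
  set B := {x ∈ G | w x ≤ M} ∩ ({x ∈ G | (Hess u x).det ≤ 0} ∪
    {x ∈ G | |(Hess ψ x).det| ≤ (Hess u x).det}) with hB
  have mB : MeasurableSet B := mA.inter (m1.union m2)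
  have hAc : CptIn {x ∈ G | w x ≤ M} Ω := CptIn.mono hG fun x hx => hx.1
  have hBG : B ⊆ G := fun x hx => hx.1.1
  refine (measure_mono (Set.image_mono (t := B) fun x hx => ⟨⟨hx.1, hx.2.1⟩, ?_⟩)).trans ?_
  · exact hx.2.2.imp (fun h => ⟨hx.1, h.le⟩) fun h => ⟨hx.1, h⟩
  refine (volume_gr_image_le mB fun x hx => hψs x (hBG hx)).trans ?_
  have h1 : ∫⁻ x in B, ENNReal.ofReal |(Hess ψ x).det| ≤ ∫⁻ x in B, ENNReal.ofReal (Hess u x).det := by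
    refine lintegral_mono_ae ((ae_restrict_iff' mB).2 ?_)
    filter_upwards [h.ae_det_pos] with x hx hxB
    refine ENNReal.ofReal_le_ofReal ?_
    rcases hxB.2 with h2 | h2
    · exact absurd h2.2 (not_le.2 (hx (hw.sub (hBG hxB))))
    · exact h2.2
  refine h1.trans ?_
  rw [h.ofReal_ma mA hAc]
  exact lintegral_mono_set fun x hx => hx.1

lemma exists_crit_density (n : ℕ) (α β : ℝ) : ∃ K ≥ (4 : ℝ), ∃ K' ≥ (1 : ℝ), ∃ δ > (0 : ℝ),
    ∀ (Ω : Set (E n)) (u : E n → ℝ),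
    Setup n α β Ω u → ∀ y ∈ Ω, ∀ r > 0, CptIn (MASection Ω u y (K * r)) Ω →
    ∀ p ∈ Ω, ∀ w, Sol Ω u (MASection Ω u y (K * r) \ {p}) w →
    (∀ x ∈ MASection Ω u y (K * r) \ {p}, 0 ≤ w x) → ∀ lam > 0,
    ∀ z ∈ MASection Ω u y r \ {p}, w z ≤ lam →
      δ * maMeasure u (MASection Ω u y (K * r)) ≤
        maMeasure u {x ∈ MASection Ω u y (K * r) \ {p} | w x ≤ K' * lam} := by
  obtain ⟨C₁, hC₁, hen⟩ := exists_engulf n α β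
  obtain ⟨c, hc, hsep⟩ := exists_separation n α β (γ := 1 / 2) (by norm_num) (by norm_num)
  set K := max 4 (2 * (2 + C₁) / c) with hKdef
  have hK4 : 4 ≤ K := le_max_left _ _
  have hKc : 2 + C₁ ≤ c * (K / 2) := by
    have : 2 * (2 + C₁) / c ≤ K := le_max_right _ _
    rw [div_le_iff₀ hc] at this
    linarith
  obtain ⟨C, hC, hcmp⟩ := exists_ma_compare n α β K
  refine ⟨K, hK4, 1 + C₁, by linarith, C⁻¹, by positivity, ?_⟩
  intro Ω u h y hy r hr hcpt p hp w hw hw0 lam hlam z hz hwz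
  set S := MASection Ω u y (K * r) with hS
  have hKr : 0 < K * r := by positivity
  have hr4 : 4 * r ≤ K * r := mul_le_mul_of_nonneg_right hK4 hr.le
  have hSo : IsOpen S := h.sec_open hcpt
  have hc1 : CptIn (MASection Ω u y r) Ω := CptIn.mono hcpt (sec_mono (by linarith))
  have hc2 : CptIn (MASection Ω u y (2 * r)) Ω := CptIn.mono hcpt (sec_mono (by linarith))
  have mA : MeasurableSet {x ∈ S \ {p} | w x ≤ (1 + C₁) * lam} :=
    measurableSet_inter_le hw.op hw.cont continuousOn_const
  have hAc : CptIn {x ∈ S \ {p} | w x ≤ (1 + C₁) * lam} Ω := CptIn.mono hcpt fun x hx => hx.1.1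
  suffices hmain : maMeasure u (MASection Ω u y r) ≤
      maMeasure u {x ∈ S \ {p} | w x ≤ (1 + C₁) * lam} by
    have h1 := hcmp Ω u h y hy y hy r hr (K * r) hKr le_rfl hcpt (sec_mono (by linarith))
    rw [inv_mul_le_iff₀ (by linarith)]
    exact h1.trans (mul_le_mul_of_nonneg_left hmain (by linarith))
  set a := lam / r with ha
  have ha0 : 0 < a := by positivity
  have har : a * r = lam := div_mul_cancel₀ _ hr.ne'
  set R := K * r / 2 with hR
  have hR0 : 0 < R := by positivity
  set Q := {x ∈ closure Ω | dd u y x ≤ R} with hQ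
  have hQS : Q ⊆ S := fun x hx => mem_section.2 ⟨hx.1, by have := hx.2; simp only [hR] at this; linarith⟩
  have hSΩ : S ⊆ Ω := subset_closure.trans hcpt.2
  have hQc : IsCompact Q := by
    have : Q = closure (MASection Ω u y R) := by
      ext x; exact ⟨fun hx => h.mem_closure_sec_of_le hy hR0 hx.1 hx.2, h.dd_le_of_mem_closure⟩
    rw [this]; exact h.sec_closure_compact y R
  set D := MASection Ω u y R with hD
  have hDc : CptIn D Ω := CptIn.mono hcpt (sec_mono (by simp only [hR]; linarith))
  have hDo : IsOpen D := h.sec_open hDc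
  have hDQ : D ⊆ Q := fun x hx => ⟨hx.1, (mem_section.1 hx).2.le⟩
  have hbig : ∀ v ∈ MASection Ω u y r, ∀ x ∈ closure Ω, R ≤ dd u y x → (2 + C₁) * lam ≤ a * dd u v x := by
    intro v hv x hx hxR
    have hv' := mem_section.1 hv
    have h1 := hsep Ω u h y hy R hR0 (CptIn.mono hcpt (sec_mono (by simp only [hR]; linarith))) v hv'.1
      (by simp only [hR]; linarith) x hx hxR
    have h2 : a * (c * R) = c * (K / 2) * lam := by rw [← har]; simp only [hR]; ring
    have h3 := mul_le_mul_of_nonneg_left h1 ha0.le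
    have h4 := mul_le_mul_of_nonneg_right hKc hlam.le
    linarith
  have hz' := mem_section.1 hz.1
  have hzQ : z ∈ Q \ {p} := ⟨⟨hz'.1, by simp only [hR]; linarith⟩, hz.2⟩
  have hsmall : ∀ v ∈ MASection Ω u y r, w z + a * dd u v z ≤ (1 + C₁) * lam := by
    intro v hv
    have hv' := mem_section.1 hv
    have h1 := hen Ω u h y hy r hr hc2 v hv'.1 hv'.2.le z hz'.1 (by linarith)
    have h2 := mul_le_mul_of_nonneg_left h1 ha0.le
    have h3 : a * (C₁ * r) = C₁ * lam := by rw [← har]; ring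
    linarith
  have hwQ : ContinuousOn w (Q \ {p}) := hw.cont.mono (Set.sdiff_subset_sdiff_left hQS)
  have hvΩ : ∀ v ∈ MASection Ω u y r, v ∈ Ω := fun v hv => hc1.2 (subset_closure hv)
  set ψ : E n → ℝ := fun y => u y + a⁻¹ * w y with hψ
  set B := {x ∈ S \ {p} | w x ≤ (1 + C₁) * lam ∧ ((Hess u x).det = 0 ∨
      |(Hess ψ x).det| ≤ (Hess u x).det)} with hB
  have hddp : ∀ v ∈ Ω, ∀ x ∈ Q, 0 ≤ a * dd u v x := fun v hv x hx =>
    mul_nonneg ha0.le (h.dd_nonneg hv hx.1)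
  have halt : ∀ v ∈ MASection Ω u y r, gr u v ∈ gr ψ '' B ∨
      (p ∈ D ∧ ∃ I, (∀ x ∈ Q \ {p}, I ≤ w x + a * dd u v x) ∧
        ∀ ε > 0, ∃ᶠ x in nhdsWithin p {p}ᶜ, x ∈ Q ∧ w x + a * dd u v x < I + ε) := by
    intro v hv
    have hfc : ContinuousOn (fun x => w x + a * dd u v x) (Q \ {p}) :=
      hwQ.add (continuousOn_const.mul ((h.dd_cont v).mono fun x hx => hx.1.1))
    have hf0 : ∀ x ∈ Q \ {p}, 0 ≤ w x + a * dd u v x := fun x hx =>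
      add_nonneg (hw0 x ⟨hQS hx.1, hx.2⟩) (hddp v (hvΩ v hv) x hx.1)
    rcases attain hQc hfc hf0 hzQ with ⟨x, hx, hmin⟩ | ⟨hpQ, I, hI, hfr⟩
    · left
      have hfx : w x + a * dd u v x ≤ (1 + C₁) * lam := (hmin z hzQ).trans (hsmall v hv)
      have hwx0 := hw0 x ⟨hQS hx.1, hx.2⟩
      have hxD : x ∈ D := by
        refine mem_section.2 ⟨hx.1.1, ?_⟩
        by_contra! hcon
        have := hbig v hv x hx.1.1 hcon
        linarith
      have hxS : x ∈ S \ {p} := ⟨hQS hx.1, hx.2⟩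
      have hmin' : IsLocalMin (fun y => w y + a * dd u v y) x := by
        filter_upwards [(hDo.sdiff isClosed_singleton : IsOpen (D \ {p})).mem_nhds ⟨hxD, hx.2⟩]
          with y' hy'
        exact hmin y' ⟨hDQ hy'.1, hy'.2⟩
      obtain ⟨e1, e2⟩ := h.contact hw hxS ha0 hmin'
      exact ⟨x, ⟨hxS, by linarith [hddp v (hvΩ v hv) x hx.1], e2⟩, e1.symm⟩
    · right
      refine ⟨mem_section.2 ⟨hpQ.1, ?_⟩, I, hI, hfr⟩
      by_contra! hcon
      have h1 := hbig v hv p hpQ.1 hcon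
      have h2 : I ≤ (1 + C₁) * lam := (hI z hzQ).trans (hsmall v hv)
      have hev : ∀ᶠ x in nhds p, (2 + C₁) * lam - lam / 2 < a * dd u v x := by
        have : ContinuousAt (fun x => a * dd u v x) p :=
          continuousAt_const.mul (h.contDiffAt_dd v hp).continuousAt
        exact this.eventually (lt_mem_nhds (by linarith))
      obtain ⟨x, ⟨hxQ, hx1⟩, hx2, hxp⟩ := ((hfr (lam / 2) (by linarith)).and_eventually
        ((Filter.Eventually.filter_mono nhdsWithin_le_nhds hev).and self_mem_nhdsWithin)).exists
      have := hw0 x ⟨hQS hxQ, hxp⟩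
      linarith
  have hBm := h.contact_measure hw (CptIn.mono hcpt Set.sdiff_subset) (a := a) (M := (1 + C₁) * lam)
  have hvol : volume (gr u '' MASection Ω u y r) ≤ volume (gr ψ '' B) := by
    by_cases hpole : ∃ v ∈ MASection Ω u y r, (p ∈ D ∧ ∃ I, (∀ x ∈ Q \ {p}, I ≤ w x + a * dd u v x) ∧
        ∀ ε > 0, ∃ᶠ x in nhdsWithin p {p}ᶜ, x ∈ Q ∧ w x + a * dd u v x < I + ε)
    · obtain ⟨v0, hv0, hpD, I0, hI0, hfr0⟩ := hpole
      set k := I0 - a * dd u v0 p with hk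
      have hcdd : ∀ v, ContinuousAt (fun x => a * dd u v x) p := fun v =>
          continuousAt_const.mul (h.contDiffAt_dd v hp).continuousAt
      have hfrk : ∀ ε > 0, ∃ᶠ x in nhdsWithin p {p}ᶜ, w x < k + ε := by
        intro ε hε
        have hev : ∀ᶠ x in nhds p, a * dd u v0 p - ε / 2 < a * dd u v0 x :=
          (hcdd v0).eventually (lt_mem_nhds (by linarith))
        refine ((hfr0 (ε / 2) (by linarith)).and_eventually
          (Filter.Eventually.filter_mono nhdsWithin_le_nhds hev)).mono fun x hx => ?_
        have h1 := hx.1.2; have h2 := hx.2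
        linarith
      have hnull := h.pole_slopes_null hDo hpD hDQ
        (hw.mono (hDo.sdiff isClosed_singleton) (Set.sdiff_subset_sdiff_left (hDQ.trans hQS)))
        ((hDQ.trans hQS).trans hSΩ)
        (fun x hx => hw0 x ⟨hQS (hDQ hx.1), hx.2⟩) ha0 hfrk
      have hsub : gr u '' MASection Ω u y r ⊆ gr ψ '' B ∪
          {q : E n | ∀ x ∈ Q \ {p}, k + a * (u p - u x + inner ℝ q (x - p)) ≤ w x} := by
        rintro _ ⟨v, hv, rfl⟩
        refine (halt v hv).imp id ?_
        rintro ⟨-, I, hI, hfr⟩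
        have hkI : k + a * dd u v p ≤ I := by
          by_contra! hcon
          set ε := (k + a * dd u v p - I) / 4 with hε
          have hε0 : 0 < ε := by simp only [hε]; linarith
          have e1 : ∀ᶠ x in nhds p, a * dd u v p - ε < a * dd u v x :=
            (hcdd v).eventually (lt_mem_nhds (by linarith))
          have e2 : ∀ᶠ x in nhds p, a * dd u v0 x < a * dd u v0 p + ε :=
            (hcdd v0).eventually (gt_mem_nhds (by linarith))
          obtain ⟨x, ⟨hxQ, hx1⟩, ⟨hx2, hx3⟩, hxp⟩ := ((hfr ε hε0).and_eventually
            ((Filter.Eventually.filter_mono nhdsWithin_le_nhds (e1.and e2)).and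
              self_mem_nhdsWithin)).exists
          have := hI0 x ⟨hxQ, hxp⟩
          linarith
        intro x hx
        have h1 := hI x hx
        rw [inner_gr]
        have e : a * (u p - u x + fderiv ℝ u v (x - p)) = a * dd u v p - a * dd u v x := by
          simp only [dd, map_sub]; ring
        rw [e]; linarith
      refine (measure_mono hsub).trans ((measure_union_le _ _).trans ?_)
      rw [hnull, add_zero]
    · refine measure_mono ?_
      rintro _ ⟨v, hv, rfl⟩
      exact (halt v hv).resolve_right fun hcon => hpole ⟨v, hv, hcon⟩
  rw [h.volume_gr_image (h.sec_open hc1).measurableSet hc1] at hvol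
  have := hvol.trans hBm
  rwa [ENNReal.ofReal_le_ofReal_iff] at this
  exact h.ma_nonneg mA fun x hx => hSΩ hx.1.1

open scoped ENNReal

lemma lintegral_affine_le {k : E n → ℝ≥0∞} (hk : Measurable k) {r : ℝ} (hr : 1 / 2 ≤ r) (c : E n) :
    ∫⁻ a, k (r • a + c) ≤ 2 ^ n * ∫⁻ q, k q := by
  have hr0 : r ≠ 0 := by linarith
  have h1 : ∫⁻ a, k (r • a + c) = ∫⁻ q, k (q + c) ∂(Measure.map (r • ·) (volume : Measure (E n))) := by
    exact (lintegral_map (f := fun q => k (q + c)) (hk.comp (measurable_id.add_const c))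
      (measurable_const_smul r)).symm
  rw [h1, Measure.map_addHaar_smul _ hr0, lintegral_smul_measure,
    lintegral_add_right_eq_self (fun q => k q), smul_eq_mul]
  gcongr
  rw [finrank_euclideanSpace_fin]
  have h2 : |(r ^ n)⁻¹| ≤ 2 ^ n := by
    rw [abs_of_nonneg (by positivity), ← inv_pow]
    refine pow_le_pow_left₀ (by positivity) ?_ n
    rw [inv_le_comm₀ (by linarith) (by norm_num)]
    linarith
  calc ENNReal.ofReal |(r ^ n)⁻¹| ≤ ENNReal.ofReal (2 ^ n) := ENNReal.ofReal_le_ofReal h2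
    _ = 2 ^ n := by rw [ENNReal.ofReal_pow (by norm_num)]; simp

lemma lintegral_segment_le {k : E n → ℝ≥0∞} (hk : Measurable k) (A B : Set (E n)) {s : ℝ}
    (_hs0 : 0 ≤ s) (_hs1 : s ≤ 1) :
    ∫⁻ a in A, ∫⁻ b in B, k ((1 - s) • a + s • b) ≤
      2 ^ n * (volume A + volume B) * ∫⁻ q, k q := by
  have hm : Measurable fun z : E n × E n => k ((1 - s) • z.1 + s • z.2) := by
    refine hk.comp ?_
    fun_prop
  rcases le_total s (1 / 2) with h | h
  · have e : ∫⁻ a in A, ∫⁻ b in B, k ((1 - s) • a + s • b)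
        = ∫⁻ b in B, ∫⁻ a in A, k ((1 - s) • a + s • b) :=
      lintegral_lintegral_swap hm.aemeasurable
    rw [e]
    calc ∫⁻ b in B, ∫⁻ a in A, k ((1 - s) • a + s • b)
        ≤ ∫⁻ _ in B, 2 ^ n * ∫⁻ q, k q := lintegral_mono fun b =>
          (setLIntegral_le_lintegral _ _).trans (lintegral_affine_le hk (by linarith) _)
      _ = 2 ^ n * volume B * ∫⁻ q, k q := by rw [setLIntegral_const]; ring
      _ ≤ _ := by gcongr; exact le_add_self
  · calc ∫⁻ a in A, ∫⁻ b in B, k ((1 - s) • a + s • b)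
        ≤ ∫⁻ _ in A, 2 ^ n * ∫⁻ q, k q := lintegral_mono fun a =>
          (setLIntegral_le_lintegral _ _).trans (by
            simp_rw [add_comm ((1 - s) • a)]; exact lintegral_affine_le hk h _)
      _ = 2 ^ n * volume A * ∫⁻ q, k q := by rw [setLIntegral_const]; ring
      _ ≤ _ := by gcongr; exact le_self_add

/-- A Poincaré type inequality for two sets joined by segments. -/
lemma volume_mul_volume_le {T A B : Set (E n)} (hT : IsOpen T) {F : E n → ℝ}
    (hF : ∀ q ∈ T, ContDiffAt ℝ ∞ F q) (hA : MeasurableSet A) (hB : MeasurableSet B)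
    (hseg : ∀ a ∈ A, ∀ b ∈ B, ∀ s ∈ Set.Icc (0 : ℝ) 1, (1 - s) • a + s • b ∈ T)
    (hFA : ∀ a ∈ A, F a ≤ 0) (hFB : ∀ b ∈ B, 1 ≤ F b) {e : Fin n → E n} {Λ : ℝ}
    (he : ∀ a ∈ A, ∀ b ∈ B, ∃ c : Fin n → ℝ, (∀ i, |c i| ≤ Λ) ∧ b - a = ∑ i, c i • e i) :
    volume A * volume B ≤ ENNReal.ofReal Λ * (2 ^ n * (volume A + volume B)) *
      ∑ i, ∫⁻ q in T, ‖fderiv ℝ F q (e i)‖ₑ := by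
  set k : E n → ℝ≥0∞ := T.indicator fun q => ∑ i, ‖fderiv ℝ F q (e i)‖ₑ with hk
  have hfc : ∀ q ∈ T, ContDiffAt ℝ ∞ (fderiv ℝ F) q := fun q hq =>
    (hF q hq).fderiv_right (m := ∞) (by simp)
  have hmeas : ∀ i, Measurable (fun q => ‖fderiv ℝ F q (e i)‖ₑ) := fun i =>
    (measurable_fderiv_apply_const ℝ F (e i)).enorm
  have hkm : Measurable k :=
    (Finset.measurable_fun_sum _ fun i _ => hmeas i).indicator hT.measurableSet
  have hkint : ∫⁻ q, k q = ∑ i, ∫⁻ q in T, ‖fderiv ℝ F q (e i)‖ₑ := by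
    rw [hk, lintegral_indicator hT.measurableSet, lintegral_finsetSum _ fun i _ => hmeas i]
  have hpt : ∀ a ∈ A, ∀ b ∈ B, (1 : ℝ≥0∞) ≤
      ∫⁻ s in Set.Icc (0 : ℝ) 1, ENNReal.ofReal Λ * k ((1 - s) • a + s • b) := by
    intro a ha b hb
    have hl : ∀ s : ℝ, HasDerivAt (fun s : ℝ => (1 - s) • a + s • b) (b - a) s := fun s => by
      have := (((hasDerivAt_id s).const_sub 1).smul_const a).add ((hasDerivAt_id s).smul_const b)
      simp only [neg_smul, one_smul] at this
      rw [sub_eq_neg_add]; exact this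
    have hlc : ContDiff ℝ 1 (fun s : ℝ => (1 - s) • a + s • b) := by fun_prop
    have hc : ContDiffOn ℝ 1 (fun s : ℝ => F ((1 - s) • a + s • b)) (Set.Icc 0 1) := fun s hs =>
      (((hF _ (hseg a ha b hb s hs)).of_le (by exact WithTop.coe_le_coe.2 le_top)).comp s
        hlc.contDiffAt).contDiffWithinAt
    have h1 := enorm_sub_le_lintegral_deriv_of_contDiffOn_Icc hc zero_le_one
    have h2 : (1 : ℝ≥0∞) ≤ ‖F ((1 - (1 : ℝ)) • a + (1 : ℝ) • b) - F ((1 - (0 : ℝ)) • a + (0 : ℝ) • b)‖ₑ := by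
      rw [← ofReal_norm, ← ENNReal.ofReal_one]
      refine ENNReal.ofReal_le_ofReal ?_
      simp only [sub_self, zero_smul, one_smul, zero_add, sub_zero, add_zero]
      have := hFA a ha; have := hFB b hb
      rw [Real.norm_eq_abs]
      exact le_trans (by linarith) (le_abs_self _)
    refine h2.trans (h1.trans (setLIntegral_mono' measurableSet_Icc fun s hs => ?_))
    have hq := hseg a ha b hb s hs
    have hd : deriv (fun s : ℝ => F ((1 - s) • a + s • b)) s
        = fderiv ℝ F ((1 - s) • a + s • b) (b - a) :=
      (((hF _ hq).differentiableAt (by simp)).hasFDerivAt.comp_hasDerivAt s (hl s)).deriv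
    rw [hd]
    obtain ⟨c, hc, hbe⟩ := he a ha b hb
    rw [hbe, map_sum, hk, Set.indicator_of_mem hq, Finset.mul_sum]
    refine (enorm_sum_le _ _).trans (Finset.sum_le_sum fun i _ => ?_)
    rw [map_smul, enorm_smul]
    gcongr
    rw [← ofReal_norm]
    exact ENNReal.ofReal_le_ofReal (by rw [Real.norm_eq_abs]; exact hc i)
  have hjm : Measurable fun z : (E n × E n) × ℝ =>
      ENNReal.ofReal Λ * k ((1 - z.2) • z.1.1 + z.2 • z.1.2) := by
    refine (hkm.comp ?_).const_mul _
    fun_prop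
  calc volume A * volume B = ∫⁻ z in A ×ˢ B, 1 ∂((volume : Measure (E n)).prod volume) := by
        rw [setLIntegral_const, one_mul, Measure.prod_prod]
    _ ≤ ∫⁻ z in A ×ˢ B, (∫⁻ s in Set.Icc (0 : ℝ) 1, ENNReal.ofReal Λ *
          k ((1 - s) • z.1 + s • z.2)) ∂((volume : Measure (E n)).prod volume) :=
        setLIntegral_mono' (hA.prod hB) fun z hz => hpt z.1 hz.1 z.2 hz.2
    _ = ∫⁻ s in Set.Icc (0 : ℝ) 1, ∫⁻ z in A ×ˢ B, ENNReal.ofReal Λ *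
          k ((1 - s) • z.1 + s • z.2) ∂((volume : Measure (E n)).prod volume) :=
        lintegral_lintegral_swap hjm.aemeasurable
    _ ≤ ∫⁻ s in Set.Icc (0 : ℝ) 1, ENNReal.ofReal Λ *
          (2 ^ n * (volume A + volume B) * ∫⁻ q, k q) := by
        refine setLIntegral_mono' measurableSet_Icc fun s hs => ?_
        have hm : Measurable fun z : E n × E n => k ((1 - s) • z.1 + s • z.2) := by
          refine hkm.comp ?_
          fun_prop
        rw [lintegral_const_mul _ hm, ← Measure.prod_restrict, lintegral_prod _ hm.aemeasurable]
        gcongr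
        exact lintegral_segment_le hkm A B hs.1 hs.2
    _ = _ := by
        rw [setLIntegral_const, Real.volume_Icc, hkint]
        simp [mul_assoc]

lemma deriv_smoothTransition_nonneg (x : ℝ) : 0 ≤ deriv Real.smoothTransition x :=
  Real.smoothTransition.monotone.deriv_nonneg

lemma deriv_smoothTransition_of_neg {x : ℝ} (hx : x < 0) : deriv Real.smoothTransition x = 0 := by
  have : Real.smoothTransition =ᶠ[nhds x] fun _ => 0 := by
    filter_upwards [Iio_mem_nhds hx] with y hy
    exact Real.smoothTransition.zero_of_nonpos (le_of_lt hy)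
  rw [this.deriv_eq]; simp

lemma deriv_smoothTransition_of_one_lt {x : ℝ} (hx : 1 < x) :
    deriv Real.smoothTransition x = 0 := by
  have : Real.smoothTransition =ᶠ[nhds x] fun _ => 1 := by
    filter_upwards [Ioi_mem_nhds hx] with y hy
    exact Real.smoothTransition.one_of_one_le (le_of_lt hy)
  rw [this.deriv_eq]; simp

lemma exists_deriv_smoothTransition_le :
    ∃ C > (0 : ℝ), ∀ x, deriv Real.smoothTransition x ≤ C := by
  have hc : Continuous (deriv Real.smoothTransition) :=
    (Real.smoothTransition.contDiff (n := 1)).continuous_deriv (by simp)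
  obtain ⟨C, hC⟩ := (isCompact_Icc (a := (0 : ℝ)) (b := 1)).bddAbove_image hc.continuousOn
  refine ⟨max C 1, by positivity, fun x => ?_⟩
  rcases lt_or_ge x 0 with h | h
  · rw [deriv_smoothTransition_of_neg h]; positivity
  rcases lt_or_ge 1 x with h' | h'
  · rw [deriv_smoothTransition_of_one_lt h']; positivity
  · exact (hC ⟨x, ⟨h, h'⟩, rfl⟩).trans (le_max_left _ _)

lemma Setup.Lu_dd (h : Setup n α β Ω u) (y : E n) {x : E n} (hx : x ∈ Ω) :
    Lu u (dd u y) x = n * (Hess u x).det := by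
  rw [Lu_eq_trace u _ (h.contDiffAt_dd y hx)]
  have : Hess (dd u y) x = Hess u x := by
    ext i j
    change pd2 (dd u y) x i j = pd2 u x i j
    rw [pd2_eq, pd2_eq]
    have h1 : (fun z => pd (dd u y) z j) =ᶠ[nhds x] fun z => pd u z j - fderiv ℝ u y (ev j) := by
      filter_upwards [h.op.mem_nhds hx] with z hz
      rw [pd, (h.hasFDerivAt_dd y hz).fderiv]; rfl
    rw [pd_congr h1, pd, pd]
    rw [fderiv_sub_const]
  rw [this, Matrix.adjugate_mul]
  simp [Matrix.trace_smul, mul_comm]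

lemma integral_eq_setIntegral {F : E n → ℝ} {G : Set (E n)} (hF : ∀ x ∉ G, F x = 0) :
    ∫ x, F x = ∫ x in G, F x := (setIntegral_eq_integral_of_forall_compl_eq_zero hF).symm

/-- Cutoff functions adapted to sections, with energy controlled by the measure. -/
theorem exists_sec_cutoff (n : ℕ) (α β : ℝ) : ∃ C > (0 : ℝ), ∀ (Ω : Set (E n)) (u : E n → ℝ),
    Setup n α β Ω u → ∀ y ∈ Ω, ∀ s > 0, CptIn (MASection Ω u y s) Ω →
    ∃ ζ : E n → ℝ, ContDiff ℝ ∞ ζ ∧ HasCompactSupport ζ ∧ tsupport ζ ⊆ MASection Ω u y s ∧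
      (∀ x, 0 ≤ ζ x ∧ ζ x ≤ 1) ∧ (∀ x ∈ MASection Ω u y (s / 2), ζ x = 1) ∧
      ∫ x, UB u x (pd ζ x) (pd ζ x) ≤ C * maMeasure u (MASection Ω u y s) / s := by
  obtain ⟨C, hC0, hC⟩ := exists_deriv_smoothTransition_le
  refine ⟨4 * C * n + 1, by positivity, fun Ω u h y hy s hs hc => ?_⟩
  set Z : ℝ → ℝ := fun τ => Real.smoothTransition (3 - 4 / s * τ) with hZ
  have hZd : ContDiff ℝ ∞ Z :=
    Real.smoothTransition.contDiff.comp (contDiff_const.sub (contDiff_const.mul contDiff_id))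
  have hZ' : ∀ τ, deriv Z τ = -(4 / s) * deriv Real.smoothTransition (3 - 4 / s * τ) := by
    intro τ
    have h1 : HasDerivAt (fun τ : ℝ => 3 - 4 / s * τ) (-(4 / s)) τ := by
      simpa using ((hasDerivAt_id τ).const_mul (4 / s)).const_sub 3
    have h2 := (Real.smoothTransition.contDiff (n := 1)).differentiable (by simp)
      (3 - 4 / s * τ)
    have := h2.hasDerivAt.comp τ h1
    rw [mul_comm]; exact this.deriv
  set S := MASection Ω u y s with hS
  have hSo : IsOpen S := h.sec_open hc
  have hSΩ : S ⊆ Ω := subset_closure.trans hc.2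
  set ζ : E n → ℝ := S.indicator fun x => Z (dd u y x) with hζ
  set K := closure (MASection Ω u y (3 / 4 * s)) with hK
  have hKc : IsCompact K := h.sec_closure_compact _ _
  have hKS : K ⊆ S := fun x hx => by
    obtain ⟨h1, h2⟩ := h.dd_le_of_mem_closure hx
    exact mem_section.2 ⟨h1, by linarith⟩
  have hζ0 : ∀ x ∉ K, ζ x = 0 := by
    intro x hx
    by_cases hxS : x ∈ S
    · rw [hζ, Set.indicator_of_mem hxS]
      refine Real.smoothTransition.zero_of_nonpos ?_
      have : 3 / 4 * s ≤ dd u y x := by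
        by_contra! hlt
        exact hx (subset_closure (mem_section.2 ⟨(mem_section.1 hxS).1, hlt⟩))
      have h2 : 4 / s * (3 / 4 * s) ≤ 4 / s * dd u y x := by gcongr
      have h3 : 4 / s * (3 / 4 * s) = 3 := by field_simp
      linarith
    · rw [hζ, Set.indicator_of_notMem hxS]
  have hζS : ∀ x ∈ S, ζ =ᶠ[nhds x] fun x => Z (dd u y x) := by
    intro x hx
    filter_upwards [hSo.mem_nhds hx] with z hz
    exact Set.indicator_of_mem hz _
  have hζc : HasCompactSupport ζ := HasCompactSupport.intro hKc hζ0
  have hζt : tsupport ζ ⊆ K := closure_minimal (fun x hx => by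
    by_contra hk; exact hx (hζ0 x hk)) hKc.isClosed
  have hζs : ContDiff ℝ ∞ ζ := by
    rw [contDiff_iff_contDiffAt]
    intro x
    by_cases hx : x ∈ S
    · exact (hZd.contDiffAt.comp x (h.contDiffAt_dd y (hSΩ hx))).congr_of_eventuallyEq (hζS x hx)
    · have : ζ =ᶠ[nhds x] fun _ => 0 := by
        filter_upwards [hKc.isClosed.isOpen_compl.mem_nhds (fun hk => hx (hKS hk))] with z hz
        exact hζ0 z hz
      exact contDiffAt_const.congr_of_eventuallyEq this
  have hζ01 : ∀ x, 0 ≤ ζ x ∧ ζ x ≤ 1 := by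
    intro x
    by_cases hx : x ∈ S
    · rw [hζ, Set.indicator_of_mem hx]
      exact ⟨Real.smoothTransition.nonneg _, Real.smoothTransition.le_one _⟩
    · rw [hζ, Set.indicator_of_notMem hx]; simp
  have hpdS : ∀ x ∈ S, pd ζ x = deriv Z (dd u y x) • pd (dd u y) x := by
    intro x hx
    ext i
    rw [pd_congr (hζS x hx), pd_comp (hZd.contDiffAt.differentiableAt (by simp))
      ((h.contDiffAt_dd y (hSΩ hx)).differentiableAt (by simp))]
    rfl
  obtain ⟨L, hL⟩ := hζs.lipschitzWith_of_hasCompactSupport hζc (by simp)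
  have hdd : ∀ x ∈ S, ContDiffAt ℝ ∞ (dd u y) x := fun x hx => h.contDiffAt_dd y (hSΩ hx)
  have hintg := integral_mul_Lu hSo (fun x hx => h.smooth x (hSΩ hx))
    (fun x hx => h.piola (hSΩ hx)) hL hζc (hζt.trans hKS) hdd
  have hI1 := integrable_UB hSo (fun x hx => h.smooth x (hSΩ hx)) hL hζc (hζt.trans hKS) hdd
  have hI2 := h.integrable_energy hζs hζc (hζt.trans (hKS.trans hSΩ))
  have hpt : ∀ x, UB u x (pd ζ x) (pd ζ x) ≤ -(4 * C / s) * UB u x (pd ζ x) (pd (dd u y) x) := by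
    intro x
    by_cases hx : x ∈ S
    · rw [hpdS x hx, UB_smul_left, UB_smul_left, UB_smul_right, hZ']
      have hU := h.UB_nonneg (hSΩ hx) (pd (dd u y) x)
      have hd0 := deriv_smoothTransition_nonneg (3 - 4 / s * dd u y x)
      have hd1 := hC (3 - 4 / s * dd u y x)
      set A := UB u x (pd (dd u y) x) (pd (dd u y) x)
      set D := deriv Real.smoothTransition (3 - 4 / s * dd u y x)
      have e1 : -(4 / s) * D * (-(4 / s) * D * A) = (4 / s) ^ 2 * (D * A) * D := by ring
      have e2 : -(4 * C / s) * (-(4 / s) * D * A) = (4 / s) ^ 2 * (D * A) * C := by ring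
      rw [e1, e2]
      gcongr
    · have h0 : pd ζ x = 0 := by
        ext i
        exact pd_eq_zero_of_notMem_tsupport (fun ht => hx (hKS (hζt ht))) i
      rw [h0, UB_zero_left, UB_zero_left]; simp
  refine ⟨ζ, hζs, hζc, hζt.trans hKS, hζ01, fun x hx => ?_, ?_⟩
  · have hxS : x ∈ S := sec_mono (by linarith) hx
    rw [hζ, Set.indicator_of_mem hxS]
    refine Real.smoothTransition.one_of_one_le ?_
    have h1 : 4 / s * dd u y x ≤ 4 / s * (s / 2) := by
      have := (mem_section.1 hx).2.le
      gcongr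
    have h3 : 4 / s * (s / 2) = 2 := by field_simp; norm_num
    linarith
  · have hm0 := h.ma_nonneg hSo.measurableSet hSΩ
    have hdet : ∫ x, ζ x * Lu u (dd u y) x ≤ n * maMeasure u S := by
      rw [integral_eq_setIntegral (G := S) (fun x hx => by
        rw [hζ, Set.indicator_of_notMem hx, zero_mul]), maMeasure, ← integral_const_mul]
      have hi := (h.integrableOn_det hc).const_mul (n : ℝ)
      have hb : ∀ x ∈ S, ζ x * Lu u (dd u y) x ≤ n * (Hess u x).det := by
        intro x hx
        rw [h.Lu_dd y (hSΩ hx)]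
        have := h.det_nonneg (hSΩ hx)
        exact mul_le_of_le_one_left (by positivity) (hζ01 x).2
      refine integral_mono_of_nonneg ?_ hi ?_
      · filter_upwards [ae_restrict_mem hSo.measurableSet] with x hx
        rw [h.Lu_dd y (hSΩ hx)]
        have := h.det_nonneg (hSΩ hx)
        exact mul_nonneg (hζ01 x).1 (by positivity)
      · filter_upwards [ae_restrict_mem hSo.measurableSet] with x hx
        exact hb x hx
    calc ∫ x, UB u x (pd ζ x) (pd ζ x)
        ≤ ∫ x, -(4 * C / s) * UB u x (pd ζ x) (pd (dd u y) x) :=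
          integral_mono hI2 (hI1.const_mul _) hpt
      _ = 4 * C / s * ∫ x, ζ x * Lu u (dd u y) x := by
          rw [integral_const_mul, hintg]; ring
      _ ≤ 4 * C / s * (n * maMeasure u S) := by gcongr
      _ = (4 * C * n) * maMeasure u S / s := by ring
      _ ≤ (4 * C * n + 1) * maMeasure u S / s := by gcongr; linarith

lemma fderiv_gr_apply {v : E n → ℝ} {x : E n} (hv : ContDiffAt ℝ ∞ v x) (w : E n) :
    fderiv ℝ (gr v) x w = WithLp.toLp 2 ((Hess v x).mulVec w) := by
  have hd : DifferentiableAt ℝ (gr v) x := (contDiffAt_gr hv).differentiableAt (by simp)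
  ext j
  have h1 : HasFDerivAt (fun y => gr v y j) ((EuclideanSpace.proj j : E n →L[ℝ] ℝ).comp
      (fderiv ℝ (gr v) x)) x := (EuclideanSpace.proj j : E n →L[ℝ] ℝ).hasFDerivAt.comp x hd.hasFDerivAt
  have h2 : fderiv ℝ (fun y => pd v y j) x w = fderiv ℝ (gr v) x w j := by
    have := h1.fderiv
    change fderiv ℝ (fun y => gr v y j) x w = _
    rw [this]; rfl
  rw [← h2, fderiv_eq_sum]
  simp only [Matrix.mulVec, dotProduct]
  refine Finset.sum_congr rfl fun i _ => ?_
  rw [← pd2_eq, pd2_symm hv, mul_comm]; rfl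

/-- Transporting a function by the Legendre map. -/
lemma exists_transport {v f : E n → ℝ} {D : Set (E n)} (hD : IsOpen D)
    (hv : ∀ x ∈ D, ContDiffAt ℝ ∞ v x) (hf : ∀ x ∈ D, ContDiffAt ℝ ∞ f x)
    (hinj : Set.InjOn (gr v) D) (hdet : ∀ x ∈ D, 0 < (Hess v x).det) :
    IsOpen (gr v '' D) ∧ ∃ F : E n → ℝ, (∀ q ∈ gr v '' D, ContDiffAt ℝ ∞ F q) ∧
      (∀ x ∈ D, F (gr v x) = f x) ∧
      ∀ e : E n, ∫⁻ q in gr v '' D, ‖fderiv ℝ F q e‖ₑ =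
        ∫⁻ x in D, ENNReal.ofReal |UB v x (pd f x) e| := by
  have hdet' : ∀ x ∈ D, (fderiv ℝ (gr v) x).det ≠ 0 := fun x hx => by
    rw [det_fderiv_gr (hv x hx)]; exact (hdet x hx).ne'
  have hstr : ∀ x (hx : x ∈ D), HasStrictFDerivAt (gr v)
      (((fderiv ℝ (gr v) x).toContinuousLinearEquivOfDetNeZero (hdet' x hx) : E n ≃L[ℝ] E n) :
        E n →L[ℝ] E n) x := fun x hx => by
    rw [ContinuousLinearMap.coe_toContinuousLinearEquivOfDetNeZero]
    exact (contDiffAt_gr (hv x hx)).hasStrictFDerivAt (by simp)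
  have hmap : IsOpenMap (D.domRestrict (gr v)) := by
    refine IsOpenMap.of_nhds_le fun x => ?_
    have h1 := (hstr x x.2).map_nhds_eq_of_equiv
    have h2 : Filter.map (Subtype.val : D → E n) (nhds x) = nhds (x : E n) :=
      hD.isOpenEmbedding_subtypeVal.map_nhds_eq x
    have h3 : Filter.map (D.domRestrict (gr v)) (nhds x) = nhds (gr v x) := by
      rw [← h1, ← h2, Filter.map_map]; rfl
    rw [h3]; rfl
  have hcont : ContinuousOn (gr v) D := fun x hx =>
    (contDiffAt_gr (hv x hx)).continuousAt.continuousWithinAt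
  let e := OpenPartialHomeomorph.ofContinuousOpenRestrict (hinj.toPartialEquiv (gr v) D)
    hcont hmap hD
  have he : ∀ x, e x = gr v x := fun x => rfl
  have hes : e.source = D := rfl
  have het : e.target = gr v '' D := rfl
  have hleft : ∀ x ∈ D, e.symm (gr v x) = x := fun x hx => e.left_inv hx
  have hsymm : ∀ q ∈ gr v '' D, ContDiffAt ℝ ∞ e.symm q := by
    rintro q ⟨x, hx, rfl⟩
    refine e.contDiffAt_symm (f₀' := (fderiv ℝ (gr v) x).toContinuousLinearEquivOfDetNeZero
      (hdet' x hx)) (e.map_source hx) ?_ ?_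
    · rw [hleft x hx]; exact (hstr x hx).hasFDerivAt
    · rw [hleft x hx]; exact contDiffAt_gr (hv x hx)
  have hF : ∀ q ∈ gr v '' D, ContDiffAt ℝ ∞ (f ∘ e.symm) q := by
    intro q hq
    refine ContDiffAt.comp q ?_ (hsymm q hq)
    obtain ⟨x, hx, rfl⟩ := hq
    rw [hleft x hx]; exact hf x hx
  refine ⟨e.open_target, f ∘ e.symm, hF, fun x hx => by simp [hleft x hx], fun w => ?_⟩
  rw [lintegral_image_eq_lintegral_abs_det_fderiv_mul volume hD.measurableSet
    (fun x hx => ((contDiffAt_gr (hv x hx)).differentiableAt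
      (by simp)).hasFDerivAt.hasFDerivWithinAt) hinj]
  refine setLIntegral_congr_fun hD.measurableSet fun x hx => ?_
  have hchain : fderiv ℝ f x = (fderiv ℝ (f ∘ e.symm) (gr v x)).comp (fderiv ℝ (gr v) x) := by
    have h1 : HasFDerivAt ((f ∘ e.symm) ∘ gr v) ((fderiv ℝ (f ∘ e.symm) (gr v x)).comp
        (fderiv ℝ (gr v) x)) x :=
      ((hF _ ⟨x, hx, rfl⟩).differentiableAt (by simp)).hasFDerivAt.comp x
        ((contDiffAt_gr (hv x hx)).differentiableAt (by simp)).hasFDerivAt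
    have h2 : (f ∘ e.symm) ∘ gr v =ᶠ[nhds x] f := by
      filter_upwards [hD.mem_nhds hx] with z hz
      simp [hleft z hz]
    rw [← h2.fderiv_eq]; exact h1.fderiv
  have hkey : UB v x (pd f x) w = (Hess v x).det * fderiv ℝ (f ∘ e.symm) (gr v x) w := by
    have h1 : fderiv ℝ (gr v) x (WithLp.toLp 2 ((cofU v x).mulVec w)) = (Hess v x).det • w := by
      rw [fderiv_gr_apply (hv x hx)]
      ext i
      simp only [Matrix.mulVec_mulVec, cofU, Matrix.mul_adjugate]
      simp [Matrix.smul_mulVec]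
    have h2 : fderiv ℝ f x (WithLp.toLp 2 ((cofU v x).mulVec w)) = UB v x (pd f x) w := by
      rw [fderiv_eq_sum, UB_eq, dotProduct]
      exact Finset.sum_congr rfl fun i _ => mul_comm _ _
    rw [← h2, hchain, ContinuousLinearMap.comp_apply, h1, map_smul, smul_eq_mul]
  simp only [hkey, abs_mul, det_fderiv_gr (hv x hx)]
  rw [ENNReal.ofReal_mul (abs_nonneg _), ← Real.norm_eq_abs (fderiv ℝ (f ∘ e.symm) (gr v x) w),
    ofReal_norm]

/-- Quadratic perturbation of a potential. -/
def ue (u : E n → ℝ) (ε : ℝ) (x : E n) : ℝ := u x + ε * (‖x‖ ^ 2 / 2)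

lemma hasFDerivAt_halfsq (x : E n) :
    HasFDerivAt (fun y : E n => ‖y‖ ^ 2 / 2) (innerSL ℝ x) x := by
  have := (hasStrictFDerivAt_norm_sq x).hasFDerivAt.mul_const (1 / 2 : ℝ)
  have e : (fun y : E n => ‖y‖ ^ 2 / 2) = fun y => ‖y‖ ^ 2 * (1 / 2) := by
    funext y; ring
  rw [e]
  refine this.congr_fderiv ?_
  ext w; simp

lemma contDiff_halfsq : ContDiff ℝ ∞ (fun y : E n => ‖y‖ ^ 2 / 2) :=
  (contDiff_norm_sq ℝ).div_const _

lemma contDiffAt_ue {x : E n} (hu : ContDiffAt ℝ ∞ u x) (ε : ℝ) : ContDiffAt ℝ ∞ (ue u ε) x :=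
  hu.add (contDiffAt_const.mul contDiff_halfsq.contDiffAt)

lemma fderiv_ue {x : E n} (hu : ContDiffAt ℝ ∞ u x) (ε : ℝ) :
    fderiv ℝ (ue u ε) x = fderiv ℝ u x + ε • innerSL ℝ x :=
  ((hu.differentiableAt (by simp)).hasFDerivAt.add ((hasFDerivAt_halfsq x).const_mul ε)).fderiv

lemma gr_ue {x : E n} (hu : ContDiffAt ℝ ∞ u x) (ε : ℝ) : gr (ue u ε) x = gr u x + ε • x := by
  ext i
  simp only [gr_apply, pd, fderiv_ue hu]
  simp [pd, innerSL_apply_apply, EuclideanSpace.inner_single_right]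

lemma hess_ue {x : E n} (hu : ∀ᶠ y in nhds x, ContDiffAt ℝ ∞ u y) (ε : ℝ) :
    Hess (ue u ε) x = Hess u x + ε • 1 := by
  ext i j
  have h := pd2_add_smul hu.self_of_nhds (contDiff_halfsq.contDiffAt (x := x)) ε i j hu
    (Filter.Eventually.of_forall fun y => contDiff_halfsq.contDiffAt)
  change pd2 (ue u ε) x i j = _
  change pd2 (ue u ε) x i j = _ at h
  rw [h]
  have e : (fun y => pd (fun y : E n => ‖y‖ ^ 2 / 2) y j) = fun y => y j := by
    funext y
    rw [pd, (hasFDerivAt_halfsq y).fderiv]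
    simp [innerSL_apply_apply, EuclideanSpace.inner_single_right]
  have h2 : pd2 (fun y : E n => ‖y‖ ^ 2 / 2) x i j = if i = j then 1 else 0 := by
    rw [pd2_eq, e]
    have : fderiv ℝ (fun y : E n => y j) x = (EuclideanSpace.proj j : E n →L[ℝ] ℝ) :=
      (EuclideanSpace.proj j : E n →L[ℝ] ℝ).hasFDerivAt.fderiv
    rw [pd, this]
    simp [eq_comm]
  rw [h2]
  simp [Hess, Matrix.one_apply]

lemma Setup.det_ue_pos (h : Setup n α β Ω u) {x : E n} (hx : x ∈ Ω) {ε : ℝ} (hε : 0 < ε) :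
    0 < (Hess (ue u ε) x).det := by
  rw [hess_ue (h.eventually_smooth hx)]
  exact ((Matrix.PosDef.one.smul hε).posSemidef_add (h.hess_posSemidef hx)).det_pos

lemma Setup.gr_ue_injOn (h : Setup n α β Ω u) {ε : ℝ} (hε : 0 < ε) :
    Set.InjOn (gr (ue u ε)) Ω := by
  intro a ha b hb hab
  have h1 := h.grad_mono ha hb
  have h2 : inner ℝ (gr (ue u ε) b - gr (ue u ε) a) (b - a) = (0 : ℝ) := by
    rw [hab, sub_self, inner_zero_left]
  rw [gr_ue (h.smooth a ha), gr_ue (h.smooth b hb)] at h2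
  have e : gr u b + ε • b - (gr u a + ε • a) = (gr u b - gr u a) + ε • (b - a) := by module
  rw [e, inner_add_left, inner_sub_left, inner_gr, inner_gr, real_inner_smul_left,
    real_inner_self_eq_norm_sq] at h2
  rw [sub_apply] at h1
  have h3 : ε * ‖b - a‖ ^ 2 ≤ 0 := by linarith
  have h4 : ‖b - a‖ = 0 := by
    by_contra hne
    have : 0 < ‖b - a‖ := lt_of_le_of_ne (norm_nonneg _) (Ne.symm hne)
    have : 0 < ε * ‖b - a‖ ^ 2 := by positivity
    linarith
  exact (sub_eq_zero.1 (norm_eq_zero.1 h4)).symm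

lemma Setup.contOn_hess (h : Setup n α β Ω u) : ContinuousOn (fun x => Hess u x) Ω := by
  refine continuousOn_pi.2 fun i => continuousOn_pi.2 fun j => fun x hx => ?_
  exact (contDiffAt_pd2 (h.smooth x hx) i j).continuousAt.continuousWithinAt

lemma Setup.contOn_hess_ue (h : Setup n α β Ω u) :
    ContinuousOn (fun z : ℝ × E n => Hess (ue u z.1) z.2) (Set.univ ×ˢ Ω) := by
  have h1 : ContinuousOn (fun z : ℝ × E n => Hess u z.2 + z.1 • (1 : Matrix (Fin n) (Fin n) ℝ))
      (Set.univ ×ˢ Ω) := by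
    refine ContinuousOn.add (h.contOn_hess.comp continuous_snd.continuousOn fun z hz => hz.2) ?_
    exact (continuous_fst.smul continuous_const).continuousOn
  refine h1.congr fun z hz => ?_
  exact hess_ue (h.eventually_smooth hz.2) _

lemma Setup.contOn_det_ue (h : Setup n α β Ω u) :
    ContinuousOn (fun z : ℝ × E n => (Hess (ue u z.1) z.2).det) (Set.univ ×ˢ Ω) :=
  (Continuous.matrix_det continuous_id).comp_continuousOn h.contOn_hess_ue

lemma Setup.contOn_UB_ue (h : Setup n α β Ω u) {G : Set (E n)} (hG : G ⊆ Ω) {a : E n → Fin n → ℝ}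
    (ha : ∀ i, ContinuousOn (fun x => a x i) G) (e : Fin n → ℝ) :
    ContinuousOn (fun z : ℝ × E n => |UB (ue u z.1) z.2 (a z.2) e|) (Set.univ ×ˢ G) := by
  refine ContinuousOn.abs ?_
  have h1 : ContinuousOn (fun z : ℝ × E n => (Hess (ue u z.1) z.2).adjugate) (Set.univ ×ˢ G) :=
    (Continuous.matrix_adjugate continuous_id).comp_continuousOn
      (h.contOn_hess_ue.mono (Set.prod_mono le_rfl hG))
  refine continuousOn_finsetSum _ fun i _ => continuousOn_finsetSum _ fun j _ => ?_
  refine ContinuousOn.mul (ContinuousOn.mul ?_ ?_) continuousOn_const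
  · exact continuousOn_pi.1 (continuousOn_pi.1 h1 i) j
  · exact (ha i).comp continuous_snd.continuousOn fun z hz => hz.2

lemma tendsto_setIntegral_param {G : ℝ × E n → ℝ} {K A : Set (E n)} (hK : IsCompact K)
    (hA : MeasurableSet A) (hAK : A ⊆ K) (hG : ContinuousOn G (Set.univ ×ˢ K)) :
    Filter.Tendsto (fun ε => ∫ x in A, G (ε, x)) (nhdsWithin 0 (Set.Ioi 0))
      (nhds (∫ x in A, G (0, x))) := by
  have hc : IsCompact (Set.Icc (0 : ℝ) 1 ×ˢ K) := isCompact_Icc.prod hK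
  obtain ⟨C, hC⟩ := hc.exists_bound_of_continuousOn (hG.mono (Set.prod_mono (Set.subset_univ _) le_rfl))
  have hvol : volume A ≠ ⊤ := ((measure_mono hAK).trans_lt hK.measure_lt_top).ne
  have hsl : ∀ ε, ContinuousOn (fun x => G (ε, x)) K := fun ε =>
    hG.comp (by fun_prop) fun x hx => ⟨trivial, hx⟩
  refine tendsto_integral_filter_of_dominated_convergence (fun _ => C) ?_ ?_ ?_ ?_
  · exact Filter.Eventually.of_forall fun ε => ((hsl ε).mono hAK).aestronglyMeasurable hA
  · filter_upwards [Ioc_mem_nhdsGT (show (0 : ℝ) < 1 by norm_num)] with ε hε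
    filter_upwards [ae_restrict_mem hA] with x hx
    exact hC (ε, x) ⟨⟨hε.1.le, hε.2⟩, hAK hx⟩
  · exact integrableOn_const hvol
  · filter_upwards [ae_restrict_mem hA] with x hx
    have h1 : ContinuousOn (fun ε : ℝ => G (ε, x)) Set.univ :=
      hG.comp (by fun_prop) fun ε _ => ⟨trivial, hAK hx⟩
    have h2 : ContinuousAt (fun ε : ℝ => G (ε, x)) 0 := h1.continuousAt Filter.univ_mem
    exact h2.tendsto.mono_left nhdsWithin_le_nhds

lemma integrableOn_param {G : ℝ × E n → ℝ} {K A : Set (E n)} (hK : IsCompact K)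
    (hAK : A ⊆ K) (hG : ContinuousOn G (Set.univ ×ˢ K)) (ε : ℝ) :
    IntegrableOn (fun x => G (ε, x)) A := by
  have hsl : ContinuousOn (fun x => G (ε, x)) K := hG.comp (by fun_prop) fun x hx => ⟨trivial, hx⟩
  exact (hsl.integrableOn_compact hK).mono_set hAK

lemma sq_le_mul_of_forall {b I J : ℝ} (hb : 0 ≤ b) (hI : 0 ≤ I) (hJ : 0 ≤ J)
    (h : ∀ t > 0, 2 * b ≤ t * I + J / t) : b ^ 2 ≤ I * J := by
  rcases hI.eq_or_lt with hI0 | hI0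
  · subst hI0
    have : b ≤ 0 := by
      by_contra! hb0
      have := h ((J + 1) / b) (by positivity)
      have h2 : J / ((J + 1) / b) ≤ b := by
        rw [div_div_eq_mul_div, div_le_iff₀ (by positivity)]; linarith
      linarith
    have : b = 0 := le_antisymm this hb
    simp [this]
  rcases hJ.eq_or_lt with hJ0 | hJ0
  · subst hJ0
    have : b ≤ 0 := by
      by_contra! hb0
      have := h (b / I) (by positivity)
      have h2 : b / I * I = b := by field_simp
      rw [h2] at this; simp at this; linarith
    have : b = 0 := le_antisymm this hb
    simp [this]
  · have h1 := h (√(J / I)) (by positivity)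
    have h2 : √(J / I) * I = √(I * J) := by
      rw [← Real.sqrt_sq hI0.le, ← Real.sqrt_mul (by positivity), Real.sqrt_sq hI0.le]
      congr 1; field_simp
    have h3 : J / √(J / I) = √(I * J) := by
      rw [div_eq_iff (by positivity), ← Real.sqrt_mul (by positivity)]
      have : I * J * (J / I) = J ^ 2 := by field_simp
      rw [this, Real.sqrt_sq hJ0.le]
    rw [h2, h3] at h1
    have h4 : b ≤ √(I * J) := by linarith
    calc b ^ 2 ≤ √(I * J) ^ 2 := by gcongr
      _ = I * J := Real.sq_sqrt (by positivity)

/-- Cauchy-Schwarz for the energy form. -/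
lemma Setup.integral_abs_UB_sq_le (h : Setup n α β Ω u) {G : Set (E n)} (hG : MeasurableSet G)
    (hGΩ : G ⊆ Ω) {a b : E n → Fin n → ℝ}
    (hab : IntegrableOn (fun x => UB u x (a x) (b x)) G)
    (haa : IntegrableOn (fun x => UB u x (a x) (a x)) G)
    (hbb : IntegrableOn (fun x => UB u x (b x) (b x)) G) :
    (∫ x in G, |UB u x (a x) (b x)|) ^ 2 ≤
      (∫ x in G, UB u x (a x) (a x)) * ∫ x in G, UB u x (b x) (b x) := by
  refine sq_le_mul_of_forall (integral_nonneg fun _ => abs_nonneg _)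
    (setIntegral_nonneg hG fun x hx => h.UB_nonneg (hGΩ hx) _)
    (setIntegral_nonneg hG fun x hx => h.UB_nonneg (hGΩ hx) _) fun t ht => ?_
  have e : t * (∫ x in G, UB u x (a x) (a x)) + (∫ x in G, UB u x (b x) (b x)) / t
      = ∫ x in G, (t * UB u x (a x) (a x) + UB u x (b x) (b x) / t) := by
    rw [integral_add (haa.const_mul t) (hbb.div_const t), integral_const_mul, integral_div]
  rw [e, ← integral_const_mul]
  refine setIntegral_mono_on (hab.abs.const_mul 2) ((haa.const_mul t).add (hbb.div_const t)) hG
    fun x hx => ?_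
  have hxΩ := hGΩ hx
  have hsq := h.UB_sq_le hxΩ (a x) (b x)
  have hA := h.UB_nonneg hxΩ (a x)
  have hB := h.UB_nonneg hxΩ (b x)
  set A := UB u x (a x) (a x)
  set B := UB u x (b x) (b x)
  have h0 : 0 ≤ t * A + B / t := by positivity
  have h1 : |2 * UB u x (a x) (b x)| ≤ |t * A + B / t| := by
    refine sq_le_sq.1 ?_
    have : (t * A + B / t) ^ 2 = (t * A - B / t) ^ 2 + 4 * (A * B) := by field_simp; ring
    have h3 := sq_nonneg (t * A - B / t)
    rw [this, mul_pow]; linarith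
  rw [abs_mul, abs_of_nonneg h0, abs_two] at h1
  exact h1

/-- Segments between perturbed gradients over a section stay in the gradient image of a larger
section. -/
lemma exists_gr_hull (n : ℕ) (α β : ℝ) : ∃ M ≥ (2 : ℝ), ∀ (Ω : Set (E n)) (u : E n → ℝ),
    Setup n α β Ω u → ∀ y ∈ Ω, ∀ r > 0, CptIn (MASection Ω u y (M * r)) Ω →
    ∃ ε₀ > 0, ∀ ε > 0, ε ≤ ε₀ → ∀ p₁ ∈ MASection Ω u y r, ∀ p₂ ∈ MASection Ω u y r,
      ∀ s ∈ Set.Icc (0 : ℝ) 1,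
        (1 - s) • gr (ue u ε) p₁ + s • gr (ue u ε) p₂ ∈ gr (ue u ε) '' MASection Ω u y (M * r) := by
  obtain ⟨C, hC1, hC⟩ := exists_engulf n α β
  obtain ⟨c, hc0, hc⟩ := exists_separation n α β (γ := 1 / 2) (by norm_num) (by norm_num)
  refine ⟨max 2 ((C + 1) / c), le_max_left _ _, fun Ω u h y hy r hr hcpt => ?_⟩
  set M := max 2 ((C + 1) / c) with hM
  have hM2 : 2 ≤ M := le_max_left _ _
  have hMc : C + 1 ≤ c * M := by
    have : (C + 1) / c ≤ M := le_max_right _ _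
    rw [div_le_iff₀ hc0] at this; linarith
  have hMr : 2 * r ≤ M * r := by gcongr
  obtain ⟨B, hB⟩ := h.bdd.exists_norm_le
  have hB0 : 0 ≤ B := (norm_nonneg y).trans (hB y hy)
  refine ⟨r / (4 * B ^ 2 + 1), by positivity, fun ε hε hεle p₁ hp₁ p₂ hp₂ s hs => ?_⟩
  set D := MASection Ω u y (M * r) with hD
  have hDo : IsOpen D := h.sec_open hcpt
  have hDΩ : D ⊆ Ω := subset_closure.trans hcpt.2
  have hsub : MASection Ω u y r ⊆ D := sec_mono (by linarith)
  set q := (1 - s) • gr (ue u ε) p₁ + s • gr (ue u ε) p₂ with hq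
  set G : E n → ℝ := fun x => ue u ε x - inner ℝ q x with hG
  have hyD : y ∈ D := Setup.self_mem_sec hy (by linarith)
  have hGc : ContinuousOn G (closure D) := fun x hx =>
    ((contDiffAt_ue (h.smooth x (hcpt.2 hx)) ε).continuousAt.sub
      (by fun_prop)).continuousWithinAt
  obtain ⟨x, hxK, hmin⟩ := hcpt.1.exists_isMinOn ⟨y, subset_closure hyD⟩ hGc
  have hcomp : ∀ p ∈ MASection Ω u y r, ∀ z : E n, ∀ w : E n,
      ue u ε z - inner ℝ (gr (ue u ε) p) z - (ue u ε w - inner ℝ (gr (ue u ε) p) w) =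
      (dd u p z + ε / 2 * ‖z - p‖ ^ 2) - (dd u p w + ε / 2 * ‖w - p‖ ^ 2) := by
    intro p hp z w
    rw [gr_ue (h.smooth p (hDΩ (hsub hp))), @norm_sub_sq_real, @norm_sub_sq_real]
    simp only [inner_add_left, inner_gr, real_inner_smul_left, dd, ue, map_sub]
    rw [real_inner_comm p z, real_inner_comm p w]
    ring
  have hpos : x ∉ D → ∀ p ∈ MASection Ω u y r,
      0 < ue u ε x - inner ℝ (gr (ue u ε) p) x - (ue u ε y - inner ℝ (gr (ue u ε) p) y) := by
    intro hxD p hp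
    rw [hcomp p hp]
    have hpΩ := hDΩ (hsub hp)
    have hpr := (mem_section.1 hp).2.le
    have hxΩ := hcpt.2 hxK
    have hxM : M * r ≤ dd u y x := by
      by_contra! hlt
      exact hxD (mem_section.2 ⟨subset_closure hxΩ, hlt⟩)
    have h1 : dd u p y ≤ C * r := hC Ω u h y hy r hr (CptIn.mono hcpt (sec_mono hMr)) p
      (subset_closure hpΩ) hpr y (subset_closure hy) (by rw [dd_self]; linarith)
    have h2 : c * (M * r) ≤ dd u p x := hc Ω u h y hy (M * r) (by positivity)
      (CptIn.mono hcpt (sec_mono (by nlinarith))) p (subset_closure hpΩ) (by linarith) x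
      (subset_closure hxΩ) hxM
    have h3 : (C + 1) * r ≤ c * (M * r) := by
      rw [← mul_assoc]; gcongr
    have h4 : ‖y - p‖ ≤ 2 * B := by
      have := norm_sub_le y p
      linarith [hB y hy, hB p hpΩ]
    have h5 : ε / 2 * ‖y - p‖ ^ 2 ≤ r / 2 := by
      have h6 : ‖y - p‖ ^ 2 ≤ (2 * B) ^ 2 := by gcongr
      have h7 : ε * (4 * B ^ 2 + 1) ≤ r := by rwa [le_div_iff₀ (by positivity)] at hεle
      have h8 : ε / 2 * ‖y - p‖ ^ 2 ≤ ε / 2 * (2 * B) ^ 2 := by gcongr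
      linarith
    have h9 : 0 ≤ ε / 2 * ‖x - p‖ ^ 2 := by positivity
    linarith
  have hxD : x ∈ D := by
    by_contra hxD
    have h1 := hpos hxD p₁ hp₁
    have h2 := hpos hxD p₂ hp₂
    have h3 : G x ≤ G y := hmin (subset_closure hyD)
    have h4 : G x - G y = (1 - s) * (ue u ε x - inner ℝ (gr (ue u ε) p₁) x -
        (ue u ε y - inner ℝ (gr (ue u ε) p₁) y)) + s * (ue u ε x - inner ℝ (gr (ue u ε) p₂) x -
        (ue u ε y - inner ℝ (gr (ue u ε) p₂) y)) := by
      simp only [hG, hq, inner_add_left, real_inner_smul_left]; ring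
    rcases hs.1.eq_or_lt with h0 | h0
    · rw [← h0] at h4; linarith
    · have := mul_pos h0 h2
      have := mul_nonneg (sub_nonneg.2 hs.2) h1.le
      linarith
  refine ⟨x, hxD, ?_⟩
  have hloc : IsLocalMin G x := hmin.isLocalMin (Filter.mem_of_superset (hDo.mem_nhds hxD) subset_closure)
  have hder : HasFDerivAt G (fderiv ℝ (ue u ε) x - innerSL ℝ q) x :=
    (((contDiffAt_ue (h.smooth x (hDΩ hxD)) ε).differentiableAt (by simp)).hasFDerivAt).sub
      (innerSL ℝ q).hasFDerivAt
  have hz := hloc.hasFDerivAt_eq_zero hder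
  ext i
  have := congrArg (fun L : E n →L[ℝ] ℝ => L (ev i)) hz
  simp only [sub_apply, innerSL_apply_apply, zero_apply] at this
  rw [EuclideanSpace.inner_single_right] at this
  simp only [gr_apply, pd]
  simpa [sub_eq_zero] using this

lemma exists_dual_family {a : Fin n → E n} (ha : 0 < da a) : ∃ e : Fin n → E n,
    (∀ i c, inner ℝ (e i) (lin a c) = c i) ∧ ∀ v, v = ∑ i, inner ℝ v (a i) • e i := by
  have hu : IsUnit (colMat a).det := by
    rw [isUnit_iff_ne_zero]; exact abs_pos.1 ha
  refine ⟨fun i => WithLp.toLp 2 ((colMat a)⁻¹ i), fun i c => ?_, fun v => ?_⟩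
  · have h1 : ∀ k, inner ℝ (WithLp.toLp 2 ((colMat a)⁻¹ i) : E n) (a k) =
        (1 : Matrix (Fin n) (Fin n) ℝ) i k := fun k => by
      rw [← Matrix.nonsing_inv_mul _ hu, Matrix.mul_apply, PiLp.inner_apply]
      simp [colMat, mul_comm]
    rw [inner_lin_right]
    simp [h1, Matrix.one_apply]
  · ext k
    have h1 : ∀ j, ∑ i, a i j * (colMat a)⁻¹ i k = (1 : Matrix (Fin n) (Fin n) ℝ) j k := fun j => by
      rw [← Matrix.mul_nonsing_inv _ hu, Matrix.mul_apply]
      simp [colMat]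
    simp only [WithLp.ofLp_sum, WithLp.ofLp_smul, Finset.sum_apply, Pi.smul_apply, smul_eq_mul,
      PiLp.inner_apply, RCLike.inner_apply, conj_trivial]
    simp only [Finset.sum_mul]
    rw [Finset.sum_comm]
    have : ∀ j, ∑ i, a i j * v j * (colMat a)⁻¹ i k = v j * (1 : Matrix (Fin n) (Fin n) ℝ) j k := by
      intro j
      rw [← h1, Finset.mul_sum]
      exact Finset.sum_congr rfl fun i _ => by ring
    simp [this, Matrix.one_apply]

lemma Setup.sol_affine (_h : Setup n α β Ω u) {G : Set (E n)} (hG : IsOpen G) (hs : G ⊆ Ω)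
    (k : ℝ) (L : E n →L[ℝ] ℝ) (p : E n) : Sol Ω u G (fun x => k + L (x - p)) := by
  have h0 : Sol Ω u G (fun _ => (0 : ℝ)) :=
    ⟨hG, hs, fun _ _ => contDiffAt_const, fun x _ => by simp [Lu, pd2]⟩
  simpa using h0.affine_sub k L p

/-- Energy of the normalized linear functions on a section. -/
lemma exists_linear_energy (n : ℕ) (α β : ℝ) : ∃ C > (0 : ℝ), ∀ (Ω : Set (E n)) (u : E n → ℝ),
    Setup n α β Ω u → ∀ y ∈ Ω, ∀ s > 0, CptIn (MASection Ω u y s) Ω →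
    ∀ a, IsBox (MASection Ω u y s) y a → ∀ e : E n, ∀ i : Fin n,
    (∀ c, inner ℝ e (lin a c) = c i) →
      ∫ x in MASection Ω u y (s / 2), UB u x e e ≤ C * maMeasure u (MASection Ω u y s) / s := by
  obtain ⟨C, hC0, hC⟩ := exists_sec_cutoff n α β
  refine ⟨4 * C, by positivity, fun Ω u h y hy s hs hc a ha e i he => ?_⟩
  obtain ⟨ζ, hζ, hζc, hζs, hζ01, hζ1, hζE⟩ := hC Ω u h y hy s hs hc
  have hSo := h.sec_open hc
  have hSΩ : MASection Ω u y s ⊆ Ω := subset_closure.trans hc.2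
  have hb := h.sol_affine hSo hSΩ 0 (innerSL ℝ e) y
  have hpd : ∀ x, pd (fun x => 0 + innerSL ℝ e (x - y)) x = e := by
    intro x
    ext j
    have : HasFDerivAt (fun x => 0 + innerSL ℝ e (x - y)) (innerSL ℝ e) x := by
      simpa using ((innerSL ℝ e).hasFDerivAt.comp x ((hasFDerivAt_id x).sub_const y)).const_add 0
    rw [pd, this.fderiv]
    simp [innerSL_apply_apply, EuclideanSpace.inner_single_right]
  have hcac := h.caccioppoli hb hζ hζc hζs (H := fun τ => τ) (fun x _ => contDiffAt_id)
    (fun x _ => by simp) (h.integrable_energy hζ hζc (hζs.trans hSΩ))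
    (fun x => h.UB_pd_nonneg (hζs.trans hSΩ) x) (fun x hx => by
      obtain ⟨c, hc1, hxc⟩ := ha.cover x (subset_closure hx)
      have h1 : innerSL ℝ e (x - y) = c i := by
        rw [hxc, add_sub_cancel_left, innerSL_apply_apply, he]
      have h2 : (c i) ^ 2 ≤ 1 := by
        rw [← sq_abs]; exact pow_le_one₀ (abs_nonneg _) (hc1 i)
      have h3 := h.UB_pd_nonneg (hζs.trans hSΩ) x
      rw [h1]
      simp only [zero_add, deriv_id'', mul_one]
      exact mul_le_of_le_one_left h3 h2)
  simp only [hpd, deriv_id'', mul_one] at hcac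
  have hsub : MASection Ω u y (s / 2) ⊆ MASection Ω u y s := sec_mono (by linarith)
  have hm : MeasurableSet (MASection Ω u y (s / 2)) :=
    (h.sec_open (CptIn.mono hc hsub)).measurableSet
  calc ∫ x in MASection Ω u y (s / 2), UB u x e e
      = ∫ x in MASection Ω u y (s / 2), ζ x ^ 2 * UB u x e e :=
        setIntegral_congr_fun hm fun x hx => by simp [hζ1 x hx]
    _ ≤ ∫ x, ζ x ^ 2 * UB u x e e := by
        refine setIntegral_le_integral hcac.1 (Filter.Eventually.of_forall fun x => ?_)
        by_cases hx : x ∈ Ω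
        · exact mul_nonneg (sq_nonneg _) (h.UB_nonneg hx _)
        · have : ζ x = 0 := image_eq_zero_of_notMem_tsupport fun hk => hx (hSΩ (hζs hk))
          simp [this]
    _ ≤ 4 * ∫ x, UB u x (pd ζ x) (pd ζ x) := hcac.2
    _ ≤ 4 * (C * maMeasure u (MASection Ω u y s) / s) := by gcongr
    _ = 4 * C * maMeasure u (MASection Ω u y s) / s := by ring

lemma volume_gr_image_eq {v : E n → ℝ} {A : Set (E n)} (hA : MeasurableSet A)
    (hv : ∀ x ∈ A, ContDiffAt ℝ ∞ v x) (hinj : Set.InjOn (gr v) A)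
    (hdet : ∀ x ∈ A, 0 ≤ (Hess v x).det) (hi : IntegrableOn (fun x => (Hess v x).det) A) :
    volume (gr v '' A) = ENNReal.ofReal (∫ x in A, (Hess v x).det) := by
  rw [ofReal_integral_eq_lintegral_ofReal hi
    (by filter_upwards [ae_restrict_mem hA] with x hx; exact hdet x hx)]
  rw [← lintegral_abs_det_fderiv_eq_addHaar_image volume hA
    (fun x hx => ((contDiffAt_gr (hv x hx)).differentiableAt
      (by simp)).hasFDerivAt.hasFDerivWithinAt) hinj]
  refine setLIntegral_congr_fun hA fun x hx => ?_
  simp only [det_fderiv_gr (hv x hx), abs_of_nonneg (hdet x hx)]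

/-- The transported one-dimensional estimate for a nondegenerate potential. -/
lemma Setup.volume_ineq (h : Setup n α β Ω u) {D E₀ E₁ : Set (E n)} (hD : IsOpen D)
    (_hc : CptIn D Ω) {f : E n → ℝ} {K : Set (E n)} (hK : IsCompact K) (hDK : D ⊆ K) (hKΩ : K ⊆ Ω)
    (hf : ∀ x ∈ K, ContDiffAt ℝ ∞ f x)
    (h₀ : MeasurableSet E₀) (h₁ : MeasurableSet E₁) (hs₀ : E₀ ⊆ D) (hs₁ : E₁ ⊆ D)
    (hf₀ : ∀ x ∈ E₀, f x ≤ 0) (hf₁ : ∀ x ∈ E₁, 1 ≤ f x) {ε Λ : ℝ} (hε : 0 < ε) (hΛ : 0 ≤ Λ)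
    (hseg : ∀ p₁ ∈ E₀, ∀ p₂ ∈ E₁, ∀ s ∈ Set.Icc (0 : ℝ) 1,
        (1 - s) • gr (ue u ε) p₁ + s • gr (ue u ε) p₂ ∈ gr (ue u ε) '' D)
    {e : Fin n → E n}
    (he : ∀ p₁ ∈ E₀, ∀ p₂ ∈ E₁, ∃ c : Fin n → ℝ, (∀ i, |c i| ≤ Λ) ∧
      gr (ue u ε) p₂ - gr (ue u ε) p₁ = ∑ i, c i • e i) :
    (∫ x in E₀, (Hess (ue u ε) x).det) * (∫ x in E₁, (Hess (ue u ε) x).det) ≤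
      Λ * (2 ^ n * ((∫ x in E₀, (Hess (ue u ε) x).det) + ∫ x in E₁, (Hess (ue u ε) x).det)) *
        ∑ i, ∫ x in D, |UB (ue u ε) x (pd f x) (e i)| := by
  have hDΩ : D ⊆ Ω := hDK.trans hKΩ
  have hv : ∀ x ∈ D, ContDiffAt ℝ ∞ (ue u ε) x := fun x hx => contDiffAt_ue (h.smooth x (hDΩ hx)) ε
  have hinj : Set.InjOn (gr (ue u ε)) D := (h.gr_ue_injOn hε).mono hDΩ
  have hdet : ∀ x ∈ D, 0 < (Hess (ue u ε) x).det := fun x hx => h.det_ue_pos (hDΩ hx) hε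
  obtain ⟨hT, F, hF, hFf, hFint⟩ := exists_transport hD hv (fun x hx => hf x (hDK hx)) hinj hdet
  have hi : ∀ A ⊆ D, IntegrableOn (fun x => (Hess (ue u ε) x).det) A := fun A hA =>
    integrableOn_param hK (hA.trans hDK)
      (h.contOn_det_ue.mono (Set.prod_mono le_rfl hKΩ)) ε
  have hcg : ContinuousOn (gr (ue u ε)) D := fun x hx =>
    (contDiffAt_gr (hv x hx)).continuousAt.continuousWithinAt
  have hme : ∀ A, MeasurableSet A → A ⊆ D → MeasurableSet (gr (ue u ε) '' A) := fun A hA hAD =>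
    hA.image_of_continuousOn_injOn (hcg.mono hAD) (hinj.mono hAD)
  have hvol : ∀ A, MeasurableSet A → A ⊆ D → volume (gr (ue u ε) '' A) =
      ENNReal.ofReal (∫ x in A, (Hess (ue u ε) x).det) := fun A hA hAD =>
    volume_gr_image_eq hA (fun x hx => hv x (hAD hx)) (hinj.mono hAD)
      (fun x hx => (hdet x (hAD hx)).le) (hi A hAD)
  have hpos : ∀ A, MeasurableSet A → A ⊆ D → 0 ≤ ∫ x in A, (Hess (ue u ε) x).det :=
    fun A hA hAD => setIntegral_nonneg hA fun x hx => (hdet x (hAD hx)).le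
  have key := volume_mul_volume_le (Λ := Λ) (e := e) hT hF (hme E₀ h₀ hs₀) (hme E₁ h₁ hs₁)
    (by rintro _ ⟨p, hp, rfl⟩ _ ⟨p', hp', rfl⟩ s hs; exact hseg p hp p' hp' s hs)
    (by rintro _ ⟨p, hp, rfl⟩; rw [hFf p (hs₀ hp)]; exact hf₀ p hp)
    (by rintro _ ⟨p, hp, rfl⟩; rw [hFf p (hs₁ hp)]; exact hf₁ p hp)
    (by rintro _ ⟨p, hp, rfl⟩ _ ⟨p', hp', rfl⟩; exact he p hp p' hp')
  have hb : ∀ i, ∫⁻ q in gr (ue u ε) '' D, ‖fderiv ℝ F q (e i)‖ₑ =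
      ENNReal.ofReal (∫ x in D, |UB (ue u ε) x (pd f x) (e i)|) := fun i => by
    rw [hFint, ofReal_integral_eq_lintegral_ofReal
      (integrableOn_param hK hDK (h.contOn_UB_ue hKΩ (contOn_pd hf) (e i)) ε)
      (Filter.Eventually.of_forall fun x => abs_nonneg _)]
  have hb0 : ∀ i, 0 ≤ ∫ x in D, |UB (ue u ε) x (pd f x) (e i)| := fun i =>
    integral_nonneg fun _ => abs_nonneg _
  rw [hvol E₀ h₀ hs₀, hvol E₁ h₁ hs₁, Finset.sum_congr rfl fun i _ => hb i] at key
  have p0 := hpos E₀ h₀ hs₀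
  have p1 := hpos E₁ h₁ hs₁
  have h2 : (2 : ℝ≥0∞) ^ n = ENNReal.ofReal (2 ^ n) := by
    rw [ENNReal.ofReal_pow (by norm_num)]; simp
  rw [h2, ← ENNReal.ofReal_sum_of_nonneg fun i _ => hb0 i, ← ENNReal.ofReal_add p0 p1,
    ← ENNReal.ofReal_mul p0, ← ENNReal.ofReal_mul (show (0 : ℝ) ≤ 2 ^ n by positivity),
    ← ENNReal.ofReal_mul hΛ, ← ENNReal.ofReal_mul (by positivity), ENNReal.ofReal_le_ofReal_iff] at key
  · exact key
  · exact mul_nonneg (by positivity) (Finset.sum_nonneg fun i _ => hb0 i)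

/-- A Poincaré type inequality on sections for smooth functions. -/
theorem exists_poincare (n : ℕ) (α β : ℝ) : ∃ M ≥ (4 : ℝ), ∃ C > (0 : ℝ),
    ∀ (Ω : Set (E n)) (u : E n → ℝ), Setup n α β Ω u → ∀ y ∈ Ω, ∀ r > 0,
    CptIn (MASection Ω u y (M * r)) Ω → ∀ f : E n → ℝ,
    (∀ x ∈ MASection Ω u y (M * r), ContDiffAt ℝ ∞ f x) → ∀ E₀ E₁ : Set (E n),
    MeasurableSet E₀ → MeasurableSet E₁ → E₀ ⊆ MASection Ω u y r → E₁ ⊆ MASection Ω u y r →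
    (∀ x ∈ E₀, f x ≤ 0) → (∀ x ∈ E₁, 1 ≤ f x) →
    (maMeasure u E₀ * maMeasure u E₁) ^ 2 ≤ C * r * maMeasure u (MASection Ω u y (M * r)) ^ 3 *
      ∫ x in MASection Ω u y (M * r / 2), UB u x (pd f x) (pd f x) := by
  obtain ⟨M, hM2, hM⟩ := exists_gr_hull n α β
  obtain ⟨C₁, hC₁0, hC₁⟩ := exists_linear_energy n α β
  obtain ⟨C₂, hC₂0, hC₂⟩ := exists_slope_bound n α β
  refine ⟨2 * M, by linarith, ((2 * C₂ + 1) * 2 ^ n * 2 * n) ^ 2 * M * C₁ + 1, by positivity,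
    fun Ω u h y hy r hr hcpt f hf E₀ E₁ h₀ h₁ hs₀ hs₁ hf₀ hf₁ => ?_⟩
  set R := M * r with hR
  have hR0 : 0 < R := by positivity
  have eR : 2 * M * r = 2 * R := by rw [hR]; ring
  rw [eR] at hcpt hf ⊢
  have eR' : 2 * R / 2 = R := by ring
  rw [eR']
  set S := MASection Ω u y (2 * R) with hS
  set D := MASection Ω u y R with hD
  have hrR : r ≤ R := by nlinarith
  have hDS : D ⊆ S := sec_mono (by linarith)
  have hcD : CptIn D Ω := CptIn.mono hcpt hDS
  have hSo : IsOpen S := h.sec_open hcpt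
  have hSΩ : S ⊆ Ω := subset_closure.trans hcpt.2
  have hDo : IsOpen D := h.sec_open hcD
  have hDΩ : D ⊆ Ω := hDS.trans hSΩ
  have hrD : MASection Ω u y r ⊆ D := sec_mono hrR
  have hKS : closure D ⊆ S := fun x hx => by
    obtain ⟨h1, h2⟩ := h.dd_le_of_mem_closure hx
    exact mem_section.2 ⟨h1, by linarith⟩
  obtain ⟨ε₀, hε₀, hseg⟩ := hM Ω u h y hy r hr hcD
  obtain ⟨a, ha⟩ := h.exists_isBox hy (by linarith) hcpt
  obtain ⟨e, he, hev⟩ := exists_dual_family ha.pos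
  obtain ⟨B, hB⟩ := h.bdd.exists_norm_le
  have hB0 : 0 ≤ B := (norm_nonneg y).trans (hB y hy)
  set A := ∑ i, ‖a i‖ with hA
  have hA0 : 0 ≤ A := Finset.sum_nonneg fun i _ => norm_nonneg _
  set Λ := (2 * C₂ + 1) * R with hΛ
  have hΛ0 : 0 ≤ Λ := by positivity
  have hslope : ∀ p ∈ D, ∀ i, |(fderiv ℝ u p - fderiv ℝ u y) (a i)| ≤ C₂ * R := by
    intro p hp i
    have h1 := hC₂ Ω u h y hy R hR0 hcpt a ha p (subset_closure (hDΩ hp)) (mem_section.1 hp).2.le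
      (Pi.single i 1) (fun j => by by_cases hj : j = i <;> simp [hj])
    rwa [lin_apply, Finset.sum_eq_single i (by
      intro j _ hj; simp [hj]) (by simp), Pi.single_eq_same, one_smul] at h1
  have hineq : ∀ᶠ ε in nhdsWithin (0 : ℝ) (Set.Ioi 0),
      (∫ x in E₀, (Hess (ue u ε) x).det) * (∫ x in E₁, (Hess (ue u ε) x).det) ≤
      Λ * (2 ^ n * ((∫ x in E₀, (Hess (ue u ε) x).det) + ∫ x in E₁, (Hess (ue u ε) x).det)) *
        ∑ i, ∫ x in D, |UB (ue u ε) x (pd f x) (e i)| := by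
    have hpos : 0 < min ε₀ (R / (2 * B * A + 1)) := by positivity
    filter_upwards [Ioc_mem_nhdsGT hpos] with ε hε
    refine h.volume_ineq hDo hcD (K := closure D) hcD.1 subset_closure hcD.2
      (fun x hx => hf x (hKS hx)) h₀ h₁ (hs₀.trans hrD) (hs₁.trans hrD) hf₀ hf₁ hε.1 hΛ0
      (fun p₁ hp₁ p₂ hp₂ s hs => hseg ε hε.1 (hε.2.trans (min_le_left _ _)) p₁ (hs₀ hp₁) p₂
        (hs₁ hp₂) s hs) (e := e) ?_
    intro p₁ hp₁ p₂ hp₂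
    refine ⟨fun i => inner ℝ (gr (ue u ε) p₂ - gr (ue u ε) p₁) (a i), fun i => ?_, hev _⟩
    have hp₁D := hrD (hs₀ hp₁)
    have hp₂D := hrD (hs₁ hp₂)
    have h1 := hslope p₁ hp₁D i
    have h2 := hslope p₂ hp₂D i
    rw [gr_ue (h.smooth _ (hDΩ hp₁D)), gr_ue (h.smooth _ (hDΩ hp₂D))]
    have e1 : inner ℝ (gr u p₂ + ε • p₂ - (gr u p₁ + ε • p₁)) (a i) =
        (fderiv ℝ u p₂ - fderiv ℝ u y) (a i) - (fderiv ℝ u p₁ - fderiv ℝ u y) (a i)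
          + ε * inner ℝ (p₂ - p₁) (a i) := by
      simp only [inner_sub_left, inner_add_left, inner_gr, real_inner_smul_left, sub_apply]
      ring
    have h3 : |ε * inner ℝ (p₂ - p₁) (a i)| ≤ R := by
      rw [abs_mul, abs_of_pos hε.1]
      have h4 : |inner ℝ (p₂ - p₁) (a i)| ≤ 2 * B * A := by
        refine (abs_real_inner_le_norm _ _).trans ?_
        have h5 : ‖p₂ - p₁‖ ≤ 2 * B := by
          have := norm_sub_le p₂ p₁
          linarith [hB _ (hDΩ hp₁D), hB _ (hDΩ hp₂D)]
        have h6 : ‖a i‖ ≤ A := Finset.single_le_sum (f := fun i => ‖a i‖)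
          (fun j _ => norm_nonneg _) (Finset.mem_univ i)
        gcongr
      have h7 : ε ≤ R / (2 * B * A + 1) := hε.2.trans (min_le_right _ _)
      rw [le_div_iff₀ (by positivity)] at h7
      calc ε * |inner ℝ (p₂ - p₁) (a i)| ≤ ε * (2 * B * A + 1) := by
            have := hε.1.le
            gcongr; linarith
        _ ≤ R := h7
    change |inner ℝ (gr u p₂ + ε • p₂ - (gr u p₁ + ε • p₁)) (a i)| ≤ Λ
    rw [e1]
    have h8 := abs_add_le ((fderiv ℝ u p₂ - fderiv ℝ u y) (a i) -
      (fderiv ℝ u p₁ - fderiv ℝ u y) (a i)) (ε * inner ℝ (p₂ - p₁) (a i))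
    have h9 := abs_sub ((fderiv ℝ u p₂ - fderiv ℝ u y) (a i)) ((fderiv ℝ u p₁ - fderiv ℝ u y) (a i))
    rw [hΛ]; linarith
  have hu0 : ue u 0 = u := by funext x; simp [ue]
  have hKu : ContinuousOn (fun z : ℝ × E n => (Hess (ue u z.1) z.2).det)
      (Set.univ ×ˢ closure D) := h.contOn_det_ue.mono (Set.prod_mono le_rfl hcD.2)
  have ht₀ := tendsto_setIntegral_param hcD.1 h₀ (hs₀.trans (hrD.trans subset_closure)) hKu
  have ht₁ := tendsto_setIntegral_param hcD.1 h₁ (hs₁.trans (hrD.trans subset_closure)) hKu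
  have htD := fun i => tendsto_setIntegral_param hcD.1 hDo.measurableSet subset_closure
    (h.contOn_UB_ue hcD.2 (contOn_pd fun x hx => hf x (hKS hx)) (e i))
  have hlim := le_of_tendsto_of_tendsto (ht₀.mul ht₁)
    ((((ht₀.add ht₁).const_mul (2 ^ n)).const_mul Λ).mul (tendsto_finsetSum Finset.univ fun i _ => htD i))
    hineq
  simp only [hu0] at hlim
  change maMeasure u E₀ * maMeasure u E₁ ≤ Λ * (2 ^ n * (maMeasure u E₀ + maMeasure u E₁)) * _
    at hlim
  set m := maMeasure u S with hm
  have hm0 : 0 ≤ m := h.ma_nonneg hSo.measurableSet hSΩ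
  have hm₀ : maMeasure u E₀ ≤ m := h.ma_mono hSo.measurableSet hcpt (hs₀.trans (hrD.trans hDS))
  have hm₁ : maMeasure u E₁ ≤ m := h.ma_mono hSo.measurableSet hcpt (hs₁.trans (hrD.trans hDS))
  have hp₀ := h.ma_nonneg h₀ (hs₀.trans (hrD.trans hDΩ))
  have hp₁ := h.ma_nonneg h₁ (hs₁.trans (hrD.trans hDΩ))
  set I := ∫ x in D, UB u x (pd f x) (pd f x) with hI
  have hI0 : 0 ≤ I := setIntegral_nonneg hDo.measurableSet fun x hx => h.UB_nonneg (hDΩ hx) _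
  have hJ : ∀ i, (∫ x in D, |UB u x (pd f x) (e i)|) ^ 2 ≤ I * (C₁ * m / (2 * R)) := by
    intro i
    have h1 := hC₁ Ω u h y hy (2 * R) (by linarith) hcpt a ha (e i) i (he i)
    rw [eR'] at h1
    have hcf : ∀ j, ContinuousOn (fun x => pd f x j) (closure D) :=
      contOn_pd fun x hx => hf x (hKS hx)
    have hce : ∀ j, ContinuousOn (fun _ : E n => e i j) (closure D) := fun j => continuousOn_const
    have h2 := h.integral_abs_UB_sq_le hDo.measurableSet hDΩ (a := pd f) (b := fun _ => e i)
      (((h.contOn_UB hcD.2 hcf hce).integrableOn_compact hcD.1).mono_set subset_closure)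
      (((h.contOn_UB hcD.2 hcf hcf).integrableOn_compact hcD.1).mono_set subset_closure)
      (((h.contOn_UB hcD.2 hce hce).integrableOn_compact hcD.1).mono_set subset_closure)
    exact h2.trans (mul_le_mul_of_nonneg_left h1 hI0)
  have hsum : (∑ i, ∫ x in D, |UB u x (pd f x) (e i)|) ^ 2 ≤
      n ^ 2 * (I * (C₁ * m / (2 * R))) := by
    have h1 := sq_sum_le_card_mul_sum_sq (s := Finset.univ)
      (f := fun i => ∫ x in D, |UB u x (pd f x) (e i)|)
    have h2 := Finset.sum_le_sum fun i (_ : i ∈ Finset.univ) => hJ i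
    simp only [Finset.sum_const, Finset.card_univ, Fintype.card_fin, nsmul_eq_mul] at h1 h2
    calc _ ≤ (n : ℝ) * ∑ i, (∫ x in D, |UB u x (pd f x) (e i)|) ^ 2 := h1
      _ ≤ n * (n * (I * (C₁ * m / (2 * R)))) := by gcongr
      _ = _ := by ring
  set T := ∑ i, ∫ x in D, |UB u x (pd f x) (e i)| with hT
  have hT0 : 0 ≤ T := Finset.sum_nonneg fun i _ => integral_nonneg fun _ => abs_nonneg _
  calc (maMeasure u E₀ * maMeasure u E₁) ^ 2
      ≤ (Λ * (2 ^ n * (maMeasure u E₀ + maMeasure u E₁)) * T) ^ 2 := by gcongr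
    _ ≤ (Λ * (2 ^ n * (m + m)) * T) ^ 2 := by gcongr
    _ = (Λ * (2 ^ n * (m + m))) ^ 2 * T ^ 2 := by ring
    _ ≤ (Λ * (2 ^ n * (m + m))) ^ 2 * (n ^ 2 * (I * (C₁ * m / (2 * R)))) := by gcongr
    _ = (((2 * C₂ + 1) * 2 ^ n * 2 * n) ^ 2 * M * C₁) / 2 * r * m ^ 3 * I := by
        rw [hΛ, hR]; field_simp; ring
    _ ≤ (((2 * C₂ + 1) * 2 ^ n * 2 * n) ^ 2 * M * C₁ + 1) * r * m ^ 3 * I := by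
        have : 0 ≤ ((2 * C₂ + 1) * 2 ^ n * 2 * n) ^ 2 * M * C₁ := by positivity
        gcongr
        linarith

lemma Setup.UB_add_le (h : Setup n α β Ω u) {x : E n} (hx : x ∈ Ω) (a b : Fin n → ℝ) :
    UB u x (a + b) (a + b) ≤ 2 * UB u x a a + 2 * UB u x b b := by
  have h1 := h.UB_nonneg hx (a - b)
  have e1 : UB u x (a - b) (a - b) = UB u x a a - 2 * UB u x a b + UB u x b b := by
    rw [sub_eq_add_neg, ← neg_one_smul ℝ b, UB_add_left, UB_add_right, UB_add_right,
      UB_smul_left, UB_smul_right, UB_smul_left, UB_smul_right, h.UB_symm hx b a]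
    ring
  rw [UB_add_left, UB_add_right, UB_add_right, h.UB_symm hx b a]
  linarith

lemma Setup.UB_pd_mul_le (h : Setup n α β Ω u) {x : E n} (hx : x ∈ Ω) {f g : E n → ℝ}
    (hf : DifferentiableAt ℝ f x) (hg : DifferentiableAt ℝ g x) :
    UB u x (pd (fun y => f y * g y) x) (pd (fun y => f y * g y) x) ≤
      2 * (f x ^ 2 * UB u x (pd g x) (pd g x)) + 2 * (g x ^ 2 * UB u x (pd f x) (pd f x)) := by
  have e : pd (fun y => f y * g y) x = f x • pd g x + g x • pd f x := by
    funext i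
    rw [pd_mul hf hg]
    simp only [Pi.add_apply, Pi.smul_apply, smul_eq_mul]
    ring
  rw [e]
  refine (h.UB_add_le hx _ _).trans_eq ?_
  rw [UB_smul_left, UB_smul_right, UB_smul_left, UB_smul_right]
  ring

lemma pd_one_sub (ξ : E n → ℝ) (x : E n) : pd (fun y => 1 - ξ y) x = (-1 : ℝ) • pd ξ x := by
  funext i
  simp [pd, fderiv_const_sub]

lemma UB_pd_one_sub (ξ : E n → ℝ) (x : E n) :
    UB u x (pd (fun y => 1 - ξ y) x) (pd (fun y => 1 - ξ y) x) = UB u x (pd ξ x) (pd ξ x) := by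
  rw [pd_one_sub, UB_smul_left, UB_smul_right]; ring

/-- Removing a small neighbourhood of a pole from a cutoff function. -/
lemma Setup.punctured_cutoff (h : Setup n α β Ω u) {G : Set (E n)} (hG : G ⊆ Ω) {p : E n}
    {ζ ξ : E n → ℝ} (hζ : ContDiff ℝ ∞ ζ) (hζc : HasCompactSupport ζ) (hζs : tsupport ζ ⊆ G)
    (hζ1 : ∀ x, 0 ≤ ζ x ∧ ζ x ≤ 1) (hξ : ContDiff ℝ ∞ ξ) (hξΩ : tsupport ξ ⊆ Ω)
    (hξc : HasCompactSupport ξ)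
    (hξ1 : ∀ x, 0 ≤ ξ x ∧ ξ x ≤ 1) (hN : ∃ N, IsOpen N ∧ p ∈ N ∧ ∀ x ∈ N, ξ x = 1) :
    ContDiff ℝ ∞ (fun x => ζ x * (1 - ξ x)) ∧ HasCompactSupport (fun x => ζ x * (1 - ξ x)) ∧
    tsupport (fun x => ζ x * (1 - ξ x)) ⊆ G \ {p} ∧
    ∫ x, UB u x (pd (fun x => ζ x * (1 - ξ x)) x) (pd (fun x => ζ x * (1 - ξ x)) x) ≤
      2 * (∫ x, UB u x (pd ζ x) (pd ζ x)) + 2 * ∫ x, UB u x (pd ξ x) (pd ξ x) := by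
  have hξ' : ContDiff ℝ ∞ fun x => 1 - ξ x := contDiff_const.sub hξ
  have hs1 : tsupport (fun x => ζ x * (1 - ξ x)) ⊆ tsupport ζ := tsupport_mul_subset_left
  refine ⟨hζ.mul hξ', hζc.mul_right, fun x hx => ⟨hζs (hs1 hx), ?_⟩, ?_⟩
  · rintro rfl
    obtain ⟨N, hNo, hxN, hN1⟩ := hN
    have : (fun y => ζ y * (1 - ξ y)) =ᶠ[nhds x] 0 := by
      filter_upwards [hNo.mem_nhds hxN] with y hy
      simp [hN1 y hy]
    exact (notMem_tsupport_iff_eventuallyEq.2 this) hx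
  · have i1 := h.integrable_energy hζ hζc (hζs.trans hG)
    have i2 := h.integrable_energy hξ hξc hξΩ
    rw [← integral_const_mul, ← integral_const_mul, ← integral_add (i1.const_mul 2) (i2.const_mul 2)]
    refine integral_mono_of_nonneg (Filter.Eventually.of_forall fun x =>
      h.UB_pd_nonneg (hs1.trans (hζs.trans hG)) x) ((i1.const_mul 2).add (i2.const_mul 2))
      (Filter.Eventually.of_forall fun x => ?_)
    by_cases hx : x ∈ Ω
    · refine (h.UB_pd_mul_le hx (hζ.differentiable (by simp)).differentiableAt
        (hξ'.differentiable (by simp)).differentiableAt).trans ?_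
      simp only [UB_pd_one_sub]
      have n1 := h.UB_nonneg hx (pd ζ x)
      have n2 := h.UB_nonneg hx (pd ξ x)
      have a1 : (1 - ξ x) ^ 2 ≤ 1 := by
        have := hξ1 x
        exact pow_le_one₀ (by linarith) (by linarith)
      have a2 : ζ x ^ 2 ≤ 1 := pow_le_one₀ (hζ1 x).1 (hζ1 x).2
      have := mul_le_of_le_one_left n1 a1
      have := mul_le_of_le_one_left n2 a2
      linarith
    · have e : pd (fun y => ζ y * (1 - ξ y)) x = 0 := by
        funext i
        exact pd_eq_zero_of_notMem_tsupport (fun hx' => hx ((hζs.trans hG) (hs1 hx'))) i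
      have e1 := h.UB_pd_nonneg (hζs.trans hG) x
      have e2 := h.UB_pd_nonneg hξΩ x
      simp only [e, UB_zero_left]
      positivity

/-- The two sets where a positive solution is large and where it is very small cannot both
have large measure. -/
theorem exists_log_density (n : ℕ) (α β : ℝ) : ∃ M ≥ (4 : ℝ), ∃ C > (0 : ℝ),
    ∀ (Ω : Set (E n)) (u : E n → ℝ), Setup n α β Ω u → ∀ y ∈ Ω, ∀ r > 0,
    CptIn (MASection Ω u y (M * r)) Ω → ∀ p ∈ Ω, ∀ w : E n → ℝ,
    Sol Ω u (MASection Ω u y (M * r) \ {p}) w →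
    (∀ x ∈ MASection Ω u y (M * r) \ {p}, 0 < w x) → ∀ l > 0, ∀ L > 0,
    (maMeasure u {x | x ∈ MASection Ω u y r \ {p} ∧ l ≤ w x} *
      maMeasure u {x | x ∈ MASection Ω u y r \ {p} ∧ w x ≤ l * Real.exp (-L)}) ^ 2 ≤
      C * maMeasure u (MASection Ω u y (M * r)) ^ 4 / L ^ 2 := by
  obtain ⟨M, hM4, C₁, hC₁0, hP⟩ := exists_poincare n α β
  obtain ⟨C₂, hC₂0, hζ⟩ := exists_sec_cutoff n α β
  obtain ⟨C₃, hC₃0, hΘ⟩ := exists_deriv_smoothTransition_le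
  refine ⟨M, hM4, C₁ * 16 * C₃ ^ 2 * C₂ / M, by positivity,
    fun Ω u h y hy r hr hcpt p hp w hw hwp l hl L hL => ?_⟩
  set S := MASection Ω u y (M * r) with hS
  set S' := MASection Ω u y (M * r / 2) with hS'
  have hMr : 0 < M * r := by positivity
  have hSo : IsOpen S := h.sec_open hcpt
  have hSΩ : S ⊆ Ω := subset_closure.trans hcpt.2
  have hrS : MASection Ω u y r ⊆ S := sec_mono (by nlinarith)
  have hrc : CptIn (MASection Ω u y r) Ω := CptIn.mono hcpt hrS
  have hro : IsOpen (MASection Ω u y r) := h.sec_open hrc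
  have hS'S : S' ⊆ S := sec_mono (by linarith)
  have hG : IsOpen (MASection Ω u y r \ {p}) := hro.sdiff isClosed_singleton
  have hwc : ContinuousOn w (MASection Ω u y r \ {p}) :=
    hw.cont.mono (Set.sdiff_subset_sdiff_left hrS)
  set E₀ := {x | x ∈ MASection Ω u y r \ {p} ∧ l ≤ w x} with hE₀
  set E₁ := {x | x ∈ MASection Ω u y r \ {p} ∧ w x ≤ l * Real.exp (-L)} with hE₁
  have hm₀ : MeasurableSet E₀ := measurableSet_inter_le hG continuousOn_const hwc
  have hm₁ : MeasurableSet E₁ := measurableSet_inter_le hG hwc continuousOn_const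
  obtain ⟨ζ, hζs, hζc, hζt, hζ1, hζe, hζE⟩ := hζ Ω u h y hy (M * r) hMr hcpt
  set m := maMeasure u S with hm
  have hm0 : 0 ≤ m := h.ma_nonneg hSo.measurableSet hSΩ
  have key : ∀ ρ > 0, (maMeasure u E₀ * maMeasure u (E₁ \ Metric.ball p ρ)) ^ 2 ≤
      C₁ * r * m ^ 3 * (2 * (C₃ / L) ^ 2 * (4 * (2 * (C₂ * m / (M * r)) + 2 * ρ)) + 2 * ρ) := by
    intro ρ hρ
    obtain ⟨ξ, hξ, hξb, hξΩ, hξ1, hξN, hξE⟩ := h.exists_pole_cutoff hp hρ hρ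
    have hξc : HasCompactSupport ξ :=
      Metric.isCompact_of_isClosed_isBounded (isClosed_tsupport ξ)
        (Metric.isBounded_ball.subset hξb)
    obtain ⟨hη, hηc, hηs, hηE⟩ :=
      h.punctured_cutoff hSΩ hζs hζc hζt hζ1 hξ hξΩ hξc hξ1 hξN
    set η := fun x => ζ x * (1 - ξ x) with hηd
    have iη := h.integrable_energy hη hηc (hηs.trans (Set.sdiff_subset.trans hSΩ))
    have hderiv : ∀ b : ℝ, deriv (fun b : ℝ => -b⁻¹) b = (b ^ 2)⁻¹ := fun b => by
      rw [deriv.fun_neg, deriv_inv]; ring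
    have hcac := h.caccioppoli hw hη hηc hηs (H := fun b => -b⁻¹)
      (fun x hx => (contDiffAt_inv ℝ (hwp x hx).ne').neg)
      (fun x hx => by rw [hderiv]; positivity) iη
      (fun x => h.UB_pd_nonneg (hηs.trans (Set.sdiff_subset.trans hSΩ)) x)
      (fun x hx => by rw [hderiv, neg_sq, inv_pow, mul_comm])
    simp only [hderiv] at hcac
    obtain ⟨iF, hF⟩ := hcac
    set H : ℝ → ℝ := fun b => Real.smoothTransition (Real.log (l / b) / L) with hH
    have hHs : ∀ b > 0, ContDiffAt ℝ ∞ H b := fun b hb =>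
      Real.smoothTransition.contDiffAt.comp b
        ((((contDiffAt_const.div contDiffAt_id hb.ne')).log (div_pos hl hb).ne').div_const L)
    have hHd : ∀ b > 0, deriv H b ^ 2 ≤ (C₃ / L) ^ 2 * (b ^ 2)⁻¹ := fun b hb => by
      have h1 : HasDerivAt (fun b : ℝ => Real.log (l / b) / L) (-b⁻¹ / L) b := by
        have h2 : HasDerivAt (fun b : ℝ => Real.log l - Real.log b) (0 - b⁻¹) b :=
          (hasDerivAt_const b _).sub (Real.hasDerivAt_log hb.ne')
        rw [zero_sub] at h2
        refine (h2.div_const L).congr_of_eventuallyEq ?_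
        filter_upwards [lt_mem_nhds hb] with c hc
        rw [Real.log_div hl.ne' hc.ne']
      have h3 : HasDerivAt H (deriv Real.smoothTransition (Real.log (l / b) / L) * (-b⁻¹ / L)) b :=
        HasDerivAt.comp (h := fun b : ℝ => Real.log (l / b) / L) (h₂ := Real.smoothTransition) b
          ((Real.smoothTransition.contDiffAt (n := 1)).differentiableAt (by simp)).hasDerivAt h1
      rw [h3.deriv]
      have h4 := deriv_smoothTransition_nonneg (Real.log (l / b) / L)
      have h5 := hΘ (Real.log (l / b) / L)
      rw [mul_pow, div_pow, div_pow, neg_sq, inv_pow]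
      have h6 := pow_le_pow_left₀ h4 h5 2
      calc _ ≤ C₃ ^ 2 * ((b ^ 2)⁻¹ / L ^ 2) := by gcongr
        _ = _ := by ring
    set f : E n → ℝ := fun x => (1 - ξ x) * H (w x) with hf
    have hξ' : ContDiff ℝ ∞ fun x => 1 - ξ x := contDiff_const.sub hξ
    have hHw : ∀ x ∈ S \ {p}, ContDiffAt ℝ ∞ (fun x => H (w x)) x := fun x hx =>
      (hHs _ (hwp x hx)).comp x (hw.smooth x hx)
    have hf0 : f =ᶠ[nhds p] fun _ => 0 := by
      obtain ⟨N, hNo, hpN, hN⟩ := hξN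
      filter_upwards [hNo.mem_nhds hpN] with x hx
      simp [hf, hN x hx]
    have hfs : ∀ x ∈ S, ContDiffAt ℝ ∞ f x := by
      intro x hx
      by_cases hxp : x = p
      · subst hxp
        exact contDiffAt_const.congr_of_eventuallyEq hf0
      · exact hξ'.contDiffAt.mul (hHw x ⟨hx, hxp⟩)
    have hPo := hP Ω u h y hy r hr hcpt f hfs E₀ (E₁ \ Metric.ball p ρ) hm₀
      (hm₁.diff Metric.isOpen_ball.measurableSet) (fun x hx => hx.1.1)
      (fun x hx => hx.1.1.1)
      (fun x hx => by
        have : H (w x) = 0 := Real.smoothTransition.zero_of_nonpos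
          (div_nonpos_of_nonpos_of_nonneg (Real.log_nonpos (by
            have := hx.2; have := hl.trans_le this; positivity)
            (div_le_one_of_le₀ hx.2 (hl.le.trans hx.2))) hL.le)
        simp [hf, this])
      (fun x hx => by
        have hw0 : 0 < w x := hwp x ⟨hrS hx.1.1.1, hx.1.1.2⟩
        have : H (w x) = 1 := Real.smoothTransition.one_of_one_le (by
          rw [one_le_div hL, Real.le_log_iff_exp_le (by positivity), le_div_iff₀ hw0]
          have h1 := hx.1.2
          rw [Real.exp_neg] at h1
          have h2 : Real.exp L * w x ≤ Real.exp L * (l * (Real.exp L)⁻¹) := by gcongr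
          rwa [mul_left_comm, mul_inv_cancel₀ (Real.exp_pos L).ne', mul_one] at h2)
        have h2 : ξ x = 0 := image_eq_zero_of_notMem_tsupport fun hx' => hx.2 (hξb hx')
        simp [hf, this, h2])
    refine hPo.trans (mul_le_mul_of_nonneg_left ?_ (by positivity))
    have iξ := h.integrable_energy hξ hξc hξΩ
    have hS'Ω := hS'S.trans hSΩ
    have hS'o : IsOpen S' := h.sec_open (CptIn.mono hcpt hS'S)
    set F := fun x => η x ^ 2 * (w x ^ 2)⁻¹ * UB u x (pd w x) (pd w x) with hFd
    have hFn : ∀ x, 0 ≤ F x := fun x => by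
      by_cases hx : x ∈ Ω
      · have := h.UB_nonneg hx (pd w x)
        simp only [hFd]; positivity
      · have : η x = 0 := image_eq_zero_of_notMem_tsupport (f := η) fun hx' =>
          hx (hSΩ (hηs hx').1)
        simp [hFd, this]
    have iG : Integrable fun x => 2 * (C₃ / L) ^ 2 * F x + 2 * UB u x (pd ξ x) (pd ξ x) :=
      (iF.const_mul _).add (iξ.const_mul 2)
    calc ∫ x in S', UB u x (pd f x) (pd f x)
        ≤ ∫ x in S', 2 * (C₃ / L) ^ 2 * F x + 2 * UB u x (pd ξ x) (pd ξ x) := by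
          refine integral_mono_of_nonneg ?_ iG.integrableOn ?_
          · filter_upwards [ae_restrict_mem hS'o.measurableSet] with x hx
            exact h.UB_nonneg (hS'Ω hx) _
          · filter_upwards [ae_restrict_mem hS'o.measurableSet] with x hx
            by_cases hxp : x = p
            · subst hxp
              have e : pd f x = 0 := by
                funext i
                rw [pd, hf0.fderiv_eq]; simp
              have := hFn x
              have := h.UB_pd_nonneg hξΩ x
              simp only [e, UB_zero_left]
              positivity
            · have hxS : x ∈ S \ {p} := ⟨hS'S hx, hxp⟩
              refine (h.UB_pd_mul_le (hS'Ω hx) (hξ'.differentiable (by simp)).differentiableAt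
                ((hHw x hxS).differentiableAt (by simp))).trans ?_
              rw [UB_pd_one_sub]
              have n1 := h.UB_nonneg (hS'Ω hx) (pd w x)
              have n2 := h.UB_nonneg (hS'Ω hx) (pd ξ x)
              have a2 : H (w x) ^ 2 ≤ 1 :=
                pow_le_one₀ (Real.smoothTransition.nonneg _) (Real.smoothTransition.le_one _)
              have e : pd (fun y => H (w y)) x = deriv H (w x) • pd w x := by
                funext i
                exact pd_comp ((hHs _ (hwp x hxS)).differentiableAt (by simp))
                  ((hw.smooth x hxS).differentiableAt (by simp)) i
              have b1 := hHd _ (hwp x hxS)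
              have e2 : η x = 1 - ξ x := by simp [hηd, hζe x hx]
              rw [e, UB_smul_left, UB_smul_right]
              have c1 := mul_le_of_le_one_left n2 a2
              have c2 : (1 - ξ x) ^ 2 * (deriv H (w x) * (deriv H (w x) * UB u x (pd w x) (pd w x)))
                  ≤ (C₃ / L) ^ 2 * F x := by
                calc _ = (1 - ξ x) ^ 2 * (deriv H (w x) ^ 2 * UB u x (pd w x) (pd w x)) := by ring
                  _ ≤ (1 - ξ x) ^ 2 * ((C₃ / L) ^ 2 * (w x ^ 2)⁻¹ * UB u x (pd w x) (pd w x)) := by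
                    gcongr
                  _ = _ := by simp only [hFd, e2]; ring
              linarith
      _ ≤ ∫ x, 2 * (C₃ / L) ^ 2 * F x + 2 * UB u x (pd ξ x) (pd ξ x) :=
          setIntegral_le_integral iG (Filter.Eventually.of_forall fun x => by
            have := hFn x
            have := h.UB_pd_nonneg hξΩ x
            simp only [Pi.zero_apply]
            positivity)
      _ = 2 * (C₃ / L) ^ 2 * (∫ x, F x) + 2 * ∫ x, UB u x (pd ξ x) (pd ξ x) := by
          rw [integral_add (iF.const_mul _) (iξ.const_mul 2), integral_const_mul,
            integral_const_mul]
      _ ≤ _ := by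
          have : ∫ x, F x ≤ 4 * (2 * (C₂ * m / (M * r)) + 2 * ρ) := hF.trans (by linarith)
          gcongr
  have hlim0 : Filter.Tendsto (fun k : ℕ => 1 / ((k : ℝ) + 1)) Filter.atTop (nhds 0) :=
    tendsto_one_div_add_atTop_nhds_zero_nat
  have hU : (⋃ k : ℕ, E₁ \ Metric.ball p (1 / ((k : ℝ) + 1))) = E₁ := by
    ext x
    simp only [Set.mem_iUnion, Set.mem_sdiff, Metric.mem_ball, not_lt]
    refine ⟨fun ⟨k, hx, _⟩ => hx, fun hx => ?_⟩
    have hd : 0 < dist x p := dist_pos.2 hx.1.2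
    obtain ⟨k, hk⟩ := exists_nat_one_div_lt hd
    exact ⟨k, hx, hk.le⟩
  have hlim1 : Filter.Tendsto (fun k : ℕ => maMeasure u (E₁ \ Metric.ball p (1 / ((k : ℝ) + 1))))
      Filter.atTop (nhds (maMeasure u E₁)) := by
    have := tendsto_setIntegral_of_monotone (μ := volume) (f := fun x => (Hess u x).det)
      (s := fun k : ℕ => E₁ \ Metric.ball p (1 / ((k : ℝ) + 1)))
      (fun k => hm₁.diff Metric.isOpen_ball.measurableSet)
      (fun i j hij => Set.sdiff_subset_sdiff_right (Metric.ball_subset_ball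
        (one_div_le_one_div_of_le (by positivity) (by exact_mod_cast Nat.succ_le_succ hij))))
      (by rw [hU]; exact (h.integrableOn_det hcpt).mono_set fun x hx => hrS hx.1.1)
    rwa [hU] at this
  have hfin := le_of_tendsto_of_tendsto' ((hlim1.const_mul (maMeasure u E₀)).pow 2)
    ((((((hlim0.const_mul 2).const_add (2 * (C₂ * m / (M * r)))).const_mul 4).const_mul
      (2 * (C₃ / L) ^ 2)).add (hlim0.const_mul 2)).const_mul (C₁ * r * m ^ 3))
    (fun k => key (1 / ((k : ℝ) + 1)) (by positivity))
  refine hfin.trans_eq ?_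
  field_simp
  ring

lemma maMeasure_mono_null {A B : Set (E n)} (hAB : A =ᵐ[volume] B) :
    maMeasure u A = maMeasure u B := setIntegral_congr_set hAB

lemma Setup.sdiff_ae_eq (h : Setup n α β Ω u) (A : Set (E n)) (p : E n) :
    (A \ {p} : Set (E n)) =ᵐ[volume] A := by
  have : Nonempty (Fin n) := ⟨⟨0, h.npos⟩⟩
  exact sdiff_null_ae_eq_self (measure_singleton p)

/-- A positive solution which is large on a portion of a section is bounded below on the
whole section. -/
theorem exists_growth (n : ℕ) (α β : ℝ) : ∃ K ≥ (4 : ℝ), ∀ ε > 0, ∃ c > (0 : ℝ), c ≤ 1 ∧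
    ∀ (Ω : Set (E n)) (u : E n → ℝ), Setup n α β Ω u → ∀ y ∈ Ω, ∀ r > 0,
    CptIn (MASection Ω u y (K * r)) Ω → ∀ p ∈ Ω, ∀ w : E n → ℝ,
    Sol Ω u (MASection Ω u y (K * r) \ {p}) w →
    (∀ x ∈ MASection Ω u y (K * r) \ {p}, 0 < w x) → ∀ l > 0,
    ε * maMeasure u (MASection Ω u y r) ≤
      maMeasure u {x | x ∈ MASection Ω u y r \ {p} ∧ l ≤ w x} →
    ∀ z ∈ MASection Ω u y r \ {p}, c * l ≤ w z := by
  obtain ⟨K₁, hK₁, K', hK', δ, hδ, hCD⟩ := exists_crit_density n α β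
  obtain ⟨M, hM, C, hC, hLD⟩ := exists_log_density n α β
  obtain ⟨Cm, hCm, hcmp⟩ := exists_ma_compare n α β (M * K₁)
  refine ⟨M * K₁, by nlinarith, fun ε hε => ?_⟩
  set κ := ε * δ / Cm ^ 2 with hκ
  have hκ0 : 0 < κ := by positivity
  set L := C / κ ^ 2 + 1 with hL
  have hL1 : 1 ≤ L := by rw [hL]; linarith [show 0 < C / κ ^ 2 by positivity]
  have hexp : Real.exp (-L) ≤ 1 := Real.exp_le_one_iff.2 (by linarith)
  refine ⟨Real.exp (-L) / K', by positivity,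
    (div_le_one (by linarith)).2 (hexp.trans hK'), ?_⟩
  intro Ω u h y hy r hr hcpt p hp w hw hwp l hl hE z hz
  by_contra! hlt
  have hK1r : 0 < K₁ * r := by positivity
  have hbig : MASection Ω u y (K₁ * r) ⊆ MASection Ω u y (M * K₁ * r) :=
    sec_mono (by nlinarith)
  have hsm : MASection Ω u y r ⊆ MASection Ω u y (K₁ * r) := sec_mono (by nlinarith)
  have hc1 : CptIn (MASection Ω u y (K₁ * r)) Ω := CptIn.mono hcpt hbig
  have hc0 : CptIn (MASection Ω u y r) Ω := CptIn.mono hc1 hsm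
  have hw1 : Sol Ω u (MASection Ω u y (K₁ * r) \ {p}) w :=
    hw.mono ((h.sec_open hc1).sdiff isClosed_singleton) (Set.sdiff_subset_sdiff_left hbig)
  have d1 := hCD Ω u h y hy r hr hc1 p hp w hw1
    (fun x hx => (hwp x ⟨hbig hx.1, hx.2⟩).le) (Real.exp (-L) / K' * l) (by positivity) z hz hlt.le
  have d2 := hLD Ω u h y hy (K₁ * r) hK1r (by rwa [← mul_assoc]) p hp w (by rwa [← mul_assoc])
    (by rwa [← mul_assoc]) l hl L (by linarith)
  rw [← mul_assoc M K₁ r] at d2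
  have e1 : K' * (Real.exp (-L) / K' * l) = l * Real.exp (-L) := by
    field_simp
  rw [e1] at d1
  set m := maMeasure u (MASection Ω u y (M * K₁ * r)) with hm
  have hm0 : 0 < m := h.ma_pos hy (by positivity) hcpt
  have c0 : m ≤ Cm * maMeasure u (MASection Ω u y r) :=
    hcmp Ω u h y hy y hy r hr (M * K₁ * r) (by positivity) le_rfl hcpt (hsm.trans hbig)
  have hmr : maMeasure u (MASection Ω u y r) ≤ maMeasure u (MASection Ω u y (K₁ * r)) :=
    h.ma_mono (h.sec_open hc1).measurableSet hc1 hsm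
  have hS1 : MeasurableSet {x | x ∈ MASection Ω u y (K₁ * r) \ {p} ∧ l ≤ w x} :=
    measurableSet_inter_le ((h.sec_open hc1).sdiff isClosed_singleton) continuousOn_const hw1.cont
  have hA : maMeasure u {x | x ∈ MASection Ω u y r \ {p} ∧ l ≤ w x} ≤
      maMeasure u {x | x ∈ MASection Ω u y (K₁ * r) \ {p} ∧ l ≤ w x} :=
    h.ma_mono hS1 (CptIn.mono hc1 fun x hx => hx.1.1) fun x hx => ⟨⟨hsm hx.1.1, hx.1.2⟩, hx.2⟩
  have b0 : ε * (m / Cm) ≤ maMeasure u {x | x ∈ MASection Ω u y (K₁ * r) \ {p} ∧ l ≤ w x} := by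
    refine le_trans ?_ (hE.trans hA)
    have : m / Cm ≤ maMeasure u (MASection Ω u y r) := by
      rw [div_le_iff₀ (by linarith), mul_comm]; exact c0
    exact mul_le_mul_of_nonneg_left this hε.le
  have b1 : δ * (m / Cm) ≤
      maMeasure u {x | x ∈ MASection Ω u y (K₁ * r) \ {p} ∧ w x ≤ l * Real.exp (-L)} := by
    refine le_trans ?_ d1
    have : m / Cm ≤ maMeasure u (MASection Ω u y (K₁ * r)) := by
      rw [div_le_iff₀ (by linarith), mul_comm]
      exact c0.trans (by gcongr)
    gcongr
  have b2 : (κ * m ^ 2) ^ 2 ≤ C * m ^ 4 / L ^ 2 := by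
    refine le_trans ?_ d2
    have : κ * m ^ 2 = (ε * (m / Cm)) * (δ * (m / Cm)) := by rw [hκ]; field_simp
    have h0 : 0 ≤ maMeasure u {x | x ∈ MASection Ω u y (K₁ * r) \ {p} ∧ l ≤ w x} :=
      le_trans (by positivity) b0
    rw [this]
    gcongr
  rw [le_div_iff₀ (by positivity)] at b2
  have b3 : κ ^ 2 * L ^ 2 ≤ C := by
    have : 0 < m ^ 4 := by positivity
    refine le_of_mul_le_mul_right ?_ this
    calc _ = (κ * m ^ 2) ^ 2 * L ^ 2 := by ring
      _ ≤ _ := b2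
  have b4 : C < κ ^ 2 * L := by rw [hL]; field_simp; linarith [show 0 < κ ^ 2 by positivity]
  have b5 : κ ^ 2 * L ≤ κ ^ 2 * L ^ 2 := by gcongr; exact le_self_pow₀ hL1 (by norm_num)
  linarith

/-- Lower bounds on a section propagate to dilated sections. -/
theorem exists_spread (n : ℕ) (α β : ℝ) : ∃ K ≥ (4 : ℝ), ∀ Λ ≥ (1 : ℝ), ∃ c > (0 : ℝ), c ≤ 1 ∧
    ∀ (Ω : Set (E n)) (u : E n → ℝ), Setup n α β Ω u → ∀ y ∈ Ω, ∀ r > 0,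
    CptIn (MASection Ω u y (K * (Λ * r))) Ω → ∀ p ∈ Ω, ∀ w : E n → ℝ,
    Sol Ω u (MASection Ω u y (K * (Λ * r)) \ {p}) w →
    (∀ x ∈ MASection Ω u y (K * (Λ * r)) \ {p}, 0 < w x) → ∀ l > 0,
    (∀ x ∈ MASection Ω u y r \ {p}, l ≤ w x) →
    ∀ z ∈ MASection Ω u y (Λ * r) \ {p}, c * l ≤ w z := by
  obtain ⟨K, hK, hG⟩ := exists_growth n α β
  refine ⟨K, hK, fun Λ hΛ => ?_⟩
  obtain ⟨Cm, hCm, hcmp⟩ := exists_ma_compare n α β Λ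
  obtain ⟨c, hc, hc1, hG⟩ := hG (1 / Cm) (by positivity)
  refine ⟨c, hc, hc1, fun Ω u h y hy r hr hcpt p hp w hw hwp l hl hlow => ?_⟩
  have hΛr : 0 < Λ * r := by positivity
  refine hG Ω u h y hy (Λ * r) hΛr hcpt p hp w hw hwp l hl ?_
  have hb : MASection Ω u y (Λ * r) ⊆ MASection Ω u y (K * (Λ * r)) := sec_mono (by nlinarith)
  have hs : MASection Ω u y r ⊆ MASection Ω u y (Λ * r) := sec_mono (by nlinarith)
  have hcb := CptIn.mono hcpt hb
  have c0 := hcmp Ω u h y hy y hy r hr (Λ * r) hΛr le_rfl hcb hs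
  rw [one_div_mul_eq_div, div_le_iff₀' (by linarith)]
  refine c0.trans (mul_le_mul_of_nonneg_left ?_ (by linarith))
  rw [← maMeasure_mono_null (h.sdiff_ae_eq (MASection Ω u y r) p)]
  refine h.ma_mono (measurableSet_inter_le ((h.sec_open hcb).sdiff isClosed_singleton)
    continuousOn_const ?_) (CptIn.mono hcb fun x hx => hx.1.1)
    fun x hx => ⟨⟨hs hx.1, hx.2⟩, hlow x hx⟩
  exact hw.cont.mono (Set.sdiff_subset_sdiff_left hb)

theorem exists_sub_sec (n : ℕ) (α β : ℝ) : ∃ c > (0 : ℝ), c ≤ 1 ∧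
    ∀ (Ω : Set (E n)) (u : E n → ℝ), Setup n α β Ω u → ∀ y ∈ Ω, ∀ t > 0,
    CptIn (MASection Ω u y (2 * t)) Ω → ∀ z ∈ closure Ω, dd u y z ≤ t →
    MASection Ω u z (c * t) ⊆ MASection Ω u y (3 / 2 * t) := by
  obtain ⟨c, hc, hsep⟩ := exists_separation n α β (γ := 1 / 3) (by norm_num) (by norm_num)
  refine ⟨min c 1, by positivity, min_le_right _ _, fun Ω u h y hy t ht hcpt z hz hyz x hx => ?_⟩
  obtain ⟨hx1, hx2⟩ := mem_section.1 hx
  refine mem_section.2 ⟨hx1, ?_⟩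
  by_contra! hge
  have := hsep Ω u h y hy (3 / 2 * t) (by positivity)
    (CptIn.mono hcpt (sec_mono (by linarith))) z hz (by linarith) x hx1 hge
  have h2 : min c 1 * t ≤ c * t := by gcongr; exact min_le_left _ _
  have h3 : 0 < c * t := by positivity
  linarith

theorem exists_sec_transfer (n : ℕ) (α β : ℝ) : ∃ C ≥ (1 : ℝ),
    ∀ (Ω : Set (E n)) (u : E n → ℝ), Setup n α β Ω u → ∀ y ∈ Ω, ∀ z ∈ Ω, ∀ r > 0,
    CptIn (MASection Ω u y (C * r)) Ω → CptIn (MASection Ω u z (C * r)) Ω → dd u y z ≤ r →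
    dd u z y ≤ C * r ∧ MASection Ω u z r ⊆ MASection Ω u y (C * r) := by
  obtain ⟨C, hC, hE⟩ := exists_engulf n α β
  refine ⟨2 * C ^ 2, by nlinarith, fun Ω u h y hy z hz r hr hc1 hc2 hyz => ?_⟩
  have hCr : C * r ≤ C ^ 2 * r := by
    have := le_self_pow₀ hC (two_ne_zero)
    gcongr
  have hrC : r ≤ C * r := by nlinarith
  have h1 : dd u z y ≤ C * r := hE Ω u h y hy r hr
    (CptIn.mono hc1 (sec_mono (by linarith))) z (subset_closure hz) hyz y (subset_closure hy)
    (by rw [dd_self]; positivity)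
  refine ⟨by nlinarith, fun x hx => ?_⟩
  obtain ⟨hx1, hx2⟩ := mem_section.1 hx
  have h2 := hE Ω u h z hz (C * r) (by positivity)
    (CptIn.mono hc2 (sec_mono (by linarith))) y (subset_closure hy) h1 x hx1 (by linarith)
  refine mem_section.2 ⟨hx1, ?_⟩
  have : 0 < C ^ 2 * r := by positivity
  nlinarith

/-- Quantitative separation of level sets of `dd u y`. -/
theorem exists_power_separation (n : ℕ) (α β : ℝ) : ∃ η > (0 : ℝ), ∃ c > (0 : ℝ),
    ∀ (Ω : Set (E n)) (u : E n → ℝ), Setup n α β Ω u → ∀ y ∈ Ω, ∀ t > 0,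
    CptIn (MASection Ω u y (2 * t)) Ω → ∀ x ∈ closure Ω, ∀ z ∈ closure Ω, dd u y x ≤ t →
    ∀ δ > 0, dd u y x + δ * t ≤ dd u y z → ∀ k : ℕ, 2 ≤ δ * (1 + η) ^ k →
    c * t ≤ 2 ^ k * dd u x z := by
  obtain ⟨η, hη, hB⟩ := exists_prolong n α β
  obtain ⟨c, hc, hc1, hs⟩ := exists_sub_sec n α β
  refine ⟨η, hη, c, hc, fun Ω u h y hy t ht hcpt x hx z hz hyx δ hδ hxz k hk => ?_⟩
  by_contra! hlt
  have hcx := hs Ω u h y hy t ht hcpt x hx hyx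
  have hxΩ : x ∈ Ω := hcpt.2 (subset_closure (mem_section.2 ⟨hx, by linarith⟩))
  have hcc : CptIn (MASection Ω u x (c * t)) Ω :=
    CptIn.mono hcpt (hcx.trans (sec_mono (by linarith)))
  have hind : ∀ j ≤ k, x + (1 + η) ^ j • (z - x) ∈ MASection Ω u x (2 ^ j / 2 ^ k * (c * t)) := by
    intro j
    induction j with
    | zero =>
      intro _
      refine mem_section.2 ⟨by simpa using hz, ?_⟩
      have e : x + (1 + η) ^ 0 • (z - x) = z := by simp
      rw [e, pow_zero, one_div_mul_eq_div, lt_div_iff₀ (by positivity), mul_comm]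
      exact hlt
    | succ j ih =>
      intro hj
      have h1 := ih (by omega)
      obtain ⟨h2, h3⟩ := mem_section.1 h1
      have hsz : (2 : ℝ) ^ (j + 1) / 2 ^ k * (c * t) ≤ c * t := by
        have : (2 : ℝ) ^ (j + 1) / 2 ^ k ≤ 1 :=
          (div_le_one (by positivity)).2 (pow_le_pow_right₀ (by norm_num) hj)
        exact mul_le_of_le_one_left (by positivity) this
      have h4 := hB Ω u h x hxΩ (2 ^ (j + 1) / 2 ^ k * (c * t)) (by positivity)
        (CptIn.mono hcc (sec_mono hsz)) _ h2 (by
          refine h3.le.trans_eq ?_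
          rw [pow_succ]; ring)
      rwa [add_sub_cancel_left, smul_smul, ← pow_succ'] at h4
  have hk1 := hind k le_rfl
  rw [div_self (by positivity), one_mul] at hk1
  obtain ⟨hw1, hw2⟩ := mem_section.1 (hcx hk1)
  set w := x + (1 + η) ^ k • (z - x) with hw
  have hP : 0 < (1 + η) ^ k := by positivity
  have hP1 : 1 ≤ (1 + η) ^ k := one_le_pow₀ (by linarith)
  have hconv := ((h.dd_convexOn y).2) hx hw1 (a := 1 - ((1 + η) ^ k)⁻¹) (b := ((1 + η) ^ k)⁻¹)
    (by rw [sub_nonneg]; exact inv_le_one_of_one_le₀ hP1) (by positivity) (by ring)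
  have e : (1 - ((1 + η) ^ k)⁻¹) • x + ((1 + η) ^ k)⁻¹ • w = z := by
    rw [hw, smul_add, smul_smul, inv_mul_cancel₀ hP.ne', one_smul, sub_smul, one_smul]
    abel
  rw [e, smul_eq_mul, smul_eq_mul] at hconv
  have h0 := h.dd_nonneg hy hx
  have h5 : δ * t ≤ ((1 + η) ^ k)⁻¹ * (dd u y w - dd u y x) := by linarith
  rw [inv_mul_eq_div, le_div_iff₀ hP] at h5
  nlinarith

/-- Lower bounds for positive solutions propagate between sections of comparable size. -/
theorem exists_chain (n : ℕ) (α β : ℝ) : ∃ c₁ > (0 : ℝ), ∀ c₀ > 0, c₀ ≤ c₁ → ∃ c > (0 : ℝ),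
    ∀ (Ω : Set (E n)) (u : E n → ℝ), Setup n α β Ω u → ∀ y ∈ Ω, ∀ t > 0,
    CptIn (MASection Ω u y (2 * t)) Ω → ∀ p ∈ Ω, ∀ w : E n → ℝ,
    Sol Ω u (MASection Ω u y (2 * t) \ {p}) w →
    (∀ x ∈ MASection Ω u y (2 * t) \ {p}, 0 < w x) → ∀ z ∈ closure Ω, dd u y z ≤ t →
    ∀ z' ∈ closure Ω, dd u y z' ≤ t → ∀ l > 0,
    (∀ x ∈ MASection Ω u z (c₀ * t) \ {p}, l ≤ w x) →
    ∀ x ∈ MASection Ω u z' (c₀ * t) \ {p}, c * l ≤ w x := by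
  obtain ⟨K, hK, hS⟩ := exists_spread n α β
  obtain ⟨cs, hcs, hcs1, hsub⟩ := exists_sub_sec n α β
  obtain ⟨CT, hCT, hT⟩ := exists_sec_transfer n α β
  obtain ⟨CE, hCE, hE⟩ := exists_engulf n α β
  obtain ⟨c, hc, hc1, hS⟩ := hS CT hCT
  refine ⟨cs / (K * CT), by positivity, fun c₀ hc₀ hc₀1 => ?_⟩
  obtain ⟨N, hN⟩ := exists_nat_gt (2 * CE * CT / c₀)
  refine ⟨c ^ N, by positivity,
    fun Ω u h y hy t ht hcpt p hp w hw hwp z hz hyz z' hz' hyz' l hl hlow => ?_⟩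
  have hNpos : (0 : ℝ) < N := lt_trans (by positivity) hN
  have hKCT : K * CT * c₀ ≤ cs := by rwa [le_div_iff₀' (by positivity)] at hc₀1
  have hSΩ : MASection Ω u y (2 * t) ⊆ Ω := subset_closure.trans hcpt.2
  have hin : ∀ x ∈ closure Ω, dd u y x ≤ t → x ∈ Ω := fun x hx hd =>
    hSΩ (mem_section.2 ⟨hx, by linarith⟩)
  have hsec : ∀ x ∈ closure Ω, dd u y x ≤ t → ∀ s ≤ cs * t,
      MASection Ω u x s ⊆ MASection Ω u y (2 * t) := fun x hx hd s hs =>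
    (sec_mono hs).trans ((hsub Ω u h y hy t ht hcpt x hx hd).trans (sec_mono (by linarith)))
  set ζ : ℕ → E n := fun i => z + ((i : ℝ) / N) • (z' - z) with hζ
  have hζd : ∀ i ≤ N, ζ i ∈ closure Ω ∧ dd u y (ζ i) ≤ t := by
    intro i hi
    have h1 : (0 : ℝ) ≤ (i : ℝ) / N := by positivity
    have h2 : (i : ℝ) / N ≤ 1 := (div_le_one hNpos).2 (by exact_mod_cast hi)
    have e : ζ i = (1 - (i : ℝ) / N) • z + ((i : ℝ) / N) • z' := by
      simp only [hζ, smul_sub, sub_smul, one_smul]; abel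
    rw [e]
    refine ⟨(h.dd_convexOn y).1 hz hz' (by linarith) h1 (by ring), ?_⟩
    refine (((h.dd_convexOn y).2) hz hz' (by linarith) h1 (by ring)).trans ?_
    simp only [smul_eq_mul]
    have a1 := mul_le_mul_of_nonneg_left hyz (sub_nonneg.2 h2)
    have a2 := mul_le_mul_of_nonneg_left hyz' h1
    linarith
  have hcc : ∀ i ≤ N, ∀ s ≤ cs * t, CptIn (MASection Ω u (ζ i) s) Ω := fun i hi s hs =>
    CptIn.mono hcpt (hsec _ (hζd i hi).1 (hζd i hi).2 s hs)
  have hbd : ∀ a ∈ closure Ω, dd u y a ≤ t → ∀ b ∈ closure Ω, dd u y b ≤ t →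
      dd u a b ≤ CE * t := fun a ha had b hb hbd =>
    hE Ω u h y hy t ht hcpt a ha had b hb (by linarith)
  have hKt : K * (CT * (c₀ * t)) ≤ cs * t := by
    calc _ = K * CT * c₀ * t := by ring
      _ ≤ _ := by gcongr
  have hCTt : CT * (c₀ * t) ≤ cs * t := by
    refine le_trans ?_ hKt
    exact le_mul_of_one_le_left (by positivity) (by linarith)
  have hct : c₀ * t ≤ cs * t := le_trans (le_mul_of_one_le_left (by positivity) hCT) hCTt
  have hstep : ∀ i < N, dd u (ζ i) (ζ (i + 1)) ≤ c₀ * t := by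
    intro i hi
    have hi' : (i : ℝ) + 1 ≤ N := by exact_mod_cast hi
    obtain ⟨p1, p2⟩ := hζd i hi.le
    obtain ⟨q1, q2⟩ := hζd (i + 1) hi
    have hi0 : (0 : ℝ) ≤ i := by positivity
    rw [div_lt_iff₀ hc₀] at hN
    have hlen : ∀ s : ℝ, N ≤ 2 * s → 1 / s * (CE * t) ≤ c₀ * t / CT := by
      intro s hs
      have hs0 : 0 < s := by linarith
      rw [le_div_iff₀ (by positivity), one_div_mul_eq_div, div_mul_eq_mul_div, div_le_iff₀ hs0]
      have : CE * CT ≤ s * c₀ := by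
        have := mul_le_mul_of_nonneg_right hs hc₀.le
        linarith
      have := mul_le_mul_of_nonneg_right this ht.le
      linarith
    rcases le_total (N : ℝ) (2 * (N - i)) with hc' | hc'
    · have hNi : (0 : ℝ) < N - i := by linarith
      have h1 := (h.dd_segment (hin _ p1 p2) hz' (t := 1 / (N - i)) (by positivity)
        ((div_le_one hNi).2 (by linarith))).2
      have e : ζ i + (1 / ((N : ℝ) - i)) • (z' - ζ i) = ζ (i + 1) := by
        have e1 : z' - ζ i = (1 - (i : ℝ) / N) • (z' - z) := by
          simp only [hζ, sub_smul, one_smul]; abel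
        rw [e1]
        simp only [hζ, add_assoc, smul_smul, ← add_smul]
        congr 2
        push_cast
        field_simp
      rw [e] at h1
      have h2 := hbd _ p1 p2 z' hz' hyz'
      have h3 := hlen _ hc'
      have h4 : c₀ * t / CT ≤ c₀ * t := div_le_self (by positivity) hCT
      exact h1.trans ((mul_le_mul_of_nonneg_left h2 (by positivity)).trans (h3.trans h4))
    · have h1 := (h.dd_segment (hin _ q1 q2) hz (t := 1 / ((i : ℝ) + 1)) (by positivity)
        ((div_le_one (by linarith)).2 (by linarith))).2
      have e : ζ (i + 1) + (1 / ((i : ℝ) + 1)) • (z - ζ (i + 1)) = ζ i := by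
        have e1 : z - ζ (i + 1) = (-(((i : ℝ) + 1) / N)) • (z' - z) := by
          simp only [hζ, neg_smul]; push_cast; abel
        rw [e1]
        simp only [hζ, add_assoc, smul_smul, ← add_smul]
        congr 2
        push_cast
        field_simp
        ring
      rw [e] at h1
      have h2 := hbd _ q1 q2 z hz hyz
      have h3 := hlen ((i : ℝ) + 1) (by linarith)
      have h5 := h1.trans ((mul_le_mul_of_nonneg_left h2 (by positivity)).trans h3)
      have e2 : CT * (c₀ * t / CT) = c₀ * t := by field_simp
      have h6 := (hT Ω u h _ (hin _ q1 q2) _ (hin _ p1 p2) (c₀ * t / CT) (by positivity)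
        (by rw [e2]; exact hcc _ hi _ hct) (by rw [e2]; exact hcc _ hi.le _ hct) h5).1
      rwa [e2] at h6
  have hind : ∀ i ≤ N, ∀ x ∈ MASection Ω u (ζ i) (c₀ * t) \ {p}, c ^ i * l ≤ w x := by
    intro i
    induction i with
    | zero =>
      intro _ x hx
      have e : ζ 0 = z := by simp [hζ]
      rw [e] at hx
      simpa using hlow x hx
    | succ i ih =>
      intro hi x hx
      have hi' : i ≤ N := by omega
      obtain ⟨p1, p2⟩ := hζd i hi'
      obtain ⟨q1, q2⟩ := hζd (i + 1) hi
      have h1 := (hT Ω u h _ (hin _ p1 p2) _ (hin _ q1 q2) (c₀ * t) (by positivity)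
        (hcc _ hi' _ hCTt) (hcc _ hi _ hCTt) (hstep i hi)).2
      have hss := hsec _ p1 p2 _ hKt
      have hcc' := hcc i hi' _ hKt
      have h2 := hS Ω u h _ (hin _ p1 p2) (c₀ * t) (by positivity) hcc' p hp w
        (hw.mono ((h.sec_open hcc').sdiff isClosed_singleton) (Set.sdiff_subset_sdiff_left hss))
        (fun x hx => hwp x ⟨hss hx.1, hx.2⟩) (c ^ i * l) (by positivity) (ih hi') x
        ⟨h1 hx.1, hx.2⟩
      calc c ^ (i + 1) * l = c * (c ^ i * l) := by ring
        _ ≤ w x := h2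
  intro x hx
  refine hind N le_rfl x ?_
  have e : ζ N = z' := by simp [hζ, hNpos.ne']
  rwa [e]

lemma one_le_one_add_mul_one_sub_pow {ν ν' : ℝ} (hν : 0 < ν) (hν' : ν' ≤ 1) {b : ℕ}
    (h : b * ν' * (1 + ν) ≤ ν) : 1 ≤ (1 + ν) * (1 - ν') ^ b := by
  have h1 := one_add_mul_le_pow (a := -ν') (by linarith) b
  rw [← sub_eq_add_neg] at h1
  have h2 := mul_le_mul_of_nonneg_left h1 (show 0 ≤ 1 + ν by linarith)
  linarith

/-- Starting from a point where the solution is nearly maximal on a section,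
one gets a lower bound on a smaller section. -/
theorem exists_lower_at_max (n : ℕ) (α β : ℝ) : ∃ K ≥ (1 : ℝ), ∃ ν > (0 : ℝ), ∃ c > (0 : ℝ),
    ∀ (Ω : Set (E n)) (u : E n → ℝ), Setup n α β Ω u → ∀ y ∈ Ω, ∀ r > 0,
    CptIn (MASection Ω u y (K * r)) Ω → ∀ p ∈ Ω, ∀ w : E n → ℝ,
    Sol Ω u (MASection Ω u y (K * r) \ {p}) w →
    (∀ x ∈ MASection Ω u y (K * r) \ {p}, 0 < w x) → y ≠ p →
    (∀ x ∈ MASection Ω u y r \ {p}, w x ≤ (1 + ν) * w y) →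
    ∀ x ∈ MASection Ω u y r \ {p}, c * w y ≤ w x := by
  obtain ⟨K₁, hK₁, K', hK', δ, hδ, hCD⟩ := exists_crit_density n α β
  obtain ⟨Kg, hKg, hG⟩ := exists_growth n α β
  obtain ⟨c, hc, hc1, hG⟩ := hG δ hδ
  have hK'0 : 0 < K' := by linarith
  refine ⟨Kg, by linarith, 1 / (2 * K'), by positivity, c / 2, by positivity,
    fun Ω u h y hy r hr hcpt p hp w hw hwp hyp hup => ?_⟩
  have hsm : MASection Ω u y r ⊆ MASection Ω u y (Kg * r) := sec_mono (by nlinarith)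
  have hcr : CptIn (MASection Ω u y r) Ω := CptIn.mono hcpt hsm
  have hwr : Sol Ω u (MASection Ω u y r \ {p}) w :=
    hw.mono ((h.sec_open hcr).sdiff isClosed_singleton) (Set.sdiff_subset_sdiff_left hsm)
  have hyr : y ∈ MASection Ω u y (r / K₁) \ {p} :=
    ⟨Setup.self_mem_sec hy (by positivity), hyp⟩
  have hy0 : 0 < w y := hwp y ⟨Setup.self_mem_sec hy (by positivity), hyp⟩
  have e1 : K₁ * (r / K₁) = r := by field_simp
  set v : E n → ℝ := fun x => (1 + 1 / (2 * K')) * w y + (0 : E n →L[ℝ] ℝ) (x - 0) - w x with hv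
  have hvs : Sol Ω u (MASection Ω u y r \ {p}) v := hwr.affine_sub _ _ _
  have hvy : ∀ x, v x = (1 + 1 / (2 * K')) * w y - w x := fun x => by simp [hv]
  have d1 := hCD Ω u h y hy (r / K₁) (by positivity) (by rwa [e1]) p hp v (by rwa [e1])
    (by rw [e1]; intro x hx; rw [hvy]; linarith [hup x hx]) (1 / (2 * K') * w y) (by positivity) y
    hyr (by rw [hvy]; linarith)
  rw [e1] at d1
  have key := hG Ω u h y hy r hr hcpt p hp w hw hwp (w y / 2) (by positivity) (d1.trans ?_)
  · intro x hx
    have := key x hx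
    linarith
  · refine h.ma_mono (measurableSet_inter_le hwr.op continuousOn_const hwr.cont)
      (CptIn.mono hcr fun x hx => hx.1.1) fun x hx => ⟨hx.1, ?_⟩
    have h2 := hx.2
    rw [hvy] at h2
    have e : K' * (1 / (2 * K') * w y) = w y / 2 := by field_simp
    rw [e] at h2
    have : 0 < 1 / (2 * K') * w y := by positivity
    linarith

set_option maxHeartbeats 2000000 in
/-- Harnack inequality on the boundary of a section around the pole. -/
theorem exists_harnack (n : ℕ) (α β : ℝ) : ∃ C ≥ (1 : ℝ),
    ∀ (Ω : Set (E n)) (u : E n → ℝ), Setup n α β Ω u → ∀ y ∈ Ω, ∀ t > 0,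
    CptIn (MASection Ω u y (2 * t)) Ω → ∀ g : E n → ℝ,
    Sol Ω u (MASection Ω u y (2 * t) \ {y}) g →
    (∀ x ∈ MASection Ω u y (2 * t) \ {y}, 0 < g x) →
    (∀ M : ℝ, (∀ x ∈ closure Ω, dd u y x = t → g x ≤ M) →
      ∀ x ∈ MASection Ω u y (2 * t), t ≤ dd u y x → g x ≤ M) →
    ∀ z ∈ closure Ω, dd u y z = t → ∀ z' ∈ closure Ω, dd u y z' = t → g z' ≤ C * g z := by
  obtain ⟨Km, hKm, ν, hν, c₃, hc₃, hmax⟩ := exists_lower_at_max n α β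
  obtain ⟨Ks, hKs, hspread⟩ := exists_spread n α β
  obtain ⟨c₂, hc₂, hc₂1, hspread⟩ := hspread 2 (by norm_num)
  obtain ⟨η, hη, cp, hcp, hsep⟩ := exists_power_separation n α β
  obtain ⟨cs, hcs, hcs1, hsub⟩ := exists_sub_sec n α β
  obtain ⟨CT, hCT, hT⟩ := exists_sec_transfer n α β
  obtain ⟨c₁, hc₁, hchain⟩ := exists_chain n α β
  set D := Km + Ks + 2 * CT with hD
  have hD0 : 0 < D := by linarith
  set m₀ := min (min cs cp) c₁ with hm₀
  have hm0 : 0 < m₀ := by positivity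
  set c₀ := m₀ / D with hc₀
  have hc₀0 : 0 < c₀ := by positivity
  have hDc : D * c₀ = m₀ := by rw [hc₀]; field_simp
  have hcs' : m₀ ≤ cs := (min_le_left _ _).trans (min_le_left _ _)
  have hcp' : m₀ ≤ cp := (min_le_left _ _).trans (min_le_right _ _)
  have hc₁' : c₀ ≤ c₁ := (div_le_self hm0.le (by linarith)).trans (min_le_right _ _)
  obtain ⟨cc, hcc, hchain⟩ := hchain c₀ hc₀0 hc₁'
  obtain ⟨b, hb⟩ := pow_unbounded_of_one_lt (1 / c₂) (show 1 < 1 + η by linarith)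
  have hb0 : b ≠ 0 := by
    rintro rfl
    rw [pow_zero, div_lt_one hc₂] at hb
    linarith
  have hb1 : (1 : ℝ) ≤ b := by exact_mod_cast Nat.one_le_iff_ne_zero.2 hb0
  set ν' := ν / (b * (1 + ν)) with hν'
  have hν'0 : 0 < ν' := by positivity
  have hν'1 : ν' < 1 := by
    rw [hν', div_lt_one (by positivity)]
    calc ν < 1 * (1 + ν) := by linarith only
      _ ≤ b * (1 + ν) := by gcongr
  have hbern : 1 ≤ (1 + ν) * (1 - ν') ^ b :=
    one_le_one_add_mul_one_sub_pow hν hν'1.le (by rw [hν']; field_simp; exact le_rfl)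
  set A := 2 * (1 + η) / ν' with hA
  have hA0 : 0 < A := by positivity
  refine ⟨(2 * A) ^ b / (c₃ * cc) + 1, by
      have : 0 < (2 * A) ^ b / (c₃ * cc) := by positivity
      linarith,
    fun Ω u h y hy t ht hcpt g hg hgp hmp z hz hyz z' hz' hyz' => ?_⟩
  set S := MASection Ω u y (2 * t) with hS
  have hSΩ : S ⊆ Ω := subset_closure.trans hcpt.2
  have hin : ∀ x ∈ closure Ω, dd u y x ≤ t → x ∈ S := fun x hx hd =>
    mem_section.2 ⟨hx, by linarith⟩
  have hne : ∀ x, 0 < dd u y x → x ≠ y := by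
    rintro x hx rfl
    rw [dd_self] at hx
    exact lt_irrefl _ hx
  have hclΩ : IsCompact (closure Ω) := Metric.isCompact_of_isClosed_isBounded isClosed_closure
    h.bdd.closure
  -- the maximum on the level set
  set Γ := closure Ω ∩ dd u y ⁻¹' {t} with hΓ
  have hΓc : IsCompact Γ := hclΩ.of_isClosed_subset
    ((h.dd_cont y).preimage_isClosed_of_isClosed isClosed_closure isClosed_singleton)
    Set.inter_subset_left
  have hΓS : Γ ⊆ S \ {y} := fun x hx =>
    ⟨hin x hx.1 (le_of_eq hx.2), hne x (by rw [show dd u y x = t from hx.2]; exact ht)⟩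
  obtain ⟨zM, hzM, hzMmax⟩ := hΓc.exists_isMaxOn ⟨z, hz, hyz⟩ (hg.cont.mono hΓS)
  set M := g zM with hM
  have hM0 : 0 < M := hgp _ (hΓS hzM)
  have hMout := hmp M fun x hx hd => hzMmax (show x ∈ Γ from ⟨hx, hd⟩)
  -- the weighted maximum
  set Q := closure Ω ∩ dd u y ⁻¹' Set.Icc (t / 2) t with hQ
  have hQc : IsCompact Q := hclΩ.of_isClosed_subset
    ((h.dd_cont y).preimage_isClosed_of_isClosed isClosed_closure isClosed_Icc)
    Set.inter_subset_left
  have hQS : Q ⊆ S \ {y} := fun x hx => ⟨hin x hx.1 hx.2.2, hne x (by linarith [hx.2.1])⟩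
  obtain ⟨q, hq, hqmax⟩ := hQc.exists_isMaxOn
    (f := fun x => g x * (dd u y x - t / 2) ^ b) ⟨z, hz, by
      simp only [Set.mem_preimage, hyz]; exact ⟨by linarith, le_rfl⟩⟩
    ((hg.cont.mono hQS).mul ((((h.dd_cont y).mono Set.inter_subset_left).sub
      continuousOn_const).pow b))
  have hqm : ∀ x ∈ closure Ω, t / 2 ≤ dd u y x → dd u y x ≤ t →
      g x * (dd u y x - t / 2) ^ b ≤ g q * (dd u y q - t / 2) ^ b := fun x hx h1 h2 =>
    hqmax (show x ∈ Q from ⟨hx, h1, h2⟩)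
  set σ := dd u y q - t / 2 with hσ
  have hqt : dd u y q ≤ t := hq.2.2
  have hqcl : q ∈ closure Ω := hq.1
  have hqS := hQS hq
  have hqΩ : q ∈ Ω := hSΩ hqS.1
  have hgq : 0 < g q := hgp q hqS
  have hMσ : M * (t / 2) ^ b ≤ g q * σ ^ b := by
    have := hqm zM hzM.1 (by rw [show dd u y zM = t from hzM.2]; linarith) (le_of_eq hzM.2)
    rwa [show dd u y zM = t from hzM.2, show t - t / 2 = t / 2 by ring] at this
  have hσ0 : 0 < σ := by
    have h1 : 0 ≤ σ := by have := hq.2.1; rw [hσ]; linarith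
    refine lt_of_le_of_ne h1 fun h0 => ?_
    rw [← h0, zero_pow hb0, mul_zero] at hMσ
    have : 0 < M * (t / 2) ^ b := by positivity
    linarith
  have hσt : σ ≤ t / 2 := by rw [hσ]; linarith
  have hMq : M ≤ g q := by
    have h1 : g q * σ ^ b ≤ g q * (t / 2) ^ b := by gcongr
    exact le_of_mul_le_mul_right (hMσ.trans h1) (by positivity)
  obtain ⟨j, hj1, hj2⟩ := exists_nat_pow_near (x := 2 * t / (ν' * σ)) (y := 1 + η)
    (by
      rw [one_le_div (by positivity)]
      calc ν' * σ ≤ 1 * σ := by gcongr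
        _ ≤ 2 * t := by linarith only [hσt, ht]) (by linarith)
  set k := j + 1 with hk
  set r := c₀ * t / 2 ^ k with hr
  have hr0 : 0 < r := by positivity
  have h2k : (1 : ℝ) ≤ 2 ^ k := one_le_pow₀ (by norm_num)
  have hrc : r ≤ c₀ * t := div_le_self (by positivity) h2k
  have hbig : ∀ C ≤ D, C * (c₀ * t) ≤ cs * t := fun C hC => by
    calc C * (c₀ * t) ≤ D * (c₀ * t) := by gcongr
      _ = m₀ * t := by rw [← hDc]; ring
      _ ≤ _ := by gcongr
  have hsec : ∀ x ∈ closure Ω, dd u y x ≤ t → ∀ s ≤ cs * t, MASection Ω u x s ⊆ S :=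
    fun x hx hd s hs => (sec_mono hs).trans
      ((hsub Ω u h y hy t ht hcpt x hx hd).trans (sec_mono (by linarith)))
  have hcq : ∀ x ∈ closure Ω, dd u y x ≤ t → ∀ s ≤ cs * t, CptIn (MASection Ω u x s) Ω :=
    fun x hx hd s hs => CptIn.mono hcpt (hsec x hx hd s hs)
  have hsol : ∀ s ≤ cs * t, Sol Ω u (MASection Ω u q s \ {y}) g := fun s hs =>
    hg.mono ((h.sec_open (hcq q hqcl hqt s hs)).sdiff isClosed_singleton)
      (Set.sdiff_subset_sdiff_left (hsec q hqcl hqt s hs))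
  have hpos : ∀ s ≤ cs * t, ∀ x ∈ MASection Ω u q s \ {y}, 0 < g x := fun s hs x hx =>
    hgp x ⟨hsec q hqcl hqt s hs hx.1, hx.2⟩
  -- the section around the weighted maximum stays in an outer region
  have hout : ∀ x ∈ MASection Ω u q r, dd u y q - ν' * σ ≤ dd u y x := by
    intro x hx
    by_contra! hlt
    obtain ⟨hx1, hx2⟩ := mem_section.1 hx
    have hνσ : 0 < ν' * σ := by positivity
    have hxt : dd u y x ≤ t := by linarith
    have s1 := hsep Ω u h y hy t ht hcpt x hx1 q hqcl hxt (ν' * σ / t) (by positivity)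
      (by rw [div_mul_cancel₀ _ ht.ne']; linarith) k (by
        rw [div_lt_iff₀ (by positivity)] at hj2
        rw [div_mul_eq_mul_div, le_div_iff₀ ht]
        linarith)
    have hCTr : CT * r ≤ cs * t := (mul_le_mul_of_nonneg_left hrc (by linarith)).trans
      (hbig CT (by rw [hD]; linarith))
    have s2 := (hT Ω u h q hqΩ x (hSΩ (hin x hx1 hxt)) r hr0 (hcq q hqcl hqt _ hCTr)
      (hcq x hx1 hxt _ hCTr) hx2.le).1
    have s3 : 2 ^ k * dd u x q ≤ CT * (c₀ * t) := by
      calc 2 ^ k * dd u x q ≤ 2 ^ k * (CT * r) := by gcongr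
        _ = CT * (c₀ * t) := by rw [hr]; field_simp
    have s4 : 2 * (CT * (c₀ * t)) ≤ cp * t := by
      calc 2 * (CT * (c₀ * t)) = (2 * CT) * (c₀ * t) := by ring
        _ ≤ D * (c₀ * t) := by gcongr; rw [hD]; linarith
        _ = m₀ * t := by rw [← hDc]; ring
        _ ≤ _ := by gcongr
    have s5 : 0 < CT * (c₀ * t) := by positivity
    linarith
  have hup : ∀ x ∈ MASection Ω u q r \ {y}, g x ≤ (1 + ν) * g q := by
    intro x hx
    have h1 := hout x hx.1
    have hxcl := (mem_section.1 hx.1).1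
    have hxS := hsec q hqcl hqt r (by
      have := hbig 1 (by rw [hD]; linarith)
      linarith) hx.1
    have hgx := hgp x ⟨hxS, hx.2⟩
    rcases le_total t (dd u y x) with h2 | h2
    · exact (hMout x hxS h2).trans (hMq.trans (le_mul_of_one_le_left hgq.le (by linarith only [hν])))
    · have h3 : (1 - ν') * σ ≤ dd u y x - t / 2 := by rw [hσ] at h1 ⊢; linarith
      have h4 : 0 ≤ (1 - ν') * σ := mul_nonneg (by linarith) hσ0.le
      have h5 := hqm x hxcl (by linarith) h2
      have h6 : g x * ((1 - ν') * σ) ^ b ≤ g q * σ ^ b := by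
        refine le_trans ?_ h5
        gcongr
      rw [mul_pow, ← mul_assoc] at h6
      have h7 := le_of_mul_le_mul_right h6 (by positivity)
      calc g x = 1 * g x := by ring
        _ ≤ ((1 + ν) * (1 - ν') ^ b) * g x := by gcongr
        _ = (1 + ν) * (g x * (1 - ν') ^ b) := by ring
        _ ≤ _ := by gcongr
  have hKmr : Km * r ≤ cs * t := (mul_le_mul_of_nonneg_left hrc (by linarith)).trans
    (hbig Km (by rw [hD]; linarith))
  have hlow := hmax Ω u h q hqΩ r hr0 (hcq q hqcl hqt _ hKmr) y hy g (hsol _ hKmr) (hpos _ hKmr)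
    hqS.2 hup
  have hasc : ∀ i ≤ k, ∀ x ∈ MASection Ω u q (2 ^ i * r) \ {y}, c₂ ^ i * (c₃ * g q) ≤ g x := by
    intro i
    induction i with
    | zero => intro _ x hx; simpa using hlow x (by simpa using hx)
    | succ i ih =>
      intro hi x hx
      have e : (2 : ℝ) ^ (i + 1) * r = 2 * (2 ^ i * r) := by ring
      have hle : Ks * (2 * (2 ^ i * r)) ≤ cs * t := by
        rw [← e]
        refine le_trans (mul_le_mul_of_nonneg_left ?_ (by linarith))
          (hbig Ks (by rw [hD]; linarith))
        rw [hr, mul_div_assoc', div_le_iff₀ (by positivity), mul_comm]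
        gcongr
        norm_num
      have := hspread Ω u h q hqΩ (2 ^ i * r) (by positivity) (hcq q hqcl hqt _ hle) y hy g
        (hsol _ hle) (hpos _ hle) (c₂ ^ i * (c₃ * g q)) (by positivity) (ih (by omega)) x
        (by rwa [← e])
      calc c₂ ^ (i + 1) * (c₃ * g q) = c₂ * (c₂ ^ i * (c₃ * g q)) := by ring
        _ ≤ g x := this
  have hasck := hasc k le_rfl
  have e2 : 2 ^ k * r = c₀ * t := by rw [hr]; field_simp
  rw [e2] at hasck
  have hfin := hchain Ω u h y hy t ht hcpt y hy g hg hgp q hqcl hqt z hz hyz.le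
    (c₂ ^ k * (c₃ * g q)) (by positivity) hasck z
    ⟨Setup.self_mem_sec (hSΩ (hin z hz hyz.le)) (by positivity),
      hne z (by rw [hyz]; exact ht)⟩
  -- compare with the maximum
  have hσk : σ * (1 + η) ^ k ≤ A * t := by
    rw [le_div_iff₀ (by positivity)] at hj1
    rw [hA, div_mul_eq_mul_div, le_div_iff₀ hν'0, hk, pow_succ]
    have := mul_le_mul_of_nonneg_left hj1 (show 0 ≤ 1 + η by linarith)
    linarith
  have hc2k : 1 ≤ c₂ ^ k * ((1 + η) ^ k) ^ b := by
    rw [← pow_mul, mul_comm k b, pow_mul, ← mul_pow]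
    refine one_le_pow₀ ?_
    rw [div_lt_iff₀ hc₂] at hb
    linarith
  have hMfin : M ≤ (2 * A) ^ b * (c₂ ^ k * g q) := by
    have h1 : σ ^ b ≤ (A * t) ^ b * c₂ ^ k := by
      calc σ ^ b = σ ^ b * 1 := by ring
        _ ≤ σ ^ b * (c₂ ^ k * ((1 + η) ^ k) ^ b) := by gcongr
        _ = (σ * (1 + η) ^ k) ^ b * c₂ ^ k := by ring_nf
        _ ≤ _ := by gcongr
    have h2 : M * (t / 2) ^ b ≤ (2 * A) ^ b * (c₂ ^ k * g q) * (t / 2) ^ b := by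
      calc M * (t / 2) ^ b ≤ g q * σ ^ b := hMσ
        _ ≤ g q * ((A * t) ^ b * c₂ ^ k) := by gcongr
        _ = g q * c₂ ^ k * ((2 * A) * (t / 2)) ^ b := by
          rw [show 2 * A * (t / 2) = A * t by ring]; ring
        _ = _ := by rw [mul_pow]; ring
    exact le_of_mul_le_mul_right h2 (by positivity)
  have hgz : 0 < g z := hgp z (hΓS ⟨hz, hyz⟩)
  have hz'M : g z' ≤ M := hzMmax (show z' ∈ Γ from ⟨hz', hyz'⟩)
  calc g z' ≤ (2 * A) ^ b * (c₂ ^ k * g q) := hz'M.trans hMfin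
    _ = (2 * A) ^ b / (c₃ * cc) * (cc * (c₂ ^ k * (c₃ * g q))) := by field_simp
    _ ≤ (2 * A) ^ b / (c₃ * cc) * g z := by gcongr
    _ ≤ _ := by gcongr; linarith

lemma pd_of_eventually_const {f : E n → ℝ} {x : E n} {c : ℝ} (hf : f =ᶠ[nhds x] fun _ => c)
    (i : Fin n) : pd f x i = 0 := by
  rw [pd_congr hf]; simp [pd]

lemma Lu_of_eventually_const {f : E n → ℝ} {x : E n} {c : ℝ} (hf : f =ᶠ[nhds x] fun _ => c) :
    Lu u f x = 0 := by
  refine Finset.sum_eq_zero fun i _ => Finset.sum_eq_zero fun j _ => ?_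
  have h1 : (fun y => fderiv ℝ f y (EuclideanSpace.single j 1)) =ᶠ[nhds x] fun _ => (0 : ℝ) := by
    filter_upwards [hf.fderiv (𝕜 := ℝ)] with y hy
    rw [hy]; simp
  rw [pd2, h1.fderiv_eq]; simp

/-- A Green's function with its standing assumptions. -/
structure Green (n : ℕ) (α β : ℝ) (Ω : Set (E n)) (u : E n → ℝ) (V : Set (E n)) (p : E n)
    (g : E n → ℝ) : Prop where
  setup : Setup n α β Ω u
  op : IsOpen V
  cpt : CptIn V Ω
  mem : p ∈ V
  green : IsGreen u V p g

namespace Green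

variable {V : Set (E n)} {p : E n} {g : E n → ℝ}

lemma sub (G : Green n α β Ω u V p g) : V ⊆ Ω := subset_closure.trans G.cpt.2

lemma pos (G : Green n α β Ω u V p g) {x : E n} (hx : x ∈ V) (hxp : x ≠ p) : 0 < g x :=
  G.green.1 x ⟨hx, hxp⟩

lemma sol (G : Green n α β Ω u V p g) : Sol Ω u (V \ {p}) g where
  op := G.op.sdiff isClosed_singleton
  sub := Set.sdiff_subset.trans G.sub
  smooth := fun x hx => (G.green.2.1 x hx).contDiffAt
    ((G.op.sdiff isClosed_singleton).mem_nhds hx)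
  eq := G.green.2.2.1

lemma level_compact (G : Green n α β Ω u V p g) (m : ℝ) :
    IsCompact {x ∈ closure V | x = p ∨ m ≤ g x} := by
  obtain ⟨O, hO, hOe⟩ := continuousOn_iff'.1 G.green.2.2.2.1 (Set.Iio m) isOpen_Iio
  have : {x ∈ closure V | x = p ∨ m ≤ g x} = closure V \ (O \ {p}) := by
    ext x
    simp only [Set.mem_sdiff, Set.mem_ofPred_eq, Set.mem_singleton_iff]
    refine and_congr_right fun hx => ?_
    by_cases hxp : x = p
    · simp [hxp]
    · have := Set.ext_iff.1 hOe x
      simp only [Set.mem_inter_iff, Set.mem_preimage, Set.mem_Iio, Set.mem_sdiff,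
        Set.mem_singleton_iff, hx, hxp, not_false_eq_true, and_true] at this
      simp only [hxp, not_false_eq_true, and_true, ← this, not_lt, false_or]
  rw [this]
  exact G.cpt.1.diff (hO.sdiff isClosed_singleton)

lemma level_subset (G : Green n α β Ω u V p g) {m : ℝ} (hm : 0 < m) :
    {x ∈ closure V | x = p ∨ m ≤ g x} ⊆ V := by
  rintro x ⟨hx, rfl | hx2⟩
  · exact G.mem
  · by_contra hxV
    have : x ∈ frontier V := by rw [frontier, G.op.interior_eq]; exact ⟨hx, hxV⟩
    rw [G.green.2.2.2.2.1 x this] at hx2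
    linarith

lemma flux (G : Green n α β Ω u V p g) {φ : E n → ℝ} (hφ : ContDiff ℝ ∞ φ)
    (hc : HasCompactSupport φ) (hs : tsupport φ ⊆ V) {N : Set (E n)} (hN : IsOpen N) (hpN : p ∈ N)
    {c : ℝ} (hφc : ∀ x ∈ N, φ x = c) : ∫ x, UB u x (pd g x) (pd φ x) = c := by
  have hW : IsOpen (V \ {p}) := G.op.sdiff isClosed_singleton
  obtain ⟨ζ, hζ, hζc, hζs, -, N', hN', hKN', hζ1⟩ := exists_cutoff (K := tsupport φ \ N)
    (hc.isCompact.diff hN) hW fun x hx => ⟨hs hx.1, fun e => hx.2 (e ▸ hpN)⟩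
  have ha := contDiff_mul_of_tsupport hζ hζs G.sol.smooth
  have hac : HasCompactSupport fun x => ζ x * g x := hζc.mul_right
  obtain ⟨L, haL⟩ := ha.lipschitzWith_of_hasCompactSupport hac (by simp)
  have has : (tsupport fun x => ζ x * g x) ⊆ Ω :=
    (tsupport_mul_subset_left (g := g)).trans (hζs.trans G.sol.sub)
  have key := integral_mul_Lu G.setup.op G.setup.smooth (fun x hx j => G.setup.piola hx j) haL hac
    has (fun x _ => hφ.contDiffAt)
  have hcase : ∀ x, (∃ d, φ =ᶠ[nhds x] fun _ => d) ∨ ζ =ᶠ[nhds x] fun _ => (1 : ℝ) := by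
    intro x
    by_cases hxN : x ∈ N
    · exact Or.inl ⟨c, by filter_upwards [hN.mem_nhds hxN] with y hy using hφc y hy⟩
    · by_cases hxs : x ∈ tsupport φ
      · exact Or.inr (by
          filter_upwards [hN'.mem_nhds (hKN' ⟨hxs, hxN⟩)] with y hy using hζ1 y hy)
      · exact Or.inl ⟨0, notMem_tsupport_iff_eventuallyEq.1 hxs⟩
  have e1 : ∫ x, ζ x * g x * Lu u φ x = -c := by
    rw [← hφc p hpN, ← G.green.2.2.2.2.2 φ hφ hc hs,
      LinMA.integral_eq_setIntegral (G := V)]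
    · refine integral_congr_ae (Filter.Eventually.of_forall fun x => ?_)
      change ζ x * g x * Lu u φ x = g x * Lu u φ x
      rcases hcase x with ⟨d, hd⟩ | hd
      · rw [Lu_of_eventually_const hd]; simp
      · rw [hd.eq_of_nhds]; simp
    · intro x hx
      rw [Lu_of_eventually_const (notMem_tsupport_iff_eventuallyEq.1 fun h => hx (hs h)), mul_zero]
  have e2 : ∫ x, UB u x (pd g x) (pd φ x) = ∫ x, UB u x (pd (fun x => ζ x * g x) x) (pd φ x) := by
    refine integral_congr_ae (Filter.Eventually.of_forall fun x => ?_)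
    rcases hcase x with ⟨d, hd⟩ | hd
    · have : pd φ x = 0 := funext fun i => pd_of_eventually_const hd i
      simp only [this, UB_zero_right]
    · have : pd (fun x => ζ x * g x) x = pd g x := funext fun i => pd_congr (by
        filter_upwards [hd] with y hy
        rw [hy, one_mul]) i
      simp only [this]
  rw [e1] at key
  rw [e2]
  linarith

/-- Outside a section around the pole, `g` is at most its maximum on the boundary. -/
lemma le_of_outside (G : Green n α β Ω u V p g) {t M : ℝ} (ht : 0 < t) (hM : 0 < M)
    (hb : ∀ x ∈ V, dd u p x = t → g x ≤ M) : ∀ x ∈ V, t ≤ dd u p x → g x ≤ M := by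
  have h := G.setup
  have hcl : closure V ⊆ closure Ω := closure_mono G.sub
  intro x hx hxt
  rcases hxt.eq_or_lt with he | hlt
  · exact hb x hx he.symm
  refine le_of_forall_pos_le_add fun ε hε => ?_
  set D := {z ∈ V | t < dd u p z} with hD
  have hDV : D ⊆ V := fun z hz => hz.1
  have hDo : IsOpen D := by
    have := ((h.dd_cont p).mono (G.sub.trans subset_closure)).isOpen_inter_preimage G.op
      (isOpen_Ioi (a := t))
    exact this
  have hpD : ∀ z ∈ D, z ≠ p := by
    rintro z hz rfl
    have := hz.2
    rw [dd_self] at this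
    linarith
  set K := {z ∈ closure V | z = p ∨ M + ε ≤ g z} ∩ (closure V ∩ dd u p ⁻¹' Set.Ici t) with hK
  have hKc : IsCompact K := (G.level_compact _).inter_right
    (((h.dd_cont p).mono hcl).preimage_isClosed_of_isClosed isClosed_closure isClosed_Ici)
  have hKD : K ⊆ D := by
    intro z hz
    have hzV := G.level_subset (by linarith) hz.1
    refine ⟨hzV, lt_of_le_of_ne hz.2.2 fun e => ?_⟩
    rcases hz.1.2 with rfl | hz2
    · rw [dd_self] at e; linarith
    · have := hb z hzV e.symm
      linarith
  have hDs : Sol Ω u (D \ {p}) g := G.sol.mono (hDo.sdiff isClosed_singleton)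
    (Set.sdiff_subset_sdiff_left hDV)
  obtain ⟨B, hB⟩ : ∃ B, ∀ z ∈ K, g z ≤ B := by
    obtain ⟨B, hB⟩ := (hKc.image_of_continuousOn (G.sol.cont.mono fun z hz =>
      ⟨hDV (hKD hz), hpD z (hKD hz)⟩)).bddAbove
    exact ⟨B, fun z hz => hB ⟨z, hz, rfl⟩⟩
  have hout : ∀ z ∈ D \ {p}, z ∉ K → g z ≤ M + ε := by
    intro z hz hzK
    by_contra! hlt'
    exact hzK ⟨⟨subset_closure (hDV hz.1), Or.inr hlt'.le⟩, subset_closure (hDV hz.1), hz.1.2.le⟩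
  have hS := (hDs.affine_sub 0 0 0).affine_sub (-(M + ε)) 0 0
  have := h.le_zero_of_compact hDo (hDV.trans G.sub) (G.sub G.mem) hS hKc hKD (M := max B (M + ε))
    (fun z hz => ?_) (fun z hz hzK => ?_) x ⟨⟨hx, hlt⟩, hpD x ⟨hx, hlt⟩⟩
  · simp at this; linarith
  · simp only [zero_apply, add_zero, zero_sub, sub_neg_eq_add]
    by_cases hzK : z ∈ K
    · have := hB z hzK; have := le_max_left B (M + ε); linarith
    · have := hout z hz hzK; have := le_max_right B (M + ε); linarith
  · have := hout z hz hzK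
    simp only [zero_apply, add_zero, zero_sub, sub_neg_eq_add]; linarith

end Green

lemma Setup.dd_pos (h : Setup n α β Ω u) {x y : E n} (hy : y ∈ Ω) (hx : x ∈ closure Ω)
    (hxy : x ≠ y) : 0 < dd u y x := by
  obtain ⟨η, hη, hB⟩ := exists_prolong n α β
  obtain ⟨s, hs, hc⟩ := h.exists_small_section hy
  by_contra! h0
  have key : ∀ k : ℕ, y + (1 + η) ^ k • (x - y) ∈ closure Ω ∧
      dd u y (y + (1 + η) ^ k • (x - y)) ≤ 0 := by
    intro k
    induction k with
    | zero => simpa using ⟨hx, h0⟩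
    | succ k ih =>
      have e : y + (1 + η) ^ (k + 1) • (x - y) =
          y + (1 + η) • (y + (1 + η) ^ k • (x - y) - y) := by
        rw [add_sub_cancel_left, smul_smul, pow_succ']
      have hm : ∀ r > 0, r ≤ s → y + (1 + η) ^ (k + 1) • (x - y) ∈ MASection Ω u y r := by
        intro r hr hrs
        rw [e]
        exact hB Ω u h y hy r hr (CptIn.mono hc (sec_mono hrs)) _ ih.1 (by linarith [ih.2])
      refine ⟨(mem_section.1 (hm s hs le_rfl)).1, ?_⟩
      by_contra! hpos
      have := (mem_section.1 (hm (min s (dd u y (y + (1 + η) ^ (k + 1) • (x - y))))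
        (by positivity) (min_le_left _ _))).2
      exact absurd (min_le_right s (dd u y (y + (1 + η) ^ (k + 1) • (x - y)))) (not_le.2 this)
  obtain ⟨R, hR⟩ := h.bdd.closure.subset_closedBall y
  have hn0 : 0 < ‖x - y‖ := norm_pos_iff.2 (sub_ne_zero.2 hxy)
  obtain ⟨k, hk⟩ := pow_unbounded_of_one_lt (R / ‖x - y‖) (show 1 < 1 + η by linarith)
  have := hR (key k).1
  rw [mem_closedBall_iff_norm, add_sub_cancel_left, norm_smul, Real.norm_of_nonneg (by positivity)]
    at this
  rw [div_lt_iff₀ hn0] at hk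
  linarith

namespace Green

variable {V : Set (E n)} {p : E n} {g : E n → ℝ}

lemma unbounded (G : Green n α β Ω u V p g) {N : Set (E n)} (hN : IsOpen N) (hpN : p ∈ N)
    (hNV : N ⊆ V) (B : ℝ) : ∃ x ∈ N, x ≠ p ∧ B < g x := by
  have h := G.setup
  by_contra! hB
  obtain ⟨ρ, hρ, hρN⟩ := Metric.isOpen_iff.1 hN p hpN
  have hρV : Metric.ball p ρ ⊆ V := hρN.trans hNV
  obtain ⟨ζ, hζ, hζc, hζs, hζ1, Nz, -, hKz, hNz⟩ := exists_cutoff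
    (isCompact_closedBall p (ρ / 2)) Metric.isOpen_ball
    (Metric.closedBall_subset_ball (show ρ / 2 < ρ by linarith))
  have hζΩ : tsupport ζ ⊆ Ω := hζs.trans (hρV.trans G.sub)
  set A := ∫ x, UB u x (pd ζ x) (pd ζ x) with hA
  have hA0 : 0 ≤ A := integral_nonneg (h.UB_pd_nonneg hζΩ)
  set T := 4 * (B ^ 2 * (2 * A + 2)) with hT
  have hT0 : 0 ≤ T := by positivity
  obtain ⟨ξ, hξ, hξs, hξΩ, -, ⟨N₁, hN₁, hpN₁, hξ1⟩, hξε⟩ := h.exists_pole_cutoff (G.sub G.mem)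
    (half_pos hρ) (show 0 < 1 / (2 * (T + 1)) by positivity)
  obtain ⟨ρ₁, hρ₁, hρN₁⟩ := Metric.isOpen_iff.1 hN₁ p hpN₁
  obtain ⟨χ, hχ, hχs, hχΩ, hχ1, hχN, hχε⟩ := h.exists_pole_cutoff (G.sub G.mem)
    hρ₁ (show (0 : ℝ) < 1 by norm_num)
  have hcb : ∀ {f : E n → ℝ} {r : ℝ}, tsupport f ⊆ Metric.ball p r → HasCompactSupport f :=
    fun hf => (isCompact_closedBall p _).of_isClosed_subset (isClosed_tsupport _)
      (hf.trans Metric.ball_subset_closedBall)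
  have hξc := hcb hξs
  obtain ⟨hη, hηc, hηs, hηE⟩ := h.punctured_cutoff (hρV.trans G.sub) hζ hζc hζs hζ1 hχ hχΩ
    (hcb hχs) hχ1 hχN
  set η : E n → ℝ := fun x => ζ x * (1 - χ x) with hηd
  have hball : IsOpen (Metric.ball p ρ \ {p}) := Metric.isOpen_ball.sdiff isClosed_singleton
  have hηΩ : tsupport η ⊆ Ω := hηs.trans (Set.sdiff_subset.trans (hρV.trans G.sub))
  have hS : Sol Ω u (Metric.ball p ρ \ {p}) g := G.sol.mono hball
    (Set.sdiff_subset_sdiff_left hρV)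
  have hEint := h.integrable_energy hη hηc hηΩ
  obtain ⟨hci, hcl⟩ := h.caccioppoli hS hη hηc hηs (H := fun τ => τ)
    (fun x _ => contDiffAt_id) (fun x _ => by simp) (R := fun x => B ^ 2 * UB u x (pd η x) (pd η x))
    (hEint.const_mul _) (fun x => mul_nonneg (sq_nonneg _) (h.UB_pd_nonneg hηΩ x)) (fun x hx => by
      simp only [deriv_id'', mul_one]
      refine mul_le_mul_of_nonneg_right ?_ (h.UB_pd_nonneg hηΩ x)
      have h1 := G.pos (hρV hx.1) hx.2
      have h2 := hB x (hρN hx.1) hx.2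
      gcongr)
  simp only [deriv_id'', mul_one] at hci hcl
  rw [integral_const_mul] at hcl
  have hcl' : ∫ x, η x ^ 2 * UB u x (pd g x) (pd g x) ≤ T := by
    refine hcl.trans ?_
    rw [hT]
    have : ∫ x, UB u x (pd η x) (pd η x) ≤ 2 * A + 2 := by linarith
    gcongr
  have hfl := G.flux hξ hξc (hξs.trans ((Metric.ball_subset_ball (by linarith)).trans hρV)) hN₁
    hpN₁ hξ1
  set K := tsupport ξ \ N₁ with hK
  have hKc : IsCompact K := hξc.isCompact.diff hN₁
  have hKb : K ⊆ V \ {p} := fun x hx =>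
    ⟨hρV (Metric.ball_subset_ball (by linarith) (hξs hx.1)), fun e => hx.2 (e ▸ hpN₁)⟩
  have hKΩ : K ⊆ Ω := hKb.trans G.sol.sub
  have hη1 : ∀ x ∈ K, η x = 1 := by
    intro x hx
    have h1 : ζ x = 1 := hNz x (hKz (Metric.ball_subset_closedBall (hξs hx.1)))
    have h2 : χ x = 0 := image_eq_zero_of_notMem_tsupport fun h2 => hx.2 (hρN₁ (hχs h2))
    simp [hηd, h1, h2]
  have hgc := contOn_pd fun x hx => G.sol.smooth x (hKb hx)
  have hξp := contOn_pd (G := K) fun x _ => hξ.contDiffAt (x := x)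
  have i1 := (h.contOn_UB hKΩ hgc hξp).integrableOn_compact (μ := volume) hKc
  have i2 := (h.contOn_UB hKΩ hgc hgc).integrableOn_compact (μ := volume) hKc
  have i3 := (h.contOn_UB hKΩ hξp hξp).integrableOn_compact (μ := volume) hKc
  have hcs := h.integral_abs_UB_sq_le hKc.measurableSet hKΩ i1 i2 i3
  have e1 : ∫ x in K, UB u x (pd g x) (pd ξ x) = 1 := by
    rw [← hfl, LinMA.integral_eq_setIntegral]
    intro x hx
    have : pd ξ x = 0 := by
      funext i
      by_cases hxs : x ∈ tsupport ξ
      · have hxN : x ∈ N₁ := by_contra fun h' => hx ⟨hxs, h'⟩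
        exact pd_of_eventually_const (by
          filter_upwards [hN₁.mem_nhds hxN] with y hy using hξ1 y hy) i
      · exact pd_eq_zero_of_notMem_tsupport hxs i
    rw [this, UB_zero_right]
  have e2 : 1 ≤ ∫ x in K, |UB u x (pd g x) (pd ξ x)| := by
    rw [← e1]
    exact setIntegral_mono i1 i1.abs fun x => le_abs_self _
  have e3 : ∫ x in K, UB u x (pd g x) (pd g x) ≤ T := by
    refine le_trans (le_of_eq ?_) ((setIntegral_le_integral (s := K) hci ?_).trans hcl')
    · exact setIntegral_congr_fun hKc.measurableSet fun x hx => by simp [hη1 x hx]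
    · refine Filter.Eventually.of_forall fun x => ?_
      change 0 ≤ _
      by_cases hx : x ∈ Ω
      · exact mul_nonneg (sq_nonneg _) (h.UB_nonneg hx _)
      · simp [image_eq_zero_of_notMem_tsupport fun hx' => hx (hηΩ hx')]
  have e4 : ∫ x in K, UB u x (pd ξ x) (pd ξ x) ≤ 1 / (2 * (T + 1)) :=
    (setIntegral_le_integral (h.integrable_energy hξ hξc hξΩ)
      (Filter.Eventually.of_forall (h.UB_pd_nonneg hξΩ))).trans hξε
  have e5 : (1 : ℝ) ≤ T * (1 / (2 * (T + 1))) := by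
    calc (1 : ℝ) ≤ (∫ x in K, |UB u x (pd g x) (pd ξ x)|) ^ 2 := one_le_pow₀ e2
      _ ≤ _ := hcs
      _ ≤ _ := by
        refine mul_le_mul e3 e4 ?_ hT0
        exact setIntegral_nonneg hKc.measurableSet fun x hx => h.UB_pd_nonneg hξΩ x
  rw [mul_one_div, le_div_iff₀ (by positivity)] at e5
  linarith

end Green

/-- Harnack inequality for Green's functions on boundaries of sections around the pole. -/
theorem exists_green_harnack (n : ℕ) (α β : ℝ) : ∃ C ≥ (1 : ℝ),
    ∀ (Ω : Set (E n)) (u : E n → ℝ) (V : Set (E n)) (p : E n) (g : E n → ℝ),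
    Green n α β Ω u V p g → ∀ t > 0, CptIn (MASection Ω u p (2 * t)) V →
    ∀ z ∈ closure Ω, dd u p z = t → ∀ z' ∈ closure Ω, dd u p z' = t → g z' ≤ C * g z := by
  obtain ⟨C, hC, H⟩ := exists_harnack n α β
  refine ⟨C, hC, fun Ω u V p g G t ht hc z hz hzt => ?_⟩
  have hsub : MASection Ω u p (2 * t) ⊆ V := subset_closure.trans hc.2
  have hcΩ : CptIn (MASection Ω u p (2 * t)) Ω := ⟨hc.1, hc.2.trans G.sub⟩
  have hin : ∀ x ∈ closure Ω, dd u p x = t → x ∈ V ∧ x ≠ p := fun x hx hd =>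
    ⟨hsub (mem_section.2 ⟨hx, by linarith⟩), by rintro rfl; rw [dd_self] at hd; linarith⟩
  refine H Ω u G.setup p (G.sub G.mem) t ht hcΩ g
    (G.sol.mono ((G.setup.sec_open hcΩ).sdiff isClosed_singleton)
      (Set.sdiff_subset_sdiff_left hsub)) (fun x hx => G.pos (hsub hx.1) hx.2)
    (fun M hM x hx hxt => ?_) z hz hzt
  obtain ⟨hzV, hzp⟩ := hin z hz hzt
  exact G.le_of_outside ht ((G.pos hzV hzp).trans_le (hM z hz hzt))
    (fun x hx hxt => hM x (subset_closure (G.sub hx)) hxt) x (hsub hx) hxt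

namespace Green

variable {V : Set (E n)} {p : E n} {g : E n → ℝ}

/-- Inside a section around the pole, `g` is at least its minimum on the boundary. -/
lemma ge_of_inside (G : Green n α β Ω u V p g) {s M : ℝ} (hs : 0 < s)
    (hc : CptIn (MASection Ω u p s) V) (hΓ : ∀ x ∈ V, dd u p x = s → M < g x) :
    ∀ x ∈ MASection Ω u p s, x ≠ p → M ≤ g x := by
  intro x hx hxp
  have h := G.setup
  have hsV : MASection Ω u p s ⊆ V := subset_closure.trans hc.2
  have hcs : CptIn (MASection Ω u p s) Ω := ⟨hc.1, hc.2.trans G.sub⟩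
  have hso := h.sec_open hcs
  obtain ⟨O, hO, hOe⟩ := continuousOn_iff'.1 G.sol.cont (Set.Ioi M) isOpen_Ioi
  have hK : closure (MASection Ω u p s) \ (O ∩ (V \ {p})) ⊆ MASection Ω u p s := by
    intro y hy
    by_contra hyS
    have hyf : y ∈ frontier (MASection Ω u p s) := by
      rw [frontier, hso.interior_eq]; exact ⟨hy.1, hyS⟩
    obtain ⟨hyΩ, hys⟩ := h.dd_eq_of_mem_frontier hcs hyf
    refine hy.2 ?_
    rw [← hOe]
    refine ⟨hΓ y (hc.2 hy.1) hys, hc.2 hy.1, ?_⟩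
    rintro rfl
    rw [dd_self] at hys
    linarith
  have hS := (G.sol.mono (hso.sdiff isClosed_singleton)
    (Set.sdiff_subset_sdiff_left hsV)).affine_sub M 0 0
  have key := h.le_zero_of_compact hso (hsV.trans G.sub) (G.sub G.mem) hS
    (hcs.1.diff (hO.inter G.sol.op)) hK (M := M) (fun y hy => ?_) (fun y hy hyK => ?_) x ⟨hx, hxp⟩
  · simp only [zero_apply, add_zero] at key
    linarith
  · have := G.pos (hsV hy.1) hy.2
    simp only [zero_apply, add_zero]; linarith
  · have hyO : y ∈ O ∩ (V \ {p}) := by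
      by_contra h'
      exact hyK ⟨subset_closure hy.1, h'⟩
    rw [← hOe] at hyO
    have : M < g y := hyO.1
    simp only [zero_apply, add_zero]; linarith

lemma blowup (G : Green n α β Ω u V p g) {t : ℝ}
    (ht : 0 < t) (hc : CptIn (MASection Ω u p (2 * t)) V) (M : ℝ) :
    ∃ N, IsOpen N ∧ p ∈ N ∧ N ⊆ V ∧ ∀ x ∈ N, x ≠ p → M ≤ g x := by
  have h := G.setup
  have hp := G.sub G.mem
  obtain ⟨C, hC, H⟩ := exists_green_harnack n α β
  have htt : MASection Ω u p t ⊆ MASection Ω u p (2 * t) := sec_mono (by linarith)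
  have hsub : MASection Ω u p (2 * t) ⊆ V := subset_closure.trans hc.2
  obtain ⟨z, hzS, hzp, hz⟩ := G.unbounded
    (h.sec_open ⟨(CptIn.mono hc htt).1, (CptIn.mono hc htt).2.trans G.sub⟩)
    (Setup.self_mem_sec hp ht) (htt.trans hsub) (C * M)
  obtain ⟨hzcl, hzt⟩ := mem_section.1 hzS
  set s := dd u p z with hs
  have hs0 : 0 < s := h.dd_pos hp hzcl hzp
  have hsS : MASection Ω u p (2 * s) ⊆ MASection Ω u p (2 * t) := sec_mono (by linarith)
  have hss : MASection Ω u p s ⊆ MASection Ω u p (2 * s) := sec_mono (by linarith)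
  have hcs := CptIn.mono hc (hss.trans hsS)
  refine ⟨MASection Ω u p s, h.sec_open ⟨hcs.1, hcs.2.trans G.sub⟩, Setup.self_mem_sec hp hs0,
    hss.trans (hsS.trans hsub), G.ge_of_inside hs0 hcs fun x hx hxs => ?_⟩
  have := H Ω u V p g G s hs0 (CptIn.mono hc hsS) x (subset_closure (G.sub hx)) hxs z hzcl rfl
  exact lt_of_mul_lt_mul_left (hz.trans_le this) (by linarith)

end Green

lemma Setup.integrable_UB_self (h : Setup n α β Ω u) {Φ : E n → ℝ} {L : NNReal}
    (hΦ : LipschitzWith L Φ) (hc : HasCompactSupport Φ) (hs : tsupport Φ ⊆ Ω) :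
    Integrable fun x => UB u x (pd Φ x) (pd Φ x) := by
  obtain ⟨χ, hχ, hχc, hχW, -, N, hN, hKN, hχ1⟩ := exists_cutoff hc h.op hs
  refine integrable_finsetSum _ fun i _ => integrable_finsetSum _ fun j _ => ?_
  have hG : ContDiff ℝ ∞ (fun x => χ x * cofU u x i j) :=
    contDiff_mul_of_tsupport hχ hχW fun x hx => contDiffAt_cofU (h.smooth x hx) i j
  have := integrable_pd_mul hΦ (integrable_pd_mul hΦ
    (hG.continuous.integrable_of_hasCompactSupport (μ := volume) hχc.mul_right) j) i
  refine this.congr (Filter.Eventually.of_forall fun x => ?_)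
  by_cases hx : x ∈ tsupport Φ
  · simp only [hχ1 x (hKN hx)]; ring
  · simp [pd_eq_zero_of_notMem_tsupport hx]

namespace Green

variable {V : Set (E n)} {p : E n} {g : E n → ℝ}

/-- Smooth test functions obtained by composing `g` with a cutoff. -/
lemma exists_comp (G : Green n α β Ω u V p g) {t : ℝ}
    (ht : 0 < t) (hcpt : CptIn (MASection Ω u p (2 * t)) V) {F : ℝ → ℝ} (hF : ContDiff ℝ ∞ F)
    {ε M c : ℝ} (hε : 0 < ε) (hF0 : ∀ τ ≤ ε, F τ = 0) (hFc : ∀ τ, M ≤ τ → F τ = c) :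
    ∃ φ : E n → ℝ, ContDiff ℝ ∞ φ ∧ HasCompactSupport φ ∧ tsupport φ ⊆ V ∧
      (∀ x ∈ V, x ≠ p → φ x = F (g x)) ∧ (∃ N, IsOpen N ∧ p ∈ N ∧ ∀ x ∈ N, φ x = c) ∧
      (∀ x ∈ V, x ≠ p → pd φ x = deriv F (g x) • pd g x) ∧
      ∫ x, UB u x (pd g x) (pd φ x) = c := by
  classical
  obtain ⟨N, hN, hpN, hNV, hNg⟩ := G.blowup ht hcpt M
  set φ : E n → ℝ := fun x => if x ∈ V then (if x = p then c else F (g x)) else 0 with hφ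
  have e1 : ∀ x ∈ V, x ≠ p → φ x = F (g x) := fun x hx hxp => by simp [hφ, hx, hxp]
  have e2 : ∀ x ∈ N, φ x = c := by
    intro x hx
    by_cases hxp : x = p
    · simp [hφ, hxp, G.mem]
    · rw [e1 x (hNV hx) hxp, hFc _ (hNg x hx hxp)]
  have e1' : ∀ x ∈ V, x ≠ p → φ =ᶠ[nhds x] fun y => F (g y) := fun x hx hxp => by
    filter_upwards [G.sol.op.mem_nhds ⟨hx, hxp⟩] with y hy using e1 y hy.1 hy.2
  have e3 : ∀ x ∉ {x ∈ closure V | x = p ∨ ε ≤ g x}, φ x = 0 := by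
    intro x hx
    by_cases hxV : x ∈ V
    · have hx' : ¬(x = p ∨ ε ≤ g x) := fun h' => hx ⟨subset_closure hxV, h'⟩
      push Not at hx'
      rw [e1 x hxV hx'.1, hF0 _ hx'.2.le]
    · simp [hφ, hxV]
  have hKc := G.level_compact ε
  have hts : tsupport φ ⊆ {x ∈ closure V | x = p ∨ ε ≤ g x} :=
    closure_minimal (fun x hx => by_contra fun h' => hx (e3 x h')) hKc.isClosed
  have hsV := hts.trans (G.level_subset hε)
  have hφc : HasCompactSupport φ := hKc.of_isClosed_subset (isClosed_tsupport _) hts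
  have hφs : ContDiff ℝ ∞ φ := by
    rw [contDiff_iff_contDiffAt]
    intro x
    by_cases hxV : x ∈ V
    · by_cases hxp : x = p
      · refine (contDiffAt_const (c := c)).congr_of_eventuallyEq ?_
        filter_upwards [hN.mem_nhds (hxp ▸ hpN)] with y hy using e2 y hy
      · exact (hF.contDiffAt.comp x (G.sol.smooth x ⟨hxV, hxp⟩)).congr_of_eventuallyEq
          (e1' x hxV hxp)
    · exact (contDiffAt_const (c := (0 : ℝ))).congr_of_eventuallyEq
        (notMem_tsupport_iff_eventuallyEq.1 fun h' => hxV (hsV h'))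
  refine ⟨φ, hφs, hφc, hsV, e1, ⟨N, hN, hpN, e2⟩, fun x hx hxp => ?_, G.flux hφs hφc hsV hN hpN e2⟩
  funext i
  rw [pd_congr (e1' x hx hxp), pd_comp (hF.differentiable (by simp)).differentiableAt
    ((G.sol.smooth x ⟨hx, hxp⟩).differentiableAt (by simp))]
  rfl

lemma pd_eq_zero_of_bad {φ : E n → ℝ} (hs : tsupport φ ⊆ V) {N : Set (E n)} (hN : IsOpen N)
    (hpN : p ∈ N) {c : ℝ} (hφ : ∀ x ∈ N, φ x = c) {x : E n} (hx : x ∉ V \ {p}) : pd φ x = 0 := by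
  funext i
  by_cases hxV : x ∈ V
  · have hxp : x = p := by_contra fun h' => hx ⟨hxV, h'⟩
    exact pd_of_eventually_const (by
      filter_upwards [hN.mem_nhds (hxp ▸ hpN)] with y hy using hφ y hy) i
  · exact pd_eq_zero_of_notMem_tsupport (fun h' => hxV (hs h')) i

/-- Integrability of the flux density of a test function which is constant near the pole. -/
lemma integrable_flux (G : Green n α β Ω u V p g) {φ Φ : E n → ℝ} (hφ : ContDiff ℝ ∞ φ)
    (hφc : HasCompactSupport φ) (hs : tsupport φ ⊆ V) {N : Set (E n)} (hN : IsOpen N)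
    (hpN : p ∈ N) {c : ℝ} (hφ1 : ∀ x ∈ N, φ x = c) (hΦ : Continuous Φ) :
    Integrable fun x => Φ x * UB u x (pd g x) (pd φ x) := by
  refine integrable_of_zero_outside (K := tsupport φ \ N) (hφc.isCompact.diff hN) G.sol.op
    (fun x hx => ⟨hs hx.1, fun e => hx.2 (e ▸ hpN)⟩) (hΦ.continuousOn.mul
      (G.setup.contOn_UB G.sol.sub (contOn_pd G.sol.smooth) (contOn_pd fun x _ => hφ.contDiffAt)))
    fun x hx => ?_
  have : pd φ x = 0 := by
    funext i
    by_cases hxs : x ∈ tsupport φ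
    · have hxN : x ∈ N := by_contra fun h' => hx ⟨hxs, h'⟩
      exact pd_of_eventually_const (by
        filter_upwards [hN.mem_nhds hxN] with y hy using hφ1 y hy) i
    · exact pd_eq_zero_of_notMem_tsupport hxs i
  rw [this, UB_zero_right, mul_zero]

end Green

lemma deriv_smoothTransition_comp {a b x : ℝ} :
    deriv (fun τ => Real.smoothTransition (a * τ - b)) x =
      a * deriv Real.smoothTransition (a * x - b) := by
  have h1 : HasDerivAt (fun τ : ℝ => a * τ - b) a x := by
    simpa using ((hasDerivAt_id x).const_mul a).sub_const b
  have h2 := (((Real.smoothTransition.contDiff (n := ⊤)).differentiable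
    (by simp)).differentiableAt (x := a * x - b)).hasDerivAt
  have := h2.comp x h1
  rw [mul_comm]
  exact this.deriv

lemma contDiff_smoothTransition_comp (a b : ℝ) :
    ContDiff ℝ ∞ fun τ => Real.smoothTransition (a * τ - b) :=
  (Real.smoothTransition.contDiff (n := ⊤)).comp
    ((contDiff_const.mul contDiff_id).sub contDiff_const)

/-- Test functions of small energy which equal `1` where `g` is large. -/
theorem exists_energy_upper : ∃ C > (0 : ℝ), ∀ (n : ℕ) (α β : ℝ) (Ω : Set (E n)) (u : E n → ℝ)
    (V : Set (E n)) (p : E n) (g : E n → ℝ), Green n α β Ω u V p g → ∀ t > 0,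
    CptIn (MASection Ω u p (2 * t)) V → ∀ m > 0, ∃ Φ : E n → ℝ, ContDiff ℝ ∞ Φ ∧
      HasCompactSupport Φ ∧ tsupport Φ ⊆ V ∧ Φ p = 1 ∧ (∀ x ∈ V, x ≠ p → m ≤ g x → Φ x = 1) ∧
      ∫ x, UB u x (pd Φ x) (pd Φ x) ≤ C / m := by
  obtain ⟨C, hC, hθ⟩ := exists_deriv_smoothTransition_le
  refine ⟨2 * C, by positivity, fun n α β Ω u V p g G t ht hcpt m hm => ?_⟩
  have hF0 : ∀ τ ≤ m / 2, Real.smoothTransition (2 / m * τ - 1) = 0 := fun τ hτ => by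
    apply Real.smoothTransition.zero_of_nonpos
    have : 2 / m * τ ≤ 2 / m * (m / 2) := by gcongr
    have e : 2 / m * (m / 2) = 1 := by field_simp
    linarith
  have hF1 : ∀ τ, m ≤ τ → Real.smoothTransition (2 / m * τ - 1) = 1 := fun τ hτ => by
    apply Real.smoothTransition.one_of_one_le
    have : 2 / m * m ≤ 2 / m * τ := by gcongr
    have e : 2 / m * m = 2 := by field_simp
    linarith
  obtain ⟨Φ, hΦ, hΦc, hΦs, hΦF, ⟨N, hN, hpN, hΦ1⟩, hΦp, hfl⟩ := G.exists_comp ht hcpt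
    (contDiff_smoothTransition_comp (2 / m) 1) (half_pos hm) hF0 hF1
  refine ⟨Φ, hΦ, hΦc, hΦs, hΦ1 p hpN, fun x hx hxp hxm => by rw [hΦF x hx hxp, hF1 _ hxm], ?_⟩
  have hintg := G.integrable_flux hΦ hΦc hΦs hN hpN hΦ1 (continuous_const (y := 2 * C / m))
  calc ∫ x, UB u x (pd Φ x) (pd Φ x) ≤ ∫ x, 2 * C / m * UB u x (pd g x) (pd Φ x) := by
        refine integral_mono (G.setup.integrable_energy hΦ hΦc (hΦs.trans G.sub)) hintg fun x => ?_
        by_cases hx : x ∈ V \ {p}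
        · simp only [hΦp x hx.1 hx.2, UB_smul_right, UB_smul_left]
          rw [deriv_smoothTransition_comp]
          have h1 := G.setup.UB_nonneg (G.sub hx.1) (pd g x)
          have h2 := deriv_smoothTransition_nonneg (2 / m * g x - 1)
          have h3 : 2 / m * deriv Real.smoothTransition (2 / m * g x - 1) ≤ 2 * C / m := by
            rw [mul_div_right_comm]
            have := hθ (2 / m * g x - 1)
            gcongr
          refine mul_le_mul_of_nonneg_right h3 ?_
          positivity
        · simp only [Green.pd_eq_zero_of_bad hΦs hN hpN hΦ1 hx, UB_zero_right, mul_zero, le_refl]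
    _ = 2 * C / m := by rw [integral_const_mul, hfl, mul_one]

lemma exists_primitive {ρ : ℝ → ℝ} (hρ : ContDiff ℝ ∞ ρ) {a b : ℝ} (hb : 0 < b)
    (h1 : ∀ τ, ρ τ ≤ 1) (ha0 : ∀ τ ≤ a, ρ τ = 0) (hb0 : ∀ τ, b ≤ τ → ρ τ = 0) (ha : 0 < a) :
    ∃ (R : ℝ → ℝ) (c : ℝ), ContDiff ℝ ∞ R ∧ deriv R = ρ ∧ (∀ τ ≤ a, R τ = 0) ∧
      (∀ τ, b ≤ τ → R τ = c) ∧ c ≤ b := by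
  have hc := hρ.continuous
  have hd : ∀ τ, HasDerivAt (fun τ => ∫ s in (0 : ℝ)..τ, ρ s) (ρ τ) τ := fun τ =>
    intervalIntegral.integral_hasDerivAt_right (hc.intervalIntegrable _ _)
      hc.stronglyMeasurable.stronglyMeasurableAtFilter hc.continuousAt
  have hder : deriv (fun τ => ∫ s in (0 : ℝ)..τ, ρ s) = ρ := funext fun τ => (hd τ).deriv
  refine ⟨fun τ => ∫ s in (0 : ℝ)..τ, ρ s, ∫ s in (0 : ℝ)..b, ρ s, ?_, hder, fun τ hτ => ?_,
    fun τ hτ => ?_, ?_⟩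
  · rw [contDiff_infty_iff_deriv, hder]
    exact ⟨fun τ => (hd τ).differentiableAt, hρ⟩
  · refine intervalIntegral.integral_zero_ae (Filter.Eventually.of_forall fun s hs => ha0 s ?_)
    exact hs.2.trans (max_le ha.le hτ)
  · change ∫ s in (0 : ℝ)..τ, ρ s = _
    rw [← intervalIntegral.integral_add_adjacent_intervals (hc.intervalIntegrable 0 b)
      (hc.intervalIntegrable b τ), add_eq_left]
    refine intervalIntegral.integral_zero_ae (Filter.Eventually.of_forall fun s hs => hb0 s ?_)
    rw [Set.uIoc_of_le hτ] at hs
    exact hs.1.le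
  · have := intervalIntegral.integral_mono_on hb.le (hc.intervalIntegrable 0 b)
      ((continuous_const (y := (1 : ℝ))).intervalIntegrable (μ := volume) 0 b) fun x _ => h1 x
    simpa using this

namespace Green

variable {V : Set (E n)} {p : E n} {g : E n → ℝ}

/-- A function which is at least `1` where `g` is large has large energy. -/
theorem energy_lower (G : Green n α β Ω u V p g) {t : ℝ}
    (ht : 0 < t) (hcpt : CptIn (MASection Ω u p (2 * t)) V) {M : ℝ} (hM : 0 < M) {Φ : E n → ℝ}
    {L : NNReal} (hΦ : LipschitzWith L Φ) (hΦc : HasCompactSupport Φ) (hΦs : tsupport Φ ⊆ V)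
    (hΦ1 : ∀ x ∈ V, x ≠ p → M ≤ g x → 1 ≤ Φ x) :
    1 / (2 * M) ≤ ∫ x, UB u x (pd Φ x) (pd Φ x) := by
  have h := G.setup
  have hΦΩ := hΦs.trans G.sub
  set F : ℝ → ℝ := fun τ => Real.smoothTransition (1 / M * τ - 1) with hF
  have hFs : ContDiff ℝ ∞ F := contDiff_smoothTransition_comp _ _
  have hF0 : ∀ τ ≤ M, F τ = 0 := fun τ hτ => Real.smoothTransition.zero_of_nonpos (by
    have : 1 / M * τ ≤ 1 / M * M := by gcongr
    have e : 1 / M * M = 1 := by field_simp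
    linarith)
  have hF1 : ∀ τ, 2 * M ≤ τ → F τ = 1 := fun τ hτ => Real.smoothTransition.one_of_one_le (by
    have : 1 / M * (2 * M) ≤ 1 / M * τ := by gcongr
    have e : 1 / M * (2 * M) = 2 := by field_simp
    linarith)
  have hFn : ∀ τ, 0 ≤ F τ := fun τ => Real.smoothTransition.nonneg _
  have hFle : ∀ τ, F τ ≤ 1 := fun τ => Real.smoothTransition.le_one _
  have hF' : ∀ τ, 0 ≤ deriv F τ := fun τ => by
    rw [hF, deriv_smoothTransition_comp]
    exact mul_nonneg (by positivity) (deriv_smoothTransition_nonneg _)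
  have hF'0 : ∀ τ < M, deriv F τ = 0 := fun τ hτ => by
    have : F =ᶠ[nhds τ] fun _ => 0 := by
      filter_upwards [Iio_mem_nhds hτ] with s hs using hF0 s (le_of_lt hs)
    rw [this.deriv_eq]; simp
  obtain ⟨φ, hφ, hφc, hφs, hφF, ⟨N, hN, hpN, hφ1⟩, hφp, hfl⟩ := G.exists_comp ht hcpt hFs hM hF0 hF1
  -- the test function `Φ * (1 - φ)`
  obtain ⟨L', hφL⟩ := hφ.lipschitzWith_of_hasCompactSupport hφc (by simp)
  obtain ⟨a, La, haL, hae⟩ : ∃ (a : E n → ℝ) (La : NNReal), LipschitzWith La a ∧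
      ∀ x, a x = Φ x * (1 - φ x) := by
    have hb : ∃ B, ∀ x, ‖Φ x‖ ≤ B := hΦc.exists_bound_of_continuous hΦ.continuous
    have hb' : ∃ B, ∀ x, ‖φ x‖ ≤ B := hφc.exists_bound_of_continuous hφ.continuous
    obtain ⟨B, hB⟩ := hb
    obtain ⟨B', hB'⟩ := hb'
    have hB0 : 0 ≤ B := (norm_nonneg _).trans (hB p)
    have hB'0 : 0 ≤ B' := (norm_nonneg _).trans (hB' p)
    refine ⟨fun x => Φ x * (1 - φ x), ⟨B * L' + (1 + B') * L, by positivity⟩,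
      LipschitzWith.of_dist_le_mul fun x y => ?_, fun _ => rfl⟩
    change |Φ x * (1 - φ x) - Φ y * (1 - φ y)| ≤ (B * L' + (1 + B') * L) * dist x y
    have h1 := hΦ.dist_le_mul x y
    have h2 := hφL.dist_le_mul x y
    rw [Real.dist_eq] at h1 h2
    calc |Φ x * (1 - φ x) - Φ y * (1 - φ y)|
        = |(Φ x - Φ y) * (1 - φ x) + Φ y * (-(φ x - φ y))| := by congr 1; ring
      _ ≤ |Φ x - Φ y| * |1 - φ x| + |Φ y| * |φ x - φ y| := by
          refine (abs_add_le _ _).trans (le_of_eq ?_)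
          rw [abs_mul, abs_mul, abs_neg]
      _ ≤ L * dist x y * (1 + B') + B * (L' * dist x y) := by
          have h3 : |1 - φ x| ≤ 1 + B' := by
            refine (abs_sub _ _).trans ?_
            rw [abs_one]
            have := hB' x
            rw [Real.norm_eq_abs] at this
            linarith
          have h4 := hB y
          rw [Real.norm_eq_abs] at h4
          gcongr
      _ = _ := by ring
  set K := tsupport Φ \ N with hK
  have hKc : IsCompact K := hΦc.isCompact.diff hN
  have hKV : K ⊆ V \ {p} := fun x hx => ⟨hΦs hx.1, fun e => hx.2 (e ▸ hpN)⟩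
  have hKΩ : K ⊆ Ω := hKV.trans G.sol.sub
  have hasup : tsupport a ⊆ K := by
    refine closure_minimal (fun x hx => ?_) hKc.isClosed
    rw [Function.mem_support, hae] at hx
    refine ⟨subset_tsupport _ (left_ne_zero_of_mul hx), fun hxN => hx ?_⟩
    rw [hφ1 x hxN, sub_self, mul_zero]
  have hac : HasCompactSupport a := hKc.of_isClosed_subset (isClosed_tsupport _) hasup
  have hweak := h.weak G.sol haL hac (hasup.trans hKV)
  have hwi := integrable_UB G.sol.op (fun x hx => h.smooth x (G.sol.sub hx)) haL hac
    (hasup.trans hKV) G.sol.smooth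
  have hfi := G.integrable_flux hφ hφc hφs hN hpN hφ1 hΦ.continuous
  have hfi1 := G.integrable_flux hφ hφc hφs hN hpN hφ1 (continuous_const (y := 1))
  have hpda : ∀ᵐ x, UB u x (pd a x) (pd g x) + Φ x * UB u x (pd g x) (pd φ x) =
      UB u x (pd Φ x) ((1 - φ x) • pd g x) := by
    filter_upwards [hΦ.ae_differentiableAt] with x hx
    by_cases hxV : x ∈ V \ {p}
    · have e : pd a x = (1 - φ x) • pd Φ x + (-Φ x) • pd φ x := by
        funext i
        rw [pd_congr (Filter.Eventually.of_forall hae), pd_mul hx (by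
          have := (hφ.differentiable (by simp)).differentiableAt (x := x)
          fun_prop), pd_one_sub]
        simp only [Pi.add_apply, Pi.smul_apply, smul_eq_mul]
        ring
      rw [e, UB_add_left, UB_smul_left, UB_smul_left, UB_smul_right,
        h.UB_symm (G.sol.sub hxV) (pd g x) (pd φ x)]
      ring
    · have e1 : pd φ x = 0 := pd_eq_zero_of_bad hφs hN hpN hφ1 hxV
      have e2 : pd a x = 0 := funext fun i =>
        pd_eq_zero_of_notMem_tsupport (fun h' => hxV (hKV (hasup h'))) i
      rw [e1, e2, UB_zero_left, UB_zero_right, UB_smul_right]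
      by_cases hxp : x ∈ V
      · have : x = p := by_contra fun h' => hxV ⟨hxp, h'⟩
        rw [this, hφ1 p hpN]; simp
      · have : pd Φ x = 0 := funext fun i =>
          pd_eq_zero_of_notMem_tsupport (fun h' => hxp (hΦs h')) i
        rw [this, UB_zero_left]; simp
  have hI : Integrable fun x => UB u x (pd Φ x) ((1 - φ x) • pd g x) :=
    (hwi.add hfi).congr hpda
  have hone : 1 ≤ ∫ x, UB u x (pd Φ x) ((1 - φ x) • pd g x) := by
    rw [← integral_congr_ae hpda, integral_add hwi hfi, hweak, zero_add, ← hfl]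
    simp only [one_mul] at hfi1
    refine integral_mono hfi1 hfi fun x => ?_
    by_cases hxV : x ∈ V \ {p}
    · simp only [hφp x hxV.1 hxV.2, UB_smul_right]
      rcases lt_or_ge (g x) M with hlt | hge
      · simp [hF'0 _ hlt]
      · exact le_mul_of_one_le_left (mul_nonneg (hF' _) (h.UB_nonneg (G.sol.sub hxV) _))
          (hΦ1 x hxV.1 hxV.2 hge)
    · simp only [pd_eq_zero_of_bad hφs hN hpN hφ1 hxV, UB_zero_right, mul_zero, le_refl]
  have hKout : ∀ x ∉ K, UB u x (pd Φ x) ((1 - φ x) • pd g x) = 0 := by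
    intro x hx
    by_cases hxs : x ∈ tsupport Φ
    · have hxN : x ∈ N := by_contra fun h' => hx ⟨hxs, h'⟩
      rw [hφ1 x hxN, UB_smul_right, sub_self, zero_mul]
    · have : pd Φ x = 0 := funext fun i => pd_eq_zero_of_notMem_tsupport hxs i
      rw [this, UB_zero_left]
  rw [LinMA.integral_eq_setIntegral hKout] at hone
  -- the energy of `g` between two levels
  obtain ⟨ε, hε, hgε⟩ := hKc.exists_forall_le' (G.sol.cont.mono hKV) (a := 0)
    fun x hx => G.pos (hKV hx).1 (hKV hx).2
  obtain ⟨R, c, hR, hR', hR0, hRc, hcM⟩ := exists_primitive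
    (ρ := fun τ => Real.smoothTransition (2 / ε * τ - 1) * (1 - F τ)) (a := ε / 2) (b := 2 * M)
    ((contDiff_smoothTransition_comp _ _).mul (contDiff_const.sub hFs)) (by positivity)
    (fun τ => mul_le_one₀ (Real.smoothTransition.le_one _) (by linarith [hFle τ])
      (by linarith [hFn τ])) (fun τ hτ => by
        have h1 : 2 / ε * τ ≤ 2 / ε * (ε / 2) := by gcongr
        have e : 2 / ε * (ε / 2) = 1 := by field_simp
        rw [Real.smoothTransition.zero_of_nonpos (by linarith), zero_mul])
    (fun τ hτ => by rw [hF1 τ hτ, sub_self, mul_zero]) (half_pos hε)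
  obtain ⟨ψ, hψ, hψc, hψs, -, ⟨N', hN', hpN', hψ1⟩, hψp, hψfl⟩ :=
    G.exists_comp ht hcpt hR (half_pos hε) hR0 hRc
  have hψi := G.integrable_flux hψ hψc hψs hN' hpN' hψ1 (continuous_const (y := 1))
  simp only [one_mul] at hψi
  have hgc := contOn_pd fun x hx => G.sol.smooth x (hKV hx)
  have hwc : ∀ i, ContinuousOn (fun x => ((1 - φ x) • pd g x) i) K := fun i =>
    ((continuous_const.sub hφ.continuous).continuousOn).mul (hgc i)
  have i2 := (h.contOn_UB hKΩ hwc hwc).integrableOn_compact (μ := volume) hKc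
  have hgE : ∫ x in K, UB u x ((1 - φ x) • pd g x) ((1 - φ x) • pd g x) ≤ 2 * M := by
    refine le_trans ?_ hcM
    rw [← hψfl]
    have hψn : ∀ x, 0 ≤ UB u x (pd g x) (pd ψ x) := fun x => by
      by_cases hxV : x ∈ V \ {p}
      · rw [hψp x hxV.1 hxV.2, UB_smul_right, hR']
        exact mul_nonneg (mul_nonneg (Real.smoothTransition.nonneg _) (by linarith [hFle (g x)]))
          (h.UB_nonneg (G.sol.sub hxV) _)
      · rw [pd_eq_zero_of_bad hψs hN' hpN' hψ1 hxV, UB_zero_right]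
    refine (setIntegral_mono_on i2 hψi.integrableOn hKc.measurableSet fun x hx => ?_).trans
      (setIntegral_le_integral hψi (Filter.Eventually.of_forall hψn))
    have hxV := hKV hx
    rw [hψp x hxV.1 hxV.2, UB_smul_right, UB_smul_right, UB_smul_left, hφF x hxV.1 hxV.2, hR']
    have h0 := h.UB_nonneg (G.sol.sub hxV) (pd g x)
    have h1 : Real.smoothTransition (2 / ε * g x - 1) = 1 :=
      Real.smoothTransition.one_of_one_le (by
        have h1 : 2 / ε * ε ≤ 2 / ε * g x := by have := hgε x hx; gcongr
        have e : 2 / ε * ε = 2 := by field_simp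
        linarith)
    have h2 : 0 ≤ 1 - F (g x) := by linarith [hFle (g x)]
    have h3 : 1 - F (g x) ≤ 1 := by linarith [hFn (g x)]
    simp only [h1, one_mul]
    exact mul_le_of_le_one_left (mul_nonneg h2 h0) h3
  have hΦi := h.integrable_UB_self hΦ hΦc hΦΩ
  have hcs := h.integral_abs_UB_sq_le hKc.measurableSet hKΩ hI.integrableOn hΦi.integrableOn i2
  have hΦn := h.UB_pd_nonneg hΦΩ
  have hΦK : ∫ x in K, UB u x (pd Φ x) (pd Φ x) ≤ ∫ x, UB u x (pd Φ x) (pd Φ x) :=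
    setIntegral_le_integral hΦi (Filter.Eventually.of_forall hΦn)
  have hE0 : 0 ≤ ∫ x, UB u x (pd Φ x) (pd Φ x) := integral_nonneg hΦn
  have e2 : 1 ≤ ∫ x in K, |UB u x (pd Φ x) ((1 - φ x) • pd g x)| :=
    hone.trans (setIntegral_mono hI.integrableOn hI.integrableOn.abs fun x => le_abs_self _)
  rw [div_le_iff₀ (by positivity)]
  calc (1 : ℝ) ≤ _ := one_le_pow₀ e2
    _ ≤ _ := hcs
    _ ≤ _ := by
      refine mul_le_mul hΦK hgE ?_ hE0
      refine setIntegral_nonneg hKc.measurableSet fun x hx => h.UB_nonneg (hKΩ hx) _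

end Green

/-- A convex function with an interior maximum is constant. -/
lemma eq_of_isMaxOn_of_mem_interior {K : Set (E n)} (hu : ConvexOn ℝ K u) {z : E n}
    (hz : z ∈ interior K) (hmax : ∀ y ∈ K, u y ≤ u z) {y : E n} (hy : y ∈ K) : u y = u z := by
  refine le_antisymm (hmax y hy) ?_
  have hc : ContinuousAt (fun r : ℝ => z + r • (z - y)) 0 := by fun_prop
  have hn : ∀ᶠ r in nhdsWithin (0 : ℝ) (Set.Ioi 0), z + r • (z - y) ∈ K :=
    nhdsWithin_le_nhds (hc.eventually_mem (by simpa using mem_interior_iff_mem_nhds.1 hz))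
  obtain ⟨r, hr, hr0⟩ := (hn.and self_mem_nhdsWithin).exists
  have hr0 : 0 < r := hr0
  have h1 := hu.2 hr hy (show 0 ≤ 1 / (1 + r) by positivity)
    (show 0 ≤ r / (1 + r) by positivity) (by field_simp)
  have e : (1 / (1 + r)) • (z + r • (z - y)) + (r / (1 + r)) • y = z := by
    have e1 : r / (1 + r) = (1 / (1 + r)) * r := by ring
    have e2 : (1 / (1 + r)) * (1 + r) = 1 := by field_simp
    rw [e1, mul_smul, ← smul_add]
    have e3 : z + r • (z - y) + r • y = (1 + r) • z := by module
    rw [e3, smul_smul, e2, one_smul]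
  rw [e, smul_eq_mul, smul_eq_mul] at h1
  have h2 := hmax _ hr
  have h3 : u z ≤ 1 / (1 + r) * u z + r / (1 + r) * u y := by
    refine h1.trans ?_
    gcongr
  have e4 : u z = 1 / (1 + r) * u z + r / (1 + r) * u z := by field_simp
  have h4 : r / (1 + r) * u z ≤ r / (1 + r) * u y := by linarith
  exact le_of_mul_le_mul_left h4 (by positivity)

lemma setup_of_cptIn_section (hn : 2 ≤ n) (hΩ : MASetup Ω u) (hd : DoublingCM Ω u α β)
    {p : E n} {s : ℝ} (hp : p ∈ Ω) (hs : 0 < s) (hc : CptIn (MASection Ω u p s) Ω) :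
    Setup n α β Ω u := by
  obtain ⟨hop, hbd, hne, -, hsm, hcv, hb⟩ := hΩ
  have : Nonempty (Fin n) := ⟨⟨0, by omega⟩⟩
  have hcpt : IsCompact (closure Ω) := hbd.isCompact_closure
  have hfr : (frontier Ω).Nonempty := by
    refine nonempty_frontier_iff.2 ⟨hne, fun h => ?_⟩
    exact NormedSpace.unbounded_univ ℝ (E n) (h ▸ hbd)
  obtain ⟨q, hq⟩ := hfr
  have hqcl : q ∈ closure Ω := frontier_subset_closure hq
  have hqΩ : q ∉ Ω := fun h => by
    rw [hop.frontier_eq] at hq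
    exact hq.2 h
  have hcl : ∀ x ∈ closure Ω, x ∉ Ω → u x = 0 := fun x hx hxΩ =>
    hb x (by rw [hop.frontier_eq]; exact ⟨hx, hxΩ⟩)
  have hintg : Ω ⊆ interior (closure Ω) := interior_maximal subset_closure hop
  have hle : ∀ x ∈ closure Ω, u x ≤ 0 := by
    obtain ⟨z, hz, hmax⟩ := hcpt.exists_isMaxOn ⟨q, hqcl⟩ hsm.continuousOn
    intro x hx
    refine (hmax hx).trans ?_
    by_cases hzΩ : z ∈ Ω
    · exact (eq_of_isMaxOn_of_mem_interior hcv (hintg hzΩ) hmax hqcl ▸ hb q hq).le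
    · exact (hcl z hz hzΩ).le
  have hneg : ∃ x ∈ Ω, u x < 0 := by
    by_contra! hcon
    have h0 : ∀ x ∈ closure Ω, u x = 0 := fun x hx => by
      by_cases hxΩ : x ∈ Ω
      · exact le_antisymm (hle x hx) (hcon x hxΩ)
      · exact hcl x hx hxΩ
    have hf : fderiv ℝ u p = 0 := by
      have : u =ᶠ[nhds p] fun _ => 0 := by
        filter_upwards [hop.mem_nhds hp] with x hx using h0 x (subset_closure hx)
      rw [this.fderiv_eq]; simp
    refine hqΩ (hc.2 (subset_closure ⟨hqcl, ?_⟩))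
    rw [h0 q hqcl, h0 p (subset_closure hp), hf]
    simpa using hs
  have heq : interior (closure Ω) = Ω := by
    refine Set.Subset.antisymm (fun z hz => ?_) hintg
    by_contra hzΩ
    obtain ⟨x, hx, hx0⟩ := hneg
    have hz0 := hcl z (interior_subset hz) hzΩ
    have := eq_of_isMaxOn_of_mem_interior hcv hz (fun y hy => hz0 ▸ hle y hy) (subset_closure hx)
    linarith
  exact ⟨hn, hop, hbd, heq ▸ hcv.1.interior, fun x hx =>
    (hsm.mono subset_closure).contDiffAt (hop.mem_nhds hx), hsm.continuousOn, hcv, hb, hneg, hd⟩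

namespace Green

variable {V : Set (E n)} {p : E n} {g : E n → ℝ}

lemma setIntegral_energy {Φ : E n → ℝ} (hΦs : tsupport Φ ⊆ V) :
    ∫ x in V, ∑ i, ∑ j, cofU u x i j * pd Φ x i * pd Φ x j =
      ∫ x, UB u x (pd Φ x) (pd Φ x) := by
  refine (LinMA.integral_eq_setIntegral (F := fun x => UB u x (pd Φ x) (pd Φ x))
    fun x hx => ?_).symm
  have : pd Φ x = 0 := funext fun i =>
    pd_eq_zero_of_notMem_tsupport (fun h' => hx (hΦs h')) i
  rw [this, UB_zero_left]

lemma capacity_le (G : Green n α β Ω u V p g) {K : Set (E n)} {Φ : E n → ℝ}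
    (hΦ : ContDiff ℝ ∞ Φ) (hΦc : HasCompactSupport Φ) (hΦs : tsupport Φ ⊆ V)
    (hK : ∀ x ∈ K, 1 ≤ Φ x) : capacity u K V ≤ ∫ x, UB u x (pd Φ x) (pd Φ x) := by
  refine csInf_le ⟨0, ?_⟩ ⟨Φ, hΦ.lipschitzWith_of_hasCompactSupport hΦc (by simp), hΦc, hΦs, hK,
    (setIntegral_energy hΦs).symm⟩
  rintro e ⟨Ψ, -, -, hΨs, -, rfl⟩
  rw [setIntegral_energy hΨs]
  exact integral_nonneg (G.setup.UB_pd_nonneg (hΨs.trans G.sub))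

lemma le_capacity {K : Set (E n)} {Φ : E n → ℝ}
    (hΦ : ContDiff ℝ ∞ Φ) (hΦc : HasCompactSupport Φ) (hΦs : tsupport Φ ⊆ V)
    (hK : ∀ x ∈ K, 1 ≤ Φ x) {e : ℝ} (he : ∀ (Ψ : E n → ℝ) (L : NNReal), LipschitzWith L Ψ →
      HasCompactSupport Ψ → tsupport Ψ ⊆ V → (∀ x ∈ K, 1 ≤ Ψ x) →
      e ≤ ∫ x, UB u x (pd Ψ x) (pd Ψ x)) : e ≤ capacity u K V := by
  refine le_csInf ⟨_, Φ, hΦ.lipschitzWith_of_hasCompactSupport hΦc (by simp), hΦc, hΦs, hK, rfl⟩ ?_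
  rintro _ ⟨Ψ, ⟨L, hL⟩, hΨc, hΨs, hΨK, rfl⟩
  rw [setIntegral_energy hΨs]
  exact he Ψ L hL hΨc hΨs hΨK

end Green

end LinMA

/-- Theorem 4.1: the Green's function is comparable to the inverse capacity. -/
theorem green_comparable_inverse_capacity (n : ℕ) (hn : 2 ≤ n) (α β : ℝ) :
    ∃ C ≥ (1 : ℝ), ∀ (Ω : Set (E n)) (u : E n → ℝ),
      MASetup Ω u → DoublingCM Ω u α β →
      ∀ V : Set (E n), IsOpen V → CptIn V Ω →
      ∀ x₀ ∈ V, ∀ t : ℝ, 0 < t → CptIn (MASection Ω u x₀ (2 * t)) V →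
      ∀ g : E n → ℝ, IsGreen u V x₀ g →
      ∀ x ∈ frontier (MASection Ω u x₀ t),
        C⁻¹ * (capacity u (closure (MASection Ω u x₀ t)) V)⁻¹ ≤ g x ∧
        g x ≤ C * (capacity u (closure (MASection Ω u x₀ t)) V)⁻¹ := by
  open LinMA in
  obtain ⟨A, hA1, hA⟩ := exists_green_harnack n α β
  obtain ⟨B, hB0, hB⟩ := exists_energy_upper
  have hA0 : 0 < A := by linarith
  refine ⟨4 * A + 2 * A * B, by nlinarith [mul_pos hA0 hB0], fun Ω u hΩ hd V hV hVc x₀ hx₀ t ht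
    hcpt g hg x hx => ?_⟩
  have hVΩ : V ⊆ Ω := subset_closure.trans hVc.2
  have h : Setup n α β Ω u := setup_of_cptIn_section hn hΩ hd (hVΩ hx₀) (s := 2 * t)
    (by positivity) ⟨hcpt.1, hcpt.2.trans hVΩ⟩
  have G : Green n α β Ω u V x₀ g := ⟨h, hV, hVc, hx₀, hg⟩
  have hsec : MASection Ω u x₀ t ⊆ MASection Ω u x₀ (2 * t) := sec_mono (by linarith)
  have hct : CptIn (MASection Ω u x₀ t) V := CptIn.mono hcpt hsec
  have hctΩ : CptIn (MASection Ω u x₀ t) Ω := ⟨hct.1, hct.2.trans hVΩ⟩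
  have hfr : ∀ y ∈ frontier (MASection Ω u x₀ t), y ∈ V ∧ dd u x₀ y = t := fun y hy =>
    ⟨hct.2 (frontier_subset_closure hy), (h.dd_eq_of_mem_frontier hctΩ hy).2⟩
  obtain ⟨hxV, hxt⟩ := hfr x hx
  have hne : ∀ y, dd u x₀ y = t → y ≠ x₀ := by
    rintro y hy rfl
    rw [dd_self] at hy
    linarith
  have hgx : 0 < g x := G.pos hxV (hne x hxt)
  have harnack : ∀ y ∈ V, ∀ z ∈ V, dd u x₀ y = t → dd u x₀ z = t → g z ≤ A * g y :=
    fun y hy z hz hyt hzt => hA Ω u V x₀ g G t ht hcpt y (subset_closure (hVΩ hy)) hyt z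
      (subset_closure (hVΩ hz)) hzt
  -- upper bound for the capacity
  have hm : 0 < g x / (2 * A) := by positivity
  have hΓ : ∀ y ∈ V, dd u x₀ y = t → g x / (2 * A) < g y := fun y hy hyt => by
    have h1 := harnack y hy x hxV hyt hxt
    have h2 : 0 < A * g y := hgx.trans_le h1
    rw [div_lt_iff₀ (by positivity)]
    linarith
  obtain ⟨Φ, hΦ, hΦc, hΦs, hΦp, hΦ1, hΦe⟩ := hB n α β Ω u V x₀ g G t ht hcpt _ hm
  have hΦK : ∀ y ∈ closure (MASection Ω u x₀ t), 1 ≤ Φ y := fun y hy => by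
    by_cases hyp : y = x₀
    · rw [hyp, hΦp]
    refine (hΦ1 y (hct.2 hy) hyp ?_).ge
    by_cases hyS : y ∈ MASection Ω u x₀ t
    · exact G.ge_of_inside ht hct hΓ y hyS hyp
    · have hyf : y ∈ frontier (MASection Ω u x₀ t) := by
        rw [(h.sec_open hctΩ).frontier_eq]; exact ⟨hy, hyS⟩
      exact (hΓ y (hfr y hyf).1 (hfr y hyf).2).le
  have hup := (G.capacity_le hΦ hΦc hΦs hΦK).trans hΦe
  -- lower bound for the capacity
  have hout := G.le_of_outside ht (M := A * g x) (by positivity)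
    fun y hy hyt => harnack x hxV y hy hxt hyt
  have hlow : 1 / (2 * (2 * (A * g x))) ≤ capacity u (closure (MASection Ω u x₀ t)) V :=
    Green.le_capacity hΦ hΦc hΦs hΦK fun Ψ L hL hΨc hΨs hΨK =>
      G.energy_lower ht hcpt (by positivity) hL hΨc hΨs fun y hy _ hyg => by
        refine hΨK y (subset_closure (mem_section.2 ⟨subset_closure (hVΩ hy), ?_⟩))
        by_contra! hcon
        have h1 := hout y hy hcon
        have h2 : 0 < A * g x := by positivity
        linarith
  set c := capacity u (closure (MASection Ω u x₀ t)) V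
  have hc : 0 < c := lt_of_lt_of_le (by positivity) hlow
  have hAB : 0 < A * B := by positivity
  rw [div_le_iff₀ (by positivity)] at hlow
  rw [div_div_eq_mul_div, le_div_iff₀ hgx] at hup
  have hcg : 0 < c * g x := by positivity
  rw [← mul_inv, inv_le_iff_one_le_mul₀ (by positivity), ← div_eq_mul_inv, le_div_iff₀ hc]
  constructor
  · have : 0 < A * B * (c * g x) := by positivity
    linarith
  · linarith
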